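/- Let d ≥ 3 be an integer and let u be a classical finite-energy free Coulomb wave on ℝ^d with energy E. Then for every ε > 0 there exist constants 0 < c₁ < c₂ < ∞ such that limsup_{t→+∞} ∫_{|x| < t − c₂·ln t} e(x,t) dx < ε and limsup_{t→+∞} ∫_{|x| > t − c₁·ln t} e(x,t) dx < ε, where e(x,t) := ½|∇ₓu(x,t)|² + ½|∂ₜu(x,t)|² + |u(x,t)|²/(2|x|) is the energy density. -/

import Mathlib

open MeasureTheory Filter

/-- The Laplacian of `u : ℝ^d → ℝ`, as the sum of second derivatives in the
coordinate directions. -/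
noncomputable def lap {d : ℕ} (u : EuclideanSpace ℝ (Fin d) → ℝ)
    (x : EuclideanSpace ℝ (Fin d)) : ℝ :=
  ∑ i : Fin d, iteratedFDeriv ℝ 2 u x ![EuclideanSpace.single i 1, EuclideanSpace.single i 1]

/-- The energy density `e(x,t) = ½|∇ₓu|² + ½|∂ₜu|² + |u|²/(2|x|)` of the free
Coulomb wave equation. -/
noncomputable def eDenFree {d : ℕ} (u : EuclideanSpace ℝ (Fin d) → ℝ → ℝ)
    (x : EuclideanSpace ℝ (Fin d)) (t : ℝ) : ℝ :=
  (1 / 2) * ‖gradient (fun y => u y t) x‖ ^ 2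
    + (1 / 2) * (deriv (u x) t) ^ 2 + (u x t) ^ 2 / (2 * ‖x‖)

/-- `u` is a classical finite-energy free Coulomb wave with (conserved)
energy `E`: it is continuous on `ℝ^d × ℝ`, `C²` on `(ℝ^d∖{0}) × ℝ`, solves
`∂ₜ²u - Δu + u/|x| = 0` away from `x = 0`, and its total energy equals `E`
at every time. -/
def IsFreeCoulombWave {d : ℕ} (u : EuclideanSpace ℝ (Fin d) → ℝ → ℝ) (E : ℝ) : Prop :=
  Continuous (fun q : EuclideanSpace ℝ (Fin d) × ℝ => u q.1 q.2) ∧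
  ContDiffOn ℝ 2 (fun q : EuclideanSpace ℝ (Fin d) × ℝ => u q.1 q.2)
    ({(0 : EuclideanSpace ℝ (Fin d))}ᶜ ×ˢ Set.univ) ∧
  (∀ x : EuclideanSpace ℝ (Fin d), x ≠ 0 → ∀ t : ℝ,
    deriv (deriv (u x)) t - lap (fun y => u y t) x + u x t / ‖x‖ = 0) ∧
  (∀ t : ℝ, Integrable (fun x => eDenFree u x t)) ∧
  (∀ t : ℝ, ∫ x, eDenFree u x t = E)

namespace Coulomb
open scoped Topology

abbrev Spc (d : ℕ) := EuclideanSpace ℝ (Fin d)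

variable {d : ℕ}

/-- Space-time with the time axis removed. -/
def Om (d : ℕ) : Set (Spc d × ℝ) := {(0 : Spc d)}ᶜ ×ˢ Set.univ

noncomputable def bv (i : Fin d) : Spc d := EuclideanSpace.single i 1

noncomputable def Dx (i : Fin d) (v : Spc d × ℝ → ℝ) (q : Spc d × ℝ) : ℝ := fderiv ℝ v q (bv i, 0)
noncomputable def Dt (v : Spc d × ℝ → ℝ) (q : Spc d × ℝ) : ℝ := fderiv ℝ v q (0, 1)
noncomputable def Dr (v : Spc d × ℝ → ℝ) (q : Spc d × ℝ) : ℝ := fderiv ℝ v q (q.1, 0)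
noncomputable def Ns (v : Spc d × ℝ → ℝ) (q : Spc d × ℝ) : ℝ := ∑ i, Dx i v q ^ 2
noncomputable def en (v : Spc d × ℝ → ℝ) (q : Spc d × ℝ) : ℝ :=
  1 / 2 * Ns v q + 1 / 2 * Dt v q ^ 2 + v q ^ 2 / (2 * ‖q.1‖)

lemma mem_Om {q : Spc d × ℝ} : q ∈ Om d ↔ q.1 ≠ 0 := by simp [Om]

lemma isOpen_Om : IsOpen (Om d) := (isOpen_compl_singleton).prod isOpen_univ

lemma Om_nhds {q : Spc d × ℝ} (h : q ∈ Om d) : Om d ∈ 𝓝 q := isOpen_Om.mem_nhds h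

lemma norm_pos_Om {q : Spc d × ℝ} (h : q ∈ Om d) : 0 < ‖q.1‖ := norm_pos_iff.2 (mem_Om.1 h)

lemma sum_bv (x : Spc d) : x = ∑ i, x i • bv i := by
  ext j
  simp [bv, Finset.sum_apply, Pi.single_apply]

lemma normsq_eq (x : Spc d) : ‖x‖ ^ 2 = ∑ i, x i ^ 2 := EuclideanSpace.real_norm_sq_eq x

lemma inner_bv (x : Spc d) (i : Fin d) : inner ℝ x (bv i) = x i := by
  simp [bv, EuclideanSpace.inner_single_right]

lemma fderiv_sum (v : Spc d × ℝ → ℝ) (q : Spc d × ℝ) (w : Spc d) :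
    fderiv ℝ v q (w, 0) = ∑ i, w i * Dx i v q := by
  have h : ((w, 0) : Spc d × ℝ) = ∑ i, w i • ((bv i, 0) : Spc d × ℝ) := by
    rw [Prod.ext_iff]
    constructor
    · simpa [Prod.fst_sum] using sum_bv w
    · simp [Prod.snd_sum]
  rw [h, map_sum]
  exact Finset.sum_congr rfl fun i _ => by rw [map_smul, smul_eq_mul, Dx]

lemma Dr_eq (v : Spc d × ℝ → ℝ) (q : Spc d × ℝ) : Dr v q = ∑ i, q.1 i * Dx i v q :=
  fderiv_sum v q q.1

lemma sq_fderiv_le (v : Spc d × ℝ → ℝ) (q : Spc d × ℝ) (w : Spc d) :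
    (fderiv ℝ v q (w, 0)) ^ 2 ≤ ‖w‖ ^ 2 * Ns v q := by
  rw [fderiv_sum, normsq_eq]
  exact Finset.sum_mul_sq_le_sq_mul_sq _ _ _

lemma Dr_sq_le (v : Spc d × ℝ → ℝ) (q : Spc d × ℝ) : Dr v q ^ 2 ≤ ‖q.1‖ ^ 2 * Ns v q :=
  sq_fderiv_le v q q.1

lemma Ns_nonneg (v : Spc d × ℝ → ℝ) (q : Spc d × ℝ) : 0 ≤ Ns v q :=
  Finset.sum_nonneg fun _ _ => sq_nonneg _

lemma pot_nonneg (v : Spc d × ℝ → ℝ) (q : Spc d × ℝ) : 0 ≤ v q ^ 2 / (2 * ‖q.1‖) := by positivity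

lemma en_nonneg (v : Spc d × ℝ → ℝ) (q : Spc d × ℝ) : 0 ≤ en v q := by
  have := Ns_nonneg v q
  unfold en; positivity

lemma Ns_le_en (v : Spc d × ℝ → ℝ) (q : Spc d × ℝ) : Ns v q ≤ 2 * en v q := by
  have := pot_nonneg v q
  unfold en; nlinarith [sq_nonneg (Dt v q)]

lemma Dt_sq_le_en (v : Spc d × ℝ → ℝ) (q : Spc d × ℝ) : Dt v q ^ 2 ≤ 2 * en v q := by
  have := pot_nonneg v q
  have := Ns_nonneg v q
  unfold en; nlinarith [sq_nonneg (Dt v q)]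

lemma pot_le_en (v : Spc d × ℝ → ℝ) (q : Spc d × ℝ) : v q ^ 2 / ‖q.1‖ ≤ 2 * en v q := by
  have := Ns_nonneg v q
  have h : v q ^ 2 / (2 * ‖q.1‖) = (v q ^ 2 / ‖q.1‖) / 2 := by rw [div_div, mul_comm]
  unfold en; rw [h]; nlinarith [sq_nonneg (Dt v q)]

lemma abs_Dr_le (v : Spc d × ℝ → ℝ) (q : Spc d × ℝ) : |Dr v q| ≤ ‖q.1‖ * √(Ns v q) := by
  rw [← Real.sqrt_sq (norm_nonneg q.1), ← Real.sqrt_mul (sq_nonneg _)]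
  exact Real.abs_le_sqrt (Dr_sq_le v q)

/-! ### Measurability -/

@[fun_prop] lemma meas_Dx (i : Fin d) (v : Spc d × ℝ → ℝ) : Measurable (Dx i v) :=
  measurable_fderiv_apply_const ℝ v _
@[fun_prop] lemma meas_Dt (v : Spc d × ℝ → ℝ) : Measurable (Dt v) :=
  measurable_fderiv_apply_const ℝ v _
@[fun_prop] lemma meas_Ns (v : Spc d × ℝ → ℝ) : Measurable (Ns v) := by
  unfold Ns; fun_prop
lemma meas_coord (i : Fin d) : Measurable (fun x : Spc d => x i) := by fun_prop
@[fun_prop] lemma meas_Dr (v : Spc d × ℝ → ℝ) : Measurable (Dr v) := by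
  have : Dr v = fun q => ∑ i, q.1 i * Dx i v q := funext (Dr_eq v)
  rw [this]
  refine Finset.measurable_sum _ fun i _ => ?_
  have : Measurable fun q : Spc d × ℝ => q.1 i := (meas_coord i).comp measurable_fst
  exact this.mul (meas_Dx i v)
lemma meas_en {v : Spc d × ℝ → ℝ} (hv : Measurable v) : Measurable (en v) := by
  unfold en; fun_prop

/-! ### Algebra of the energy density -/

lemma Dx_add {v w : Spc d × ℝ → ℝ} {q} (hv : DifferentiableAt ℝ v q) (hw : DifferentiableAt ℝ w q)
    (i : Fin d) : Dx i (v + w) q = Dx i v q + Dx i w q := by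
  simp [Dx, fderiv_add hv hw]
lemma Dt_add {v w : Spc d × ℝ → ℝ} {q} (hv : DifferentiableAt ℝ v q) (hw : DifferentiableAt ℝ w q) :
    Dt (v + w) q = Dt v q + Dt w q := by
  simp [Dt, fderiv_add hv hw]
lemma Dx_smul (c : ℝ) (v : Spc d × ℝ → ℝ) (q) (i : Fin d) : Dx i (c • v) q = c * Dx i v q := by
  simp [Dx, fderiv_const_smul_field]
lemma Dt_smul (c : ℝ) (v : Spc d × ℝ → ℝ) (q : Spc d × ℝ) : Dt (c • v) q = c * Dt v q := by
  simp [Dt, fderiv_const_smul_field]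

lemma en_smul (c : ℝ) (v : Spc d × ℝ → ℝ) (q) : en (c • v) q = c ^ 2 * en v q := by
  have : Ns (c • v) q = c ^ 2 * Ns v q := by
    simp [Ns, Dx_smul, mul_pow, Finset.mul_sum]
  simp only [en, this, Dt_smul, Pi.smul_apply, smul_eq_mul]
  ring

/-- The bilinear form polarizing the energy density. -/
noncomputable def bi (v w : Spc d × ℝ → ℝ) (q : Spc d × ℝ) : ℝ :=
  1 / 2 * ∑ i, Dx i v q * Dx i w q + 1 / 2 * (Dt v q * Dt w q) + v q * w q / (2 * ‖q.1‖)

lemma en_add {v w : Spc d × ℝ → ℝ} {q} (hv : DifferentiableAt ℝ v q) (hw : DifferentiableAt ℝ w q) :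
    en (v + w) q = en v q + 2 * bi v w q + en w q := by
  have : Ns (v + w) q = Ns v q + 2 * ∑ i, Dx i v q * Dx i w q + Ns w q := by
    simp only [Ns, Dx_add hv hw, Finset.mul_sum, ← Finset.sum_add_distrib]
    exact Finset.sum_congr rfl fun i _ => by ring
  simp only [en, bi, this, Dt_add hv hw, Pi.add_apply]
  ring

lemma bi_smul_right (c : ℝ) (v w : Spc d × ℝ → ℝ) (q) : bi v (c • w) q = c * bi v w q := by
  simp only [bi, Dx_smul, Dt_smul, Pi.smul_apply, smul_eq_mul]
  have : ∑ i, Dx i v q * (c * Dx i w q) = c * ∑ i, Dx i v q * Dx i w q := by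
    rw [Finset.mul_sum]; exact Finset.sum_congr rfl fun i _ => by ring
  rw [this]; ring

lemma en_sub {v w : Spc d × ℝ → ℝ} {q} (hv : DifferentiableAt ℝ v q) (hw : DifferentiableAt ℝ w q) :
    en (v - w) q = en v q - 2 * bi v w q + en w q := by
  have h : v - w = v + (-1 : ℝ) • w := by ext; simp [sub_eq_add_neg]
  rw [h, en_add hv (by simpa using hw.neg), bi_smul_right, en_smul]
  ring

lemma en_par {v w : Spc d × ℝ → ℝ} {q} (hv : DifferentiableAt ℝ v q) (hw : DifferentiableAt ℝ w q) :
    en (v + w) q + en (v - w) q = 2 * en v q + 2 * en w q := by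
  rw [en_add hv hw, en_sub hv hw]; ring

lemma en_add_le {v w : Spc d × ℝ → ℝ} {q} (hv : DifferentiableAt ℝ v q)
    (hw : DifferentiableAt ℝ w q) : en (v + w) q ≤ 2 * en v q + 2 * en w q := by
  have := en_par hv hw
  have := en_nonneg (v - w) q
  linarith

lemma en_sub_le {v w : Spc d × ℝ → ℝ} {q} (hv : DifferentiableAt ℝ v q)
    (hw : DifferentiableAt ℝ w q) : en (v - w) q ≤ 2 * en v q + 2 * en w q := by
  have := en_par hv hw
  have := en_nonneg (v + w) q
  linarith

/-! ### Waves -/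

/-- Finite energy waves, in terms of space-time functions. -/
structure IsW0 (v : Spc d × ℝ → ℝ) : Prop where
  cont : Continuous v
  cd : ContDiffOn ℝ 2 v (Om d)
  pde : ∀ q ∈ Om d, Dt (Dt v) q = ∑ i, Dx i (Dx i v) q - v q / ‖q.1‖
  int : ∀ t, Integrable (fun x => en v (x, t))
  bdd : ∃ C, ∀ t, ∫ x, en v (x, t) ≤ C

lemma cdAt {n : WithTop ℕ∞} {v : Spc d × ℝ → ℝ} (h : ContDiffOn ℝ n v (Om d)) {q} (hq : q ∈ Om d) :
    ContDiffAt ℝ n v q := h.contDiffAt (Om_nhds hq)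

lemma diffAt {n : WithTop ℕ∞} (hn : n ≠ 0) {v : Spc d × ℝ → ℝ} (h : ContDiffOn ℝ n v (Om d)) {q}
    (hq : q ∈ Om d) : DifferentiableAt ℝ v q := (cdAt h hq).differentiableAt hn

lemma IsW0.diff {v : Spc d × ℝ → ℝ} (h : IsW0 v) {q} (hq : q ∈ Om d) : DifferentiableAt ℝ v q :=
  diffAt two_ne_zero h.cd hq

lemma cd_fderiv {v : Spc d × ℝ → ℝ} (h : ContDiffOn ℝ 2 v (Om d)) (w : Spc d × ℝ) :
    ContDiffOn ℝ 1 (fun q => fderiv ℝ v q w) (Om d) := by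
  have := h.fderiv_of_isOpen (m := 1) isOpen_Om (by norm_num)
  exact this.clm_apply contDiffOn_const

lemma cd_Dx {v : Spc d × ℝ → ℝ} (h : ContDiffOn ℝ 2 v (Om d)) (i) : ContDiffOn ℝ 1 (Dx i v) (Om d) :=
  cd_fderiv h _
lemma cd_Dt {v : Spc d × ℝ → ℝ} (h : ContDiffOn ℝ 2 v (Om d)) : ContDiffOn ℝ 1 (Dt v) (Om d) :=
  cd_fderiv h _

lemma fderiv_comm {v : Spc d × ℝ → ℝ} (h : ContDiffOn ℝ 2 v (Om d)) {q} (hq : q ∈ Om d)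
    (a b : Spc d × ℝ) :
    fderiv ℝ (fun p => fderiv ℝ v p a) q b = fderiv ℝ (fun p => fderiv ℝ v p b) q a := by
  have hc := cdAt h hq
  have hd : DifferentiableAt ℝ (fderiv ℝ v) q :=
    (hc.fderiv_right (m := 1) (by norm_num)).differentiableAt one_ne_zero
  have hs : IsSymmSndFDerivAt ℝ v q := hc.isSymmSndFDerivAt (by simp)
  rw [fderiv_clm_apply hd (by fun_prop), fderiv_clm_apply hd (by fun_prop)]
  simpa using hs b a

lemma Dt_Dx {v : Spc d × ℝ → ℝ} (h : ContDiffOn ℝ 2 v (Om d)) {q} (hq : q ∈ Om d) (i) :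
    Dt (Dx i v) q = Dx i (Dt v) q := fderiv_comm h hq _ _
lemma Dx_Dx {v : Spc d × ℝ → ℝ} (h : ContDiffOn ℝ 2 v (Om d)) {q} (hq : q ∈ Om d) (i j) :
    Dx i (Dx j v) q = Dx j (Dx i v) q := fderiv_comm h hq _ _

instance nontriv [Fact (3 ≤ d)] : Nontrivial (Spc d) := by
  have : Nonempty (Fin d) := ⟨⟨0, by have := Fact.out (p := 3 ≤ d); omega⟩⟩
  infer_instance

/-- Almost every spatial point is nonzero. -/
lemma ae_ne [Fact (3 ≤ d)] : ∀ᵐ x : Spc d, x ≠ 0 := by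
  have := measure_singleton (μ := (volume : Measure (Spc d))) 0
  exact compl_mem_ae_iff.2 this

end Coulomb

namespace Coulomb
open scoped Topology
variable {d : ℕ}

/-! ### Radial weights -/

noncomputable def ra (a : Spc d × ℝ → ℝ) (q : Spc d × ℝ) : ℝ := Dr a q / ‖q.1‖ ^ 2

structure Rad (a : Spc d × ℝ → ℝ) : Prop where
  cd : ContDiffOn ℝ 1 a (Om d)
  meas : Measurable a
  rad : ∀ q ∈ Om d, ∀ i, Dx i a q = q.1 i * ra a q

@[fun_prop] lemma meas_ra (a : Spc d × ℝ → ℝ) : Measurable (ra a) := by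
  unfold ra; fun_prop

lemma hasFDerivAt_norm {V : Type*} [NormedAddCommGroup V] [InnerProductSpace ℝ V] {x : V}
    (hx : x ≠ 0) : HasFDerivAt (fun y : V => ‖y‖) (‖x‖⁻¹ • innerSL ℝ x) x := by
  have h1 := (hasStrictFDerivAt_norm_sq x).hasFDerivAt
  have h2 := h1.sqrt (by simpa using hx)
  have h3 : (fun y : V => √(‖y‖ ^ 2)) = fun y => ‖y‖ := by
    ext y; exact Real.sqrt_sq (norm_nonneg y)
  rw [h3] at h2
  have hn : ‖x‖ ≠ 0 := norm_ne_zero_iff.2 hx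
  convert h2 using 1
  rw [Real.sqrt_sq (norm_nonneg x)]
  ext y
  simp
  field_simp

section of
variable {F : ℝ × ℝ → ℝ}

lemma cd_norm {n : WithTop ℕ∞} : ContDiffOn ℝ n (fun q : Spc d × ℝ => ‖q.1‖) (Om d) := fun q hq =>
  ((contDiffAt_norm ℝ (mem_Om.1 hq)).comp q contDiffAt_fst).contDiffWithinAt

lemma comp_cd (hF : ContDiffOn ℝ 1 F (Set.Ioi 0 ×ˢ Set.univ)) :
    ContDiffOn ℝ 1 (fun q : Spc d × ℝ => F (‖q.1‖, q.2)) (Om d) := by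
  refine hF.comp (cd_norm.prodMk contDiffOn_snd) fun q hq => ?_
  simpa using norm_pos_Om hq

lemma diffF (hF : ContDiffOn ℝ 1 F (Set.Ioi 0 ×ˢ Set.univ)) {q : Spc d × ℝ} (hq : q ∈ Om d) :
    DifferentiableAt ℝ F (‖q.1‖, q.2) := by
  refine (hF.contDiffAt ?_).differentiableAt one_ne_zero
  refine (isOpen_Ioi.prod isOpen_univ).mem_nhds ?_
  simpa using norm_pos_Om hq

lemma comp_fderiv (hF : ContDiffOn ℝ 1 F (Set.Ioi 0 ×ˢ Set.univ)) {q : Spc d × ℝ} (hq : q ∈ Om d)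
    (w : Spc d × ℝ) : fderiv ℝ (fun q : Spc d × ℝ => F (‖q.1‖, q.2)) q w =
      fderiv ℝ F (‖q.1‖, q.2) (‖q.1‖⁻¹ * inner ℝ q.1 w.1, w.2) := by
  have h1 : HasFDerivAt (fun q : Spc d × ℝ => ‖q.1‖) _ q :=
    (hasFDerivAt_norm (mem_Om.1 hq)).comp q hasFDerivAt_fst
  have h2 := h1.prodMk (hasFDerivAt_snd (p := q))
  have h3 := (diffF hF hq).hasFDerivAt.comp q h2
  have := h3.fderiv
  change fderiv ℝ (F ∘ fun q : Spc d × ℝ => (‖q.1‖, q.2)) q w = _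
  rw [this]
  simp

lemma F_r {r t c : ℝ} (hF : DifferentiableAt ℝ F (r, t))
    (h : HasDerivAt (fun s => F (s, t)) c r) : fderiv ℝ F (r, t) (1, 0) = c := by
  have h1 : HasDerivAt (fun s : ℝ => (s, t)) ((1 : ℝ), (0 : ℝ)) r :=
    (hasDerivAt_id r).prodMk (hasDerivAt_const r t)
  exact (hF.hasFDerivAt.comp_hasDerivAt r h1).unique h

lemma F_t {r t c : ℝ} (hF : DifferentiableAt ℝ F (r, t))
    (h : HasDerivAt (fun s => F (r, s)) c t) : fderiv ℝ F (r, t) (0, 1) = c := by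
  have h1 : HasDerivAt (fun s : ℝ => (r, s)) ((0 : ℝ), (1 : ℝ)) t :=
    (hasDerivAt_const t r).prodMk (hasDerivAt_id t)
  exact (hF.hasFDerivAt.comp_hasDerivAt t h1).unique h

lemma ra_of (hF : ContDiffOn ℝ 1 F (Set.Ioi 0 ×ˢ Set.univ)) {q : Spc d × ℝ} (hq : q ∈ Om d) {c : ℝ}
    (h : HasDerivAt (fun s => F (s, q.2)) c ‖q.1‖) :
    ra (fun q : Spc d × ℝ => F (‖q.1‖, q.2)) q = c / ‖q.1‖ := by
  have hr := norm_pos_Om hq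
  rw [ra, Dr, comp_fderiv hF hq]
  have : ((‖q.1‖⁻¹ * inner ℝ q.1 q.1, 0) : ℝ × ℝ) = ‖q.1‖ • ((1 : ℝ), (0 : ℝ)) := by
    rw [real_inner_self_eq_norm_sq]; ext <;> simp; field_simp
  simp only [this, map_smul, F_r (diffF hF hq) h, smul_eq_mul]
  field_simp

lemma Dt_of (hF : ContDiffOn ℝ 1 F (Set.Ioi 0 ×ˢ Set.univ)) {q : Spc d × ℝ} (hq : q ∈ Om d) {c : ℝ}
    (h : HasDerivAt (fun s => F (‖q.1‖, s)) c q.2) :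
    Dt (fun q : Spc d × ℝ => F (‖q.1‖, q.2)) q = c := by
  rw [Dt, comp_fderiv hF hq]
  simpa using F_t (diffF hF hq) h

lemma Rad.of (hF : ContDiffOn ℝ 1 F (Set.Ioi 0 ×ˢ Set.univ)) (hm : Measurable F) :
    Rad (fun q : Spc d × ℝ => F (‖q.1‖, q.2)) where
  cd := comp_cd hF
  meas := by fun_prop
  rad q hq i := by
    have hr := norm_pos_Om hq
    rw [ra, Dr, Dx, comp_fderiv hF hq, comp_fderiv hF hq, real_inner_self_eq_norm_sq]
    have e1 : ((‖q.1‖⁻¹ * inner ℝ q.1 (bv i), 0) : ℝ × ℝ) = (‖q.1‖⁻¹ * q.1 i) • ((1 : ℝ), (0 : ℝ)) := by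
      rw [inner_bv]; ext <;> simp
    have e2 : ((‖q.1‖⁻¹ * ‖q.1‖ ^ 2, 0) : ℝ × ℝ) = ‖q.1‖ • ((1 : ℝ), (0 : ℝ)) := by
      ext <;> simp; field_simp
    simp only [e1, e2, map_smul, smul_eq_mul]
    field_simp

end of

/-! ### Directional derivatives -/

lemma hd {f : Spc d × ℝ → ℝ} {q} (h : DifferentiableAt ℝ f q) (w : Spc d × ℝ) :
    HasDerivAt (fun s : ℝ => f (q + s • w)) (fderiv ℝ f q w) 0 := by
  have h1 : HasDerivAt (fun s : ℝ => q + s • w) w 0 := by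
    simpa using ((hasDerivAt_id (0 : ℝ)).smul_const w).const_add q
  have h2 : HasFDerivAt f (fderiv ℝ f q) (q + (0 : ℝ) • w) := by simpa using h.hasFDerivAt
  exact h2.comp_hasDerivAt 0 h1

lemma hd_eq {f : Spc d × ℝ → ℝ} {q} (h : DifferentiableAt ℝ f q) {w : Spc d × ℝ} {c : ℝ}
    (h' : HasDerivAt (fun s : ℝ => f (q + s • w)) c 0) : fderiv ℝ f q w = c :=
  (hd h w).unique h'

lemma fderiv_mul' {f g : Spc d × ℝ → ℝ} {q} (hf : DifferentiableAt ℝ f q)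
    (hg : DifferentiableAt ℝ g q) (w : Spc d × ℝ) :
    fderiv ℝ (fun q => f q * g q) q w = f q * fderiv ℝ g q w + g q * fderiv ℝ f q w := by
  rw [fderiv_fun_mul hf hg]; simp

lemma Rad.diff {a : Spc d × ℝ → ℝ} (ha : Rad a) {q} (hq : q ∈ Om d) : DifferentiableAt ℝ a q :=
  diffAt one_ne_zero ha.cd hq

lemma ra_mul {a b : Spc d × ℝ → ℝ} (ha : Rad a) (hb : Rad b) {q} (hq : q ∈ Om d) :
    ra (fun q => a q * b q) q = a q * ra b q + b q * ra a q := by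
  rw [ra, Dr, fderiv_mul' (ha.diff hq) (hb.diff hq), ra, Dr, ra, Dr]; ring

lemma Dt_mul {a b : Spc d × ℝ → ℝ} {q} (ha : DifferentiableAt ℝ a q) (hb : DifferentiableAt ℝ b q) :
    Dt (fun q => a q * b q) q = a q * Dt b q + b q * Dt a q := fderiv_mul' ha hb _

lemma Rad.mul {a b : Spc d × ℝ → ℝ} (ha : Rad a) (hb : Rad b) : Rad (fun q => a q * b q) where
  cd := ha.cd.mul hb.cd
  meas := ha.meas.mul hb.meas
  rad q hq i := by
    rw [ra_mul ha hb hq, Dx, fderiv_mul' (ha.diff hq) (hb.diff hq)]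
    have h1 := ha.rad q hq i
    have h2 := hb.rad q hq i
    simp only [Dx] at h1 h2
    rw [h1, h2]; ring

/-! ### Integration of compactly supported space-time functions -/

/-- Lebesgue measure on the slab between the times `t0` and `t1`. -/
noncomputable def slab (d : ℕ) (t0 t1 : ℝ) : Measure (Spc d × ℝ) :=
  (volume : Measure (Spc d)).prod (volume.restrict (Set.Ioc t0 t1))

lemma slab_eq (t0 t1 : ℝ) : slab d t0 t1 =
    ((volume : Measure (Spc d)).prod (volume : Measure ℝ)).restrict (Set.univ ×ˢ Set.Ioc t0 t1) := by
  rw [slab, ← Measure.prod_restrict, Measure.restrict_univ]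

instance (t0 t1 : ℝ) : SFinite (slab d t0 t1) := by unfold slab; infer_instance

lemma slab_ae_time (t0 t1 : ℝ) : ∀ᵐ q ∂slab d t0 t1, q.2 ∈ Set.Ioc t0 t1 := by
  rw [slab_eq]
  filter_upwards [ae_restrict_mem (MeasurableSet.univ.prod measurableSet_Ioc)] with q hq
  exact hq.2

lemma slab_ae_Om [Fact (3 ≤ d)] (t0 t1 : ℝ) : ∀ᵐ q ∂slab d t0 t1, q ∈ Om d := by
  have h : (slab d t0 t1) ({(0 : Spc d)} ×ˢ Set.univ) = 0 := by
    rw [slab, Measure.prod_prod]; simp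
  refine (measure_eq_zero_iff_ae_notMem.1 h).mono fun q hq => ?_
  rw [mem_Om]; simpa using hq

lemma integrable_slab {f : Spc d × ℝ → ℝ} (hf : Continuous f) {R : ℝ}
    (hs : ∀ p, R < ‖p.1‖ → f p = 0) (t0 t1 : ℝ) : Integrable f (slab d t0 t1) := by
  rw [slab_eq]
  have h1 : IntegrableOn f (Metric.closedBall (0 : Spc d) R ×ˢ Set.Icc t0 t1)
      ((volume : Measure (Spc d)).prod (volume : Measure ℝ)) :=
    hf.continuousOn.integrableOn_compact ((isCompact_closedBall _ _).prod isCompact_Icc)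
  have h2 : IntegrableOn f (Set.univ ×ˢ Set.Icc t0 t1)
      ((volume : Measure (Spc d)).prod (volume : Measure ℝ)) := by
    refine h1.of_forall_sdiff_eq_zero (MeasurableSet.univ.prod measurableSet_Icc) fun p hp => hs p ?_
    by_contra hcon
    exact hp.2 ⟨by simpa using hcon, hp.1.2⟩
  exact h2.mono_set (Set.prod_mono subset_rfl Set.Ioc_subset_Icc_self)

lemma integrable_slice {f : Spc d × ℝ → ℝ} (hf : Continuous f) {R : ℝ}
    (hs : ∀ p, R < ‖p.1‖ → f p = 0) (t : ℝ) : Integrable (fun x => f (x, t)) := by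
  refine Continuous.integrable_of_hasCompactSupport (by fun_prop) ?_
  refine HasCompactSupport.intro (isCompact_closedBall (0 : Spc d) R) fun x hx => hs _ ?_
  simpa using hx

lemma glue {f : Spc d × ℝ → ℝ} {n : WithTop ℕ∞} (hf : ContDiffOn ℝ n f (Om d)) {δ : ℝ} (hδ : 0 < δ)
    (hs : ∀ p, ‖p.1‖ < δ → f p = 0) : ContDiff ℝ n f := by
  refine contDiff_iff_contDiffAt.2 fun q => ?_
  by_cases hq : q ∈ Om d
  · exact cdAt hf hq
  · have h0 : q.1 = 0 := by simpa [mem_Om] using hq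
    have : f =ᶠ[𝓝 q] fun _ => 0 := by
      have hc : ContinuousAt (fun p : Spc d × ℝ => ‖p.1‖) q := by fun_prop
      filter_upwards [hc.eventually_lt (continuousAt_const (y := δ)) (by simpa [h0] using hδ)] with p hp
      exact hs p hp
    exact contDiffAt_const.congr_of_eventuallyEq this

lemma fderiv_zero_out {f : Spc d × ℝ → ℝ} {R : ℝ} (hs : ∀ p, R < ‖p.1‖ → f p = 0) (p : Spc d × ℝ)
    (hp : R < ‖p.1‖) : fderiv ℝ f p = 0 := by
  have : f =ᶠ[𝓝 p] fun _ => 0 := by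
    have hc : ContinuousAt (fun p : Spc d × ℝ => ‖p.1‖) p := by fun_prop
    filter_upwards [(continuousAt_const (y := R)).eventually_lt hc hp] with q hq
    exact hs q hq
  rw [this.fderiv_eq]; simp

lemma fderiv_slice {f : Spc d × ℝ → ℝ} (hf : Differentiable ℝ f) (t : ℝ) (x w : Spc d) :
    fderiv ℝ (fun y => f (y, t)) x w = fderiv ℝ f (x, t) (w, 0) := by
  have h1 : HasFDerivAt (fun y : Spc d => (y, t)) (ContinuousLinearMap.inl ℝ (Spc d) ℝ) x :=
    hasFDerivAt_prodMk_left x t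
  have := ((hf (x, t)).hasFDerivAt.comp x h1).fderiv
  change fderiv ℝ (f ∘ fun y : Spc d => (y, t)) x w = _
  rw [this]; simp

lemma integral_Dx_zero {f : Spc d × ℝ → ℝ} (hf : ContDiff ℝ 1 f) {R : ℝ}
    (hs : ∀ p, R < ‖p.1‖ → f p = 0) (t : ℝ) (i : Fin d) : ∫ x, Dx i f (x, t) = 0 := by
  have hd : Differentiable ℝ f := hf.differentiable one_ne_zero
  have hc : Continuous (Dx i f) := (hf.continuous_fderiv one_ne_zero).clm_apply continuous_const
  have hi : Integrable (fun x => Dx i f (x, t)) :=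
    integrable_slice hc (R := R) (fun p hp => by simp [Dx, fderiv_zero_out hs p hp]) t
  have h := integral_mul_fderiv_eq_neg_fderiv_mul_of_integrable (𝕜 := ℝ) (E := Spc d)
    (f := fun _ => (1 : ℝ)) (g := fun x => f (x, t)) (v := bv i) (μ := volume)
    (by simp) ?_ ?_ (by fun_prop) (by fun_prop)
  · simpa [fderiv_slice hd, Dx] using h
  · simpa [fderiv_slice hd, Dx] using hi
  · simpa using integrable_slice hf.continuous hs t

lemma div_time {f b : Spc d × ℝ → ℝ} [Fact (3 ≤ d)] {h : Fin d → Spc d × ℝ → ℝ}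
    (hf : ContDiffOn ℝ 1 f (Om d)) (hh : ∀ i, ContDiffOn ℝ 1 (h i) (Om d)) {δ R : ℝ} (hδ : 0 < δ)
    (hfs : ∀ p, (‖p.1‖ < δ ∨ R < ‖p.1‖) → f p = 0)
    (hhs : ∀ i p, (‖p.1‖ < δ ∨ R < ‖p.1‖) → h i p = 0)
    (hb : ∀ p ∈ Om d, Dt f p = b p + ∑ i, Dx i (h i) p) {t0 t1 : ℝ} (h01 : t0 ≤ t1) :
    (∫ x, f (x, t1)) - ∫ x, f (x, t0) = ∫ p, b p ∂slab d t0 t1 := by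
  have hf' : ContDiff ℝ 1 f := glue hf hδ fun p hp => hfs p (Or.inl hp)
  have hh' : ∀ i, ContDiff ℝ 1 (h i) := fun i => glue (hh i) hδ fun p hp => hhs i p (Or.inl hp)
  have hcT : Continuous (Dt f) := (hf'.continuous_fderiv one_ne_zero).clm_apply continuous_const
  have hcX : ∀ i, Continuous (Dx i (h i)) := fun i =>
    ((hh' i).continuous_fderiv one_ne_zero).clm_apply continuous_const
  have hsT : ∀ p, R < ‖p.1‖ → Dt f p = 0 := fun p hp => by
    simp [Dt, fderiv_zero_out (fun p hp => hfs p (Or.inr hp)) p hp]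
  have hsX : ∀ i p, R < ‖p.1‖ → Dx i (h i) p = 0 := fun i p hp => by
    simp [Dx, fderiv_zero_out (fun p hp => hhs i p (Or.inr hp)) p hp]
  have hiT := integrable_slab hcT hsT t0 t1
  have hiX := fun i => integrable_slab (hcX i) (hsX i) t0 t1
  have e1 : ∫ p, b p ∂slab d t0 t1 = ∫ p, (Dt f p - ∑ i, Dx i (h i) p) ∂slab d t0 t1 := by
    refine integral_congr_ae ?_
    filter_upwards [slab_ae_Om t0 t1] with p hp
    rw [hb p hp]; ring
  have e2 : ∀ i, ∫ p, Dx i (h i) p ∂slab d t0 t1 = 0 := fun i => by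
    have := hiX i
    rw [slab] at this ⊢
    rw [integral_prod_symm _ this]
    simp [integral_Dx_zero (hh' i) (fun p hp => hhs i p (Or.inr hp))]
  rw [e1, integral_sub hiT (integrable_finsetSum _ fun i _ => hiX i),
    integral_finsetSum _ fun i _ => hiX i]
  simp only [e2, Finset.sum_const_zero, sub_zero]
  have hi2 := hiT
  rw [slab] at hi2 ⊢
  rw [integral_prod _ hi2, ← integral_sub (integrable_slice hf'.continuous (fun p hp => hfs p (Or.inr hp)) t1)
    (integrable_slice hf'.continuous (fun p hp => hfs p (Or.inr hp)) t0)]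
  · refine integral_congr_ae (Eventually.of_forall fun x => ?_)
    have hder : ∀ t, HasDerivAt (fun s => f (x, s)) (Dt f (x, t)) t := fun t => by
      have h1 : HasDerivAt (fun s : ℝ => (x, s)) ((0 : Spc d), (1 : ℝ)) t :=
        (hasDerivAt_const t x).prodMk (hasDerivAt_id t)
      exact ((hf'.differentiable one_ne_zero) (x, t)).hasFDerivAt.comp_hasDerivAt t h1
    have := intervalIntegral.integral_eq_sub_of_hasDerivAt (fun t _ => hder t)
      (Continuous.intervalIntegrable (by fun_prop) t0 t1)
    simp only [← this, intervalIntegral.integral_of_le h01]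

end Coulomb

namespace Coulomb
open scoped Topology
variable {d : ℕ}

/-! ### Cutoffs -/

noncomputable abbrev th : ℝ → ℝ := Real.smoothTransition

lemma th_cd1 : ContDiff ℝ 1 th := Real.smoothTransition.contDiff (n := 1)
lemma th_nonneg (s : ℝ) : 0 ≤ th s := Real.smoothTransition.nonneg s
lemma th_le_one (s : ℝ) : th s ≤ 1 := Real.smoothTransition.le_one s
lemma th_zero {s : ℝ} (h : s ≤ 0) : th s = 0 := Real.smoothTransition.zero_of_nonpos h
lemma th_one {s : ℝ} (h : 1 ≤ s) : th s = 1 := Real.smoothTransition.one_of_one_le h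
lemma th_diff : Differentiable ℝ th := th_cd1.differentiable one_ne_zero
@[fun_prop] lemma th_cont : Continuous th := th_cd1.continuous
@[fun_prop] lemma th'_cont : Continuous (deriv th) := th_cd1.continuous_deriv le_rfl
@[fun_prop] lemma th_meas : Measurable th := th_cont.measurable
lemma th_hd (s : ℝ) : HasDerivAt th (deriv th s) s := (th_diff s).hasDerivAt
lemma th'_nonneg (s : ℝ) : 0 ≤ deriv th s := Real.smoothTransition.monotone.deriv_nonneg

lemma th'_neg {s : ℝ} (hs : s < 0) : deriv th s = 0 := by
  have : th =ᶠ[𝓝 s] fun _ => 0 := by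
    filter_upwards [gt_mem_nhds hs] with x hx
    exact Real.smoothTransition.zero_of_nonpos hx.le
  rw [this.deriv_eq]; simp

lemma th'_gt {s : ℝ} (hs : 1 < s) : deriv th s = 0 := by
  have : th =ᶠ[𝓝 s] fun _ => 1 := by
    filter_upwards [lt_mem_nhds hs] with x hx
    exact Real.smoothTransition.one_of_one_le hx.le
  rw [this.deriv_eq]; simp

lemma th'_bound : ∃ C, 0 < C ∧ ∀ s, |deriv th s| ≤ C := by
  obtain ⟨C, hC⟩ := (isCompact_Icc (a := (0 : ℝ)) (b := 1)).exists_bound_of_continuousOn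
    th'_cont.continuousOn
  refine ⟨max C 1, by positivity, fun s => ?_⟩
  by_cases h0 : s < 0
  · simp [th'_neg h0]
  by_cases h1 : 1 < s
  · simp [th'_gt h1]
  exact (hC s ⟨not_lt.1 h0, not_lt.1 h1⟩).trans (le_max_left _ _)

noncomputable def etaF (n : ℕ) (z : ℝ × ℝ) : ℝ :=
  th ((n + 1 : ℝ) * z.1 - 1) * th (2 - z.1 / (n + 1 : ℝ))

noncomputable def eta (d n : ℕ) (q : Spc d × ℝ) : ℝ := etaF n (‖q.1‖, q.2)

lemma etaF_cd (n : ℕ) : ContDiff ℝ 1 (etaF n) := by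
  unfold etaF
  exact (th_cd1.comp (by fun_prop)).mul (th_cd1.comp (by fun_prop))

lemma eta_rad (n : ℕ) : Rad (eta d n) :=
  Rad.of (etaF_cd n).contDiffOn (etaF_cd n).continuous.measurable

lemma eta_nonneg (n : ℕ) (q : Spc d × ℝ) : 0 ≤ eta d n q := mul_nonneg (th_nonneg _) (th_nonneg _)
lemma eta_le_one (n : ℕ) (q : Spc d × ℝ) : eta d n q ≤ 1 :=
  mul_le_one₀ (th_le_one _) (th_nonneg _) (th_le_one _)

lemma eta_supp (n : ℕ) (q : Spc d × ℝ) (h : ‖q.1‖ < 1 / (n + 1 : ℝ) ∨ 2 * (n + 1 : ℝ) < ‖q.1‖) :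
    eta d n q = 0 := by
  have hn : (0 : ℝ) < n + 1 := by positivity
  unfold eta etaF
  rcases h with h | h
  · rw [lt_div_iff₀ hn] at h
    rw [th_zero (s := (n + 1 : ℝ) * ‖q.1‖ - 1) (by linarith), zero_mul]
  · have : 2 < ‖q.1‖ / (n + 1 : ℝ) := by rw [lt_div_iff₀ hn]; exact h
    rw [th_zero (s := 2 - ‖q.1‖ / (n + 1 : ℝ)) (by linarith), mul_zero]

lemma etaF_hd (n : ℕ) (r t : ℝ) : HasDerivAt (fun s => etaF n (s, t))
    ((n + 1 : ℝ) * deriv th ((n + 1 : ℝ) * r - 1) * th (2 - r / (n + 1 : ℝ))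
      - th ((n + 1 : ℝ) * r - 1) * (deriv th (2 - r / (n + 1 : ℝ)) / (n + 1 : ℝ))) r := by
  have h1 : HasDerivAt (fun s : ℝ => (n + 1 : ℝ) * s - 1) (n + 1 : ℝ) r := by
    simpa using ((hasDerivAt_id r).const_mul (n + 1 : ℝ)).sub_const 1
  have h2 : HasDerivAt (fun s : ℝ => 2 - s / (n + 1 : ℝ)) (-(1 / (n + 1 : ℝ))) r := by
    simpa using ((hasDerivAt_id r).div_const (n + 1 : ℝ)).const_sub 2
  refine (((th_hd _).comp r h1).mul ((th_hd _).comp r h2)).congr_deriv ?_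
  simp only [Function.comp]
  ring

lemma eta_Dt (n : ℕ) {q : Spc d × ℝ} (hq : q ∈ Om d) : Dt (eta d n) q = 0 :=
  Dt_of (etaF_cd n).contDiffOn hq (hasDerivAt_const q.2 (etaF n (‖q.1‖, 0)))

lemma eta_ra (n : ℕ) {q : Spc d × ℝ} (hq : q ∈ Om d) : ra (eta d n) q =
    ((n + 1 : ℝ) * deriv th ((n + 1 : ℝ) * ‖q.1‖ - 1) * th (2 - ‖q.1‖ / (n + 1 : ℝ))
      - th ((n + 1 : ℝ) * ‖q.1‖ - 1) * (deriv th (2 - ‖q.1‖ / (n + 1 : ℝ)) / (n + 1 : ℝ))) / ‖q.1‖ :=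
  ra_of (etaF_cd n).contDiffOn hq (etaF_hd n _ _)

lemma eta_ra_bound (d : ℕ) : ∃ C, 0 < C ∧ ∀ n, ∀ q ∈ Om d, ‖q.1‖ ^ 2 * |ra (eta d n) q| ≤ C := by
  obtain ⟨C, hC0, hC⟩ := th'_bound
  refine ⟨4 * C, by positivity, fun n q hq => ?_⟩
  have hr := norm_pos_Om hq
  have hn : (0 : ℝ) < n + 1 := by positivity
  set r := ‖q.1‖
  have key : ∀ s a : ℝ, (0 ≤ s → s ≤ 1 → |a| ≤ 2) → |a * deriv th s| ≤ 2 * C := fun s a h => by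
    by_cases h0 : s < 0
    · simp [th'_neg h0]; positivity
    by_cases h1 : 1 < s
    · simp [th'_gt h1]; positivity
    rw [abs_mul]
    exact mul_le_mul (h (not_lt.1 h0) (not_lt.1 h1)) (hC s) (abs_nonneg _) (by norm_num)
  have k1 := key ((n + 1 : ℝ) * r - 1) ((n + 1 : ℝ) * r) fun h0 h1 => by
    rw [abs_of_nonneg (by positivity)]; linarith
  have k2 := key (2 - r / (n + 1 : ℝ)) (r / (n + 1 : ℝ)) fun h0 h1 => by
    rw [abs_of_nonneg (by positivity)]; linarith
  have e : ‖q.1‖ ^ 2 * ra (eta d n) q =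
      (n + 1 : ℝ) * r * deriv th ((n + 1 : ℝ) * r - 1) * th (2 - r / (n + 1 : ℝ))
      - r / (n + 1 : ℝ) * deriv th (2 - r / (n + 1 : ℝ)) * th ((n + 1 : ℝ) * r - 1) := by
    rw [eta_ra n hq]; change r ^ 2 * (_ / r) = _; simp only [show ‖q.1‖ = r from rfl]; field_simp
  have e' : ‖q.1‖ ^ 2 * |ra (eta d n) q| = |‖q.1‖ ^ 2 * ra (eta d n) q| := by
    rw [abs_mul, abs_of_nonneg (by positivity : 0 ≤ ‖q.1‖ ^ 2)]
  have k3 : ∀ a s : ℝ, |a| ≤ 2 * C → |a * th s| ≤ 2 * C := fun a s h => by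
    rw [abs_mul, abs_of_nonneg (th_nonneg s)]
    exact (mul_le_of_le_one_right (abs_nonneg _) (th_le_one s)).trans h
  rw [e', e]
  refine (abs_sub _ _).trans ?_
  linarith [k3 _ (2 - r / (n + 1 : ℝ)) k1, k3 _ ((n + 1 : ℝ) * r - 1) k2]

lemma eta_ev {q : Spc d × ℝ} (hq : q ∈ Om d) :
    ∀ᶠ n : ℕ in atTop, eta d n q = 1 ∧ ra (eta d n) q = 0 := by
  have hr := norm_pos_Om hq
  have ht : Tendsto (fun n : ℕ => (n : ℝ)) atTop atTop := tendsto_natCast_atTop_atTop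
  filter_upwards [ht.eventually_gt_atTop (2 / ‖q.1‖), ht.eventually_gt_atTop ‖q.1‖] with n h1 h2
  have hn : (0 : ℝ) < n + 1 := by positivity
  have a1 : 1 < (n + 1 : ℝ) * ‖q.1‖ - 1 := by
    rw [div_lt_iff₀ hr] at h1
    nlinarith
  have a2 : 1 < 2 - ‖q.1‖ / (n + 1 : ℝ) := by
    have : ‖q.1‖ / (n + 1 : ℝ) < 1 := by rw [div_lt_one hn]; linarith
    linarith
  constructor
  · unfold eta etaF
    simp only
    rw [th_one a1.le, th_one a2.le, one_mul]
  · rw [eta_ra n hq, th'_gt a1, th'_gt a2]; simp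

lemma eta_tendsto {q : Spc d × ℝ} (hq : q ∈ Om d) :
    Tendsto (fun n => eta d n q) atTop (𝓝 1) ∧ Tendsto (fun n => ra (eta d n) q) atTop (𝓝 0) :=
  ⟨tendsto_const_nhds.congr' ((eta_ev hq).mono fun _ h => h.1.symm),
    tendsto_const_nhds.congr' ((eta_ev hq).mono fun _ h => h.2.symm)⟩

/-! ### Local identities -/

lemma cd_en {v : Spc d × ℝ → ℝ} (h : ContDiffOn ℝ 2 v (Om d)) : ContDiffOn ℝ 1 (en v) (Om d) := by
  have h1 : ContDiffOn ℝ 1 v (Om d) := h.of_le (by norm_num)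
  unfold en Ns
  refine ((contDiffOn_const.mul ?_).add (contDiffOn_const.mul ((cd_Dt h).pow 2))).add
    ((h1.pow 2).div (contDiffOn_const.mul cd_norm) fun q hq => ?_)
  · exact ContDiffOn.sum fun i _ => (cd_Dx h i).pow 2
  · have := norm_pos_Om hq; positivity

lemma Dt_en {v : Spc d × ℝ → ℝ} (hv : IsW0 v) {q} (hq : q ∈ Om d) :
    Dt (en v) q = ∑ i, (Dx i v q * Dx i (Dt v) q + Dt v q * Dx i (Dx i v) q) := by
  have hx := fun i => hd (diffAt one_ne_zero (cd_Dx hv.cd i) hq) (0, 1)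
  have ht := hd (diffAt one_ne_zero (cd_Dt hv.cd) hq) (0, 1)
  have h0 := hd (hv.diff hq) (0, 1)
  have hr := norm_pos_Om hq
  have H := (((HasDerivAt.fun_sum fun i (_ : i ∈ Finset.univ) => (hx i).pow 2).const_mul (1 / 2 : ℝ)).add
    ((ht.pow 2).const_mul (1 / 2 : ℝ))).add ((h0.pow 2).div_const (2 * ‖q.1‖))
  have H2 := H.congr_of_eventuallyEq (f₁ := fun s : ℝ => en v (q + s • ((0 : Spc d), (1 : ℝ))))
    (Eventually.of_forall fun s => by simp [en, Ns])
  rw [Dt, hd_eq (diffAt one_ne_zero (cd_en hv.cd) hq) H2]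
  have hp := hv.pde q hq
  simp only [zero_smul, add_zero]
  change _ + 1 / 2 * (_ * _ * Dt (Dt v) q) + _ * _ * Dt v q / _ = _
  rw [hp, Finset.sum_add_distrib, ← Finset.mul_sum]
  have : ∀ i, fderiv ℝ (Dx i v) q (0, 1) = Dx i (Dt v) q := fun i => Dt_Dx hv.cd hq i
  simp only [this, Finset.mul_sum]
  have e : ∑ i, 1 / 2 * (((2 : ℕ) : ℝ) * Dx i v q ^ (2 - 1) * Dx i (Dt v) q) =
    ∑ i, Dx i v q * Dx i (Dt v) q := Finset.sum_congr rfl fun i _ => by norm_num; ring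
  rw [e]
  norm_num
  field_simp
  rw [← Finset.mul_sum]
  ring

lemma E_cpt [Fact (3 ≤ d)] {v a : Spc d × ℝ → ℝ} (hv : IsW0 v) (ha : Rad a) {δ R : ℝ} (hδ : 0 < δ)
    (hs : ∀ p, (‖p.1‖ < δ ∨ R < ‖p.1‖) → a p = 0) {t0 t1 : ℝ} (h01 : t0 ≤ t1) :
    (∫ x, a (x, t1) * en v (x, t1)) - ∫ x, a (x, t0) * en v (x, t0) =
      ∫ p, (Dt a p * en v p - ra a p * Dt v p * Dr v p) ∂slab d t0 t1 := by
  refine div_time (f := fun p => a p * en v p) (h := fun i p => a p * (Dt v p * Dx i v p))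
    (ha.cd.mul (cd_en hv.cd)) (fun i => ha.cd.mul ((cd_Dt hv.cd).mul (cd_Dx hv.cd i))) hδ
    (R := R) (fun p hp => by simp [hs p hp]) (fun i p hp => by simp [hs p hp]) (fun q hq => ?_) h01
  have d1 := ha.diff hq
  have d2 := diffAt one_ne_zero (cd_Dt hv.cd) hq
  have d3 := fun i => diffAt one_ne_zero (cd_Dx hv.cd i) hq
  rw [Dt_mul d1 (diffAt one_ne_zero (cd_en hv.cd) hq), Dt_en hv hq]
  have : ∀ i, Dx i (fun p => a p * (Dt v p * Dx i v p)) q =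
      a q * (Dx i v q * Dx i (Dt v) q + Dt v q * Dx i (Dx i v) q)
        + (ra a q * Dt v q) * (q.1 i * Dx i v q) := fun i => by
    rw [Dx, fderiv_mul' d1 (g := fun p => Dt v p * Dx i v p) (d2.mul (d3 i)), fderiv_mul' d2 (d3 i)]
    have := ha.rad q hq i
    simp only [Dx] at this ⊢
    rw [this]; ring
  simp only [this, Finset.sum_add_distrib, ← Finset.mul_sum, ← Dr_eq]
  ring

noncomputable def qM (v α γ : Spc d × ℝ → ℝ) (q : Spc d × ℝ) : ℝ :=
  Dt v q * (α q * Dr v q + γ q * v q)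

noncomputable def bulk (v α γ : Spc d × ℝ → ℝ) (q : Spc d × ℝ) : ℝ :=
  Dt v q * (Dt α q * Dr v q + Dt γ q * v q)
    + (γ q - 1 / 2 * (d * α q + ‖q.1‖ ^ 2 * ra α q)) * (Dt v q ^ 2 - Ns v q)
    - α q * Ns v q - ra α q * Dr v q ^ 2 - v q * ra γ q * Dr v q
    - v q / ‖q.1‖ * (α q * Dr v q + γ q * v q)

lemma cd_coord {n : WithTop ℕ∞} (i : Fin d) : ContDiff ℝ n (fun q : Spc d × ℝ => q.1 i) := by
  fun_prop

lemma cd_Dr {v : Spc d × ℝ → ℝ} (h : ContDiffOn ℝ 2 v (Om d)) : ContDiffOn ℝ 1 (Dr v) (Om d) := by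
  have : Dr v = fun q => ∑ i, q.1 i * Dx i v q := funext (Dr_eq v)
  rw [this]
  exact ContDiffOn.sum fun i _ => (cd_coord i).contDiffOn.mul (cd_Dx h i)

lemma cd_Ns {v : Spc d × ℝ → ℝ} (h : ContDiffOn ℝ 2 v (Om d)) : ContDiffOn ℝ 1 (Ns v) (Om d) :=
  ContDiffOn.sum fun i _ => (cd_Dx h i).pow 2

lemma fderiv_coord (q w : Spc d × ℝ) (i : Fin d) :
    HasDerivAt (fun s : ℝ => (q + s • w).1 i) (w.1 i) 0 := by
  have : HasDerivAt (fun s : ℝ => q.1 i + s * w.1 i) (w.1 i) 0 := by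
    simpa using ((hasDerivAt_id (0 : ℝ)).mul_const (w.1 i)).const_add (q.1 i)
  simpa using this

lemma Dr_hd {v : Spc d × ℝ → ℝ} (h : ContDiffOn ℝ 2 v (Om d)) {q} (hq : q ∈ Om d) (w : Spc d × ℝ) :
    fderiv ℝ (Dr v) q w = ∑ j, (w.1 j * Dx j v q + q.1 j * fderiv ℝ (Dx j v) q w) := by
  refine hd_eq (diffAt one_ne_zero (cd_Dr h) hq) ?_
  have H := HasDerivAt.fun_sum fun j (_ : j ∈ Finset.univ) =>
    (fderiv_coord q w j).mul (hd (diffAt one_ne_zero (cd_Dx h j) hq) w)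
  refine (H.congr_of_eventuallyEq (Eventually.of_forall fun s => ?_)).congr_deriv ?_
  · exact Dr_eq v _
  · simp

lemma Ns_hd {v : Spc d × ℝ → ℝ} (h : ContDiffOn ℝ 2 v (Om d)) {q} (hq : q ∈ Om d) (w : Spc d × ℝ) :
    fderiv ℝ (Ns v) q w = ∑ j, 2 * (Dx j v q * fderiv ℝ (Dx j v) q w) := by
  refine hd_eq (diffAt one_ne_zero (cd_Ns h) hq) ?_
  have H := HasDerivAt.fun_sum fun j (_ : j ∈ Finset.univ) =>
    (hd (diffAt one_ne_zero (cd_Dx h j) hq) w).pow 2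
  refine (H.congr_of_eventuallyEq (Eventually.of_forall fun s => ?_)).congr_deriv ?_
  · simp [Ns]
  · exact Finset.sum_congr rfl fun j _ => by simp; ring

lemma bv_self (i : Fin d) : (bv i) i = 1 := by simp [bv]

lemma sum_bv_mul (i : Fin d) (f : Fin d → ℝ) : ∑ j, (bv i) j * f j = f i := by
  simp [bv]

lemma M_cpt [Fact (3 ≤ d)] {v α γ : Spc d × ℝ → ℝ} (hv : IsW0 v) (ha : Rad α) (hg : Rad γ) {δ R : ℝ}
    (hδ : 0 < δ) (hs : ∀ p, (‖p.1‖ < δ ∨ R < ‖p.1‖) → α p = 0)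
    (hs' : ∀ p, (‖p.1‖ < δ ∨ R < ‖p.1‖) → γ p = 0) {t0 t1 : ℝ} (h01 : t0 ≤ t1) :
    (∫ x, qM v α γ (x, t1)) - ∫ x, qM v α γ (x, t0) = ∫ p, bulk v α γ p ∂slab d t0 t1 := by
  have c0 : ContDiffOn ℝ 1 v (Om d) := hv.cd.of_le (by norm_num)
  have cx := fun i => cd_Dx hv.cd i
  have ct := cd_Dt hv.cd
  have cr := cd_Dr hv.cd
  have cn := cd_Ns hv.cd
  have cc := fun i => (cd_coord (d := d) (n := 1) i).contDiffOn (s := Om d)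
  refine div_time (f := qM v α γ)
    (h := fun i p => α p * (p.1 i * (1 / 2 * (Dt v p ^ 2 - Ns v p)) + Dx i v p * Dr v p)
      + γ p * (v p * Dx i v p))
    (ct.mul ((ha.cd.mul cr).add (hg.cd.mul c0)))
    (fun i => (ha.cd.mul (((cc i).mul (contDiffOn_const.mul ((ct.pow 2).sub cn))).add
      ((cx i).mul cr))).add (hg.cd.mul (c0.mul (cx i)))) hδ (R := R)
    (fun p hp => by simp [qM, hs p hp, hs' p hp]) (fun i p hp => by simp [hs p hp, hs' p hp])
    (fun q hq => ?_) h01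
  have D {f : Spc d × ℝ → ℝ} (hf : ContDiffOn ℝ 1 f (Om d)) (w) := hd (diffAt one_ne_zero hf hq) w
  have hp := hv.pde q hq
  have eT : Dt (qM v α γ) q = Dt (Dt v) q * (α q * Dr v q + γ q * v q)
      + Dt v q * (Dt α q * Dr v q + α q * ∑ j, q.1 j * Dx j (Dt v) q
        + Dt γ q * v q + γ q * Dt v q) := by
    refine hd_eq (diffAt one_ne_zero (ct.mul ((ha.cd.mul cr).add (hg.cd.mul c0))) hq) ?_
    refine ((D ct (0, 1)).mul (((D ha.cd (0, 1)).mul (D cr (0, 1))).add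
      ((D hg.cd (0, 1)).mul (D c0 (0, 1))))).congr_deriv ?_
    have : fderiv ℝ (Dr v) q (0, 1) = ∑ j, q.1 j * Dx j (Dt v) q := by
      rw [Dr_hd hv.cd hq]
      refine Finset.sum_congr rfl fun j _ => ?_
      have := Dt_Dx hv.cd hq j
      rw [Dt] at this
      rw [this]; simp
    simp only [Pi.add_apply, Pi.mul_apply]
    rw [this]
    simp only [zero_smul, add_zero, Dt]
    ring
  have eX : ∀ i, Dx i (fun p => α p * (p.1 i * (1 / 2 * (Dt v p ^ 2 - Ns v p)) + Dx i v p * Dr v p)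
      + γ p * (v p * Dx i v p)) q =
      ra α q * (1 / 2 * (Dt v q ^ 2 - Ns v q)) * (q.1 i) ^ 2 + ra α q * Dr v q * (q.1 i * Dx i v q)
      + α q * (1 / 2 * (Dt v q ^ 2 - Ns v q)) + α q * Dt v q * (q.1 i * Dx i (Dt v) q)
      - α q * ∑ j, q.1 i * Dx j v q * Dx i (Dx j v) q
      + (α q * Dr v q + γ q * v q) * Dx i (Dx i v) q
      + (α q + γ q) * Dx i v q ^ 2 + α q * ∑ j, Dx i v q * q.1 j * Dx i (Dx j v) q
      + ra γ q * v q * (q.1 i * Dx i v q) := fun i => by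
    refine hd_eq (diffAt one_ne_zero ((ha.cd.mul (((cc i).mul (contDiffOn_const.mul
      ((ct.pow 2).sub cn))).add ((cx i).mul cr))).add (hg.cd.mul (c0.mul (cx i)))) hq) ?_
    have w : Spc d × ℝ := (bv i, 0)
    refine (((D ha.cd (bv i, 0)).mul (((fderiv_coord q (bv i, 0) i).mul ((((D ct (bv i, 0)).pow 2).sub
      (D cn (bv i, 0))).const_mul (1 / 2 : ℝ))).add ((D (cx i) (bv i, 0)).mul (D cr (bv i, 0))))).add
      ((D hg.cd (bv i, 0)).mul ((D c0 (bv i, 0)).mul (D (cx i) (bv i, 0))))).congr_deriv ?_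
    have r1 := ha.rad q hq i
    have r2 := hg.rad q hq i
    rw [Dx] at r1 r2
    rw [r1, r2, Dr_hd hv.cd hq, Ns_hd hv.cd hq, Finset.sum_add_distrib]
    simp only [zero_smul, add_zero, Pi.add_apply, Pi.mul_apply, Pi.sub_apply, Pi.pow_apply, bv_self,
      sum_bv_mul]
    have s1 : ∑ j, q.1 i * Dx j v q * Dx i (Dx j v) q = q.1 i * (1 / 2) *
        ∑ j, 2 * (Dx j v q * fderiv ℝ (Dx j v) q (bv i, 0)) := by
      rw [Finset.mul_sum]
      exact Finset.sum_congr rfl fun j _ => by rw [Dx.eq_1 i (Dx j v)]; ring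
    have s2 : ∑ j, Dx i v q * q.1 j * Dx i (Dx j v) q = Dx i v q *
        ∑ j, q.1 j * fderiv ℝ (Dx j v) q (bv i, 0) := by
      rw [Finset.mul_sum]
      exact Finset.sum_congr rfl fun j _ => by rw [Dx.eq_1 i (Dx j v)]; ring
    rw [s1, s2]
    change _ + _ * (_ + (fderiv ℝ (Dx i v) q (bv i, 0) * _ + _)) + _ = _
    rw [Dx.eq_1 i (Dx i v), Dx.eq_1 i (Dt v), show fderiv ℝ v q (bv i, 0) = Dx i v q from rfl]
    norm_num
    ring
  have sw : ∑ i, ∑ j, q.1 i * Dx j v q * Dx i (Dx j v) q =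
      ∑ i, ∑ j, Dx i v q * q.1 j * Dx i (Dx j v) q := by
    rw [Finset.sum_comm]
    refine Finset.sum_congr rfl fun i _ => Finset.sum_congr rfl fun j _ => ?_
    rw [Dx_Dx hv.cd hq j i]; ring
  rw [eT, hp]
  simp only [eX, Finset.sum_add_distrib, Finset.sum_sub_distrib, ← Finset.mul_sum, ← Dr_eq, sw,
    ← normsq_eq, Finset.sum_const, Finset.card_univ, Fintype.card_fin, nsmul_eq_mul]
  rw [show ∑ i, Dx i v q ^ 2 = Ns v q from rfl, bulk]
  ring

lemma H_cpt {v κ : Spc d × ℝ → ℝ} (hv : IsW0 v) (hk : Rad κ) {δ R : ℝ}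
    (hδ : 0 < δ) (hs : ∀ p, (‖p.1‖ < δ ∨ R < ‖p.1‖) → κ p = 0) [Fact (3 ≤ d)] (t : ℝ) :
    ∫ x, (2 * v (x, t) * κ (x, t) * Dr v (x, t)
      + v (x, t) ^ 2 * (d * κ (x, t) + ‖x‖ ^ 2 * ra κ (x, t))) = 0 := by
  have c0 : ContDiffOn ℝ 1 v (Om d) := hv.cd.of_le (by norm_num)
  have cc := fun i => (cd_coord (d := d) (n := 1) i).contDiffOn (s := Om d)
  have hcd : ∀ i, ContDiffOn ℝ 1 (fun p : Spc d × ℝ => κ p * (p.1 i * v p ^ 2)) (Om d) := fun i =>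
    hk.cd.mul ((cc i).mul (c0.pow 2))
  have hg := fun i => glue (hcd i) hδ fun p hp => by simp [hs p (Or.inl hp)]
  have hz : ∀ i p, R < ‖p.1‖ → κ p * (p.1 i * v p ^ 2) = 0 := fun i p hp => by
    simp [hs p (Or.inr hp)]
  have h0 := fun i => integral_Dx_zero (hg i) (hz i) t i
  have hi : ∀ i, Integrable fun x => Dx i (fun p : Spc d × ℝ => κ p * (p.1 i * v p ^ 2)) (x, t) :=
    fun i => integrable_slice (R := R)
      (((hg i).continuous_fderiv one_ne_zero).clm_apply continuous_const)
      (fun p hp => by simp [fderiv_zero_out (hz i) p hp]) t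
  have hsum : ∫ x, ∑ i, Dx i (fun p : Spc d × ℝ => κ p * (p.1 i * v p ^ 2)) (x, t) = 0 := by
    rw [integral_finsetSum _ fun i _ => hi i]; simp [h0]
  rw [← hsum]
  refine integral_congr_ae ?_
  filter_upwards [ae_ne] with x hx
  have hq : (x, t) ∈ Om d := mem_Om.2 hx
  have e : ∀ i, Dx i (fun p : Spc d × ℝ => κ p * (p.1 i * v p ^ 2)) (x, t) =
      (ra κ (x, t) * v (x, t) ^ 2) * (x i) ^ 2 + κ (x, t) * v (x, t) ^ 2
        + 2 * v (x, t) * κ (x, t) * (x i * Dx i v (x, t)) := fun i => by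
    refine hd_eq (diffAt one_ne_zero (hcd i) hq) ?_
    refine ((hd (hk.diff hq) (bv i, 0)).mul ((fderiv_coord (x, t) (bv i, 0) i).mul
      ((hd (hv.diff hq) (bv i, 0)).pow 2))).congr_deriv ?_
    have r1 := hk.rad (x, t) hq i
    rw [Dx] at r1
    rw [r1, Dx]
    simp only [zero_smul, add_zero, Pi.mul_apply, Pi.pow_apply, bv_self]
    norm_num
    ring
  simp only [e, Finset.sum_add_distrib, ← Finset.mul_sum, ← normsq_eq, Finset.sum_const,
    Finset.card_univ, Fintype.card_fin, nsmul_eq_mul]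
  rw [Dr_eq]
  ring

end Coulomb

namespace Coulomb
open scoped Topology
variable {d : ℕ}

/-! ### Integrability and dominated convergence -/

lemma IsW0.meas {v : Spc d × ℝ → ℝ} (h : IsW0 v) : Measurable v := h.cont.measurable

lemma slice_meas {f : Spc d × ℝ → ℝ} (hf : Measurable f) (t : ℝ) : Measurable fun x => f (x, t) :=
  hf.comp (by fun_prop)

lemma IsW0.int_slab {v : Spc d × ℝ → ℝ} (h : IsW0 v) (t0 t1 : ℝ) : Integrable (en v) (slab d t0 t1) := by
  obtain ⟨C, hC⟩ := h.bdd
  have hm : AEStronglyMeasurable (en v) (slab d t0 t1) := (meas_en h.meas).aestronglyMeasurable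
  rw [slab] at hm ⊢
  rw [integrable_prod_iff' hm]
  refine ⟨Eventually.of_forall fun t => h.int t, ?_⟩
  have h2 := hm.norm.prod_swap.integral_prod_right'
  refine Integrable.of_bound h2 C (Eventually.of_forall fun t => ?_)
  have e : ∀ x, ‖en v (x, t)‖ = en v (x, t) := fun x => by
    rw [Real.norm_eq_abs, abs_of_nonneg (en_nonneg _ _)]
  simp only [e]
  rw [Real.norm_eq_abs, abs_of_nonneg (integral_nonneg fun x => en_nonneg _ _)]
  exact hC t

/-- Fubini on a slab. -/
lemma slab_fubini {f : Spc d × ℝ → ℝ} {t0 t1 : ℝ} (h01 : t0 ≤ t1) (hf : Integrable f (slab d t0 t1)) :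
    ∫ p, f p ∂slab d t0 t1 = ∫ t in t0..t1, ∫ x, f (x, t) := by
  rw [intervalIntegral.integral_of_le h01]
  rw [slab] at hf ⊢
  exact integral_prod_symm _ hf

/-- The weight `|x|⁻²` on the unit ball. -/
noncomputable def wz (x : Spc d) : ℝ := if ‖x‖ ≤ 1 then 1 / ‖x‖ ^ 2 else 0

lemma wz_nonneg (x : Spc d) : 0 ≤ wz x := by unfold wz; split_ifs <;> positivity

@[fun_prop] lemma wz_meas : Measurable (wz (d := d)) := by
  unfold wz
  exact Measurable.ite (measurableSet_le (by fun_prop) (by fun_prop)) (by fun_prop) (by fun_prop)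

lemma wz_int [hd : Fact (3 ≤ d)] : Integrable (wz (d := d)) := by
  have hd3 := hd.out
  have h1 : IntegrableOn (wz (d := d)) (Metric.ball 0 2) := by
    refine integrableOn_ball_of_norm_le_rpow (α := 2) (C := 1) ?_ ?_ ?_
      wz_meas.aestronglyMeasurable
    · rw [finrank_euclideanSpace_fin]; omega
    · rw [finrank_euclideanSpace_fin]
      have : (3 : ℝ) ≤ d := by exact_mod_cast hd3
      linarith
    · refine Eventually.of_forall fun x => ?_
      rw [Real.norm_eq_abs, abs_of_nonneg (wz_nonneg x), one_mul, Real.rpow_neg (norm_nonneg x)]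
      unfold wz
      split_ifs
      · simp
      · positivity
  rw [← integrableOn_univ]
  refine h1.of_forall_sdiff_eq_zero MeasurableSet.univ fun x hx => ?_
  have : 2 ≤ ‖x‖ := by simpa using hx.2
  unfold wz
  rw [if_neg (by linarith)]

lemma bdd_near {f : Spc d × ℝ → ℝ} (hf : Continuous f) (t0 t1 : ℝ) :
    ∃ M, 0 < M ∧ ∀ q : Spc d × ℝ, ‖q.1‖ ≤ 1 → q.2 ∈ Set.Icc t0 t1 → |f q| ≤ M := by
  obtain ⟨M, hM⟩ := ((isCompact_closedBall (0 : Spc d) 1).prod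
    (isCompact_Icc (a := t0) (b := t1))).exists_bound_of_continuousOn hf.continuousOn
  refine ⟨max M 1, by positivity, fun q h1 h2 => (hM q ⟨by simpa using h1, h2⟩).trans (le_max_left _ _)⟩


lemma dct_slab [Fact (3 ≤ d)] {v : Spc d × ℝ → ℝ} (hv : IsW0 v) {F : ℕ → Spc d × ℝ → ℝ}
    {f : Spc d × ℝ → ℝ} {t0 t1 : ℝ} (K : ℝ) (hm : ∀ n, Measurable (F n))
    (hb : ∀ n, ∀ q ∈ Om d, q.2 ∈ Set.Icc t0 t1 → |F n q| ≤ K * (en v q + wz q.1))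
    (hl : ∀ q ∈ Om d, Tendsto (fun n => F n q) atTop (𝓝 (f q))) :
    Integrable f (slab d t0 t1) ∧
      Tendsto (fun n => ∫ q, F n q ∂slab d t0 t1) atTop (𝓝 (∫ q, f q ∂slab d t0 t1)) := by
  have hbi : Integrable (fun q : Spc d × ℝ => K * (en v q + wz q.1)) (slab d t0 t1) :=
    ((hv.int_slab t0 t1).add (wz_int.comp_fst _)).const_mul K
  have hB : ∀ n, ∀ᵐ q ∂slab d t0 t1, ‖F n q‖ ≤ K * (en v q + wz q.1) := fun n => by
    filter_upwards [slab_ae_Om t0 t1, slab_ae_time t0 t1] with q h1 h2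
    exact hb n q h1 (Set.Ioc_subset_Icc_self h2)
  have hL : ∀ᵐ q ∂slab d t0 t1, Tendsto (fun n => F n q) atTop (𝓝 (f q)) := by
    filter_upwards [slab_ae_Om t0 t1] with q h1 using hl q h1
  refine ⟨?_, tendsto_integral_of_dominated_convergence _ (fun n => (hm n).aestronglyMeasurable)
    hbi hB hL⟩
  refine hbi.mono' (aestronglyMeasurable_of_tendsto_ae atTop
    (fun n => (hm n).aestronglyMeasurable) hL) ?_
  filter_upwards [hL, ae_all_iff.2 hB] with q h1 h2
  exact le_of_tendsto h1.norm (Eventually.of_forall h2)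

lemma dct_slice [Fact (3 ≤ d)] {v : Spc d × ℝ → ℝ} (hv : IsW0 v) {F : ℕ → Spc d × ℝ → ℝ}
    {f : Spc d × ℝ → ℝ} {t : ℝ} (K : ℝ) (hm : ∀ n, Measurable (F n))
    (hb : ∀ n x, x ≠ 0 → |F n (x, t)| ≤ K * (en v (x, t) + wz x))
    (hl : ∀ x, x ≠ 0 → Tendsto (fun n => F n (x, t)) atTop (𝓝 (f (x, t)))) :
    Integrable (fun x => f (x, t)) ∧
      Tendsto (fun n => ∫ x, F n (x, t)) atTop (𝓝 (∫ x, f (x, t))) := by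
  have hbi : Integrable (fun x : Spc d => K * (en v (x, t) + wz x)) :=
    ((hv.int t).add wz_int).const_mul K
  have hB : ∀ n, ∀ᵐ x : Spc d, ‖F n (x, t)‖ ≤ K * (en v (x, t) + wz x) := fun n => by
    filter_upwards [ae_ne] with x h1 using hb n x h1
  have hL : ∀ᵐ x : Spc d, Tendsto (fun n => F n (x, t)) atTop (𝓝 (f (x, t))) := by
    filter_upwards [ae_ne] with x h1 using hl x h1
  have hm' := fun n => (slice_meas (hm n) t).aestronglyMeasurable (μ := volume)
  refine ⟨?_, tendsto_integral_of_dominated_convergence _ hm' hbi hB hL⟩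
  refine hbi.mono' (aestronglyMeasurable_of_tendsto_ae atTop hm' hL) ?_
  filter_upwards [hL, ae_all_iff.2 hB] with x h1 h2
  exact le_of_tendsto h1.norm (Eventually.of_forall h2)

/-! ### Identities with non-compactly supported weights -/

/-- Admissible Morawetz weights on a time interval. -/
structure MW (α γ : Spc d × ℝ → ℝ) (t0 t1 C : ℝ) : Prop where
  rad : Rad α
  rad' : Rad γ
  a0 : ∀ q ∈ Om d, q.2 ∈ Set.Icc t0 t1 → |α q| ≤ C
  a1 : ∀ q ∈ Om d, q.2 ∈ Set.Icc t0 t1 → ‖q.1‖ * |α q| ≤ C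
  a2 : ∀ q ∈ Om d, q.2 ∈ Set.Icc t0 t1 → ‖q.1‖ ^ 2 * |ra α q| ≤ C
  a3 : ∀ q ∈ Om d, q.2 ∈ Set.Icc t0 t1 → ‖q.1‖ * |Dt α q| ≤ C
  g0 : ∀ q ∈ Om d, q.2 ∈ Set.Icc t0 t1 → |γ q| ≤ C
  g1 : ∀ q ∈ Om d, q.2 ∈ Set.Icc t0 t1 → ‖q.1‖ * γ q ^ 2 ≤ C
  g2 : ∀ q ∈ Om d, q.2 ∈ Set.Icc t0 t1 → ‖q.1‖ ^ 3 * ra γ q ^ 2 ≤ C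
  g3 : ∀ q ∈ Om d, q.2 ∈ Set.Icc t0 t1 → ‖q.1‖ * Dt γ q ^ 2 ≤ C

lemma abs_mul_le_half (a b : ℝ) : |a * b| ≤ (a ^ 2 + b ^ 2) / 2 := by
  rw [abs_mul]
  nlinarith [sq_nonneg (|a| - |b|), sq_abs a, sq_abs b]

lemma bulk_bound {v α γ : Spc d × ℝ → ℝ} {q : Spc d × ℝ} (hq : q ∈ Om d) {C : ℝ}
    (a0 : |α q| ≤ C) (a1 : ‖q.1‖ * |α q| ≤ C) (a2 : ‖q.1‖ ^ 2 * |ra α q| ≤ C)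
    (a3 : ‖q.1‖ * |Dt α q| ≤ C) (g0 : |γ q| ≤ C) (g2 : ‖q.1‖ ^ 3 * ra γ q ^ 2 ≤ C)
    (g3 : ‖q.1‖ * Dt γ q ^ 2 ≤ C) :
    |bulk v α γ q| ≤ (3 + 13 * C + d * C + C ^ 2) * en v q := by
  have hr := norm_pos_Om hq
  set r := ‖q.1‖ with hrd
  set e := en v q with he
  set p := √(Ns v q) with hp
  have hp0 : 0 ≤ p := Real.sqrt_nonneg _
  have hpp : p ^ 2 = Ns v q := Real.sq_sqrt (Ns_nonneg v q)
  have hS : |Dr v q| ≤ r * p := abs_Dr_le v q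
  have hN : Ns v q ≤ 2 * e := Ns_le_en v q
  have hN0 := Ns_nonneg v q
  have hT : Dt v q ^ 2 ≤ 2 * e := Dt_sq_le_en v q
  have hV : v q ^ 2 / r ≤ 2 * e := pot_le_en v q
  have hV' : v q ^ 2 ≤ 2 * e * r := by rwa [div_le_iff₀ hr] at hV
  have he0 : 0 ≤ e := en_nonneg v q
  have hC : 0 ≤ C := (abs_nonneg _).trans a0
  have t1 : |Dt v q * (Dt α q * Dr v q)| ≤ 2 * C * e := by
    have h1 : |Dt α q * Dr v q| ≤ C * p := by
      rw [abs_mul]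
      calc |Dt α q| * |Dr v q| ≤ |Dt α q| * (r * p) := by gcongr
        _ = r * |Dt α q| * p := by ring
        _ ≤ C * p := by gcongr
    rw [abs_mul]
    calc |Dt v q| * |Dt α q * Dr v q| ≤ |Dt v q| * (C * p) := by gcongr
      _ = C * |Dt v q * p| := by rw [abs_mul, abs_of_nonneg hp0]; ring
      _ ≤ C * ((Dt v q ^ 2 + p ^ 2) / 2) := by gcongr; exact abs_mul_le_half _ _
      _ ≤ C * (2 * e) := by gcongr; linarith
      _ = _ := by ring
  have sqb : ∀ w : ℝ, r * w ^ 2 ≤ C → (w * v q) ^ 2 ≤ 2 * C * e := fun w hw => by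
    calc (w * v q) ^ 2 = w ^ 2 * v q ^ 2 := by ring
      _ ≤ w ^ 2 * (2 * e * r) := by gcongr
      _ = (r * w ^ 2) * (2 * e) := by ring
      _ ≤ C * (2 * e) := by gcongr
      _ = _ := by ring
  have t2 : |Dt v q * (Dt γ q * v q)| ≤ (1 + C) * e := by
    have := sqb _ g3
    exact (abs_mul_le_half _ _).trans (by linarith)
  have hTN : |Dt v q ^ 2 - Ns v q| ≤ 2 * e := by
    rw [abs_le]; constructor <;> nlinarith [sq_nonneg (Dt v q)]
  have t3 : |(γ q - 1 / 2 * (d * α q + r ^ 2 * ra α q)) * (Dt v q ^ 2 - Ns v q)| ≤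
      (C + 1 / 2 * (d * C + C)) * (2 * e) := by
    rw [abs_mul]
    gcongr
    refine (abs_sub _ _).trans ?_
    gcongr
    rw [abs_mul, abs_of_pos (by norm_num : (0 : ℝ) < 1 / 2)]
    gcongr
    refine (abs_add_le _ _).trans ?_
    rw [abs_mul, abs_mul, abs_of_nonneg (by positivity : (0 : ℝ) ≤ d),
      abs_of_nonneg (by positivity : (0 : ℝ) ≤ r ^ 2)]
    gcongr
  have t4 : |α q * Ns v q| ≤ C * (2 * e) := by
    rw [abs_mul, abs_of_nonneg hN0]; gcongr
  have t5 : |ra α q * Dr v q ^ 2| ≤ C * (2 * e) := by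
    rw [abs_mul, abs_of_nonneg (sq_nonneg (Dr v q))]
    calc |ra α q| * Dr v q ^ 2 ≤ |ra α q| * (r ^ 2 * Ns v q) := by gcongr; exact Dr_sq_le v q
      _ = r ^ 2 * |ra α q| * Ns v q := by ring
      _ ≤ _ := by gcongr
  have t6 : |v q * ra γ q * Dr v q| ≤ (1 + C) * e := by
    rw [abs_mul]
    have h3 := sqb (r * ra γ q) (by linarith [g2, show r * (r * ra γ q) ^ 2 = r ^ 3 * ra γ q ^ 2 by ring])
    calc |v q * ra γ q| * |Dr v q| ≤ |v q * ra γ q| * (r * p) := by gcongr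
      _ = |(r * ra γ q * v q) * p| := by
        rw [abs_mul _ p, abs_of_nonneg hp0, abs_mul, abs_mul, abs_mul, abs_of_pos hr]; ring
      _ ≤ ((r * ra γ q * v q) ^ 2 + p ^ 2) / 2 := abs_mul_le_half _ _
      _ ≤ _ := by linarith
  have t7 : |v q / r * (α q * Dr v q)| ≤ (1 + C ^ 2) * e := by
    have h3 : (α q * v q) ^ 2 ≤ 2 * C ^ 2 * e := by
      calc (α q * v q) ^ 2 = |α q| * |α q| * v q ^ 2 := by rw [abs_mul_abs_self]; ring
        _ ≤ |α q| * |α q| * (2 * e * r) := by gcongr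
        _ = (|α q|) * (r * |α q|) * (2 * e) := by ring
        _ ≤ C * C * (2 * e) := by gcongr
        _ = _ := by ring
    rw [abs_mul, abs_mul, abs_div, abs_of_pos hr]
    calc |v q| / r * (|α q| * |Dr v q|) ≤ |v q| / r * (|α q| * (r * p)) := by gcongr
      _ = |(α q * v q) * p| := by
        rw [abs_mul _ p, abs_of_nonneg hp0, abs_mul]; field_simp
      _ ≤ ((α q * v q) ^ 2 + p ^ 2) / 2 := abs_mul_le_half _ _
      _ ≤ _ := by linarith
  have t8 : |v q / r * (γ q * v q)| ≤ C * (2 * e) := by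
    have : v q / r * (γ q * v q) = γ q * (v q ^ 2 / r) := by field_simp
    rw [this, abs_mul, abs_of_nonneg (by positivity : 0 ≤ v q ^ 2 / r)]
    gcongr
  have hb : bulk v α γ q = Dt v q * (Dt α q * Dr v q) + Dt v q * (Dt γ q * v q)
    + (γ q - 1 / 2 * (d * α q + r ^ 2 * ra α q)) * (Dt v q ^ 2 - Ns v q)
    - α q * Ns v q - ra α q * Dr v q ^ 2 - v q * ra γ q * Dr v q
    - v q / r * (α q * Dr v q) - v q / r * (γ q * v q) := by rw [bulk]; ring
  rw [hb]
  have u1 := abs_le.1 t1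
  have u2 := abs_le.1 t2
  have u3 := abs_le.1 t3
  have u4 := abs_le.1 t4
  have u5 := abs_le.1 t5
  have u6 := abs_le.1 t6
  have u7 := abs_le.1 t7
  have u8 := abs_le.1 t8
  have hK : 2 * C * e + (1 + C) * e + (C + 1 / 2 * (d * C + C)) * (2 * e) + C * (2 * e)
      + C * (2 * e) + (1 + C) * e + (1 + C ^ 2) * e + C * (2 * e)
      ≤ (3 + 13 * C + d * C + C ^ 2) * e := by
    have : 0 ≤ C * e := by positivity
    linarith
  refine le_trans ?_ hK
  rw [abs_le]
  constructor <;> linarith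

lemma qM_bound {v α γ : Spc d × ℝ → ℝ} {q : Spc d × ℝ} (hq : q ∈ Om d) {C : ℝ}
    (a1 : ‖q.1‖ * |α q| ≤ C) (g1 : ‖q.1‖ * γ q ^ 2 ≤ C) :
    |qM v α γ q| ≤ (3 * C + 1) * en v q := by
  have hr := norm_pos_Om hq
  set p := √(Ns v q) with hp
  have hp0 : 0 ≤ p := Real.sqrt_nonneg _
  have hpp : p ^ 2 = Ns v q := Real.sq_sqrt (Ns_nonneg v q)
  have hS : |Dr v q| ≤ ‖q.1‖ * p := abs_Dr_le v q
  have hN := Ns_le_en v q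
  have hT := Dt_sq_le_en v q
  have hV := pot_le_en v q
  rw [div_le_iff₀ hr] at hV
  have he0 := en_nonneg v q
  have hC : 0 ≤ C := le_trans (by positivity) g1
  have t1 : |Dt v q * (α q * Dr v q)| ≤ 2 * C * en v q := by
    have h1 : |α q * Dr v q| ≤ C * p := by
      rw [abs_mul]
      calc |α q| * |Dr v q| ≤ |α q| * (‖q.1‖ * p) := by gcongr
        _ = ‖q.1‖ * |α q| * p := by ring
        _ ≤ C * p := by gcongr
    rw [abs_mul]
    calc |Dt v q| * |α q * Dr v q| ≤ |Dt v q| * (C * p) := by gcongr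
      _ = C * |Dt v q * p| := by rw [abs_mul, abs_of_nonneg hp0]; ring
      _ ≤ C * ((Dt v q ^ 2 + p ^ 2) / 2) := by gcongr; exact abs_mul_le_half _ _
      _ ≤ C * (2 * en v q) := by gcongr; linarith
      _ = _ := by ring
  have t2 : |Dt v q * (γ q * v q)| ≤ (1 + C) * en v q := by
    have : (γ q * v q) ^ 2 ≤ 2 * C * en v q := by
      calc (γ q * v q) ^ 2 = γ q ^ 2 * v q ^ 2 := by ring
        _ ≤ γ q ^ 2 * (2 * en v q * ‖q.1‖) := by gcongr
        _ = (‖q.1‖ * γ q ^ 2) * (2 * en v q) := by ring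
        _ ≤ C * (2 * en v q) := by gcongr
        _ = _ := by ring
    exact (abs_mul_le_half _ _).trans (by linarith)
  have : qM v α γ q = Dt v q * (α q * Dr v q) + Dt v q * (γ q * v q) := by rw [qM]; ring
  rw [this]
  exact (abs_add_le _ _).trans (by linarith)

lemma meas_bulk {v α γ : Spc d × ℝ → ℝ} (hv : Measurable v) (ha : Measurable α) (hg : Measurable γ) :
    Measurable (bulk v α γ) := by unfold bulk; fun_prop
lemma meas_qM {v α γ : Spc d × ℝ → ℝ} (hv : Measurable v) (ha : Measurable α) (hg : Measurable γ) :
    Measurable (qM v α γ) := by unfold qM; fun_prop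

lemma MW.int_qM [Fact (3 ≤ d)] {v α γ : Spc d × ℝ → ℝ} {t0 t1 C : ℝ} (hv : IsW0 v)
    (h : MW α γ t0 t1 C) {t : ℝ} (ht : t ∈ Set.Icc t0 t1) : Integrable (fun x => qM v α γ (x, t)) := by
  refine ((hv.int t).const_mul (3 * C + 1)).mono' (slice_meas (meas_qM hv.meas h.rad.meas
    h.rad'.meas) t).aestronglyMeasurable ?_
  filter_upwards [ae_ne] with x hx
  exact qM_bound (mem_Om.2 hx) (h.a1 _ (mem_Om.2 hx) ht) (h.g1 _ (mem_Om.2 hx) ht)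

lemma M_full [Fact (3 ≤ d)] {v α γ : Spc d × ℝ → ℝ} {t0 t1 C : ℝ} (hv : IsW0 v)
    (h : MW α γ t0 t1 C) (h01 : t0 ≤ t1) :
    Integrable (bulk v α γ) (slab d t0 t1) ∧
    (∫ x, qM v α γ (x, t1)) - ∫ x, qM v α γ (x, t0) = ∫ p, bulk v α γ p ∂slab d t0 t1 := by
  obtain ⟨C', hC'0, hC'⟩ := eta_ra_bound d
  obtain ⟨M, hM0, hM⟩ := bdd_near hv.cont t0 t1
  have hcpt := fun n => M_cpt (v := v) (α := fun q => eta d n q * α q) (γ := fun q => eta d n q * γ q)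
    hv ((eta_rad n).mul h.rad) ((eta_rad n).mul h.rad') (δ := 1 / (n + 1 : ℝ))
    (R := 2 * (n + 1 : ℝ)) (by positivity) (fun p hp => by simp [eta_supp n p hp])
    (fun p hp => by simp [eta_supp n p hp]) h01
  have ebulk : ∀ n, ∀ q ∈ Om d, bulk v (fun q => eta d n q * α q) (fun q => eta d n q * γ q) q =
      eta d n q * bulk v α γ q + ra (eta d n) q * (-(1 / 2 * (‖q.1‖ ^ 2 * α q) * (Dt v q ^ 2 - Ns v q))
        - α q * Dr v q ^ 2 - v q * γ q * Dr v q) := fun n q hq => by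
    have hd := (eta_rad (d := d) n).diff hq
    simp only [bulk, ra_mul (eta_rad n) h.rad hq, ra_mul (eta_rad n) h.rad' hq,
      Dt_mul hd (h.rad.diff hq), Dt_mul hd (h.rad'.diff hq), eta_Dt n hq]
    ring
  have eq : ∀ n q, qM v (fun q => eta d n q * α q) (fun q => eta d n q * γ q) q =
      eta d n q * qM v α γ q := fun n q => by simp only [qM]; ring
  have L1 := dct_slab (f := bulk v α γ) (t0 := t0) (t1 := t1) hv
    ((3 + 13 * C + d * C + C ^ 2) + C' * C * 3 + C' * (1 + C + M ^ 2 * C ^ 2))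
    (F := fun n => bulk v (fun q => eta d n q * α q) (fun q => eta d n q * γ q))
    (fun n => meas_bulk hv.meas ((eta_rad n).meas.mul h.rad.meas) ((eta_rad n).meas.mul h.rad'.meas))
    (fun n q hq ht => ?_) (fun q hq => ?_)
  · have L2 : ∀ t ∈ Set.Icc t0 t1, Tendsto (fun n => ∫ x, qM v (fun q => eta d n q * α q)
        (fun q => eta d n q * γ q) (x, t)) atTop (𝓝 (∫ x, qM v α γ (x, t))) := fun t ht => by
      have hC : 0 ≤ 3 * C + 1 := by
        have : Nontrivial (Spc d) := inferInstance
        obtain ⟨y, hy⟩ := exists_ne (0 : Spc d)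
        have := (abs_nonneg _).trans (h.a0 (y, t) (mem_Om.2 hy) ht)
        linarith
      refine (dct_slice (t := t) (f := qM v α γ)
        (F := fun n => qM v (fun q => eta d n q * α q) (fun q => eta d n q * γ q))
        hv (3 * C + 1) (fun n => meas_qM hv.meas
        ((eta_rad n).meas.mul h.rad.meas) ((eta_rad n).meas.mul h.rad'.meas)) (fun n x hx => ?_)
        (fun x hx => ?_)).2
      · have hq : (x, t) ∈ Om d := mem_Om.2 hx
        rw [eq, abs_mul, abs_of_nonneg (eta_nonneg n _)]
        have b := qM_bound (v := v) hq (h.a1 _ hq ht) (h.g1 _ hq ht)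
        have := wz_nonneg x
        calc _ ≤ |qM v α γ (x, t)| := mul_le_of_le_one_left (abs_nonneg _) (eta_le_one n _)
          _ ≤ _ := b.trans (by nlinarith)
      · simp only [eq]
        simpa using (eta_tendsto (d := d) (q := (x, t)) (mem_Om.2 hx)).1.mul_const (qM v α γ (x, t))
    refine ⟨L1.1, ?_⟩
    refine tendsto_nhds_unique ((L2 t1 ⟨h01, le_rfl⟩).sub (L2 t0 ⟨le_rfl, h01⟩)) ?_
    simp only [hcpt]
    exact L1.2
  · rw [ebulk n q hq]
    have hr := norm_pos_Om hq
    have b1 := bulk_bound (v := v) hq (h.a0 q hq ht) (h.a1 q hq ht) (h.a2 q hq ht) (h.a3 q hq ht)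
      (h.g0 q hq ht) (h.g2 q hq ht) (h.g3 q hq ht)
    have a0 := h.a0 q hq ht
    have g0 := h.g0 q hq ht
    have g1 := h.g1 q hq ht
    have hη := hC' n q hq
    have hC : 0 ≤ C := (abs_nonneg _).trans a0
    set r := ‖q.1‖ with hrd
    set e := en v q with he
    set p := √(Ns v q) with hp
    set η' := ra (eta d n) q with hη'
    have hp0 : 0 ≤ p := Real.sqrt_nonneg _
    have hpp : p ^ 2 = Ns v q := Real.sq_sqrt (Ns_nonneg v q)
    have hS : |Dr v q| ≤ r * p := abs_Dr_le v q
    have hN : Ns v q ≤ 2 * e := Ns_le_en v q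
    have hN0 := Ns_nonneg v q
    have hT : Dt v q ^ 2 ≤ 2 * e := Dt_sq_le_en v q
    have hV : v q ^ 2 / r ≤ 2 * e := pot_le_en v q
    have hV' : v q ^ 2 ≤ 2 * e * r := by rwa [div_le_iff₀ hr] at hV
    have he0 : 0 ≤ e := en_nonneg v q
    have hw0 := wz_nonneg q.1
    have hTN : |Dt v q ^ 2 - Ns v q| ≤ 2 * e := by
      rw [abs_le]; constructor <;> nlinarith [sq_nonneg (Dt v q)]
    have s1 : |η' * (1 / 2 * (r ^ 2 * α q) * (Dt v q ^ 2 - Ns v q))| ≤ C' * C * e := by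
      have : η' * (1 / 2 * (r ^ 2 * α q) * (Dt v q ^ 2 - Ns v q)) =
        (r ^ 2 * η') * α q * (1 / 2 * (Dt v q ^ 2 - Ns v q)) := by ring
      rw [this, abs_mul, abs_mul, abs_mul, abs_mul, abs_of_nonneg (sq_nonneg r),
        abs_of_pos (by norm_num : (0 : ℝ) < 1 / 2)]
      gcongr
      linarith
    have s2 : |η' * (α q * Dr v q ^ 2)| ≤ C' * C * (2 * e) := by
      rw [abs_mul, abs_mul, abs_of_nonneg (sq_nonneg (Dr v q))]
      calc |η'| * (|α q| * Dr v q ^ 2) ≤ |η'| * (|α q| * (r ^ 2 * Ns v q)) := by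
            gcongr; exact Dr_sq_le v q
        _ = (r ^ 2 * |η'|) * |α q| * Ns v q := by ring
        _ ≤ _ := by gcongr
    have s3' : (v q * γ q / r) ^ 2 ≤ 2 * C * e + M ^ 2 * C ^ 2 * wz q.1 := by
      by_cases hr1 : r ≤ 1
      · have hvM := hM q hr1 ht
        have : wz q.1 = 1 / r ^ 2 := by unfold wz; rw [if_pos hr1]
        rw [this, div_pow, mul_pow, ← sq_abs (v q), ← sq_abs (γ q)]
        have h1 : |v q| ^ 2 * |γ q| ^ 2 / r ^ 2 ≤ M ^ 2 * C ^ 2 * (1 / r ^ 2) := by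
          rw [mul_one_div]; gcongr
        have : 0 ≤ 2 * C * e := by positivity
        linarith
      · have h1 : (v q * γ q / r) ^ 2 ≤ (v q * γ q) ^ 2 := by
          rw [div_pow]
          exact div_le_self (sq_nonneg _) (one_le_pow₀ (not_le.1 hr1).le)
        have h2 : (v q * γ q) ^ 2 ≤ 2 * C * e := by
          calc (v q * γ q) ^ 2 = γ q ^ 2 * v q ^ 2 := by ring
            _ ≤ γ q ^ 2 * (2 * e * r) := by gcongr
            _ = (r * γ q ^ 2) * (2 * e) := by ring
            _ ≤ C * (2 * e) := by gcongr
            _ = _ := by ring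
        have : 0 ≤ M ^ 2 * C ^ 2 * wz q.1 := by positivity
        linarith
    have s3 : |η' * (v q * γ q * Dr v q)| ≤ C' * ((1 + C) * e + M ^ 2 * C ^ 2 * wz q.1) := by
      rw [abs_mul, abs_mul]
      calc |η'| * (|v q * γ q| * |Dr v q|) ≤ |η'| * (|v q * γ q| * (r * p)) := by gcongr
        _ = (r ^ 2 * |η'|) * |(v q * γ q / r) * p| := by
          rw [abs_mul _ p, abs_of_nonneg hp0, abs_div, abs_of_pos hr]; field_simp
        _ ≤ C' * (((v q * γ q / r) ^ 2 + p ^ 2) / 2) := by gcongr; exact abs_mul_le_half _ _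
        _ ≤ _ := by
          gcongr
          have : 0 ≤ M ^ 2 * C ^ 2 * wz q.1 := by positivity
          linarith
    have s0 : |eta d n q * bulk v α γ q| ≤ (3 + 13 * C + d * C + C ^ 2) * e := by
      rw [abs_mul, abs_of_nonneg (eta_nonneg n q)]
      exact (mul_le_of_le_one_left (abs_nonneg _) (eta_le_one n q)).trans b1
    have split : eta d n q * bulk v α γ q + η' * (-(1 / 2 * (r ^ 2 * α q) * (Dt v q ^ 2 - Ns v q))
        - α q * Dr v q ^ 2 - v q * γ q * Dr v q) = eta d n q * bulk v α γ q
        - η' * (1 / 2 * (r ^ 2 * α q) * (Dt v q ^ 2 - Ns v q)) - η' * (α q * Dr v q ^ 2)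
        - η' * (v q * γ q * Dr v q) := by ring
    rw [split]
    have m1 : 0 ≤ (3 + 13 * C + d * C + C ^ 2) * wz q.1 := by positivity
    have m2 : 0 ≤ C' * C * wz q.1 := by positivity
    have m3 : 0 ≤ C' * (1 + C) * wz q.1 := by positivity
    have m4 : 0 ≤ C' * (M ^ 2 * C ^ 2) * e := by positivity
    have := abs_le.1 s0
    have := abs_le.1 s1
    have := abs_le.1 s2
    have := abs_le.1 s3
    rw [abs_le]
    constructor <;> linarith
  · simp only [ebulk _ q hq]
    obtain ⟨l1, l2⟩ := eta_tendsto hq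
    simpa using (l1.mul_const (bulk v α γ q)).add (l2.mul_const (-(1 / 2 * (‖q.1‖ ^ 2 * α q) *
      (Dt v q ^ 2 - Ns v q)) - α q * Dr v q ^ 2 - v q * γ q * Dr v q))

lemma H_full [Fact (3 ≤ d)] {v κ : Spc d × ℝ → ℝ} (hv : IsW0 v) (hk : Rad κ) {t C : ℝ}
    (k0 : ∀ x, x ≠ 0 → ‖x‖ * |κ (x, t)| ≤ C) (k1 : ∀ x, x ≠ 0 → ‖x‖ * κ (x, t) ^ 2 * ‖x‖ ^ 2 ≤ C)
    (k2 : ∀ x, x ≠ 0 → ‖x‖ * |d * κ (x, t) + ‖x‖ ^ 2 * ra κ (x, t)| ≤ C) :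
    Integrable (fun x => 2 * v (x, t) * κ (x, t) * Dr v (x, t)
      + v (x, t) ^ 2 * (d * κ (x, t) + ‖x‖ ^ 2 * ra κ (x, t))) ∧
    ∫ x, (2 * v (x, t) * κ (x, t) * Dr v (x, t)
      + v (x, t) ^ 2 * (d * κ (x, t) + ‖x‖ ^ 2 * ra κ (x, t))) = 0 := by
  obtain ⟨C', hC'0, hC'⟩ := eta_ra_bound d
  set F : Spc d × ℝ → ℝ := fun q => 2 * v q * κ q * Dr v q
    + v q ^ 2 * (d * κ q + ‖q.1‖ ^ 2 * ra κ q) with hF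
  have hcpt := fun n => H_cpt (v := v) (κ := fun q => eta d n q * κ q)
    hv ((eta_rad n).mul hk) (δ := 1 / (n + 1 : ℝ))
    (R := 2 * (n + 1 : ℝ)) (by positivity) (fun p hp => by simp [eta_supp n p hp]) t
  have e1 : ∀ n, ∀ q ∈ Om d, 2 * v q * (eta d n q * κ q) * Dr v q + v q ^ 2 *
      (d * (eta d n q * κ q) + ‖q.1‖ ^ 2 * ra (fun q => eta d n q * κ q) q) =
      eta d n q * F q + ra (eta d n) q * (‖q.1‖ ^ 2 * v q ^ 2 * κ q) := fun n q hq => by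
    simp only [ra_mul (eta_rad n) hk hq, hF]
    ring
  have hvm := hv.meas
  have hkm := hk.meas
  have hem := fun n => (eta_rad (d := d) n).meas
  have L := dct_slice (t := t) (f := F) (F := fun n q => 2 * v q * (eta d n q * κ q) * Dr v q +
      v q ^ 2 * (d * (eta d n q * κ q) + ‖q.1‖ ^ 2 * ra (fun q => eta d n q * κ q) q))
    hv (4 * C + 2 + 2 * C' * C) (fun n => by have := hem n; fun_prop) (fun n x hx => ?_)
    (fun x hx => ?_)
  · refine ⟨L.1, tendsto_nhds_unique L.2 ?_⟩
    simp only [hcpt]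
    exact tendsto_const_nhds
  · have hq : (x, t) ∈ Om d := mem_Om.2 hx
    rw [e1 n _ hq]
    have hr := norm_pos_Om hq
    have hη := hC' n _ hq
    have k0' := k0 x hx
    have k1' := k1 x hx
    have k2' := k2 x hx
    have hC : 0 ≤ C := le_trans (by positivity) k0'
    simp only at hr hη
    set r := ‖x‖ with hrd
    set q := (x, t) with hqd
    set e := en v q with he
    set p := √(Ns v q) with hp
    set η' := ra (eta d n) q with hη'
    have hp0 : 0 ≤ p := Real.sqrt_nonneg _
    have hpp : p ^ 2 = Ns v q := Real.sq_sqrt (Ns_nonneg v q)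
    have hS : |Dr v q| ≤ r * p := abs_Dr_le v q
    have hN : Ns v q ≤ 2 * e := Ns_le_en v q
    have hV : v q ^ 2 / r ≤ 2 * e := pot_le_en v q
    have hV' : v q ^ 2 ≤ 2 * e * r := by rwa [div_le_iff₀ hr] at hV
    have he0 : 0 ≤ e := en_nonneg v q
    have hw0 := wz_nonneg x
    have s1 : |2 * v q * κ q * Dr v q| ≤ (2 * C + 2) * e := by
      have h3 : (r * κ q * v q) ^ 2 ≤ 2 * C * e := by
        calc (r * κ q * v q) ^ 2 = r ^ 2 * κ q ^ 2 * v q ^ 2 := by ring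
          _ ≤ r ^ 2 * κ q ^ 2 * (2 * e * r) := by gcongr
          _ = (r * κ q ^ 2 * r ^ 2) * (2 * e) := by ring
          _ ≤ C * (2 * e) := by gcongr
          _ = _ := by ring
      have h4 : |2 * v q * κ q| = 2 * |v q| * |κ q| := by rw [abs_mul, abs_mul]; norm_num
      rw [abs_mul, h4]
      calc 2 * |v q| * |κ q| * |Dr v q| ≤ 2 * |v q| * |κ q| * (r * p) := by gcongr
        _ = 2 * |(r * κ q * v q) * p| := by
          rw [abs_mul _ p, abs_of_nonneg hp0, abs_mul, abs_mul, abs_of_pos hr]; ring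
        _ ≤ 2 * (((r * κ q * v q) ^ 2 + p ^ 2) / 2) := by gcongr; exact abs_mul_le_half _ _
        _ ≤ _ := by linarith
    have s2 : |v q ^ 2 * (d * κ q + r ^ 2 * ra κ q)| ≤ C * (2 * e) := by
      rw [abs_mul, abs_of_nonneg (sq_nonneg (v q))]
      calc v q ^ 2 * |d * κ q + r ^ 2 * ra κ q| ≤ (2 * e * r) * |d * κ q + r ^ 2 * ra κ q| := by
            gcongr
        _ = (r * |d * κ q + r ^ 2 * ra κ q|) * (2 * e) := by ring
        _ ≤ _ := by gcongr
    have s3 : |η' * (r ^ 2 * v q ^ 2 * κ q)| ≤ 2 * C' * C * e := by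
      have : η' * (r ^ 2 * v q ^ 2 * κ q) = (r ^ 2 * η') * (v q ^ 2 * κ q) := by ring
      rw [this, abs_mul, abs_mul, abs_mul, abs_of_nonneg (sq_nonneg r), abs_of_nonneg (sq_nonneg (v q))]
      calc r ^ 2 * |η'| * (v q ^ 2 * |κ q|) ≤ C' * ((2 * e * r) * |κ q|) := by gcongr
        _ = C' * (2 * e * (r * |κ q|)) := by ring
        _ ≤ C' * (2 * e * C) := by gcongr
        _ = _ := by ring
    have s4 : |eta d n q * F q| ≤ (4 * C + 2) * e := by
      rw [abs_mul, abs_of_nonneg (eta_nonneg n q)]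
      refine (mul_le_of_le_one_left (abs_nonneg _) (eta_le_one n q)).trans ?_
      exact (abs_add_le _ _).trans (by linarith)
    have : 0 ≤ (4 * C + 2 + 2 * C' * C) * wz x := by positivity
    exact (abs_add_le _ _).trans (by linarith)
  · have hq : (x, t) ∈ Om d := mem_Om.2 hx
    simp only [e1 _ _ hq]
    obtain ⟨l1, l2⟩ := eta_tendsto hq
    simpa using (l1.mul_const (F (x, t))).add (l2.mul_const (‖x‖ ^ 2 * v (x, t) ^ 2 * κ (x, t)))

lemma TS_le (v : Spc d × ℝ → ℝ) (q : Spc d × ℝ) : |Dt v q * Dr v q| ≤ ‖q.1‖ * (2 * en v q) := by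
  have hpp : √(Ns v q) ^ 2 = Ns v q := Real.sq_sqrt (Ns_nonneg v q)
  have hp0 := Real.sqrt_nonneg (Ns v q)
  have := Ns_le_en v q
  have := Dt_sq_le_en v q
  rw [abs_mul]
  calc |Dt v q| * |Dr v q| ≤ |Dt v q| * (‖q.1‖ * √(Ns v q)) := by gcongr; exact abs_Dr_le v q
    _ = ‖q.1‖ * |Dt v q * √(Ns v q)| := by rw [abs_mul, abs_of_nonneg hp0]; ring
    _ ≤ ‖q.1‖ * ((Dt v q ^ 2 + √(Ns v q) ^ 2) / 2) := by gcongr; exact abs_mul_le_half _ _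
    _ ≤ _ := by gcongr; linarith

lemma E_full [Fact (3 ≤ d)] {v a : Spc d × ℝ → ℝ} {t0 t1 C M : ℝ} (hv : IsW0 v) (ha : Rad a)
    (a0 : ∀ q ∈ Om d, q.2 ∈ Set.Icc t0 t1 → |a q| ≤ C)
    (a1 : ∀ q ∈ Om d, q.2 ∈ Set.Icc t0 t1 → |Dt a q| ≤ C)
    (a2 : ∀ q ∈ Om d, q.2 ∈ Set.Icc t0 t1 → ‖q.1‖ * |ra a q| ≤ C)
    (a3 : ∀ q ∈ Om d, q.2 ∈ Set.Icc t0 t1 → ‖q.1‖ ≤ 1 → |a q * Dt v q| ≤ M * (‖q.1‖ * |Dt v q| + 1))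
    (h01 : t0 ≤ t1) :
    Integrable (fun p => Dt a p * en v p - ra a p * Dt v p * Dr v p) (slab d t0 t1) ∧
    (∫ x, a (x, t1) * en v (x, t1)) - ∫ x, a (x, t0) * en v (x, t0) =
      ∫ p, (Dt a p * en v p - ra a p * Dt v p * Dr v p) ∂slab d t0 t1 := by
  obtain ⟨C', hC'0, hC'⟩ := eta_ra_bound d
  set F : Spc d × ℝ → ℝ := fun p => Dt a p * en v p - ra a p * Dt v p * Dr v p with hF
  have hcpt := fun n => E_cpt (v := v) (a := fun q => eta d n q * a q)
    hv ((eta_rad n).mul ha) (δ := 1 / (n + 1 : ℝ))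
    (R := 2 * (n + 1 : ℝ)) (by positivity) (fun p hp => by simp [eta_supp n p hp]) h01
  have e1 : ∀ n, ∀ q ∈ Om d, Dt (fun q => eta d n q * a q) q * en v q
      - ra (fun q => eta d n q * a q) q * Dt v q * Dr v q =
      eta d n q * F q + ra (eta d n) q * (-(a q * Dt v q * Dr v q)) := fun n q hq => by
    simp only [ra_mul (eta_rad n) ha hq, Dt_mul ((eta_rad n).diff hq) (ha.diff hq), eta_Dt n hq, hF]
    ring
  have hvm := meas_en hv.meas
  have ham := ha.meas
  have hem := fun n => (eta_rad (d := d) n).meas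
  obtain ⟨y, hy⟩ := exists_ne (0 : Spc d)
  have hC : 0 ≤ C := (abs_nonneg _).trans (a0 (y, t0) (mem_Om.2 hy) ⟨le_rfl, h01⟩)
  have L1 := dct_slab (t0 := t0) (t1 := t1) (f := F) (F := fun n q =>
      Dt (fun q => eta d n q * a q) q * en v q - ra (fun q => eta d n q * a q) q * Dt v q * Dr v q)
    hv (3 * C + C' * (2 * C) + 4 * C' * |M|) (fun n => by have := hem n; fun_prop)
    (fun n q hq ht => ?_) (fun q hq => ?_)
  · have L2 : ∀ t ∈ Set.Icc t0 t1, Tendsto (fun n => ∫ x, eta d n (x, t) * a (x, t) * en v (x, t))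
        atTop (𝓝 (∫ x, a (x, t) * en v (x, t))) := fun t ht => by
      refine (dct_slice (t := t) (f := fun q => a q * en v q)
        (F := fun n q => eta d n q * a q * en v q) hv C
        (fun n => by have := hem n; fun_prop) (fun n x hx => ?_) (fun x hx => ?_)).2
      · have hq : (x, t) ∈ Om d := mem_Om.2 hx
        have h1 := a0 _ hq ht
        have h2 := en_nonneg v (x, t)
        have h3 := wz_nonneg x
        rw [mul_assoc, abs_mul, abs_of_nonneg (eta_nonneg n _)]
        refine (mul_le_of_le_one_left (abs_nonneg _) (eta_le_one n _)).trans ?_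
        rw [abs_mul, abs_of_nonneg h2]
        gcongr
        linarith
      · have := ((eta_tendsto (d := d) (q := (x, t)) (mem_Om.2 hx)).1.mul_const
          (a (x, t))).mul_const (en v (x, t))
        simpa using this
    refine ⟨L1.1, tendsto_nhds_unique ((L2 t1 ⟨h01, le_rfl⟩).sub (L2 t0 ⟨le_rfl, h01⟩)) ?_⟩
    simp only [hcpt]
    exact L1.2
  · rw [e1 n _ hq]
    have hr := norm_pos_Om hq
    have hη := hC' n _ hq
    have b0 := a0 q hq ht
    have b1 := a1 q hq ht
    have b2 := a2 q hq ht
    have b3 := a3 q hq ht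
    set r := ‖q.1‖ with hrd
    set e := en v q with he
    set p := √(Ns v q) with hp
    set η' := ra (eta d n) q with hη'
    have hp0 : 0 ≤ p := Real.sqrt_nonneg _
    have hpp : p ^ 2 = Ns v q := Real.sq_sqrt (Ns_nonneg v q)
    have hS : |Dr v q| ≤ r * p := abs_Dr_le v q
    have hN : Ns v q ≤ 2 * e := Ns_le_en v q
    have hT : Dt v q ^ 2 ≤ 2 * e := Dt_sq_le_en v q
    have hTS : |Dt v q * Dr v q| ≤ r * (2 * e) := TS_le v q
    have he0 : 0 ≤ e := en_nonneg v q
    have hw0 := wz_nonneg q.1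
    have s1 : |eta d n q * F q| ≤ (3 * C) * e := by
      rw [abs_mul, abs_of_nonneg (eta_nonneg n q)]
      refine (mul_le_of_le_one_left (abs_nonneg _) (eta_le_one n q)).trans ?_
      have h1 : |Dt a q * e| ≤ C * e := by rw [abs_mul, abs_of_nonneg he0]; gcongr
      have h2 : |ra a q * Dt v q * Dr v q| ≤ C * (2 * e) := by
        rw [mul_assoc, abs_mul]
        calc |ra a q| * |Dt v q * Dr v q| ≤ |ra a q| * (r * (2 * e)) := by gcongr
          _ = (r * |ra a q|) * (2 * e) := by ring
          _ ≤ _ := by gcongr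
      exact (abs_sub _ _).trans (by linarith)
    have s2 : |η' * (-(a q * Dt v q * Dr v q))| ≤ (C' * (2 * C) + 4 * C' * |M|) * (e + wz q.1) := by
      rw [abs_mul, abs_neg]
      by_cases hr1 : r ≤ 1
      · have hw : wz q.1 = 1 / r ^ 2 := by unfold wz; rw [if_pos hr1]
        have h1 : |a q * Dt v q| ≤ |M| * (r * |Dt v q| + 1) :=
          (b3 hr1).trans (by gcongr; exact le_abs_self M)
        have h2 : |Dt v q * p| ≤ 2 * e := (abs_mul_le_half _ _).trans (by linarith)
        have h3 : |1 / r * p| ≤ wz q.1 + e := by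
          rw [hw]
          refine (abs_mul_le_half _ _).trans ?_
          rw [one_div_pow]
          have : 0 ≤ 1 / r ^ 2 := by positivity
          linarith
        calc |η'| * |a q * Dt v q * Dr v q| = |η'| * (|a q * Dt v q| * |Dr v q|) := by rw [abs_mul]
          _ ≤ |η'| * ((|M| * (r * |Dt v q| + 1)) * (r * p)) := by gcongr
          _ = (r ^ 2 * |η'|) * |M| * (|Dt v q| * p + 1 / r * p) := by field_simp
          _ = (r ^ 2 * |η'|) * |M| * (|Dt v q * p| + |1 / r * p|) := by
            rw [abs_mul _ p, abs_mul _ p, abs_of_nonneg hp0, abs_of_pos (by positivity : 0 < 1 / r)]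
          _ ≤ C' * |M| * (2 * e + (wz q.1 + e)) := by gcongr
          _ ≤ _ := by
            have m1 : 0 ≤ C' * (2 * C) * (e + wz q.1) := by positivity
            have m2 : 0 ≤ C' * |M| * (e + 3 * wz q.1) := by positivity
            linarith
      · have hr1' := (not_le.1 hr1).le
        calc |η'| * |a q * Dt v q * Dr v q| = |η'| * (|a q| * |Dt v q * Dr v q|) := by
              rw [← abs_mul (a q), mul_assoc]
          _ ≤ |η'| * (C * (r * (2 * e))) := by gcongr
          _ ≤ |η'| * (C * (r * r * (2 * e))) := by gcongr; nlinarith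
          _ = (r ^ 2 * |η'|) * (2 * C * e) := by ring
          _ ≤ C' * (2 * C * e) := by gcongr
          _ ≤ _ := by
            have m1 : 0 ≤ C' * (2 * C) * wz q.1 := by positivity
            have m2 : 0 ≤ 4 * C' * |M| * (e + wz q.1) := by positivity
            linarith
    have : 0 ≤ (3 * C) * wz q.1 := by positivity
    exact (abs_add_le _ _).trans (by linarith)
  · simp only [e1 _ _ hq]
    obtain ⟨l1, l2⟩ := eta_tendsto hq
    simpa using (l1.mul_const (F q)).add (l2.mul_const (-(a q * Dt v q * Dr v q)))

end Coulomb

namespace Coulomb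
open scoped Topology
variable {d : ℕ}

/-! ### Symmetries -/

lemma bilin_inv (B : Spc d →L[ℝ] Spc d →L[ℝ] ℝ) (L : Spc d ≃ₗᵢ[ℝ] Spc d) :
    ∑ i, B (L (bv i)) (L (bv i)) = ∑ i, B (bv i) (bv i) := by
  have h1 : ∀ x y : Spc d, B x y = ∑ j, ∑ k, x j * y k * B (bv j) (bv k) := fun x y => by
    conv_lhs => rw [sum_bv x, sum_bv y]
    simp only [map_sum, map_smul, _root_.sum_apply, _root_.smul_apply,
      smul_eq_mul, Finset.mul_sum]
    rw [Finset.sum_comm]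
    refine Finset.sum_congr rfl fun j _ => Finset.sum_congr rfl fun k _ => by ring
  have h2 : ∀ j k, ∑ i, (L (bv i)) j * (L (bv i)) k = ∑ i, bv i j * bv i k := fun j k => by
    have e : ∀ i j, (L (bv i)) j = inner ℝ (bv i) (L.symm (bv j)) := fun i j => by
      rw [← inner_bv, ← L.inner_map_map (bv i), L.apply_symm_apply]
    have e' : ∀ i j : Fin d, bv i j = inner ℝ (bv i) (bv j) := fun i j => by rw [inner_bv]
    have hb : ∀ x y : Spc d, ∑ i, inner ℝ (bv i) x * inner ℝ (bv i) y = inner ℝ x y := fun x y => by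
      have := (EuclideanSpace.basisFun (Fin d) ℝ).sum_inner_mul_inner x y
      rw [← this]
      refine Finset.sum_congr rfl fun i _ => ?_
      rw [EuclideanSpace.basisFun_apply, real_inner_comm]; rfl
    simp only [e, e', hb]
    exact L.symm.inner_map_map _ _
  have h3 : ∀ f : Fin d → Spc d, ∑ i, B (f i) (f i) = ∑ j, ∑ k, (∑ i, f i j * f i k) * B (bv j) (bv k) :=
    fun f => by
    simp only [h1 (f _) (f _), Finset.sum_mul]
    rw [Finset.sum_comm]
    refine Finset.sum_congr rfl fun j _ => Finset.sum_comm
  rw [h3, h3]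
  simp only [h2]

/-- The space-time isometry `(x, t) ↦ (L x, t + s)`. -/
noncomputable def phi (L : Spc d ≃ₗᵢ[ℝ] Spc d) (s : ℝ) (q : Spc d × ℝ) : Spc d × ℝ := (L q.1, q.2 + s)

/-- The linear part of `phi`. -/
noncomputable def Phi (L : Spc d →L[ℝ] Spc d) : Spc d × ℝ →L[ℝ] Spc d × ℝ :=
  L.prodMap (ContinuousLinearMap.id ℝ ℝ)

noncomputable def act (L : Spc d ≃ₗᵢ[ℝ] Spc d) (s : ℝ) (v : Spc d × ℝ → ℝ) (q : Spc d × ℝ) : ℝ := v (phi L s q)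

lemma Phi_apply (L : Spc d →L[ℝ] Spc d) (w : Spc d × ℝ) : Phi L w = (L w.1, w.2) := rfl

noncomputable abbrev toC (L : Spc d ≃ₗᵢ[ℝ] Spc d) : Spc d →L[ℝ] Spc d :=
  (L.toContinuousLinearEquiv : Spc d →L[ℝ] Spc d)

variable (L : Spc d ≃ₗᵢ[ℝ] Spc d) (s : ℝ)

lemma phi_hasFDerivAt (q : Spc d × ℝ) : HasFDerivAt (phi L s) (Phi (toC L)) q := by
  have h : phi L s = fun q => Phi (toC L) q + (0, s) := by
    funext q; simp [phi, Phi_apply]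
  rw [h]
  exact (Phi (toC L)).hasFDerivAt.add_const _

lemma phi_cont : Continuous (phi L s) := by unfold phi; fun_prop

lemma phi_contDiff {n : WithTop ℕ∞} : ContDiff ℝ n (phi L s) := by
  have h : phi L s = fun q => Phi (toC L) q + (0, s) := by
    funext q; simp [phi, Phi_apply]
  rw [h]; fun_prop

lemma phi_Om {q : Spc d × ℝ} (hq : q ∈ Om d) : phi L s q ∈ Om d := by
  rw [mem_Om] at *
  simpa [phi] using hq

lemma norm_phi (q : Spc d × ℝ) : ‖(phi L s q).1‖ = ‖q.1‖ := by simp [phi]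

lemma act_fderiv {v : Spc d × ℝ → ℝ} (hv : ContDiffOn ℝ 1 v (Om d)) {q} (hq : q ∈ Om d) :
    fderiv ℝ (act L s v) q = (fderiv ℝ v (phi L s q)).comp (Phi (toC L)) :=
  ((diffAt one_ne_zero hv (phi_Om L s hq)).hasFDerivAt.comp q (phi_hasFDerivAt L s q)).fderiv

lemma act_fderiv2 {v : Spc d × ℝ → ℝ} (hv : ContDiffOn ℝ 2 v (Om d)) {q} (hq : q ∈ Om d) :
    fderiv ℝ (fderiv ℝ (act L s v)) q =
      ((ContinuousLinearMap.compL ℝ (Spc d × ℝ) (Spc d × ℝ) ℝ).flip (Phi (toC L))).comp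
        ((fderiv ℝ (fderiv ℝ v) (phi L s q)).comp (Phi (toC L))) := by
  have hv1 := hv.of_le (show (1 : WithTop ℕ∞) ≤ 2 by norm_num)
  have e : fderiv ℝ (act L s v) =ᶠ[𝓝 q] fun p =>
      (ContinuousLinearMap.compL ℝ (Spc d × ℝ) (Spc d × ℝ) ℝ).flip (Phi (toC L))
        (fderiv ℝ v (phi L s p)) := by
    filter_upwards [Om_nhds hq] with p hp
    rw [act_fderiv L s hv1 hp]; rfl
  rw [e.fderiv_eq]
  have hd : DifferentiableAt ℝ (fderiv ℝ v) (phi L s q) :=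
    ((cdAt hv (phi_Om L s hq)).fderiv_right (m := 1) (by norm_num)).differentiableAt one_ne_zero
  exact (((ContinuousLinearMap.compL ℝ (Spc d × ℝ) (Spc d × ℝ) ℝ).flip
    (Phi (toC L))).hasFDerivAt.comp q
      (hd.hasFDerivAt.comp q (phi_hasFDerivAt L s q))).fderiv

lemma fderiv2_apply {v : Spc d × ℝ → ℝ} (hv : ContDiffOn ℝ 2 v (Om d)) {q} (hq : q ∈ Om d)
    (a b : Spc d × ℝ) : fderiv ℝ (fun p => fderiv ℝ v p a) q b = fderiv ℝ (fderiv ℝ v) q b a := by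
  have hd : DifferentiableAt ℝ (fderiv ℝ v) q :=
    ((cdAt hv hq).fderiv_right (m := 1) (by norm_num)).differentiableAt one_ne_zero
  rw [fderiv_clm_apply hd (by fun_prop)]
  simp

/-- The wave operator in terms of the second derivative. -/
noncomputable def box (D : Spc d × ℝ →L[ℝ] Spc d × ℝ →L[ℝ] ℝ) : ℝ :=
  D (0, 1) (0, 1) - ∑ i, D (bv i, 0) (bv i, 0)

lemma pde_iff {v : Spc d × ℝ → ℝ} (hv : ContDiffOn ℝ 2 v (Om d)) {q} (hq : q ∈ Om d) :
    Dt (Dt v) q = ∑ i, Dx i (Dx i v) q - v q / ‖q.1‖ ↔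
      box (fderiv ℝ (fderiv ℝ v) q) + v q / ‖q.1‖ = 0 := by
  have h1 : Dt (Dt v) q = fderiv ℝ (fderiv ℝ v) q (0, 1) (0, 1) := fderiv2_apply hv hq _ _
  have h2 : ∀ i, Dx i (Dx i v) q = fderiv ℝ (fderiv ℝ v) q (bv i, 0) (bv i, 0) :=
    fun i => fderiv2_apply hv hq _ _
  rw [h1, box]
  simp only [h2]
  constructor <;> intro h <;> linarith

lemma act_Dt {v : Spc d × ℝ → ℝ} (hv : ContDiffOn ℝ 1 v (Om d)) {q} (hq : q ∈ Om d) :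
    Dt (act L s v) q = Dt v (phi L s q) := by
  rw [Dt, act_fderiv L s hv hq]
  simp [Phi_apply, Dt]

lemma act_Ns {v : Spc d × ℝ → ℝ} (hv : ContDiffOn ℝ 1 v (Om d)) {q} (hq : q ∈ Om d) :
    Ns (act L s v) q = Ns v (phi L s q) := by
  set A : Spc d →L[ℝ] ℝ := (fderiv ℝ v (phi L s q)).comp (ContinuousLinearMap.inl ℝ (Spc d) ℝ)
  have := bilin_inv (A.smulRight A) L
  simp only [Ns, Dx, act_fderiv L s hv hq]
  simpa [A, Phi_apply, pow_two] using this

lemma act_en {v : Spc d × ℝ → ℝ} (hv : ContDiffOn ℝ 1 v (Om d)) {q} (hq : q ∈ Om d) :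
    en (act L s v) q = en v (phi L s q) := by
  rw [en, act_Ns L s hv hq, act_Dt L s hv hq, en, norm_phi]; rfl

/-- The total energy at a given time. -/
noncomputable def Eg (v : Spc d × ℝ → ℝ) (t : ℝ) : ℝ := ∫ x, en v (x, t)

lemma Eg_nonneg (v : Spc d × ℝ → ℝ) (t : ℝ) : 0 ≤ Eg v t := integral_nonneg fun _ => en_nonneg _ _

lemma act_int [Fact (3 ≤ d)] {v : Spc d × ℝ → ℝ} (hv : ContDiffOn ℝ 1 v (Om d)) (t : ℝ)
    (hi : Integrable fun x => en v (x, t + s)) :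
    Integrable (fun x => en (act L s v) (x, t)) ∧ Eg (act L s v) t = Eg v (t + s) := by
  have hmp : MeasurePreserving L := L.measurePreserving
  have e : (fun x => en (act L s v) (x, t)) =ᵐ[volume] fun x => en v (L x, t + s) := by
    filter_upwards [ae_ne] with x hx using act_en L s hv (q := (x, t)) (mem_Om.2 hx)
  have hme : MeasurableEmbedding L := L.toHomeomorph.measurableEmbedding
  refine ⟨(integrable_congr e).2 ((hmp.integrable_comp_emb hme).2 hi), ?_⟩
  rw [Eg, integral_congr_ae e, Eg]
  exact hmp.integral_comp hme (fun x => en v (x, t + s))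

lemma IsW0.cd1 {v : Spc d × ℝ → ℝ} (hv : IsW0 v) : ContDiffOn ℝ 1 v (Om d) :=
  hv.cd.of_le (by norm_num)

lemma IsW0.act [Fact (3 ≤ d)] {v : Spc d × ℝ → ℝ} (hv : IsW0 v) : IsW0 (act L s v) := by
  have hcd : ContDiffOn ℝ 2 (Coulomb.act L s v) (Om d) :=
    hv.cd.comp (phi_contDiff L s).contDiffOn fun q hq => phi_Om L s hq
  refine ⟨hv.cont.comp (phi_cont L s), hcd, fun q hq => ?_, fun t => ?_, ?_⟩
  · rw [pde_iff hcd hq, act_fderiv2 L s hv.cd hq]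
    have h := (pde_iff hv.cd (phi_Om L s hq)).1 (hv.pde _ (phi_Om L s hq))
    rw [norm_phi] at h
    rw [← h]
    congr 1
    set D := fderiv ℝ (fderiv ℝ v) (phi L s q)
    have h2 := bilin_inv (d := d) ((ContinuousLinearMap.compL ℝ (Spc d) (Spc d × ℝ) ℝ).flip
      (ContinuousLinearMap.inl ℝ (Spc d) ℝ) ∘L D ∘L ContinuousLinearMap.inl ℝ (Spc d) ℝ) L
    simp only [box]
    simp only [ContinuousLinearMap.comp_apply, ContinuousLinearMap.flip_apply,
      ContinuousLinearMap.compL_apply, Phi_apply, ContinuousLinearMap.inl_apply] at h2 ⊢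
    simp only [map_zero]
    congr 1
  · exact (act_int L s hv.cd1 t (hv.int _)).1
  · obtain ⟨C, hC⟩ := hv.bdd
    exact ⟨C, fun t => ((act_int L s hv.cd1 t (hv.int _)).2).le.trans (hC _)⟩

/-! ### Linear combinations -/

lemma fderiv2_add {v w : Spc d × ℝ → ℝ} (hv : ContDiffOn ℝ 2 v (Om d))
    (hw : ContDiffOn ℝ 2 w (Om d)) {q} (hq : q ∈ Om d) :
    fderiv ℝ (fderiv ℝ (v + w)) q = fderiv ℝ (fderiv ℝ v) q + fderiv ℝ (fderiv ℝ w) q := by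
  have hd : ∀ {f : Spc d × ℝ → ℝ}, ContDiffOn ℝ 2 f (Om d) → DifferentiableAt ℝ (fderiv ℝ f) q :=
    fun hf => ((cdAt hf hq).fderiv_right (m := 1) (by norm_num)).differentiableAt one_ne_zero
  have e : fderiv ℝ (v + w) =ᶠ[𝓝 q] fderiv ℝ v + fderiv ℝ w := by
    filter_upwards [Om_nhds hq] with p hp
    exact fderiv_add (diffAt two_ne_zero hv hp) (diffAt two_ne_zero hw hp)
  rw [e.fderiv_eq, fderiv_add (hd hv) (hd hw)]

lemma IsW0.smul {v : Spc d × ℝ → ℝ} (c : ℝ) (hv : IsW0 v) : IsW0 (c • v) := by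
  have hcd : ContDiffOn ℝ 2 (c • v) (Om d) := contDiffOn_const.smul hv.cd
  have e : ∀ t, (fun x => en (c • v) (x, t)) = fun x => c ^ 2 * en v (x, t) := fun t => by
    funext x; rw [en_smul]
  refine ⟨hv.cont.const_smul c, hcd, fun q hq => ?_, fun t => ?_, ?_⟩
  · rw [pde_iff hcd hq]
    have h := (pde_iff hv.cd hq).1 (hv.pde q hq)
    have e1 : fderiv ℝ (c • v) = c • fderiv ℝ v := fderiv_const_smul_field c
    have e2 : fderiv ℝ (c • fderiv ℝ v) q = c • fderiv ℝ (fderiv ℝ v) q := 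
      congrFun (fderiv_const_smul_field (𝕜 := ℝ) (R := ℝ) (f := fderiv ℝ v) c) q
    rw [e1, e2]
    have : box (c • fderiv ℝ (fderiv ℝ v) q) = c * box (fderiv ℝ (fderiv ℝ v) q) := by
      simp [box, mul_sub, Finset.mul_sum]
    rw [this, Pi.smul_apply, smul_eq_mul, mul_div_assoc, ← mul_add, h, mul_zero]
  · rw [e]; exact (hv.int t).const_mul _
  · obtain ⟨C, hC⟩ := hv.bdd
    refine ⟨c ^ 2 * C, fun t => ?_⟩
    rw [e, integral_const_mul]
    gcongr
    exact hC t

lemma int_bi {v w : Spc d × ℝ → ℝ} (hv : IsW0 v) (hw : IsW0 w) [Fact (3 ≤ d)] (t : ℝ) :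
    Integrable (fun x => bi v w (x, t)) ∧ Integrable (fun x => en (v + w) (x, t)) := by
  have e1 : ∀ x : Spc d, x ≠ 0 → en (v + w) (x, t) = en v (x, t) + 2 * bi v w (x, t) + en w (x, t) :=
    fun x hx => en_add (hv.diff (mem_Om.2 hx)) (hw.diff (mem_Om.2 hx))
  have hi : Integrable (fun x => en (v + w) (x, t)) := by
    refine (((hv.int t).const_mul 2).add ((hw.int t).const_mul 2)).mono'
      (slice_meas (meas_en (hv.meas.add hw.meas)) t).aestronglyMeasurable ?_
    filter_upwards [ae_ne] with x hx
    rw [Real.norm_eq_abs, abs_of_nonneg (en_nonneg _ _)]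
    exact en_add_le (hv.diff (mem_Om.2 hx)) (hw.diff (mem_Om.2 hx))
  refine ⟨?_, hi⟩
  have := ((hi.sub (hv.int t)).sub (hw.int t)).const_mul (1 / 2)
  refine this.congr ?_
  filter_upwards [ae_ne] with x hx
  simp only [Pi.sub_apply, e1 x hx]
  ring

lemma IsW0.add [Fact (3 ≤ d)] {v w : Spc d × ℝ → ℝ} (hv : IsW0 v) (hw : IsW0 w) : IsW0 (v + w) := by
  have hcd : ContDiffOn ℝ 2 (v + w) (Om d) := hv.cd.add hw.cd
  refine ⟨hv.cont.add hw.cont, hcd, fun q hq => ?_, fun t => (int_bi hv hw t).2, ?_⟩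
  · rw [pde_iff hcd hq, fderiv2_add hv.cd hw.cd hq]
    have h1 := (pde_iff hv.cd hq).1 (hv.pde q hq)
    have h2 := (pde_iff hw.cd hq).1 (hw.pde q hq)
    have : ∀ A B : Spc d × ℝ →L[ℝ] Spc d × ℝ →L[ℝ] ℝ, box (A + B) = box A + box B := fun A B => by
      simp [box, Finset.sum_add_distrib]; ring
    rw [this, Pi.add_apply, add_div]
    linarith
  · obtain ⟨C, hC⟩ := hv.bdd
    obtain ⟨C', hC'⟩ := hw.bdd
    refine ⟨2 * C + 2 * C', fun t => ?_⟩
    have : ∫ x, en (v + w) (x, t) ≤ ∫ x, (2 * en v (x, t) + 2 * en w (x, t)) := by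
      refine integral_mono_ae (int_bi hv hw t).2
        (((hv.int t).const_mul 2).add ((hw.int t).const_mul 2)) ?_
      filter_upwards [ae_ne] with x hx
      exact en_add_le (hv.diff (mem_Om.2 hx)) (hw.diff (mem_Om.2 hx))
    rw [integral_add ((hv.int t).const_mul 2) ((hw.int t).const_mul 2), integral_const_mul,
      integral_const_mul] at this
    linarith [hC t, hC' t]

lemma IsW0.sub [Fact (3 ≤ d)] {v w : Spc d × ℝ → ℝ} (hv : IsW0 v) (hw : IsW0 w) : IsW0 (v - w) := by
  have h : v - w = v + (-1 : ℝ) • w := by ext; simp [sub_eq_add_neg]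
  rw [h]
  exact hv.add (hw.smul _)

end Coulomb

namespace Coulomb
open scoped Topology
variable {d : ℕ}

/-! ### Averages over compact parameter spaces -/

set_option linter.unusedSectionVars false

section Average
variable {Y : Type*} [TopologicalSpace Y] [CompactSpace Y] [T2Space Y] [MeasurableSpace Y]
  [OpensMeasurableSpace Y] [SecondCountableTopology Y] {ν : Measure Y}
  {G : Type*} [NormedAddCommGroup G] [NormedSpace ℝ G]

omit [CompactSpace Y] [T2Space Y] [MeasurableSpace Y] [OpensMeasurableSpace Y]
  [SecondCountableTopology Y] in
lemma slice_cont {f : Y → Spc d × ℝ → G}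
    (h : ContinuousOn (fun p : (Spc d × ℝ) × Y => f p.2 p.1) (Om d ×ˢ Set.univ)) {q} (hq : q ∈ Om d) :
    Continuous fun y => f y q :=
  h.comp_continuous (f := fun y => (q, y)) (by fun_prop) fun _ => ⟨hq, trivial⟩

lemma compact_int [IsFiniteMeasure ν] {g : Y → G} (hg : Continuous g) : Integrable g ν := by
  have := hg.continuousOn.integrableOn_compact (μ := ν) isCompact_univ
  rwa [integrableOn_univ] at this

lemma local_bound {f : Y → Spc d × ℝ → G}
    (h : ContinuousOn (fun p : (Spc d × ℝ) × Y => f p.2 p.1) (Om d ×ˢ Set.univ)) {q} (hq : q ∈ Om d) :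
    ∃ s ∈ 𝓝 q, s ⊆ Om d ∧ ∃ M, ∀ p ∈ s, ∀ y, ‖f y p‖ ≤ M := by
  obtain ⟨s, hs, hsO, hsc⟩ := local_compact_nhds (Om_nhds hq)
  obtain ⟨M, hM⟩ := (hsc.prod (isCompact_univ (X := Y))).exists_bound_of_continuousOn
    (h.mono (Set.prod_mono hsO subset_rfl))
  exact ⟨s, hs, hsO, M, fun p hp y => hM (p, y) ⟨hp, trivial⟩⟩

lemma avg_cont [IsFiniteMeasure ν] {f : Y → Spc d × ℝ → G}
    (h : ContinuousOn (fun p : (Spc d × ℝ) × Y => f p.2 p.1) (Om d ×ˢ Set.univ)) :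
    ContinuousOn (fun q => ∫ y, f y q ∂ν) (Om d) := by
  intro q hq
  refine ContinuousAt.continuousWithinAt ?_
  obtain ⟨s, hs, hsO, M, hM⟩ := local_bound h hq
  refine continuousAt_of_dominated (bound := fun _ => M) ?_ ?_ (integrable_const _) ?_
  · filter_upwards [hs] with p hp using (slice_cont h (hsO hp)).aestronglyMeasurable
  · filter_upwards [hs] with p hp using Eventually.of_forall (hM p hp)
  · refine Eventually.of_forall fun y => ?_
    have : ContinuousAt (fun p : (Spc d × ℝ) × Y => f p.2 p.1) (q, y) :=
      h.continuousAt ((isOpen_Om.prod isOpen_univ).mem_nhds ⟨hq, trivial⟩)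
    exact this.comp (f := fun p : Spc d × ℝ => (p, y)) (by fun_prop)

lemma avg_hasFDerivAt [IsFiniteMeasure ν] {f : Y → Spc d × ℝ → G}
    (hd : ∀ y, ∀ q ∈ Om d, DifferentiableAt ℝ (f y) q)
    (h : ContinuousOn (fun p : (Spc d × ℝ) × Y => f p.2 p.1) (Om d ×ˢ Set.univ))
    (h' : ContinuousOn (fun p : (Spc d × ℝ) × Y => fderiv ℝ (f p.2) p.1) (Om d ×ˢ Set.univ))
    {q} (hq : q ∈ Om d) :
    HasFDerivAt (fun q => ∫ y, f y q ∂ν) (∫ y, fderiv ℝ (f y) q ∂ν) q := by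
  obtain ⟨s, hs, hsO, M, hM⟩ := local_bound (f := fun y => fderiv ℝ (f y)) h' hq
  refine hasFDerivAt_integral_of_dominated_of_fderiv_le (F := fun q y => f y q)
    (F' := fun q y => fderiv ℝ (f y) q) (bound := fun _ => M) hs ?_
    (compact_int (slice_cont h hq)) ?_ (Eventually.of_forall fun y p hp => hM p hp y)
    (integrable_const _) (Eventually.of_forall fun y p hp => (hd y p (hsO hp)).hasFDerivAt)
  · filter_upwards [hs] with p hp using (slice_cont h (hsO hp)).aestronglyMeasurable
  · exact (slice_cont (f := fun y => fderiv ℝ (f y)) h' hq).aestronglyMeasurable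

/-- A family of functions depending continuously on a compact parameter. -/
structure Fam (z : Y → Spc d × ℝ → ℝ) : Prop where
  cd : ∀ y, ContDiffOn ℝ 2 (z y) (Om d)
  c0 : Continuous fun p : (Spc d × ℝ) × Y => z p.2 p.1
  c1 : ContinuousOn (fun p : (Spc d × ℝ) × Y => fderiv ℝ (z p.2) p.1) (Om d ×ˢ Set.univ)
  c2 : ContinuousOn (fun p : (Spc d × ℝ) × Y => fderiv ℝ (fderiv ℝ (z p.2)) p.1) (Om d ×ˢ Set.univ)

noncomputable def avg (ν : Measure Y) (z : Y → Spc d × ℝ → ℝ) (q : Spc d × ℝ) : ℝ := ∫ y, z y q ∂ν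

variable {z : Y → Spc d × ℝ → ℝ}

lemma Fam.avg_fderiv (h : Fam z) [IsFiniteMeasure ν] {q} (hq : q ∈ Om d) :
    HasFDerivAt (avg ν z) (∫ y, fderiv ℝ (z y) q ∂ν) q :=
  avg_hasFDerivAt (fun y _ hq => diffAt two_ne_zero (h.cd y) hq) h.c0.continuousOn h.c1 hq

lemma Fam.avg_fderiv2 (h : Fam z) [IsFiniteMeasure ν] {q} (hq : q ∈ Om d) :
    HasFDerivAt (fderiv ℝ (avg ν z)) (∫ y, fderiv ℝ (fderiv ℝ (z y)) q ∂ν) q := by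
  refine HasFDerivAt.congr_of_eventuallyEq (f₁ := fderiv ℝ (avg ν z))
    (avg_hasFDerivAt (ν := ν) (f := fun y => fderiv ℝ (z y)) (fun y q hq =>
    ((cdAt (h.cd y) hq).fderiv_right (m := 1) (by norm_num)).differentiableAt one_ne_zero)
    h.c1 h.c2 hq) ?_
  filter_upwards [Om_nhds hq] with p hp using (h.avg_fderiv hp).fderiv

lemma Fam.avg_cd (h : Fam z) [IsFiniteMeasure ν] : ContDiffOn ℝ 2 (avg ν z) (Om d) := by
  have c2 : ContinuousOn (fderiv ℝ (fderiv ℝ (avg ν z))) (Om d) :=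
    (avg_cont (ν := ν) (f := fun y => fderiv ℝ (fderiv ℝ (z y))) h.c2).congr
      fun q hq => (h.avg_fderiv2 hq).fderiv
  have c1 : ContDiffOn ℝ 1 (fderiv ℝ (avg ν z)) (Om d) := by
    rw [show (1 : WithTop ℕ∞) = 0 + 1 by norm_num, contDiffOn_succ_iff_fderiv_of_isOpen isOpen_Om]
    exact ⟨fun q hq => (h.avg_fderiv2 hq).differentiableAt.differentiableWithinAt, by simp,
      contDiffOn_zero.2 c2⟩
  rw [show (2 : WithTop ℕ∞) = 1 + 1 by norm_num, contDiffOn_succ_iff_fderiv_of_isOpen isOpen_Om]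
  exact ⟨fun q hq => (h.avg_fderiv hq).differentiableAt.differentiableWithinAt, by simp, c1⟩

lemma Fam.avg_continuous (h : Fam z) [IsFiniteMeasure ν] : Continuous (avg ν z) := by
  have := continuous_parametric_integral_of_continuous (μ := ν) (f := fun q y => z y q) h.c0
    (isCompact_univ)
  rw [Measure.restrict_univ] at this
  exact this

lemma Fam.avg_D (h : Fam z) [IsFiniteMeasure ν] {q} (hq : q ∈ Om d) (w : Spc d × ℝ) :
    fderiv ℝ (avg ν z) q w = ∫ y, fderiv ℝ (z y) q w ∂ν := by
  rw [(h.avg_fderiv hq).fderiv]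
  exact ContinuousLinearMap.integral_apply
    (compact_int (slice_cont (f := fun y => fderiv ℝ (z y)) h.c1 hq)) w

lemma Fam.avg_D2 (h : Fam z) [IsFiniteMeasure ν] {q} (hq : q ∈ Om d) (w w' : Spc d × ℝ) :
    fderiv ℝ (fderiv ℝ (avg ν z)) q w w' = ∫ y, fderiv ℝ (fderiv ℝ (z y)) q w w' ∂ν := by
  have hc := slice_cont (f := fun y => fderiv ℝ (fderiv ℝ (z y))) h.c2 hq
  rw [(h.avg_fderiv2 hq).fderiv, ContinuousLinearMap.integral_apply (compact_int hc),
    ContinuousLinearMap.integral_apply (compact_int (by fun_prop))]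

lemma Fam.avg_pde (h : Fam z) [IsFiniteMeasure ν] {q} (hq : q ∈ Om d)
    (hp : ∀ y, Dt (Dt (z y)) q = ∑ i, Dx i (Dx i (z y)) q - z y q / ‖q.1‖) :
    Dt (Dt (avg ν z)) q = ∑ i, Dx i (Dx i (avg ν z)) q - avg ν z q / ‖q.1‖ := by
  rw [pde_iff h.avg_cd hq, box]
  have hc := slice_cont (f := fun y => fderiv ℝ (fderiv ℝ (z y))) h.c2 hq
  have hc' : ∀ w w', Integrable (fun y => fderiv ℝ (fderiv ℝ (z y)) q w w') ν := fun w w' =>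
    compact_int (by fun_prop)
  have hz : Integrable (fun y => z y q / ‖q.1‖) ν :=
    (compact_int (slice_cont h.c0.continuousOn hq)).div_const _
  simp only [h.avg_D2 hq]
  have hs : Integrable (fun y => ∑ i, fderiv ℝ (fderiv ℝ (z y)) q (bv i, 0) (bv i, 0)) ν :=
    integrable_finsetSum _ fun i _ => hc' _ _
  have hs' : Integrable (fun y => fderiv ℝ (fderiv ℝ (z y)) q (0, 1) (0, 1)
    - ∑ i, fderiv ℝ (fderiv ℝ (z y)) q (bv i, 0) (bv i, 0)) ν := (hc' _ _).sub hs
  rw [avg, ← integral_finsetSum _ fun i _ => hc' _ _, ← integral_div, ← integral_sub (hc' _ _) hs,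
    ← integral_add hs' hz]
  refine integral_eq_zero_of_ae (Eventually.of_forall fun y => ?_)
  exact (pde_iff (h.cd y) hq).1 (hp y)

lemma sq_integral_le [IsProbabilityMeasure ν] {a : Y → ℝ} (ha : Continuous a) :
    (∫ y, a y ∂ν) ^ 2 ≤ ∫ y, a y ^ 2 ∂ν := by
  have h1 := compact_int (ν := ν) ha
  have h2 : Integrable (fun y => a y ^ 2) ν := compact_int (ha.pow 2)
  set m := ∫ y, a y ∂ν with hm
  have h3 : 0 ≤ ∫ y, (a y - m) ^ 2 ∂ν := integral_nonneg fun _ => sq_nonneg _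
  have e : ∀ y, (a y - m) ^ 2 = a y ^ 2 - 2 * m * a y + m ^ 2 := fun y => by ring
  simp only [e] at h3
  have h4 : Integrable (fun y => a y ^ 2 - 2 * m * a y) ν := h2.sub (h1.const_mul _)
  rw [integral_add h4 (integrable_const _), integral_sub h2 (h1.const_mul _),
    integral_const_mul, ← hm] at h3
  simp at h3
  linarith

omit [CompactSpace Y] [T2Space Y] [MeasurableSpace Y] [OpensMeasurableSpace Y]
  [SecondCountableTopology Y] in
lemma en_cont {f : Y → Spc d × ℝ → ℝ} (h : Fam f) :
    ContinuousOn (fun p : (Spc d × ℝ) × Y => en (f p.2) p.1) (Om d ×ˢ Set.univ) := by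
  have h1 : ∀ w, ContinuousOn (fun p : (Spc d × ℝ) × Y => fderiv ℝ (f p.2) p.1 w)
    (Om d ×ˢ Set.univ) := fun w => h.c1.clm_apply continuousOn_const
  unfold en Ns
  refine ((continuousOn_const.mul (continuousOn_finsetSum _ fun i _ => (h1 _).pow 2)).add
    (continuousOn_const.mul ((h1 _).pow 2))).add ((h.c0.continuousOn.pow 2).div
    (by fun_prop) fun p hp => ?_)
  have := norm_pos_Om hp.1
  positivity

lemma Fam.avg_en_le (h : Fam z) [IsProbabilityMeasure ν] {q} (hq : q ∈ Om d) :
    en (avg ν z) q ≤ ∫ y, en (z y) q ∂ν := by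
  have hc : ∀ w, Continuous fun y => fderiv ℝ (z y) q w := fun w => by
    have := slice_cont (f := fun y => fderiv ℝ (z y)) h.c1 hq
    fun_prop
  have hw : ∀ w, fderiv ℝ (avg ν z) q w ^ 2 ≤ ∫ y, fderiv ℝ (z y) q w ^ 2 ∂ν := fun w => by
    rw [h.avg_D hq]; exact sq_integral_le (hc w)
  have h0 := slice_cont h.c0.continuousOn hq
  have hz : avg ν z q ^ 2 ≤ ∫ y, z y q ^ 2 ∂ν := sq_integral_le h0
  have i1 : ∀ w, Integrable (fun y => fderiv ℝ (z y) q w ^ 2) ν := fun w => compact_int ((hc w).pow 2)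
  have i2 : Integrable (fun y => z y q ^ 2) ν := compact_int (h0.pow 2)
  have e : ∫ y, en (z y) q ∂ν = 1 / 2 * ∑ i, ∫ y, Dx i (z y) q ^ 2 ∂ν
      + 1 / 2 * ∫ y, Dt (z y) q ^ 2 ∂ν + (∫ y, z y q ^ 2 ∂ν) / (2 * ‖q.1‖) := by
    unfold en Ns
    have i3 : Integrable (fun y => ∑ i, Dx i (z y) q ^ 2) ν := integrable_finsetSum _ fun i _ => i1 _
    have i4 : Integrable (fun y => Dt (z y) q ^ 2) ν := i1 _
    have i5 : Integrable (fun y => 1 / 2 * ∑ i, Dx i (z y) q ^ 2 + 1 / 2 * Dt (z y) q ^ 2) ν :=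
      (i3.const_mul _).add (i4.const_mul _)
    rw [integral_add i5 (i2.div_const _), integral_add (i3.const_mul _) (i4.const_mul _), integral_const_mul, integral_const_mul,
      integral_div, integral_finsetSum (f := fun i y => Dx i (z y) q ^ 2) _ fun i _ => i1 _]
  rw [e, en, Ns]
  gcongr with i
  · exact hw _
  · exact hw _

lemma Fam.avg_energy_ae (h : Fam z) [IsProbabilityMeasure ν] [Fact (3 ≤ d)] {t C : ℝ}
    (hi : ∀ y, Integrable fun x => en (z y) (x, t)) (hC : ∀ᵐ y ∂ν, Eg (z y) t ≤ C) :
    Integrable (fun x => en (avg ν z) (x, t)) ∧ Eg (avg ν z) t ≤ C := by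
  have hm : Measurable (en (avg ν z)) := meas_en h.avg_continuous.measurable
  have hmt := slice_meas hm t
  have hC0 : 0 ≤ C := by
    obtain ⟨y, hy⟩ := hC.exists
    exact (Eg_nonneg _ _).trans hy
  have hae : AEMeasurable (fun p : Spc d × Y => ENNReal.ofReal (en (z p.2) (p.1, t)))
      (volume.prod ν) := by
    have hO : MeasurableSet ({(0 : Spc d)}ᶜ ×ˢ (Set.univ : Set Y)) :=
      (measurableSet_singleton _).compl.prod MeasurableSet.univ
    have c : ContinuousOn (fun p : Spc d × Y => en (z p.2) (p.1, t)) ({(0 : Spc d)}ᶜ ×ˢ Set.univ) :=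
      (en_cont h).comp (f := fun p : Spc d × Y => ((p.1, t), p.2)) (by fun_prop)
        fun p hp => ⟨mem_Om.2 hp.1, trivial⟩
    have := (c.aemeasurable hO (μ := volume.prod ν)).ennreal_ofReal
    rwa [Measure.restrict_eq_self_of_ae_mem] at this
    have := (Measure.quasiMeasurePreserving_fst (μ := (volume : Measure (Spc d))) (ν := ν)).ae ae_ne
    filter_upwards [this] with p hp using ⟨hp, trivial⟩
  have key : ∫⁻ x, ENNReal.ofReal (en (avg ν z) (x, t)) ≤ ENNReal.ofReal C := by
    calc ∫⁻ x, ENNReal.ofReal (en (avg ν z) (x, t))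
        ≤ ∫⁻ x, ∫⁻ y, ENNReal.ofReal (en (z y) (x, t)) ∂ν := by
          refine lintegral_mono_ae ?_
          filter_upwards [ae_ne] with x hx
          have hq : (x, t) ∈ Om d := mem_Om.2 hx
          rw [← ofReal_integral_eq_lintegral_ofReal (compact_int (slice_cont (f := fun y => en (z y))
            (en_cont h) hq)) (Eventually.of_forall fun y => en_nonneg _ _)]
          exact ENNReal.ofReal_le_ofReal (h.avg_en_le hq)
      _ = ∫⁻ y, (∫⁻ x, ENNReal.ofReal (en (z y) (x, t))) ∂ν :=
          lintegral_lintegral_swap (f := fun x y => ENNReal.ofReal (en (z y) (x, t))) hae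
      _ ≤ ∫⁻ _ : Y, ENNReal.ofReal C ∂ν := by
          refine lintegral_mono_ae (hC.mono fun y hy => ?_)
          rw [← ofReal_integral_eq_lintegral_ofReal (hi y)
            (Eventually.of_forall fun x => en_nonneg _ _)]
          exact ENNReal.ofReal_le_ofReal hy
      _ = _ := by simp
  have hI : Integrable (fun x => en (avg ν z) (x, t)) := by
    refine ⟨hmt.aestronglyMeasurable, ?_⟩
    rw [hasFiniteIntegral_iff_ofReal (Eventually.of_forall fun x => en_nonneg _ _)]
    exact key.trans_lt ENNReal.ofReal_lt_top
  refine ⟨hI, ?_⟩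
  rw [← ofReal_integral_eq_lintegral_ofReal hI (Eventually.of_forall fun x => en_nonneg _ _),
    ENNReal.ofReal_le_ofReal_iff hC0] at key
  exact key

lemma Fam.avg_energy (h : Fam z) [IsProbabilityMeasure ν] [Fact (3 ≤ d)] {t C : ℝ}
    (hi : ∀ y, Integrable fun x => en (z y) (x, t)) (hC : ∀ y, Eg (z y) t ≤ C) :
    Integrable (fun x => en (avg ν z) (x, t)) ∧ Eg (avg ν z) t ≤ C :=
  h.avg_energy_ae hi (Eventually.of_forall hC)

lemma Fam.avg_W0 (h : Fam z) [IsProbabilityMeasure ν] [Fact (3 ≤ d)] {C : ℝ}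
    (hz : ∀ y, IsW0 (z y)) (hC : ∀ y t, Eg (z y) t ≤ C) : IsW0 (avg ν z) where
  cont := h.avg_continuous
  cd := h.avg_cd
  pde q hq := h.avg_pde hq fun y => (hz y).pde q hq
  int t := (h.avg_energy (fun y => (hz y).int t) (fun y => hC y t)).1
  bdd := ⟨C, fun t => (h.avg_energy (fun y => (hz y).int t) (fun y => hC y t)).2⟩

lemma contOn_sub {X : Type*} [TopologicalSpace X] {f g : X → G} {s : Set X}
    (hf : ContinuousOn f s) (hg : ContinuousOn g s) : ContinuousOn (fun x => f x - g x) s := hf.sub hg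

omit [CompactSpace Y] [T2Space Y] [MeasurableSpace Y] [OpensMeasurableSpace Y]
  [SecondCountableTopology Y] in
lemma Fam.sub (h : Fam z) {z' : Y → Spc d × ℝ → ℝ} (h' : Fam z') : Fam fun y => z y - z' y where
  cd y := (h.cd y).sub (h'.cd y)
  c0 := h.c0.sub h'.c0
  c1 := by
    refine (h.c1.sub h'.c1).congr fun p hp => ?_
    exact fderiv_sub (diffAt two_ne_zero (h.cd _) hp.1) (diffAt two_ne_zero (h'.cd _) hp.1)
  c2 := by
    refine (contOn_sub (G := Spc d × ℝ →L[ℝ] Spc d × ℝ →L[ℝ] ℝ) h.c2 h'.c2).congr fun p hp => ?_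
    have hd : ∀ {f : Spc d × ℝ → ℝ}, ContDiffOn ℝ 2 f (Om d) →
      DifferentiableAt ℝ (fderiv ℝ f) p.1 :=
      fun hf => ((cdAt hf hp.1).fderiv_right (m := 1) (by norm_num)).differentiableAt one_ne_zero
    have e : fderiv ℝ (z p.2 - z' p.2) =ᶠ[𝓝 p.1] fderiv ℝ (z p.2) - fderiv ℝ (z' p.2) := by
      filter_upwards [Om_nhds hp.1] with q hq
      exact fderiv_sub (diffAt two_ne_zero (h.cd _) hq) (diffAt two_ne_zero (h'.cd _) hq)
    show fderiv ℝ (fderiv ℝ (z p.2 - z' p.2)) p.1 = _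
    rw [e.fderiv_eq, fderiv_sub (hd (h.cd _)) (hd (h'.cd _))]

omit [CompactSpace Y] [T2Space Y] [MeasurableSpace Y] [OpensMeasurableSpace Y]
  [SecondCountableTopology Y] in
lemma fam_act {v : Spc d × ℝ → ℝ} (hv : ContDiffOn ℝ 2 v (Om d)) (hc : Continuous v)
    {L : Y → Spc d ≃ₗᵢ[ℝ] Spc d} {s : Y → ℝ} (hL : Continuous fun y => toC (L y))
    (hs : Continuous s) : Fam fun y => act (L y) (s y) v := by
  have hphi : Continuous fun p : (Spc d × ℝ) × Y => phi (L p.2) (s p.2) p.1 := by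
    have : Continuous fun p : (Spc d × ℝ) × Y => toC (L p.2) p.1.1 :=
      (hL.comp continuous_snd).clm_apply (by fun_prop)
    exact this.prodMk (by fun_prop)
  have hPhi : Continuous fun p : (Spc d × ℝ) × Y => Phi (toC (L p.2)) := by
    have h1 : Continuous fun A : Spc d →L[ℝ] Spc d => Phi A := by
      have := (ContinuousLinearMap.prodMapL ℝ (Spc d) (Spc d) ℝ ℝ).continuous
      exact this.comp (f := fun A : Spc d →L[ℝ] Spc d => (A, ContinuousLinearMap.id ℝ ℝ)) (by fun_prop)
    exact h1.comp (hL.comp continuous_snd)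
  have hmap : ∀ p ∈ Om d ×ˢ (Set.univ : Set Y), phi (L p.2) (s p.2) p.1 ∈ Om d := fun p hp =>
    phi_Om _ _ hp.1
  have hv1 := hv.of_le (show (1 : WithTop ℕ∞) ≤ 2 by norm_num)
  have cf : ContDiffOn ℝ 1 (fderiv ℝ v) (Om d) := hv.fderiv_of_isOpen isOpen_Om (by norm_num)
  refine ⟨fun y => hv.comp (phi_contDiff _ _).contDiffOn fun q hq => phi_Om _ _ hq,
    hc.comp hphi, ?_, ?_⟩
  · refine ContinuousOn.congr ?_ fun p hp => act_fderiv (L p.2) (s p.2) hv1 hp.1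
    exact (cf.continuousOn.comp hphi.continuousOn hmap).clm_comp hPhi.continuousOn
  · refine ContinuousOn.congr ?_ fun p hp => act_fderiv2 (L p.2) (s p.2) hv hp.1
    have cff : ContinuousOn (fderiv ℝ (fderiv ℝ v)) (Om d) :=
      cf.continuousOn_fderiv_of_isOpen isOpen_Om (by norm_num)
    refine ContinuousOn.clm_comp ?_ ((cff.comp hphi.continuousOn hmap).clm_comp hPhi.continuousOn)
    exact ((ContinuousLinearMap.compL ℝ (Spc d × ℝ) (Spc d × ℝ) ℝ).flip.continuous.comp
      hPhi).continuousOn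

end Average

end Coulomb

namespace Coulomb
open scoped Topology
set_option linter.unusedSectionVars false
variable {d : ℕ}

/-! ### Strongly continuous waves and conservation of energy -/

lemma Eg_smul (c : ℝ) (v : Spc d × ℝ → ℝ) (t : ℝ) : Eg (c • v) t = c ^ 2 * Eg v t := by
  simp only [Eg, en_smul, integral_const_mul]

section CS
variable [Fact (3 ≤ d)] {v w : Spc d × ℝ → ℝ}

lemma bi_cs (hv : IsW0 v) (hw : IsW0 w) (t : ℝ) (S : Set (Spc d)) :
    |∫ x in S, bi v w (x, t)| ≤ √(∫ x in S, en v (x, t)) * √(∫ x in S, en w (x, t)) := by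
  set a := ∫ x in S, en v (x, t)
  set b := ∫ x in S, bi v w (x, t)
  set c := ∫ x in S, en w (x, t)
  have ha : 0 ≤ a := integral_nonneg fun _ => en_nonneg _ _
  have hc : 0 ≤ c := integral_nonneg fun _ => en_nonneg _ _
  have key : ∀ y : ℝ, 0 ≤ c * (y * y) + (2 * b) * y + a := fun y => by
    have h : 0 ≤ ∫ x in S, en (v + y • w) (x, t) := integral_nonneg fun _ => en_nonneg _ _
    have e : ∫ x in S, en (v + y • w) (x, t)
        = ∫ x in S, (en v (x, t) + (2 * y) * bi v w (x, t)) + y ^ 2 * en w (x, t) := by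
      refine integral_congr_ae ((ae_restrict_of_ae ae_ne).mono fun x hx => ?_)
      have hq : (x, t) ∈ Om d := mem_Om.2 hx
      show en (v + y • w) (x, t) = _
      rw [en_add (hv.diff hq) ((hw.smul y).diff hq), bi_smul_right, en_smul]; ring
    have i1 : Integrable (fun x => en v (x, t)) (volume.restrict S) := (hv.int t).integrableOn
    have i2 : Integrable (fun x => bi v w (x, t)) (volume.restrict S) := (int_bi hv hw t).1.integrableOn
    have i3 : Integrable (fun x => en w (x, t)) (volume.restrict S) := (hw.int t).integrableOn
    have i4 : Integrable (fun x => en v (x, t) + (2 * y) * bi v w (x, t)) (volume.restrict S) :=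
      i1.add (i2.const_mul _)
    rw [e, integral_add i4 (i3.const_mul _), integral_add i1 (i2.const_mul _), integral_const_mul,
      integral_const_mul] at h
    simp only [a, b, c]; linarith
  have := discrim_le_zero key
  unfold discrim at this
  rw [← Real.sqrt_mul ha]
  apply Real.abs_le_sqrt
  linarith

lemma Eg_add (hv : IsW0 v) (hw : IsW0 w) (t : ℝ) :
    Eg (v + w) t = Eg v t + 2 * (∫ x, bi v w (x, t)) + Eg w t := by
  have i : Integrable (fun x => en v (x, t) + 2 * bi v w (x, t)) :=
    (hv.int t).add ((int_bi hv hw t).1.const_mul 2)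
  rw [Eg, Eg, Eg, ← integral_const_mul, ← integral_add (hv.int t) ((int_bi hv hw t).1.const_mul 2),
    ← integral_add i (hw.int t)]
  exact integral_congr_ae (ae_ne.mono fun x hx =>
    en_add (hv.diff (mem_Om.2 hx)) (hw.diff (mem_Om.2 hx)))

lemma Eg_bi_le (hv : IsW0 v) (hw : IsW0 w) (t : ℝ) :
    |∫ x, bi v w (x, t)| ≤ √(Eg v t) * √(Eg w t) := by
  simpa [Eg] using bi_cs hv hw t Set.univ

lemma Eg_tri (hv : IsW0 v) (hw : IsW0 w) (t : ℝ) : √(Eg (v + w) t) ≤ √(Eg v t) + √(Eg w t) := by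
  refine Real.sqrt_le_iff.2 ⟨by positivity, ?_⟩
  have h1 := Real.sq_sqrt (Eg_nonneg v t)
  have h2 := Real.sq_sqrt (Eg_nonneg w t)
  have h3 := (abs_le.1 (Eg_bi_le hv hw t)).2
  rw [Eg_add hv hw]; nlinarith

lemma Eg_add_le (hv : IsW0 v) (hw : IsW0 w) (t : ℝ) : Eg (v + w) t ≤ 2 * Eg v t + 2 * Eg w t := by
  rw [Eg, Eg, Eg, ← integral_const_mul, ← integral_const_mul, ← integral_add
    ((hv.int t).const_mul 2) ((hw.int t).const_mul 2)]
  exact integral_mono_ae (int_bi hv hw t).2 (((hv.int t).const_mul 2).add ((hw.int t).const_mul 2))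
    (ae_ne.mono fun x hx => en_add_le (hv.diff (mem_Om.2 hx)) (hw.diff (mem_Om.2 hx)))

lemma Eg_sub_comm (v w : Spc d × ℝ → ℝ) (t : ℝ) : Eg (v - w) t = Eg (w - v) t := by
  have : v - w = (-1 : ℝ) • (w - v) := by simp
  rw [this, Eg_smul]; norm_num

lemma Eg_sub_abs (hv : IsW0 v) (hw : IsW0 w) (t : ℝ) : |√(Eg v t) - √(Eg w t)| ≤ √(Eg (v - w) t) := by
  have h1 := Eg_tri (hv.sub hw) hw t
  have h2 := Eg_tri (hw.sub hv) hv t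
  rw [sub_add_cancel] at h1 h2
  rw [Eg_sub_comm w v] at h2
  rw [abs_le]; constructor <;> linarith

end CS

/-- Time translation. -/
noncomputable def tau (s : ℝ) (v : Spc d × ℝ → ℝ) : Spc d × ℝ → ℝ :=
  act (LinearIsometryEquiv.refl ℝ (Spc d)) s v

lemma tau_apply (s : ℝ) (v : Spc d × ℝ → ℝ) (x : Spc d) (t : ℝ) : tau s v (x, t) = v (x, t + s) := rfl

lemma tau_zero (v : Spc d × ℝ → ℝ) : tau 0 v = v := by
  funext q; obtain ⟨x, t⟩ := q; simp [tau_apply]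

lemma act_sub (L : Spc d ≃ₗᵢ[ℝ] Spc d) (s : ℝ) (v w : Spc d × ℝ → ℝ) :
    act L s (v - w) = act L s v - act L s w := rfl

lemma tau_act (L : Spc d ≃ₗᵢ[ℝ] Spc d) (s r : ℝ) (v : Spc d × ℝ → ℝ) :
    tau s (act L r v) = act L r (tau s v) := by
  funext q; obtain ⟨x, t⟩ := q
  show v (L x, t + s + r) = v (L x, t + r + s)
  ring_nf

structure IsW (v : Spc d × ℝ → ℝ) : Prop extends IsW0 v where
  sc : ∀ t, Tendsto (fun s => Eg (tau s v - v) t) (𝓝 0) (𝓝 0)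

section
variable [Fact (3 ≤ d)] {v w : Spc d × ℝ → ℝ}

lemma IsW0.tau (hv : IsW0 v) (s : ℝ) : IsW0 (tau s v) := IsW0.act _ s hv

lemma Eg_act (hv : IsW0 v) (L : Spc d ≃ₗᵢ[ℝ] Spc d) (s t : ℝ) : Eg (act L s v) t = Eg v (t + s) :=
  (act_int L s hv.cd1 t (hv.int _)).2

lemma Eg_tau (hv : IsW0 v) (s t : ℝ) : Eg (tau s v) t = Eg v (t + s) := Eg_act hv _ s t

lemma IsW.act (hv : IsW v) (L : Spc d ≃ₗᵢ[ℝ] Spc d) (s : ℝ) : IsW (act L s v) where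
  toIsW0 := hv.toIsW0.act L s
  sc t := by
    refine (hv.sc (t + s)).congr fun r => ?_
    rw [tau_act, ← act_sub, Eg_act ((hv.tau r).sub hv.toIsW0)]

lemma IsW.tau (hv : IsW v) (s : ℝ) : IsW (tau s v) := hv.act _ s

lemma IsW.add (hv : IsW v) (hw : IsW w) : IsW (v + w) where
  toIsW0 := hv.toIsW0.add hw.toIsW0
  sc t := by
    have h := ((hv.sc t).const_mul 2).add ((hw.sc t).const_mul 2)
    simp only [mul_zero, add_zero] at h
    refine squeeze_zero (fun _ => Eg_nonneg _ _) (fun s => ?_) h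
    have e : Coulomb.tau s (v + w) - (v + w) = (Coulomb.tau s v - v) + (Coulomb.tau s w - w) := by
      rw [show Coulomb.tau s (v + w) = Coulomb.tau s v + Coulomb.tau s w from rfl]; abel
    rw [e]
    exact Eg_add_le ((hv.toIsW0.tau s).sub hv.toIsW0) ((hw.toIsW0.tau s).sub hw.toIsW0) t

lemma IsW.smul (hv : IsW v) (c : ℝ) : IsW (c • v) where
  toIsW0 := hv.toIsW0.smul c
  sc t := by
    have h := (hv.sc t).const_mul (c ^ 2)
    rw [mul_zero] at h
    refine h.congr fun s => ?_
    rw [← Eg_smul, smul_sub]; rfl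

lemma IsW.sub (hv : IsW v) (hw : IsW w) : IsW (v - w) := by
  have h : v - w = v + (-1 : ℝ) • w := by ext; simp [sub_eq_add_neg]
  rw [h]; exact hv.add (hw.smul _)

/-- Convergence of energy densities and of total energies implies convergence in energy norm. -/
lemma scheffe {ι : Type*} {l : Filter ι} [l.IsCountablyGenerated] {z : ι → Spc d × ℝ → ℝ}
    (hz : ∀ i, IsW0 (z i)) (hv : IsW0 v) (t : ℝ)
    (h1 : ∀ x ≠ 0, Tendsto (fun i => en (z i - v) (x, t)) l (𝓝 0))
    (h2 : ∀ x ≠ 0, Tendsto (fun i => en (z i) (x, t)) l (𝓝 (en v (x, t))))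
    (h3 : Tendsto (fun i => Eg (z i) t) l (𝓝 (Eg v t))) :
    Tendsto (fun i => Eg (z i - v) t) l (𝓝 0) := by
  have iz := fun i => (hz i).int t
  have iv := hv.int t
  have id := fun i => ((hz i).sub hv).int t
  have m : ∀ {f : Spc d × ℝ → ℝ}, IsW0 f → AEStronglyMeasurable (fun x => en f (x, t)) volume :=
    fun hf => (hf.int t).1
  have A : Tendsto (fun i => ∫ x, min (en (z i - v) (x, t)) (4 * en v (x, t))) l (𝓝 (∫ _ : Spc d, (0 : ℝ))) := by
    refine tendsto_integral_filter_of_dominated_convergence (fun x => 4 * en v (x, t))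
      (Eventually.of_forall fun i => ((id i).1.inf (iv.const_mul 4).1)) (Eventually.of_forall fun i =>
      Eventually.of_forall fun x => ?_) (iv.const_mul 4) (ae_ne.mono fun x hx => ?_)
    · have := en_nonneg (z i - v) (x, t)
      have := en_nonneg v (x, t)
      rw [Real.norm_of_nonneg (le_min (by positivity) (by positivity))]
      exact min_le_right _ _
    · have := (h1 x hx).min (tendsto_const_nhds (x := 4 * en v (x, t)))
      rwa [min_eq_left (by have := en_nonneg v (x, t); positivity)] at this
  have B : Tendsto (fun i => ∫ x, min (en (z i) (x, t)) (en v (x, t))) l (𝓝 (Eg v t)) := by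
    refine tendsto_integral_filter_of_dominated_convergence (fun x => en v (x, t))
      (Eventually.of_forall fun i => ((iz i).1.inf iv.1)) (Eventually.of_forall fun i =>
      Eventually.of_forall fun x => ?_) iv (ae_ne.mono fun x hx => ?_)
    · rw [Real.norm_of_nonneg (le_min (en_nonneg _ _) (en_nonneg _ _))]
      exact min_le_right _ _
    · have := (h2 x hx).min (tendsto_const_nhds (x := en v (x, t)))
      rwa [min_self] at this
  have C := A.add (((h3.add (tendsto_const_nhds (x := Eg v t))).sub (B.const_mul 2)).const_mul 2)
  have e0 : (∫ _ : Spc d, (0 : ℝ)) + 2 * (Eg v t + Eg v t - 2 * Eg v t) = 0 := by simp; ring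
  rw [e0] at C
  refine squeeze_zero (fun _ => Eg_nonneg _ _) (fun i => ?_) C
  have i1 : Integrable (fun x => min (en (z i - v) (x, t)) (4 * en v (x, t))) :=
    (id i).inf (iv.const_mul 4)
  have i2 : Integrable (fun x => min (en (z i) (x, t)) (en v (x, t))) := (iz i).inf iv
  have i3 : Integrable (fun x => en (z i) (x, t) + en v (x, t)) := (iz i).add iv
  have i4 : Integrable (fun x => en (z i) (x, t) + en v (x, t)
    - 2 * min (en (z i) (x, t)) (en v (x, t))) := i3.sub (i2.const_mul 2)
  rw [Eg, Eg, Eg, ← integral_add (iz i) iv, ← integral_const_mul, ← integral_sub i3 (i2.const_mul 2),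
    ← integral_const_mul, ← integral_add i1 (i4.const_mul 2)]
  refine integral_mono_ae (id i) (i1.add (i4.const_mul 2)) (ae_ne.mono fun x hx => ?_)
  have hq : (x, t) ∈ Om d := mem_Om.2 hx
  have h := en_sub_le ((hz i).diff hq) (hv.diff hq)
  show en (z i - v) (x, t) ≤ min (en (z i - v) (x, t)) (4 * en v (x, t)) + 2 * (en (z i) (x, t) + en v (x, t)
    - 2 * min (en (z i) (x, t)) (en v (x, t)))
  rcases min_choice (en (z i - v) (x, t)) (4 * en v (x, t)) with h1 | h1 <;> rw [h1] <;>
  rcases le_total (en (z i) (x, t)) (en v (x, t)) with h2 | h2 <;>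
  simp only [min_eq_left h2, min_eq_right h2] <;> linarith

lemma fam_cont_en {Y : Type*} [TopologicalSpace Y] {z : Y → Spc d × ℝ → ℝ} (h : Fam z) {q}
    (hq : q ∈ Om d) : Continuous fun y => en (z y) q :=
  slice_cont (f := fun y => en (z y)) (en_cont h) hq

lemma fam_const {Y : Type*} [TopologicalSpace Y] (hv : IsW0 v) : Fam fun _ : Y => v := by
  have h1 : ContinuousOn (fderiv ℝ v) (Om d) := hv.cd.continuousOn_fderiv_of_isOpen isOpen_Om (by norm_num)
  have h2 : ContDiffOn ℝ 1 (fderiv ℝ v) (Om d) := hv.cd.fderiv_of_isOpen isOpen_Om (by norm_num)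
  have h3 : ContinuousOn (fderiv ℝ (fderiv ℝ v)) (Om d) :=
    h2.continuousOn_fderiv_of_isOpen isOpen_Om (by norm_num)
  exact ⟨fun _ => hv.cd, hv.cont.comp continuous_fst, h1.comp continuousOn_fst fun p hp => hp.1,
    h3.comp continuousOn_fst fun p hp => hp.1⟩

lemma fam_tau {Y : Type*} [TopologicalSpace Y] (hv : IsW0 v) {s : Y → ℝ} (hs : Continuous s) :
    Fam fun y => tau (s y) v := fam_act hv.cd hv.cont continuous_const hs

lemma en_zero (q : Spc d × ℝ) : en (0 : Spc d × ℝ → ℝ) q = 0 := by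
  have := en_smul 0 (0 : Spc d × ℝ → ℝ) q
  simpa using this

/-- Waves of constant energy are strongly continuous. -/
lemma IsW.of_const (hv : IsW0 v) {E : ℝ} (hE : ∀ t, Eg v t = E) : IsW v where
  toIsW0 := hv
  sc t := by
    refine scheffe (fun s => hv.tau s) hv t (fun x hx => ?_) (fun x hx => ?_) ?_
    · have := (fam_cont_en ((fam_tau hv continuous_id).sub (fam_const hv)) (mem_Om.2 hx : (x, t) ∈ Om d)).tendsto 0
      simp only [id, tau_zero, sub_self, en_zero] at this
      exact this
    · have := (fam_cont_en (fam_tau hv continuous_id) (mem_Om.2 hx : (x, t) ∈ Om d)).tendsto 0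
      simp only [id, tau_zero] at this
      exact this
    · simp only [Eg_tau hv, hE]; exact tendsto_const_nhds

end

end Coulomb

namespace Coulomb
open scoped Topology
set_option linter.unusedSectionVars false
variable {d : ℕ} [Fact (3 ≤ d)] {v w : Spc d × ℝ → ℝ}

/-! ### Time averages and conservation of energy -/

section
variable {Y : Type*} [TopologicalSpace Y] [CompactSpace Y] [T2Space Y] [MeasurableSpace Y]
  [OpensMeasurableSpace Y] [SecondCountableTopology Y] {ν : Measure Y} [IsProbabilityMeasure ν]
  {z : Y → Spc d × ℝ → ℝ}

lemma avg_sub_const (h : Fam z) : avg ν z - v = avg ν (fun y => z y - v) := by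
  funext q
  have hc : Continuous fun y => z y q := h.c0.comp (by fun_prop : Continuous fun y : Y => (q, y))
  have := integral_sub (compact_int (ν := ν) hc) (integrable_const (v q))
  simp only [integral_const, probReal_univ, one_smul] at this
  exact this.symm

lemma avg_close (h : Fam z) (hz : ∀ y, IsW0 (z y)) (hv : IsW0 v) {t C : ℝ}
    (hC : ∀ᵐ y ∂ν, Eg (z y - v) t ≤ C) : Eg (avg ν z - v) t ≤ C := by
  rw [avg_sub_const h]
  exact ((h.sub (fam_const hv)).avg_energy_ae (fun y => ((hz y).sub hv).int t) hC).2

end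

/-- The forward time average over `[t, t + h]`. -/
noncomputable def A (h : ℝ) (v : Spc d × ℝ → ℝ) : Spc d × ℝ → ℝ :=
  avg (volume : Measure unitInterval) (fun y => tau (h * y) v)

lemma fam_A (hv : IsW0 v) (h : ℝ) : Fam fun y : unitInterval => tau (h * y) v :=
  fam_tau hv (by fun_prop)

lemma IsW0.A (hv : IsW0 v) (h : ℝ) : IsW0 (A h v) := by
  obtain ⟨C, hC⟩ := hv.bdd
  refine (fam_A hv h).avg_W0 (C := C) (fun y => hv.tau _) fun y t => ?_
  rw [Eg_tau hv]; exact hC _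

lemma A_Dt (hv : IsW0 v) {h : ℝ} (hh : h ≠ 0) {x : Spc d} (hx : x ≠ 0) (t : ℝ) :
    Dt (A h v) (x, t) = (v (x, t + h) - v (x, t)) / h := by
  have hq : ∀ s, (x, s) ∈ Om d := fun s => mem_Om.2 hx
  rw [Dt, A, (fam_A hv h).avg_D (hq t)]
  have e1 : ∀ y : unitInterval, fderiv ℝ (tau (h * y) v) (x, t) (0, 1) = Dt v (x, t + h * y) := fun y =>
    act_Dt _ _ hv.cd1 (hq t)
  simp only [e1]
  have e2 : ∫ y : unitInterval, Dt v (x, t + h * y) = ∫ y in Set.Icc (0 : ℝ) 1, Dt v (x, t + h * y) :=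
    integral_subtype measurableSet_Icc fun y => Dt v (x, t + h * y)
  rw [e2, integral_Icc_eq_integral_Ioc, ← intervalIntegral.integral_of_le zero_le_one]
  have hd : ∀ y ∈ Set.uIcc (0 : ℝ) 1, HasDerivAt (fun y => v (x, t + h * y) / h) (Dt v (x, t + h * y)) y := by
    intro y _
    have h1 : HasDerivAt (fun y : ℝ => ((x, t + h * y) : Spc d × ℝ)) ((0 : Spc d), h) y := by
      have : HasDerivAt (fun y : ℝ => t + h * y) h y := by
        simpa using ((hasDerivAt_id y).const_mul h).const_add t
      exact (hasDerivAt_const y x).prodMk this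
    have h2 := ((hv.diff (hq (t + h * y))).hasFDerivAt.comp_hasDerivAt y h1).div_const h
    refine h2.congr_deriv ?_
    have : ((0 : Spc d), h) = h • ((0 : Spc d), (1 : ℝ)) := by simp
    rw [this, map_smul, smul_eq_mul, Dt]; field_simp
  have hc : Continuous fun y : ℝ => Dt v (x, t + h * y) := by
    have := (cd_Dt hv.cd).continuousOn
    exact this.comp_continuous (f := fun y : ℝ => ((x, t + h * y) : Spc d × ℝ)) (by fun_prop) fun y => hq _
  rw [intervalIntegral.integral_eq_sub_of_hasDerivAt hd (hc.intervalIntegrable _ _)]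
  simp; ring

lemma A_tendsto (hv : IsW v) (t : ℝ) : Tendsto (fun h => Eg (A h v - v) t) (𝓝 0) (𝓝 0) := by
  rw [Metric.tendsto_nhds]
  intro ε hε
  have h1 := Metric.tendsto_nhds.1 (hv.sc t) (ε / 2) (by positivity)
  obtain ⟨δ, hδ, h2⟩ := Metric.eventually_nhds_iff.1 h1
  refine Metric.eventually_nhds_iff.2 ⟨δ, hδ, fun h hh => ?_⟩
  have : Eg (A h v - v) t ≤ ε / 2 := by
    refine avg_close (fam_A hv.toIsW0 h) (fun y => hv.toIsW0.tau _) hv.toIsW0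
      (Eventually.of_forall fun y => ?_)
    have h3 : dist (h * (y : ℝ)) 0 < δ := by
      rw [Real.dist_eq, sub_zero] at hh ⊢
      rw [abs_mul, abs_of_nonneg y.2.1]
      exact (mul_le_of_le_one_right (abs_nonneg h) y.2.2).trans_lt hh
    have := h2 h3
    rw [Real.dist_eq, sub_zero, abs_of_nonneg (Eg_nonneg _ _)] at this
    exact this.le
  rw [Real.dist_eq, sub_zero, abs_of_nonneg (Eg_nonneg _ _)]
  linarith

lemma one_cd : Rad (fun _ : Spc d × ℝ => (1 : ℝ)) :=
  ⟨contDiffOn_const, measurable_const, fun q hq i => by simp [Dx, ra, Dr]⟩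

lemma A_Dt_bdd (hv : IsW0 v) {h : ℝ} (hh : h ≠ 0) (t0 t1 R : ℝ) :
    ∃ M, 0 ≤ M ∧ ∀ q ∈ Om d, q.2 ∈ Set.Icc t0 t1 → ‖q.1‖ ≤ R → |Dt (A h v) q| ≤ M := by
  have hc : Continuous fun q : Spc d × ℝ => (v (q.1, q.2 + h) - v q) / h := by
    have := hv.cont
    fun_prop
  obtain ⟨M, hM⟩ := ((isCompact_closedBall (0 : Spc d) R).prod
    (isCompact_Icc (a := t0) (b := t1))).exists_bound_of_continuousOn hc.continuousOn
  refine ⟨|M|, abs_nonneg _, fun q hq ht hr => ?_⟩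
  obtain ⟨x, t⟩ := q
  rw [A_Dt hv hh (mem_Om.1 hq)]
  exact (hM (x, t) ⟨by simpa using hr, ht⟩).trans (le_abs_self M)

lemma A_conserve (hv : IsW0 v) {h : ℝ} (hh : h ≠ 0) {t0 t1 : ℝ} (h01 : t0 ≤ t1) :
    Eg (A h v) t1 = Eg (A h v) t0 := by
  obtain ⟨M, hM0, hM⟩ := A_Dt_bdd hv hh t0 t1 1
  have := (E_full (a := fun _ => 1) (C := 1) (M := M) (hv.A h) one_cd (by simp) (by simp [Dt]) (by simp [ra, Dr])
    (fun q hq ht hr => by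
      have := hM q hq ht hr
      rw [one_mul]
      have h2 : 0 ≤ M * (‖q.1‖ * |Dt (A h v) q|) := by positivity
      linarith) h01).2
  simp [Dt, ra, Dr] at this
  simp only [Eg]; linarith

lemma conserve' (hv : IsW v) {t0 t1 : ℝ} (h01 : t0 ≤ t1) : Eg v t1 = Eg v t0 := by
  have key : ∀ t, Tendsto (fun h => √(Eg (A h v) t)) (𝓝[≠] 0) (𝓝 √(Eg v t)) := fun t => by
    have h1 : Tendsto (fun h => √(Eg (A h v - v) t)) (𝓝 0) (𝓝 0) := by
      have := (Real.continuous_sqrt.tendsto 0).comp (A_tendsto hv t)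
      rwa [Real.sqrt_zero] at this
    rw [tendsto_iff_dist_tendsto_zero]
    refine squeeze_zero (fun _ => dist_nonneg) (fun h => ?_) (h1.mono_left nhdsWithin_le_nhds)
    exact Eg_sub_abs (hv.toIsW0.A h) hv.toIsW0 t
  have h2 := key t1
  have h3 : Tendsto (fun h => √(Eg (A h v) t1)) (𝓝[≠] 0) (𝓝 √(Eg v t0)) := by
    refine (key t0).congr' ?_
    filter_upwards [self_mem_nhdsWithin] with h hh
    rw [A_conserve hv.toIsW0 hh h01]
  have := tendsto_nhds_unique h2 h3
  rw [← Real.sq_sqrt (Eg_nonneg v t1), this, Real.sq_sqrt (Eg_nonneg v t0)]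

lemma IsW.conserve (hv : IsW v) (t s : ℝ) : Eg v t = Eg v s := by
  rcases le_total t s with h | h
  · exact (conserve' hv h).symm
  · exact conserve' hv h

section
variable {Y : Type*} [TopologicalSpace Y] [CompactSpace Y] [T2Space Y] [MeasurableSpace Y]
  [OpensMeasurableSpace Y] [SecondCountableTopology Y] {ν : Measure Y} [IsProbabilityMeasure ν]
  {L : Y → Spc d ≃ₗᵢ[ℝ] Spc d} {s : Y → ℝ}

/-- Averages of a wave over a compact set of symmetries. -/
lemma IsW.avg (hv : IsW v) (hL : Continuous fun y => toC (L y)) (hs : Continuous s) :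
    IsW (avg ν fun y => Coulomb.act (L y) (s y) v) where
  toIsW0 := (fam_act hv.cd hv.cont hL hs).avg_W0 (C := Eg v 0) (fun y => hv.toIsW0.act _ _) fun y t => by
    rw [Eg_act hv.toIsW0, hv.conserve _ 0]
  sc t := by
    refine squeeze_zero (fun _ => Eg_nonneg _ _) (fun r => ?_) (hv.sc t)
    have hr : IsW (Coulomb.tau r v - v) := (hv.tau r).sub hv
    have e : Coulomb.tau r (Coulomb.avg ν fun y => Coulomb.act (L y) (s y) v)
        - (Coulomb.avg ν fun y => Coulomb.act (L y) (s y) v)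
        = Coulomb.avg ν fun y => Coulomb.act (L y) (s y) (Coulomb.tau r v - v) := by
      funext q
      have hc : ∀ q, Continuous fun y => Coulomb.act (L y) (s y) v q := fun q =>
        (fam_act hv.cd hv.cont hL hs).c0.comp (by fun_prop : Continuous fun y : Y => (q, y))
      have := integral_sub (compact_int (ν := ν) (hc (phi (LinearIsometryEquiv.refl ℝ (Spc d)) r q)))
        (compact_int (ν := ν) (hc q))
      simp only [act_sub]
      refine this.symm.trans (integral_congr_ae (Eventually.of_forall fun y => ?_))
      show _ = Coulomb.act (L y) (s y) (Coulomb.tau r v) q - _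
      rw [← tau_act]; rfl
    rw [e]
    refine ((fam_act hr.cd hr.cont hL hs).avg_energy (fun y => (hr.toIsW0.act _ _).int t) fun y => ?_).2
    rw [Eg_act hr.toIsW0, hr.conserve _ t]

lemma Eg_avg_le (hv : IsW v) (hL : Continuous fun y => toC (L y)) (hs : Continuous s) (t : ℝ) :
    Eg (Coulomb.avg ν fun y => Coulomb.act (L y) (s y) v) t ≤ Eg v 0 := by
  refine ((fam_act hv.cd hv.cont hL hs).avg_energy (fun y => (hv.toIsW0.act _ _).int t) fun y => ?_).2
  rw [Eg_act hv.toIsW0, hv.conserve _ 0]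

end

lemma IsW.A (hv : IsW v) (h : ℝ) : IsW (A h v) := hv.avg continuous_const (by fun_prop)

lemma Eg_A_le (hv : IsW v) (h t : ℝ) : Eg (Coulomb.A h v) t ≤ Eg v 0 :=
  Eg_avg_le hv continuous_const (by fun_prop) t

end Coulomb

namespace Coulomb
open scoped Topology
set_option linter.unusedSectionVars false
variable {d : ℕ} {v w : Spc d × ℝ → ℝ}

/-! ### Energy flux through outgoing cones -/

lemma TSr_le (v : Spc d × ℝ → ℝ) {q : Spc d × ℝ} (hq : q ∈ Om d) :
    |Dt v q * Dr v q / ‖q.1‖| ≤ en v q := by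
  have hr := norm_pos_Om hq
  have h1 : (Dr v q / ‖q.1‖) ^ 2 ≤ Ns v q := by
    rw [div_pow, div_le_iff₀ (by positivity), mul_comm]; exact Dr_sq_le v q
  have h2 := pot_nonneg v q
  rw [mul_div_assoc]
  refine (abs_mul_le_half _ _).trans ?_
  unfold en; linarith

section flux
variable {G : ℝ → ℝ}

lemma rad_G (hG : ContDiff ℝ 1 G) : Rad (fun q : Spc d × ℝ => G (‖q.1‖ - q.2)) :=
  Rad.of (F := fun p => G (p.1 - p.2)) (by fun_prop) (hG.continuous.measurable.comp (by fun_prop))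

lemma ra_G (hG : ContDiff ℝ 1 G) {q : Spc d × ℝ} (hq : q ∈ Om d) :
    ra (fun q : Spc d × ℝ => G (‖q.1‖ - q.2)) q = deriv G (‖q.1‖ - q.2) / ‖q.1‖ := by
  refine ra_of (F := fun p => G (p.1 - p.2)) (by fun_prop) hq ?_
  have := ((hG.differentiable one_ne_zero) (‖q.1‖ - q.2)).hasDerivAt
  simpa [Function.comp_def] using this.comp ‖q.1‖ ((hasDerivAt_id ‖q.1‖).sub_const q.2)

lemma Dt_G (hG : ContDiff ℝ 1 G) {q : Spc d × ℝ} (hq : q ∈ Om d) :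
    Dt (fun q : Spc d × ℝ => G (‖q.1‖ - q.2)) q = - deriv G (‖q.1‖ - q.2) := by
  refine Dt_of (F := fun p => G (p.1 - p.2)) (by fun_prop) hq ?_
  have := ((hG.differentiable one_ne_zero) (‖q.1‖ - q.2)).hasDerivAt
  simpa [Function.comp_def] using this.comp q.2 ((hasDerivAt_id q.2).const_sub ‖q.1‖)

variable [Fact (3 ≤ d)]

lemma flux (hv : IsW0 v) (hG : ContDiff ℝ 1 G) {C S t0 t1 : ℝ} (hG0 : ∀ s, |G s| ≤ C)
    (hG1 : ∀ s, |deriv G s| ≤ C) (hGS : ∀ s ≤ -S, G s = 0) (h0 : 1 + S ≤ t0) (h01 : t0 ≤ t1) :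
    Integrable (fun p => deriv G (‖p.1‖ - p.2) * (en v p + Dt v p * Dr v p / ‖p.1‖)) (slab d t0 t1) ∧
    (∫ x, G (‖x‖ - t1) * en v (x, t1)) - ∫ x, G (‖x‖ - t0) * en v (x, t0) =
      - ∫ p, deriv G (‖p.1‖ - p.2) * (en v p + Dt v p * Dr v p / ‖p.1‖) ∂slab d t0 t1 := by
  have h := E_full (a := fun q => G (‖q.1‖ - q.2)) (C := C) (M := 0) hv (rad_G hG) (fun q _ _ => hG0 _)
    (fun q hq _ => by rw [Dt_G hG hq, abs_neg]; exact hG1 _)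
    (fun q hq _ => by
      have hr := norm_pos_Om hq
      rw [ra_G hG hq, abs_div, abs_of_pos hr, mul_div_cancel₀ _ hr.ne']; exact hG1 _)
    (fun q hq ht hr => by
      rw [hGS _ (by have := ht.1; linarith)]; simp) h01
  have e : (fun p => Dt (fun q : Spc d × ℝ => G (‖q.1‖ - q.2)) p * en v p
      - ra (fun q : Spc d × ℝ => G (‖q.1‖ - q.2)) p * Dt v p * Dr v p) =ᵐ[slab d t0 t1]
      fun p => -(deriv G (‖p.1‖ - p.2) * (en v p + Dt v p * Dr v p / ‖p.1‖)) := by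
    filter_upwards [slab_ae_Om t0 t1] with p hp
    rw [Dt_G hG hp, ra_G hG hp]; ring
  refine ⟨?_, ?_⟩
  · have := (h.1.congr e).neg
    refine this.congr (Eventually.of_forall fun p => ?_)
    simp
  · rw [h.2, integral_congr_ae e, integral_neg]

lemma int_G (hv : IsW0 v) (hG : Continuous G) {C : ℝ} (hG0 : ∀ s, |G s| ≤ C) (b t : ℝ) :
    Integrable fun x => G (‖x‖ - b) * en v (x, t) :=
  (hv.int t).bdd_mul (by fun_prop : Measurable fun x : Spc d => G (‖x‖ - b)).aestronglyMeasurable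
    (Eventually.of_forall fun x => hG0 _)

lemma flux_mono (hv : IsW0 v) (hG : ContDiff ℝ 1 G) {C S t0 t1 : ℝ} (hG0 : ∀ s, |G s| ≤ C)
    (hG1 : ∀ s, |deriv G s| ≤ C) (hG' : ∀ s, 0 ≤ deriv G s) (hGS : ∀ s ≤ -S, G s = 0) (h0 : 1 + S ≤ t0)
    (h01 : t0 ≤ t1) : ∫ x, G (‖x‖ - t1) * en v (x, t1) ≤ ∫ x, G (‖x‖ - t0) * en v (x, t0) := by
  have h := (flux hv hG hG0 hG1 hGS h0 h01).2
  have : 0 ≤ ∫ p, deriv G (‖p.1‖ - p.2) * (en v p + Dt v p * Dr v p / ‖p.1‖) ∂slab d t0 t1 := by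
    refine integral_nonneg_of_ae ?_
    filter_upwards [slab_ae_Om t0 t1] with p hp
    have h1 := (abs_le.1 (TSr_le v hp)).1
    exact mul_nonneg (hG' _) (by linarith)
  linarith

end flux

variable [Fact (3 ≤ d)]

lemma ext_anti (hv : IsW0 v) (t : ℝ) {S S' : Set (Spc d)} (h : S ⊆ S') :
    ∫ x in S, en v (x, t) ≤ ∫ x in S', en v (x, t) :=
  setIntegral_mono_set (hv.int t).integrableOn (Eventually.of_forall fun _ => en_nonneg _ _)
    (Eventually.of_forall h)

lemma loc_le (hv : IsW0 v) (t : ℝ) (S : Set (Spc d)) : ∫ x in S, en v (x, t) ≤ Eg v t :=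
  setIntegral_le_integral (hv.int t) (Eventually.of_forall fun _ => en_nonneg _ _)

/-- Comparison of weighted and localized integrals. -/
lemma ind_le {f g : Spc d → ℝ} {S : Set (Spc d)} (hS : MeasurableSet S) (hf : Integrable f) (hg : Integrable g)
    (h : ∀ x ∈ S, f x ≤ g x) (h0 : ∀ x, 0 ≤ g x) : ∫ x in S, f x ≤ ∫ x, g x := by
  rw [← integral_indicator hS]
  refine integral_mono (hf.indicator hS) hg fun x => ?_
  by_cases hx : x ∈ S
  · rw [Set.indicator_of_mem hx]; exact h x hx
  · rw [Set.indicator_of_notMem hx]; exact h0 x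

lemma le_ind {f g : Spc d → ℝ} {S : Set (Spc d)} (hS : MeasurableSet S) (hf : Integrable f) (hg : Integrable g)
    (h : ∀ x ∈ S, g x ≤ f x) (h0 : ∀ x ∉ S, g x ≤ 0) : ∫ x, g x ≤ ∫ x in S, f x := by
  rw [← integral_indicator hS]
  refine integral_mono hg (hf.indicator hS) fun x => ?_
  by_cases hx : x ∈ S
  · rw [Set.indicator_of_mem hx]; exact h x hx
  · rw [Set.indicator_of_notMem hx]; exact h0 x hx

lemma meas_ext (a : ℝ) : MeasurableSet {x : Spc d | a ≤ ‖x‖} := measurableSet_le (by fun_prop) (by fun_prop)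

lemma finite_speed (hv : IsW0 v) {S t0 t1 : ℝ} (h0 : 1 + S ≤ t0) (h01 : t0 ≤ t1) :
    ∫ x in {x | t1 + 1 - S ≤ ‖x‖}, en v (x, t1) ≤ ∫ x in {x | t0 - S ≤ ‖x‖}, en v (x, t0) := by
  obtain ⟨C, hC0, hC⟩ := th'_bound
  set G : ℝ → ℝ := fun s => th (s + S) with hGd
  have hG : ContDiff ℝ 1 G := th_cd1.comp (by fun_prop)
  have hd : ∀ s, deriv G s = deriv th (s + S) := fun s => by
    rw [hGd, deriv_comp_add_const]
  have hb : ∀ s, |G s| ≤ max C 1 := fun s => by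
    rw [abs_of_nonneg (th_nonneg _)]; exact (th_le_one _).trans (le_max_right _ _)
  have hm := flux_mono hv hG (C := max C 1) (S := S) hb
    (fun s => by rw [hd]; exact (hC _).trans (le_max_left _ _)) (fun s => by rw [hd]; exact th'_nonneg _)
    (fun s hs => th_zero (by linarith)) h0 h01
  refine (ind_le (meas_ext _) (hv.int t1) (int_G hv hG.continuous hb t1 t1) (fun x hx => ?_) fun x => ?_).trans
    (hm.trans (le_ind (meas_ext _) (hv.int t0) (int_G hv hG.continuous hb t0 t0) (fun x hx => ?_) fun x hx => ?_))
  · have hx : t1 + 1 - S ≤ ‖x‖ := hx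
    simp only [hGd]
    rw [th_one (by linarith), one_mul]
  · exact mul_nonneg (th_nonneg _) (en_nonneg _ _)
  · exact mul_le_of_le_one_left (en_nonneg _ _) (th_le_one _)
  · have hx : ¬ t0 - S ≤ ‖x‖ := hx
    simp only [hGd]
    rw [th_zero (by linarith), zero_mul]

lemma tail_zero {f : Spc d → ℝ} (hf : Integrable f) :
    Tendsto (fun n : ℕ => ∫ x in {x : Spc d | (n : ℝ) ≤ ‖x‖}, f x) atTop (𝓝 0) := by
  have h := tendsto_setIntegral_of_antitone (μ := volume) (f := f)
    (s := fun n : ℕ => {x : Spc d | (n : ℝ) ≤ ‖x‖})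
    (fun n => meas_ext _) (fun m n hmn x hx => by
      have : (m : ℝ) ≤ n := by exact_mod_cast hmn
      exact this.trans hx) ⟨0, hf.integrableOn⟩
  have e : (⋂ n : ℕ, {x : Spc d | (n : ℝ) ≤ ‖x‖}) = ∅ := by
    ext x
    simp only [Set.mem_iInter, Set.mem_ofPred_eq, Set.mem_empty_iff_false, iff_false, not_forall, not_le]
    exact exists_nat_gt ‖x‖
  rw [e] at h
  simpa using h

/-- Uniform smallness of the energy outside a forward light cone. -/
lemma tail (hv : IsW0 v) {ε : ℝ} (hε : 0 < ε) : ∃ R, 1 ≤ R ∧ ∀ t, 0 ≤ t →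
    ∫ x in {x | t + R ≤ ‖x‖}, en v (x, t) ≤ ε := by
  obtain ⟨n, h1, h2⟩ := (((tail_zero (hv.int 0)).eventually (ge_mem_nhds hε)).and
    (eventually_ge_atTop 1)).exists
  have hn : (1 : ℝ) ≤ n := by exact_mod_cast h2
  refine ⟨n + 1, by linarith, fun t ht => ?_⟩
  have := finite_speed hv (S := -n) (t0 := 0) (t1 := t) (by linarith) ht
  rw [show t + 1 - (-(n : ℝ)) = t + (n + 1) by ring, show 0 - -(n : ℝ) = n by ring] at this
  exact this.trans h1

end Coulomb

namespace Coulomb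
open scoped Topology
set_option linter.unusedSectionVars false
variable {d : ℕ} {v w : Spc d × ℝ → ℝ}

/-! ### The Morawetz identity -/

/-- The regularized radius `√(r² + ρ²)`. -/
noncomputable def sg (ρ r : ℝ) : ℝ := √(r ^ 2 + ρ ^ 2)

section sg
variable {ρ r : ℝ}

lemma sg_sq (ρ r : ℝ) : sg ρ r ^ 2 = r ^ 2 + ρ ^ 2 := Real.sq_sqrt (by positivity)

lemma sg_pos (hρ : 0 < ρ) (r : ℝ) : 0 < sg ρ r := Real.sqrt_pos.2 (by positivity)

lemma le_sg (ρ r : ℝ) : r ≤ sg ρ r := Real.le_sqrt_of_sq_le (by nlinarith [sq_nonneg ρ])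

lemma le_sg' (ρ r : ℝ) : ρ ≤ sg ρ r := Real.le_sqrt_of_sq_le (by nlinarith [sq_nonneg r])

lemma sg_hd (hρ : 0 < ρ) (r : ℝ) : HasDerivAt (sg ρ) (r / sg ρ r) r := by
  have h1 : HasDerivAt (fun r : ℝ => r ^ 2 + ρ ^ 2) (2 * r) r := by
    simpa using (hasDerivAt_pow 2 r).add_const (ρ ^ 2)
  refine (h1.sqrt (by positivity)).congr_deriv ?_
  rw [sg]; field_simp

lemma sg_cd (hρ : 0 < ρ) : ContDiff ℝ 1 (sg ρ) := by
  unfold sg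
  exact ContDiff.sqrt (by fun_prop) fun x => by positivity

@[fun_prop] lemma sg_meas (ρ : ℝ) : Measurable (sg ρ) := by unfold sg; fun_prop

lemma sg_pow_inv (hρ : 0 < ρ) (n : ℕ) (r : ℝ) :
    HasDerivAt (fun r => 1 / sg ρ r ^ n) (-(n * r) / sg ρ r ^ (n + 2)) r := by
  have h0 := (sg_pos hρ r).ne'
  have h := (((sg_hd hρ r).pow n).inv (pow_ne_zero n h0))
  have e : (fun r => 1 / sg ρ r ^ n) = (sg ρ ^ n)⁻¹ := by funext s; simp
  rw [e]
  refine h.congr_deriv ?_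
  rcases n with _ | n
  · simp
  · simp only [Nat.add_sub_cancel, Pi.pow_apply]
    field_simp
    ring

/-- The weight `c |x|^{-k} σ^{-n}`. -/
noncomputable def wt (d : ℕ) (ρ c : ℝ) (n : ℕ) (q : Spc d × ℝ) : ℝ := c * (1 / sg ρ ‖q.1‖ ^ n)

noncomputable def wtr (d : ℕ) (ρ c : ℝ) (n : ℕ) (q : Spc d × ℝ) : ℝ := c * (1 / sg ρ ‖q.1‖ ^ n) / ‖q.1‖

lemma wt_cdF (hρ : 0 < ρ) (c : ℝ) (n : ℕ) : ContDiff ℝ 1 fun p : ℝ × ℝ => c * (1 / sg ρ p.1 ^ n) := by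
  have h1 : ContDiff ℝ 1 fun p : ℝ × ℝ => sg ρ p.1 ^ n := ((sg_cd hρ).comp contDiff_fst).pow n
  exact contDiff_const.mul (contDiff_const.div h1 fun _ => pow_ne_zero n (sg_pos hρ _).ne')

lemma wtr_cdF (hρ : 0 < ρ) (c : ℝ) (n : ℕ) :
    ContDiffOn ℝ 1 (fun p : ℝ × ℝ => c * (1 / sg ρ p.1 ^ n) / p.1) (Set.Ioi 0 ×ˢ Set.univ) :=
  (wt_cdF hρ c n).contDiffOn.div contDiffOn_fst fun _ hp => (Set.mem_Ioi.1 hp.1).ne'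

lemma rad_wt (hρ : 0 < ρ) (c : ℝ) (n : ℕ) : Rad (wt d ρ c n) :=
  Rad.of (F := fun p => c * (1 / sg ρ p.1 ^ n)) (wt_cdF hρ c n).contDiffOn (by fun_prop)

lemma rad_wtr (hρ : 0 < ρ) (c : ℝ) (n : ℕ) : Rad (wtr d ρ c n) :=
  Rad.of (F := fun p => c * (1 / sg ρ p.1 ^ n) / p.1) (wtr_cdF hρ c n) (by fun_prop)

lemma ra_wt (hρ : 0 < ρ) (c : ℝ) (n : ℕ) {q : Spc d × ℝ} (hq : q ∈ Om d) :
    ra (wt d ρ c n) q = -(c * n) / sg ρ ‖q.1‖ ^ (n + 2) := by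
  have hr := norm_pos_Om hq
  have hs := sg_pos hρ ‖q.1‖
  have := ra_of (F := fun p => c * (1 / sg ρ p.1 ^ n)) (wt_cdF hρ c n).contDiffOn hq
    ((sg_pow_inv hρ n ‖q.1‖).const_mul c)
  refine this.trans ?_
  field_simp

lemma ra_wtr (hρ : 0 < ρ) (c : ℝ) (n : ℕ) {q : Spc d × ℝ} (hq : q ∈ Om d) :
    ‖q.1‖ ^ 2 * ra (wtr d ρ c n) q =
      -(c / (‖q.1‖ * sg ρ ‖q.1‖ ^ n)) - c * n * ‖q.1‖ / sg ρ ‖q.1‖ ^ (n + 2) := by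
  have hr := norm_pos_Om hq
  have hs := sg_pos hρ ‖q.1‖
  have := ra_of (F := fun p => c * (1 / sg ρ p.1 ^ n) / p.1) (wtr_cdF hρ c n) hq
    (((sg_pow_inv hρ n ‖q.1‖).const_mul c).div (hasDerivAt_id ‖q.1‖) hr.ne')
  have h2 : ra (wtr d ρ c n) q = _ := this
  rw [h2]
  simp only []
  field_simp
  ring

lemma Dt_wt (hρ : 0 < ρ) (c : ℝ) (n : ℕ) {q : Spc d × ℝ} (hq : q ∈ Om d) : Dt (wt d ρ c n) q = 0 :=
  Dt_of (F := fun p => c * (1 / sg ρ p.1 ^ n)) (wt_cdF hρ c n).contDiffOn hq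
    (hasDerivAt_const q.2 (c * (1 / sg ρ ‖q.1‖ ^ n)))

end sg

/-- The Hardy integrand. -/
noncomputable def hI (v κ : Spc d × ℝ → ℝ) (q : Spc d × ℝ) : ℝ :=
  2 * v q * κ q * Dr v q + v q ^ 2 * (d * κ q + ‖q.1‖ ^ 2 * ra κ q)

variable [Fact (3 ≤ d)]

lemma slab_zero {f : Spc d × ℝ → ℝ} {t0 t1 : ℝ} (h01 : t0 ≤ t1) (hf : Integrable f (slab d t0 t1))
    (h : ∀ t ∈ Set.Icc t0 t1, ∫ x, f (x, t) = 0) : ∫ p, f p ∂slab d t0 t1 = 0 := by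
  rw [slab_fubini h01 hf]
  rw [intervalIntegral.integral_congr (g := fun _ => 0)]
  · simp
  · intro t ht
    rw [Set.uIcc_of_le h01] at ht
    exact h t ht

section
variable {ρ : ℝ}

/-- Basic bounds: the ratios `r/σ` and `1/σ` lie in `[0, 1]`. -/
lemma ratios (hρ : 1 ≤ ρ) {r : ℝ} (hr : 0 < r) : 0 ≤ r / sg ρ r ∧ r / sg ρ r ≤ 1 ∧ 0 ≤ 1 / sg ρ r ∧
    1 / sg ρ r ≤ 1 := by
  have hs := sg_pos (by linarith : 0 < ρ) r
  refine ⟨by positivity, (div_le_one hs).2 (le_sg _ _), by positivity, (div_le_one hs).2 ?_⟩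
  exact hρ.trans (le_sg' _ _)

lemma mono_le_one {b c : ℝ} (hb : 0 ≤ b) (hb1 : b ≤ 1) (hc : 0 ≤ c) (hc1 : c ≤ 1) (i j : ℕ) :
    0 ≤ b ^ i * c ^ j ∧ b ^ i * c ^ j ≤ 1 :=
  ⟨by positivity, mul_le_one₀ (pow_le_one₀ hb hb1) (by positivity) (pow_le_one₀ hc hc1)⟩

lemma hI_wt (hv : IsW0 v) (hρ : 1 ≤ ρ) (c : ℝ) (n : ℕ) (hn : 2 ≤ n) (t : ℝ) :
    Integrable (fun x => hI v (wt d ρ c n) (x, t)) ∧ ∫ x, hI v (wt d ρ c n) (x, t) = 0 := by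
  have hρ0 : 0 < ρ := by linarith
  obtain ⟨n, rfl⟩ := Nat.exists_eq_add_of_le hn
  set D : ℝ := |c| * (1 + d + (2 + n)) + c ^ 2 with hD
  have key : ∀ x : Spc d, x ≠ 0 → _ := fun x hx => ratios hρ (norm_pos_iff.2 hx)
  refine H_full (C := D) hv (rad_wt hρ0 c _) (fun x hx => ?_) (fun x hx => ?_) (fun x hx => ?_)
  all_goals
    obtain ⟨h1, h2, h3, h4⟩ := key x hx
    have hs := sg_pos hρ0 ‖x‖
    have hm := mono_le_one h1 h2 h3 h4
    set b := ‖x‖ / sg ρ ‖x‖ with hb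
    set e := 1 / sg ρ ‖x‖ with he
    have hr : ‖x‖ = b * sg ρ ‖x‖ := by rw [hb]; field_simp
    have hc0 := abs_nonneg c
    have hw : wt d ρ c (2 + n) (x, t) = c * e ^ (2 + n) := by simp [wt, he]
    have hse : sg ρ ‖x‖ * e = 1 := by rw [he]; field_simp
  · have e1 : ‖x‖ * |wt d ρ c (2 + n) (x, t)| = |c| * (b ^ 1 * e ^ (1 + n)) := by
      rw [hw, abs_mul, abs_of_nonneg (pow_nonneg h3 _), hr, pow_one]
      calc _ = |c| * (b * e ^ (1 + n)) * (sg ρ ‖x‖ * e) := by ring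
        _ = _ := by rw [hse, mul_one]
    rw [e1, hD]
    have h5 := mul_le_mul_of_nonneg_left (hm 1 (1 + n)).2 hc0
    have : 0 ≤ |c| * (d + (2 + n)) := by positivity
    nlinarith [sq_nonneg c]
  · have e1 : ‖x‖ * wt d ρ c (2 + n) (x, t) ^ 2 * ‖x‖ ^ 2 = c ^ 2 * (b ^ 3 * e ^ (1 + 2 * n)) := by
      rw [hw, hr]
      calc _ = c ^ 2 * (b ^ 3 * e ^ (1 + 2 * n)) * (sg ρ ‖x‖ * e) ^ 3 := by ring
        _ = _ := by rw [hse]; ring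
    rw [e1, hD]
    have h5 := mul_le_mul_of_nonneg_left (hm 3 (1 + 2 * n)).2 (sq_nonneg c)
    have : 0 ≤ |c| * (1 + d + (2 + n)) := by positivity
    linarith
  · have e1 : ‖x‖ * |d * wt d ρ c (2 + n) (x, t) + ‖x‖ ^ 2 * ra (wt d ρ c (2 + n)) (x, t)|
        = |c| * |d * (b ^ 1 * e ^ (1 + n)) - (2 + n) * (b ^ 3 * e ^ (1 + n))| := by
      rw [← abs_of_nonneg (norm_nonneg x), ← abs_mul, ← abs_mul, abs_of_nonneg (norm_nonneg x),
        ra_wt hρ0 c _ (mem_Om.2 hx), hw]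
      congr 1
      have : -(c * ((2 + n : ℕ) : ℝ)) / sg ρ ‖((x, t) : Spc d × ℝ).1‖ ^ (2 + n + 2)
          = -(c * (2 + n)) * e ^ (2 + n + 2) := by
        rw [he, one_div, inv_pow]; push_cast; ring
      rw [this, hr]
      calc _ = (sg ρ ‖x‖ * e) * c * (d * (b * e ^ (1 + n)) - (2 + n) * (b ^ 3 * e ^ (1 + n)) * (sg ρ ‖x‖ * e) ^ 2) := by
            ring
        _ = _ := by rw [hse]; ring
    rw [e1, hD]
    have h5 := hm 1 (1 + n)
    have h6 := hm 3 (1 + n)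
    have hd0 : (0 : ℝ) ≤ d := by positivity
    have hn0 : (0 : ℝ) ≤ 2 + (n : ℝ) := by positivity
    have h7 := mul_le_mul_of_nonneg_left h5.2 hd0
    have h8 := mul_le_mul_of_nonneg_left h6.2 hn0
    have h9 := mul_nonneg hd0 h5.1
    have h10 := mul_nonneg hn0 h6.1
    have h11 : |(d : ℝ) * (b ^ 1 * e ^ (1 + n)) - (2 + (n : ℝ)) * (b ^ 3 * e ^ (1 + n))| ≤ 1 + (d : ℝ) + (2 + (n : ℝ)) := by
      rw [abs_le]; constructor <;> linarith
    have := mul_le_mul_of_nonneg_left h11 hc0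
    nlinarith [sq_nonneg c]

lemma hI_wtr (hv : IsW0 v) (hρ : 1 ≤ ρ) (c : ℝ) (n : ℕ) (hn : 1 ≤ n) (t : ℝ) :
    Integrable (fun x => hI v (wtr d ρ c n) (x, t)) ∧ ∫ x, hI v (wtr d ρ c n) (x, t) = 0 := by
  have hρ0 : 0 < ρ := by linarith
  obtain ⟨n, rfl⟩ := Nat.exists_eq_add_of_le hn
  set D : ℝ := |c| * (1 + d + 1 + (1 + n)) + c ^ 2 with hD
  have key : ∀ x : Spc d, x ≠ 0 → _ := fun x hx => ratios hρ (norm_pos_iff.2 hx)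
  refine H_full (C := D) hv (rad_wtr hρ0 c _) (fun x hx => ?_) (fun x hx => ?_) (fun x hx => ?_)
  all_goals
    obtain ⟨h1, h2, h3, h4⟩ := key x hx
    have hs := sg_pos hρ0 ‖x‖
    have hm := mono_le_one h1 h2 h3 h4
    have hx0 := norm_pos_iff.2 hx
    set b := ‖x‖ / sg ρ ‖x‖ with hb
    set e := 1 / sg ρ ‖x‖ with he
    have hr : ‖x‖ = b * sg ρ ‖x‖ := by rw [hb]; field_simp
    have hc0 := abs_nonneg c
    have hw : ‖x‖ * wtr d ρ c (1 + n) (x, t) = c * e ^ (1 + n) := by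
      simp only [wtr, he, one_div, inv_pow]; field_simp
    have hse : sg ρ ‖x‖ * e = 1 := by rw [he]; field_simp
  · have e1 : ‖x‖ * |wtr d ρ c (1 + n) (x, t)| = |c| * (b ^ 0 * e ^ (1 + n)) := by
      rw [← abs_of_nonneg (norm_nonneg x), ← abs_mul, hw, abs_mul,
        abs_of_nonneg (pow_nonneg h3 _), pow_zero, one_mul]
    rw [e1, hD]
    have h5 := mul_le_mul_of_nonneg_left (hm 0 (1 + n)).2 hc0
    have : 0 ≤ |c| * (d + 1 + (1 + n)) := by positivity
    nlinarith [sq_nonneg c]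
  · have e1 : ‖x‖ * wtr d ρ c (1 + n) (x, t) ^ 2 * ‖x‖ ^ 2 = c ^ 2 * (b ^ 1 * e ^ (1 + 2 * n)) := by
      calc _ = ‖x‖ * (‖x‖ * wtr d ρ c (1 + n) (x, t)) ^ 2 := by ring
        _ = b * sg ρ ‖x‖ * (c * e ^ (1 + n)) ^ 2 := by rw [hw, ← hr]
        _ = c ^ 2 * (b ^ 1 * e ^ (1 + 2 * n)) * (sg ρ ‖x‖ * e) := by ring
        _ = _ := by rw [hse]; ring
    rw [e1, hD]
    have h5 := mul_le_mul_of_nonneg_left (hm 1 (1 + 2 * n)).2 (sq_nonneg c)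
    have : 0 ≤ |c| * (1 + d + 1 + (1 + n)) := by positivity
    linarith
  · have e1 : ‖x‖ * |d * wtr d ρ c (1 + n) (x, t) + ‖x‖ ^ 2 * ra (wtr d ρ c (1 + n)) (x, t)|
        = |c| * |d * (b ^ 0 * e ^ (1 + n)) - (b ^ 0 * e ^ (1 + n)) - (1 + n) * (b ^ 2 * e ^ (1 + n))| := by
      rw [← abs_of_nonneg (norm_nonneg x), ← abs_mul, ← abs_mul, abs_of_nonneg (norm_nonneg x),
        mul_add, mul_left_comm, hw]
      congr 1
      have h6 := ra_wtr hρ0 c (1 + n) (mem_Om.2 hx : ((x, t) : Spc d × ℝ) ∈ Om d)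
      simp only at h6
      rw [h6]
      simp only [hb, he, one_div, inv_pow, div_pow]
      push_cast
      field_simp
      ring
    rw [e1, hD]
    have h5 := hm 0 (1 + n)
    have h6 := hm 2 (1 + n)
    have hd0 : (0 : ℝ) ≤ d := by positivity
    have hn0 : (0 : ℝ) ≤ 1 + (n : ℝ) := by positivity
    have h7 := mul_le_mul_of_nonneg_left h5.2 hd0
    have h8 := mul_le_mul_of_nonneg_left h6.2 hn0
    have h9 := mul_nonneg hd0 h5.1
    have h10 := mul_nonneg hn0 h6.1
    have h11 : |(d : ℝ) * (b ^ 0 * e ^ (1 + n)) - (b ^ 0 * e ^ (1 + n)) - (1 + (n : ℝ)) * (b ^ 2 * e ^ (1 + n))|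
        ≤ 1 + (d : ℝ) + 1 + (1 + (n : ℝ)) := by
      rw [abs_le]; constructor <;> linarith
    have := mul_le_mul_of_nonneg_left h11 hc0
    nlinarith [sq_nonneg c]

end

end Coulomb

namespace Coulomb
open scoped Topology
set_option linter.unusedSectionVars false
variable {d : ℕ} {v w : Spc d × ℝ → ℝ} [Fact (3 ≤ d)] {ρ : ℝ}

lemma three_le (d : ℕ) [h : Fact (3 ≤ d)] : (3 : ℝ) ≤ d := by exact_mod_cast h.out

lemma MW_mor (hρ : 1 ≤ ρ) (t0 t1 : ℝ) :
    MW (wt d ρ 1 1) (wt d ρ ((d - 1) / 2) 1) t0 t1 ((d : ℝ) ^ 2) := by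
  have hρ0 : 0 < ρ := by linarith
  have hd := three_le d
  have hd2 : (1 : ℝ) ≤ (d : ℝ) ^ 2 := by nlinarith
  have hd3 : ((d - 1) / 2 : ℝ) ^ 2 ≤ (d : ℝ) ^ 2 := by nlinarith
  have hb : ∀ q : Spc d × ℝ, q ∈ Om d → _ := fun q hq => ratios hρ (norm_pos_Om hq)
  have hm : ∀ q : Spc d × ℝ, q ∈ Om d → _ := fun q hq =>
    mono_le_one (hb q hq).1 (hb q hq).2.1 (hb q hq).2.2.1 (hb q hq).2.2.2
  refine ⟨rad_wt hρ0 _ _, rad_wt hρ0 _ _, ?_, ?_, ?_, ?_, ?_, ?_, ?_, ?_⟩ <;> intro q hq _ <;>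
    have hs := sg_pos hρ0 ‖q.1‖
  · have h := hm q hq 0 1
    rw [wt, abs_of_nonneg (by positivity)]
    simp only [pow_zero, pow_one, one_mul] at h ⊢
    linarith
  · have h := hm q hq 1 0
    rw [wt, abs_of_nonneg (by positivity)]
    have : ‖q.1‖ * (1 * (1 / sg ρ ‖q.1‖ ^ 1)) = (‖q.1‖ / sg ρ ‖q.1‖) ^ 1 * (1 / sg ρ ‖q.1‖) ^ 0 := by
      simp; field_simp
    linarith
  · have h := hm q hq 2 1
    rw [ra_wt hρ0 _ _ hq]
    have : ‖q.1‖ ^ 2 * |-(1 * ((1 : ℕ) : ℝ)) / sg ρ ‖q.1‖ ^ (1 + 2)| =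
        (‖q.1‖ / sg ρ ‖q.1‖) ^ 2 * (1 / sg ρ ‖q.1‖) ^ 1 := by
      rw [neg_div, abs_neg, abs_of_nonneg (by positivity)]
      simp; field_simp
    linarith
  · rw [Dt_wt hρ0 _ _ hq]; simp
  · have h := hm q hq 0 1
    rw [wt, abs_of_nonneg (mul_nonneg (by linarith) (by positivity))]
    simp only [pow_zero, pow_one, one_mul] at h ⊢
    have := mul_le_mul_of_nonneg_left h.2 (by linarith : (0 : ℝ) ≤ (d - 1) / 2)
    nlinarith
  · have h := hm q hq 1 1
    have : ‖q.1‖ * wt d ρ ((d - 1) / 2) 1 q ^ 2 =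
        ((d - 1) / 2) ^ 2 * ((‖q.1‖ / sg ρ ‖q.1‖) ^ 1 * (1 / sg ρ ‖q.1‖) ^ 1) := by
      rw [wt]; simp; field_simp
    rw [this]
    have := mul_le_mul_of_nonneg_left h.2 (sq_nonneg ((d - 1) / 2 : ℝ))
    linarith
  · have h := hm q hq 3 3
    rw [ra_wt hρ0 _ _ hq]
    have : ‖q.1‖ ^ 3 * (-((d - 1) / 2 * ((1 : ℕ) : ℝ)) / sg ρ ‖q.1‖ ^ (1 + 2)) ^ 2 =
        ((d - 1) / 2) ^ 2 * ((‖q.1‖ / sg ρ ‖q.1‖) ^ 3 * (1 / sg ρ ‖q.1‖) ^ 3) := by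
      simp; field_simp
    rw [this]
    have := mul_le_mul_of_nonneg_left h.2 (sq_nonneg ((d - 1) / 2 : ℝ))
    linarith
  · rw [Dt_wt hρ0 _ _ hq]; simp

/-- The positive density in the Morawetz identity. -/
noncomputable def good (v : Spc d × ℝ → ℝ) (ρ : ℝ) (q : Spc d × ℝ) : ℝ :=
  hI v (wt d ρ ((d - 1) / 4) 3) q + hI v (wtr d ρ (-(1 / 2)) 1) q
    - bulk v (wt d ρ 1 1) (wt d ρ ((d - 1) / 2) 1) q

lemma good_eq (hρ : 1 ≤ ρ) (v : Spc d × ℝ → ℝ) {q : Spc d × ℝ} (hq : q ∈ Om d) :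
    good v ρ q = ρ ^ 2 / (2 * sg ρ ‖q.1‖ ^ 3) * (Dt v q ^ 2 - Ns v q) + Ns v q / sg ρ ‖q.1‖
      - Dr v q ^ 2 / sg ρ ‖q.1‖ ^ 3
      + (d - 1) / 4 * v q ^ 2 * (((d - 3) * ‖q.1‖ ^ 2 + d * ρ ^ 2) / sg ρ ‖q.1‖ ^ 5)
      + v q ^ 2 * ‖q.1‖ / (2 * sg ρ ‖q.1‖ ^ 3) := by
  have hρ0 : 0 < ρ := by linarith
  have hs := sg_pos hρ0 ‖q.1‖
  have hr := norm_pos_Om hq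
  have e := sg_sq ρ ‖q.1‖
  have e2 : ρ ^ 2 = sg ρ ‖q.1‖ ^ 2 - ‖q.1‖ ^ 2 := by linarith
  rw [e2]
  simp only [good, hI, bulk, ra_wtr hρ0 _ _ hq, ra_wt hρ0 _ _ hq, Dt_wt hρ0 _ _ hq]
  simp only [wt, wtr]
  generalize sg ρ ‖q.1‖ = s at hs
  generalize ‖q.1‖ = r at hr
  have hs' := hs.ne'
  have hr' := hr.ne'
  push_cast
  field_simp
  ring

lemma good_ge (hρ : 1 ≤ ρ) (v : Spc d × ℝ → ℝ) {q : Spc d × ℝ} (hq : q ∈ Om d) :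
    ρ ^ 2 / (2 * sg ρ ‖q.1‖ ^ 3) * (Dt v q ^ 2 + Ns v q) + 3 / 2 * ρ ^ 2 * v q ^ 2 / sg ρ ‖q.1‖ ^ 5
      + v q ^ 2 * ‖q.1‖ / (2 * sg ρ ‖q.1‖ ^ 3) ≤ good v ρ q := by
  have hρ0 : 0 < ρ := by linarith
  have hs := sg_pos hρ0 ‖q.1‖
  have hr := norm_pos_Om hq
  have e := sg_sq ρ ‖q.1‖
  have hP := Dr_sq_le v q
  have hd := three_le d
  rw [good_eq hρ v hq]
  have h1 : Dr v q ^ 2 / sg ρ ‖q.1‖ ^ 3 ≤ ‖q.1‖ ^ 2 * Ns v q / sg ρ ‖q.1‖ ^ 3 := by gcongr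
  have h2 : Ns v q / sg ρ ‖q.1‖ = ρ ^ 2 / sg ρ ‖q.1‖ ^ 3 * Ns v q + ‖q.1‖ ^ 2 * Ns v q / sg ρ ‖q.1‖ ^ 3 := by
    have e2 : ρ ^ 2 = sg ρ ‖q.1‖ ^ 2 - ‖q.1‖ ^ 2 := by linarith
    rw [e2]; field_simp; ring
  have h3 : 3 / 2 * ρ ^ 2 * v q ^ 2 / sg ρ ‖q.1‖ ^ 5 ≤
      (d - 1) / 4 * v q ^ 2 * (((d - 3) * ‖q.1‖ ^ 2 + d * ρ ^ 2) / sg ρ ‖q.1‖ ^ 5) := by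
    rw [← mul_div_assoc]
    apply div_le_div_of_nonneg_right _ (by positivity)
    have h4 : 3 * ρ ^ 2 ≤ (d - 3) * ‖q.1‖ ^ 2 + d * ρ ^ 2 := by
      nlinarith [mul_nonneg (by linarith : (0 : ℝ) ≤ d - 3) (sq_nonneg ‖q.1‖), sq_nonneg ρ]
    calc _ = 1 / 2 * v q ^ 2 * (3 * ρ ^ 2) := by ring
      _ ≤ (d - 1) / 4 * v q ^ 2 * (3 * ρ ^ 2) :=
          mul_le_mul_of_nonneg_right (mul_le_mul_of_nonneg_right (by linarith) (sq_nonneg _)) (by positivity)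
      _ ≤ _ := mul_le_mul_of_nonneg_left h4 (mul_nonneg (by linarith) (sq_nonneg _))
  have h5 : ρ ^ 2 / (2 * sg ρ ‖q.1‖ ^ 3) * (Dt v q ^ 2 + Ns v q)
      = ρ ^ 2 / (2 * sg ρ ‖q.1‖ ^ 3) * (Dt v q ^ 2 - Ns v q) + ρ ^ 2 / sg ρ ‖q.1‖ ^ 3 * Ns v q := by
    field_simp; ring
  rw [h5]
  linarith

lemma good_nonneg (hρ : 1 ≤ ρ) (v : Spc d × ℝ → ℝ) {q : Spc d × ℝ} (hq : q ∈ Om d) : 0 ≤ good v ρ q := by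
  have hρ0 : 0 < ρ := by linarith
  have hs := sg_pos hρ0 ‖q.1‖
  have := Ns_nonneg v q
  refine le_trans ?_ (good_ge hρ v hq)
  positivity

/-- Crude upper bound, giving integrability. -/
lemma good_le (hρ : 1 ≤ ρ) (v : Spc d × ℝ → ℝ) {q : Spc d × ℝ} (hq : q ∈ Om d) :
    good v ρ q ≤ (4 + (d : ℝ) ^ 2 + (d : ℝ) ^ 2 * ρ ^ 2) * en v q := by
  have hρ0 : 0 < ρ := by linarith
  have hs := sg_pos hρ0 ‖q.1‖
  have hr := norm_pos_Om hq
  have e := sg_sq ρ ‖q.1‖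
  have hd := three_le d
  have hN := Ns_nonneg v q
  obtain ⟨h1, h2, h3, h4⟩ := ratios hρ hr
  have hm := mono_le_one h1 h2 h3 h4
  rw [good_eq hρ v hq]
  set b := ‖q.1‖ / sg ρ ‖q.1‖ with hb
  set f := 1 / sg ρ ‖q.1‖ with hf
  set s := sg ρ ‖q.1‖ with hsd
  have hρs : ρ / s ≤ 1 := (div_le_one hs).2 (le_sg' _ _)
  have hρs0 : 0 ≤ ρ / s := by positivity
  have k1 : ρ ^ 2 / (2 * s ^ 3) * (Dt v q ^ 2 - Ns v q) ≤ en v q := by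
    have : ρ ^ 2 / (2 * s ^ 3) ≤ 1 / 2 := by
      have : ρ ^ 2 / (2 * s ^ 3) = 1 / 2 * ((ρ / s) ^ 2 * f ^ 1) := by rw [hf]; field_simp
      rw [this]
      have := (mono_le_one hρs0 hρs h3 h4 2 1).2
      linarith
    have h0 : 0 ≤ ρ ^ 2 / (2 * s ^ 3) := by positivity
    have := mul_le_mul_of_nonneg_right this (sq_nonneg (Dt v q))
    have := Dt_sq_le_en v (q := q)
    nlinarith
  have k2 : Ns v q / s ≤ 2 * en v q := by
    have : Ns v q / s = Ns v q * f := by rw [hf]; ring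
    rw [this]
    have := Ns_le_en v q
    nlinarith
  have k3 : 0 ≤ Dr v q ^ 2 / s ^ 3 := by positivity
  have hp := pot_le_en v q
  have hp0 : 0 ≤ v q ^ 2 / ‖q.1‖ := by positivity
  have k4 : (d - 1) / 4 * v q ^ 2 * (((d - 3) * ‖q.1‖ ^ 2 + d * ρ ^ 2) / s ^ 5) ≤
      ((d : ℝ) ^ 2 / 4 + (d : ℝ) ^ 2 / 4 * ρ ^ 2) * (v q ^ 2 / ‖q.1‖) := by
    have : (d - 1) / 4 * v q ^ 2 * (((d - 3) * ‖q.1‖ ^ 2 + d * ρ ^ 2) / s ^ 5) =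
        ((d - 1) * (d - 3) / 4 * (b ^ 3 * f ^ 2) + (d - 1) * d / 4 * ρ ^ 2 * (b ^ 1 * f ^ 4))
          * (v q ^ 2 / ‖q.1‖) := by rw [hb, hf]; field_simp
    rw [this]
    have m1 := (hm 3 2).2
    have m2 := (hm 1 4).2
    have m3 := (hm 3 2).1
    have m4 := (hm 1 4).1
    refine mul_le_mul_of_nonneg_right (add_le_add ?_ ?_) hp0
    · calc _ ≤ (d - 1) * (d - 3) / 4 * (1 : ℝ) :=
          mul_le_mul_of_nonneg_left m1 (by
            have := mul_nonneg (by linarith : (0 : ℝ) ≤ d - 1) (by linarith : (0 : ℝ) ≤ d - 3); linarith)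
        _ ≤ _ := by nlinarith
    · calc _ ≤ (d - 1) * d / 4 * ρ ^ 2 * (1 : ℝ) :=
          mul_le_mul_of_nonneg_left m2 (by
            have := mul_nonneg (by linarith : (0 : ℝ) ≤ d - 1) (by linarith : (0 : ℝ) ≤ d)
            positivity)
        _ ≤ _ := by
          rw [mul_one]
          apply mul_le_mul_of_nonneg_right _ (sq_nonneg ρ)
          nlinarith
  have k5 : v q ^ 2 * ‖q.1‖ / (2 * s ^ 3) ≤ 1 / 2 * (v q ^ 2 / ‖q.1‖) := by
    have : v q ^ 2 * ‖q.1‖ / (2 * s ^ 3) = 1 / 2 * (b ^ 2 * f ^ 1) * (v q ^ 2 / ‖q.1‖) := by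
      rw [hb, hf]; field_simp
    rw [this]
    refine mul_le_mul_of_nonneg_right ?_ hp0
    have := (hm 2 1).2
    linarith
  have k6 := mul_le_mul_of_nonneg_left hp (by positivity : 0 ≤ (d : ℝ) ^ 2 / 4 + (d : ℝ) ^ 2 / 4 * ρ ^ 2)
  have k7 := en_nonneg v q
  have k8 : 0 ≤ (d : ℝ) ^ 2 * en v q := by positivity
  have k9 : 0 ≤ (d : ℝ) ^ 2 * ρ ^ 2 * en v q := by positivity
  nlinarith

lemma meas_hI {κ : Spc d × ℝ → ℝ} (hv : Measurable v) (hk : Measurable κ) : Measurable (hI v κ) := by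
  unfold hI ra; fun_prop

lemma meas_good (hv : Measurable v) (hρ : 1 ≤ ρ) : Measurable (good v ρ) := by
  have hρ0 : 0 < ρ := by linarith
  exact ((meas_hI hv (rad_wt hρ0 _ _).meas).add (meas_hI hv (rad_wtr hρ0 _ _).meas)).sub
    (meas_bulk hv (rad_wt hρ0 _ _).meas (rad_wt hρ0 _ _).meas)

lemma int_good (hv : IsW0 v) (hρ : 1 ≤ ρ) (t0 t1 : ℝ) : Integrable (good v ρ) (slab d t0 t1) := by
  refine ((hv.int_slab t0 t1).const_mul (4 + (d : ℝ) ^ 2 + (d : ℝ) ^ 2 * ρ ^ 2)).mono'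
    (meas_good hv.meas hρ).aestronglyMeasurable ?_
  filter_upwards [slab_ae_Om t0 t1] with q hq
  rw [Real.norm_eq_abs, abs_of_nonneg (good_nonneg hρ v hq)]
  exact good_le hρ v hq

/-- The momentum density for the Morawetz multiplier. -/
noncomputable def qm (v : Spc d × ℝ → ℝ) (ρ : ℝ) : Spc d × ℝ → ℝ :=
  qM v (wt d ρ 1 1) (wt d ρ ((d - 1) / 2) 1)

lemma int_qm (hv : IsW0 v) (hρ : 1 ≤ ρ) (t : ℝ) : Integrable fun x => qm v ρ (x, t) :=
  (MW_mor hρ t t).int_qM hv ⟨le_rfl, le_rfl⟩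

/-- The Morawetz identity. -/
lemma morawetz (hv : IsW0 v) (hρ : 1 ≤ ρ) {t0 t1 : ℝ} (h01 : t0 ≤ t1) :
    ∫ q, good v ρ q ∂slab d t0 t1 = (∫ x, qm v ρ (x, t0)) - ∫ x, qm v ρ (x, t1) := by
  obtain ⟨h1, h2⟩ := M_full hv (MW_mor hρ t0 t1) h01
  have h3 := int_good hv hρ t0 t1
  set H : Spc d × ℝ → ℝ := fun q => hI v (wt d ρ ((d - 1) / 4) 3) q + hI v (wtr d ρ (-(1 / 2)) 1) q with hH
  have hHi : Integrable H (slab d t0 t1) := by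
    refine (h3.add h1).congr (Eventually.of_forall fun q => ?_)
    simp only [Pi.add_apply, good, hH]; ring
  have h4 : ∫ q, H q ∂slab d t0 t1 = 0 := by
    refine slab_zero h01 hHi fun t _ => ?_
    obtain ⟨a1, a2⟩ := hI_wt hv hρ ((d - 1) / 4) 3 (by norm_num) t
    obtain ⟨b1, b2⟩ := hI_wtr hv hρ (-(1 / 2)) 1 le_rfl t
    rw [hH, integral_add a1 b1, a2, b2, add_zero]
  have h5 : good v ρ = fun q => H q - bulk v (wt d ρ 1 1) (wt d ρ ((d - 1) / 2) 1) q := by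
    funext q; simp only [good, hH]
  rw [h5, integral_sub hHi h1, h4, ← h2]
  simp only [qm]
  ring

lemma qm_le (hρ : 1 ≤ ρ) (v : Spc d × ℝ → ℝ) {q : Spc d × ℝ} (hq : q ∈ Om d) :
    |qm v ρ q| ≤ d * en v q := by
  have hρ0 : 0 < ρ := by linarith
  have hs := sg_pos hρ0 ‖q.1‖
  have hr := norm_pos_Om hq
  have hd := three_le d
  have e := sg_sq ρ ‖q.1‖
  simp only [qm, qM, wt, pow_one, one_mul]
  have h1 : |Dt v q * (Dr v q / sg ρ ‖q.1‖)| ≤ (Dt v q ^ 2 + Ns v q) / 2 := by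
    refine (abs_mul_le_half _ _).trans ?_
    have : (Dr v q / sg ρ ‖q.1‖) ^ 2 ≤ Ns v q := by
      rw [div_pow, div_le_iff₀ (by positivity)]
      have := Dr_sq_le v q
      have h0 := Ns_nonneg v q
      have : ‖q.1‖ ^ 2 * Ns v q ≤ sg ρ ‖q.1‖ ^ 2 * Ns v q := by
        rw [e]; nlinarith [mul_nonneg (sq_nonneg ρ) h0]
      linarith
    linarith
  have h2 : |Dt v q * (v q / sg ρ ‖q.1‖)| ≤ (Dt v q ^ 2 + v q ^ 2 / ‖q.1‖) / 2 := by
    refine (abs_mul_le_half _ _).trans ?_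
    have : (v q / sg ρ ‖q.1‖) ^ 2 ≤ v q ^ 2 / ‖q.1‖ := by
      rw [div_pow, e]
      apply div_le_div_of_nonneg_left (sq_nonneg _) hr
      nlinarith [sq_nonneg (‖q.1‖ - 1)]
    linarith
  have h3 : en v q = 1 / 2 * Ns v q + 1 / 2 * Dt v q ^ 2 + v q ^ 2 / (2 * ‖q.1‖) := by
    rw [en]
  have h4 : v q ^ 2 / (2 * ‖q.1‖) = (v q ^ 2 / ‖q.1‖) / 2 := by field_simp
  have h5 : Dt v q * (1 / sg ρ ‖q.1‖ * Dr v q + (d - 1) / 2 * (1 / sg ρ ‖q.1‖) * v q) =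
      Dt v q * (Dr v q / sg ρ ‖q.1‖) + (d - 1) / 2 * (Dt v q * (v q / sg ρ ‖q.1‖)) := by ring
  rw [h5]
  have h6 : |(d - 1) / 2 * (Dt v q * (v q / sg ρ ‖q.1‖))| ≤ (d - 1) / 2 * ((Dt v q ^ 2 + v q ^ 2 / ‖q.1‖) / 2) := by
    rw [abs_mul, abs_of_nonneg (by linarith : (0 : ℝ) ≤ (d - 1) / 2)]
    exact mul_le_mul_of_nonneg_left h2 (by linarith)
  refine (abs_add_le _ _).trans ((add_le_add h1 h6).trans ?_)
  rw [h3, h4]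
  have := Ns_nonneg v q
  have : 0 ≤ v q ^ 2 / ‖q.1‖ := by positivity
  nlinarith [sq_nonneg (Dt v q)]

lemma abs_int_qm_le (hv : IsW0 v) (hρ : 1 ≤ ρ) (t : ℝ) : |∫ x, qm v ρ (x, t)| ≤ d * Eg v t := by
  rw [Eg, ← integral_const_mul]
  refine (abs_integral_le_integral_abs).trans (integral_mono_ae (int_qm hv hρ t).abs
    ((hv.int t).const_mul _) ?_)
  filter_upwards [ae_ne] with x hx
  exact qm_le hρ v (mem_Om.2 hx)

lemma ld_pt (v : Spc d × ℝ → ℝ) {q : Spc d × ℝ} (hq : q ∈ Om d) :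
    en v q / sg 1 ‖q.1‖ ^ 5 ≤ 2 * good v 1 q + 1 / 4 * hI v (wtr d 1 1 5) q := by
  have hs := sg_pos one_pos ‖q.1‖
  have hr := norm_pos_Om hq
  have hd := three_le d
  have e := sg_sq 1 ‖q.1‖
  have hg := good_ge le_rfl v hq
  have hP := abs_Dr_le v q
  set p := √(Ns v q) with hp
  have hpp : p ^ 2 = Ns v q := Real.sq_sqrt (Ns_nonneg v q)
  have hs1 : 1 ≤ sg 1 ‖q.1‖ := le_sg' _ _
  set r := ‖q.1‖ with hrd
  set s := sg 1 r with hsd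
  have k1 : hI v (wtr d 1 1 5) q = 2 * v q * Dr v q / (r * s ^ 5)
      + v q ^ 2 * ((d - 1) / (r * s ^ 5) - 5 * r / s ^ 7) := by
    simp only [hI, ra_wtr one_pos _ _ hq]
    simp only [wtr, ← hrd, ← hsd]
    push_cast; field_simp; ring
  have k2 : -(v q ^ 2 + p ^ 2) / s ^ 5 ≤ 2 * v q * Dr v q / (r * s ^ 5) := by
    rw [div_le_div_iff₀ (by positivity) (by positivity)]
    have : -(v q ^ 2 + p ^ 2) * r ≤ 2 * v q * Dr v q := by
      have h1 : |v q * Dr v q| ≤ |v q| * (r * p) := by rw [abs_mul]; gcongr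
      have h2 := neg_abs_le (v q * Dr v q)
      nlinarith [sq_nonneg (|v q| - p), sq_abs (v q), mul_nonneg hr.le (sq_nonneg (|v q| - p))]
    calc _ = -(v q ^ 2 + p ^ 2) * r * s ^ 5 := by ring
      _ ≤ _ := mul_le_mul_of_nonneg_right this (by positivity)
  have k3 : 5 * r / s ^ 7 ≤ 5 / 2 / s ^ 5 := by
    rw [div_le_div_iff₀ (by positivity) (by positivity)]
    have : 5 * r ≤ 5 / 2 * s ^ 2 := by rw [e]; nlinarith [sq_nonneg (r - 1)]
    calc _ ≤ 5 / 2 * s ^ 2 * s ^ 5 := mul_le_mul_of_nonneg_right this (by positivity)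
      _ = _ := by ring
  have k4 : 2 / (r * s ^ 5) ≤ (d - 1) / (r * s ^ 5) := by gcongr; linarith
  have k5 : v q ^ 2 * (2 / (r * s ^ 5) - 5 / 2 / s ^ 5) ≤ v q ^ 2 * ((d - 1) / (r * s ^ 5) - 5 * r / s ^ 7) :=
    mul_le_mul_of_nonneg_left (by linarith) (sq_nonneg _)
  have k6 : (Dt v q ^ 2 + p ^ 2) / (2 * s ^ 5) ≤ 1 ^ 2 / (2 * s ^ 3) * (Dt v q ^ 2 + Ns v q) := by
    rw [← hpp]
    have : (2 * s ^ 3) ≤ 2 * s ^ 5 := by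
      have := pow_le_pow_right₀ hs1 (by norm_num : 3 ≤ 5); linarith
    calc _ ≤ (Dt v q ^ 2 + p ^ 2) / (2 * s ^ 3) := by gcongr
      _ = _ := by ring
  have k7 : 0 ≤ v q ^ 2 * r / (2 * s ^ 3) := by positivity
  have k8 : en v q / s ^ 5 = (Dt v q ^ 2 + p ^ 2) / (2 * s ^ 5) + v q ^ 2 / (2 * r * s ^ 5) := by
    rw [en, ← hrd, ← hpp]; field_simp; ring
  have k9 : 0 ≤ v q ^ 2 / s ^ 5 := by positivity
  have k10 : v q ^ 2 * (2 / (r * s ^ 5) - 5 / 2 / s ^ 5) = 4 * (v q ^ 2 / (2 * r * s ^ 5)) - 5 / 2 * (v q ^ 2 / s ^ 5) := by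
    field_simp; ring
  have k11 : -(v q ^ 2 + p ^ 2) / s ^ 5 = -(v q ^ 2 / s ^ 5) - p ^ 2 / s ^ 5 := by ring
  have k12 : (Dt v q ^ 2 + p ^ 2) / (2 * s ^ 5) = Dt v q ^ 2 / s ^ 5 / 2 + p ^ 2 / s ^ 5 / 2 := by ring
  have k13 : 0 ≤ Dt v q ^ 2 / s ^ 5 := by positivity
  have k14 : 0 ≤ p ^ 2 / s ^ 5 := by positivity
  have k15 : 3 / 2 * 1 ^ 2 * v q ^ 2 / s ^ 5 = 3 / 2 * (v q ^ 2 / s ^ 5) := by ring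
  have k16 : 0 ≤ v q ^ 2 / (2 * r * s ^ 5) := by positivity
  rw [k1]
  linarith

lemma int_hI5 (hv : IsW0 v) (t0 t1 : ℝ) : Integrable (hI v (wtr d 1 1 5)) (slab d t0 t1) := by
  refine ((hv.int_slab t0 t1).const_mul (4 + 2 * (d + 4))).mono'
    (meas_hI hv.meas (rad_wtr one_pos _ _).meas).aestronglyMeasurable ?_
  filter_upwards [slab_ae_Om t0 t1] with q hq
  have hs := sg_pos one_pos ‖q.1‖
  have hr := norm_pos_Om hq
  have hd := three_le d
  have e := sg_sq 1 ‖q.1‖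
  obtain ⟨h1, h2, h3, h4⟩ := ratios le_rfl hr
  have hm := mono_le_one h1 h2 h3 h4
  have hP := abs_Dr_le v q
  set p := √(Ns v q) with hp
  have hpp : p ^ 2 = Ns v q := Real.sq_sqrt (Ns_nonneg v q)
  have hp0 : 0 ≤ p := Real.sqrt_nonneg _
  have k1 : hI v (wtr d 1 1 5) q = 2 * v q * Dr v q / (‖q.1‖ * sg 1 ‖q.1‖ ^ 5)
      + (v q ^ 2 / ‖q.1‖) * ((d - 1) * (1 / sg 1 ‖q.1‖) ^ 5 -
        5 * ((‖q.1‖ / sg 1 ‖q.1‖) ^ 2 * (1 / sg 1 ‖q.1‖) ^ 5)) := by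
    simp only [hI, ra_wtr one_pos _ _ hq]
    simp only [wtr]
    push_cast; field_simp; ring
  have h5 := hm 0 5
  have h6 := hm 2 5
  have h7 := hm 1 4
  set r := ‖q.1‖ with hrd
  set s := sg 1 r with hsd
  rw [pow_zero, one_mul] at h5
  have hpt := pot_le_en v q
  have hN := Ns_le_en v q
  have hX : 0 ≤ v q ^ 2 / r := by positivity
  have k2 : |2 * v q * Dr v q / (r * s ^ 5)| ≤ 4 * en v q := by
    rw [abs_div, abs_of_pos (by positivity : 0 < r * s ^ 5), div_le_iff₀ (by positivity)]
    have h8 : |2 * v q * Dr v q| ≤ 2 * |v q| * (r * p) := by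
      rw [abs_mul, abs_mul, abs_two]; gcongr
    have h9 : 2 * |v q| * p ≤ v q ^ 2 + p ^ 2 := by nlinarith [sq_nonneg (|v q| - p), sq_abs (v q)]
    have h10 : v q ^ 2 ≤ v q ^ 2 / r * s ^ 5 := by
      have : r ≤ s ^ 5 := (le_sg 1 r).trans (le_self_pow₀ (le_sg' _ _) (by norm_num))
      rw [div_mul_eq_mul_div, le_div_iff₀ hr]; gcongr
    have h11 : p ^ 2 ≤ p ^ 2 * s ^ 5 := le_mul_of_one_le_right (sq_nonneg _) (one_le_pow₀ (le_sg' _ _))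
    have h12 : v q ^ 2 / r * s ^ 5 + p ^ 2 * s ^ 5 ≤ 4 * en v q * s ^ 5 := by
      rw [← add_mul]; gcongr; linarith
    nlinarith [mul_le_mul_of_nonneg_left (h9.trans ((add_le_add h10 h11).trans h12)) hr.le]
  rw [Real.norm_eq_abs, k1]
  refine (abs_add_le _ _).trans ?_
  rw [abs_mul, abs_of_nonneg hX]
  have k3 : |(d - 1) * (1 / s) ^ 5 - 5 * ((r / s) ^ 2 * (1 / s) ^ 5)| ≤ (d : ℝ) + 4 := by
    have := mul_le_mul_of_nonneg_left h5.2 (by linarith : (0 : ℝ) ≤ d - 1)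
    have := mul_nonneg (by linarith : (0 : ℝ) ≤ d - 1) h5.1
    rw [abs_le]; constructor <;> linarith
  have k4 := mul_le_mul hpt k3 (abs_nonneg _) (by linarith)
  linarith

/-- Local energy decay. -/
lemma local_decay (hv : IsW0 v) {t0 t1 M : ℝ} (h01 : t0 ≤ t1) (hM : ∀ t, Eg v t ≤ M) :
    Integrable (fun q => en v q / sg 1 ‖q.1‖ ^ 5) (slab d t0 t1) ∧
    ∫ q, en v q / sg 1 ‖q.1‖ ^ 5 ∂slab d t0 t1 ≤ 4 * d * M := by
  have h1 := int_good hv le_rfl t0 t1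
  have h2 := int_hI5 hv t0 t1
  have hi : Integrable (fun q => en v q / sg 1 ‖q.1‖ ^ 5) (slab d t0 t1) := by
    refine (hv.int_slab t0 t1).mono' (((meas_en hv.meas).div (by fun_prop)).aestronglyMeasurable) ?_
    refine Eventually.of_forall fun q => ?_
    have hs := sg_pos one_pos ‖q.1‖
    have := en_nonneg v q
    rw [Real.norm_eq_abs, abs_of_nonneg (by positivity)]
    exact div_le_self this (one_le_pow₀ (le_sg' _ _))
  refine ⟨hi, ?_⟩
  have h3 : ∫ q, hI v (wtr d 1 1 5) q ∂slab d t0 t1 = 0 :=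
    slab_zero h01 h2 fun t _ => (hI_wtr hv le_rfl 1 5 (by norm_num) t).2
  calc _ ≤ ∫ q, (2 * good v 1 q + 1 / 4 * hI v (wtr d 1 1 5) q) ∂slab d t0 t1 := by
        refine integral_mono_ae hi ((h1.const_mul 2).add (h2.const_mul _)) ?_
        filter_upwards [slab_ae_Om t0 t1] with q hq using ld_pt v hq
    _ = 2 * ((∫ x, qm v 1 (x, t0)) - ∫ x, qm v 1 (x, t1)) := by
        rw [integral_add (h1.const_mul 2) (h2.const_mul _), integral_const_mul, integral_const_mul, h3,
          morawetz hv le_rfl h01]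
        ring
    _ ≤ _ := by
        have a1 := abs_le.1 (abs_int_qm_le hv le_rfl t0)
        have a2 := abs_le.1 (abs_int_qm_le hv le_rfl t1)
        have hd := three_le d
        have a3 := mul_le_mul_of_nonneg_left (hM t0) (by linarith : (0 : ℝ) ≤ d)
        have a4 := mul_le_mul_of_nonneg_left (hM t1) (by linarith : (0 : ℝ) ≤ d)
        linarith [a1.2, a2.1]

end Coulomb

namespace Coulomb
open scoped Topology
set_option linter.unusedSectionVars false
variable {d : ℕ} {v w z : Spc d × ℝ → ℝ} [Fact (3 ≤ d)]

/-! ### The ergodic theorem -/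

lemma abs_bi_le (v w : Spc d × ℝ → ℝ) {q : Spc d × ℝ} (hv : DifferentiableAt ℝ v q) (hw : DifferentiableAt ℝ w q)
    {κ : ℝ} (hκ : 0 < κ) : |bi v w q| ≤ κ / 2 * en v q + 1 / (2 * κ) * en w q := by
  have h1 := en_nonneg (w + κ • v) q
  have h2 := en_nonneg (w + (-κ) • v) q
  rw [en_add hw (hv.const_smul _), bi_smul_right, en_smul] at h1 h2
  have e : bi w v q = bi v w q := by
    simp only [bi, mul_comm (w q), mul_comm (Dt w q), mul_comm (Dx _ w q)]
  rw [e] at h1 h2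
  have e2 : κ / 2 * en v q + 1 / (2 * κ) * en w q = (κ ^ 2 * en v q + en w q) / (2 * κ) := by
    field_simp
  rw [e2, abs_le]
  constructor
  · rw [← neg_div, div_le_iff₀ (by positivity)]; linarith
  · rw [le_div_iff₀ (by positivity)]; linarith

lemma bi_conserve (hv : IsW v) (hw : IsW w) (t s : ℝ) : ∫ x, bi v w (x, t) = ∫ x, bi v w (x, s) := by
  have h1 := Eg_add hv.toIsW0 hw.toIsW0 t
  have h2 := Eg_add hv.toIsW0 hw.toIsW0 s
  rw [(hv.add hw).conserve t s, hv.conserve t s, hw.conserve t s] at h1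
  linarith

lemma bi_add_right (hv : IsW0 v) (hw : IsW0 w) (hz : IsW0 z) (t : ℝ) :
    ∫ x, bi v (w + z) (x, t) = (∫ x, bi v w (x, t)) + ∫ x, bi v z (x, t) := by
  rw [← integral_add (int_bi hv hw t).1 (int_bi hv hz t).1]
  refine integral_congr_ae (ae_ne.mono fun x hx => ?_)
  have h1 := hw.diff (mem_Om.2 hx : (x, t) ∈ Om d)
  have h2 := hz.diff (mem_Om.2 hx : (x, t) ∈ Om d)
  simp only [bi, Dx_add h1 h2, Dt_add h1 h2, Pi.add_apply, mul_add, Finset.sum_add_distrib]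
  ring

lemma bi_smul_right' (c : ℝ) (v w : Spc d × ℝ → ℝ) (t : ℝ) :
    ∫ x, bi v (c • w) (x, t) = c * ∫ x, bi v w (x, t) := by
  simp only [bi_smul_right, integral_const_mul]

lemma bi_self (hv : IsW0 v) (t : ℝ) : ∫ x, bi v v (x, t) = Eg v t := by
  have h1 := Eg_add hv hv t
  have h2 : Eg (v + v) t = 4 * Eg v t := by
    rw [← two_smul ℝ v, Eg_smul]; norm_num
  linarith

lemma en_tau (hv : IsW0 v) (s : ℝ) {x : Spc d} (hx : x ≠ 0) (t : ℝ) : en (tau s v) (x, t) = en v (x, t + s) :=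
  act_en (hv := hv.cd1) (hq := mem_Om.2 hx) ..

/-- The sum of the first `N` integer translates. -/
noncomputable def trs (v : Spc d × ℝ → ℝ) (N : ℕ) : Spc d × ℝ → ℝ := ∑ n ∈ Finset.range N, tau n v

lemma trs_succ (v : Spc d × ℝ → ℝ) (N : ℕ) : trs v (N + 1) = trs v N + tau N v := by
  rw [trs, Finset.sum_range_succ, trs]

lemma trs_zero (v : Spc d × ℝ → ℝ) : trs v 0 = (0 : ℝ) • v := by simp [trs]

lemma IsW.trs (hv : IsW v) (N : ℕ) : IsW (trs v N) := by
  induction N with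
  | zero => rw [trs_zero]; exact hv.smul 0
  | succ n ih => rw [trs_succ]; exact ih.add (hv.tau _)

lemma Eg_trs (hv : IsW v) (N : ℕ) (t : ℝ) : √(Eg (trs v N) t) ≤ N * √(Eg v 0) := by
  induction N with
  | zero => rw [trs_zero, Eg_smul]; simp
  | succ n ih =>
    rw [trs_succ]
    refine (Eg_tri (hv.trs n).toIsW0 (hv.tau _).toIsW0 t).trans ?_
    rw [Eg_tau hv.toIsW0, hv.conserve _ 0]
    push_cast; linarith

lemma bi_trs (hw : IsW0 w) (hv : IsW v) (N : ℕ) (t : ℝ) :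
    ∫ x, bi w (trs v N) (x, t) = ∑ n ∈ Finset.range N, ∫ x, bi w (tau n v) (x, t) := by
  induction N with
  | zero => rw [trs_zero, bi_smul_right']; simp
  | succ n ih => rw [trs_succ, bi_add_right hw (hv.trs n).toIsW0 (hv.tau _).toIsW0, ih, Finset.sum_range_succ]

/-- Correlation of a wave with a translate, in terms of local energy at one time. -/
lemma corr_le (hw : IsW0 w) (hv : IsW0 v) {κ M : ℝ} (hκ : 0 < κ) (s n : ℝ) :
    |∫ x, bi w (tau n v) (x, s)| ≤ κ / 2 * sg 1 M ^ 5 * (∫ x, en w (x, s) / sg 1 ‖x‖ ^ 5)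
      + 1 / (2 * κ) * (Eg w s + Eg v (s + n)) + κ / 2 * ∫ x in {x | M ≤ ‖x‖}, en v (x, s + n) := by
  have hS := meas_ext (d := d) M
  have i1 : Integrable fun x => en w (x, s) / sg 1 ‖x‖ ^ 5 := by
    refine (hw.int s).mono' ((slice_meas (meas_en hw.meas) s).div (by fun_prop)).aestronglyMeasurable ?_
    refine Eventually.of_forall fun x => ?_
    have hs := sg_pos one_pos ‖x‖
    have := en_nonneg w (x, s)
    rw [Real.norm_eq_abs, abs_of_nonneg (by positivity)]
    exact div_le_self this (one_le_pow₀ (le_sg' _ _))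
  have i2 : Integrable fun x => en w (x, s) + en v (x, s + n) := (hw.int s).add (hv.int (s + n))
  have i3 := (hv.int (s + n)).indicator hS
  rw [← integral_indicator hS, Eg, Eg, ← integral_add (hw.int s) (hv.int (s + n)), ← integral_const_mul,
    ← integral_const_mul, ← integral_const_mul,
    ← integral_add (i1.const_mul _) (i2.const_mul _)]
  have i4 : Integrable fun x => κ / 2 * sg 1 M ^ 5 * (en w (x, s) / sg 1 ‖x‖ ^ 5) +
    1 / (2 * κ) * (en w (x, s) + en v (x, s + n)) := (i1.const_mul _).add (i2.const_mul _)
  rw [← integral_add i4 (i3.const_mul _)]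
  refine (abs_integral_le_integral_abs).trans (integral_mono_ae (int_bi hw (hv.tau n) s).1.abs
    (i4.add (i3.const_mul _)) ?_)
  filter_upwards [ae_ne] with x hx
  have hq : (x, s) ∈ Om d := mem_Om.2 hx
  have hE := en_tau hv n hx s
  have d1 := hw.diff hq
  have d2 := (hv.tau n).diff hq
  have p1 := en_nonneg w (x, s)
  have p2 := en_nonneg v (x, s + n)
  have hs := sg_pos one_pos ‖x‖
  have hsM := sg_pos one_pos M
  by_cases hxM : x ∈ {x : Spc d | M ≤ ‖x‖}
  · rw [Set.indicator_of_mem hxM]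
    have := abs_bi_le w (tau n v) d1 d2 (inv_pos.2 hκ)
    rw [hE] at this
    refine this.trans ?_
    have e1 : κ⁻¹ / 2 = 1 / (2 * κ) := by field_simp
    have e2 : 1 / (2 * κ⁻¹) = κ / 2 := by field_simp
    rw [e1, e2]
    have : 0 ≤ κ / 2 * sg 1 M ^ 5 * (en w (x, s) / sg 1 ‖x‖ ^ 5) := by positivity
    have : 0 ≤ 1 / (2 * κ) * en v (x, s + n) := by positivity
    linarith
  · rw [Set.indicator_of_notMem hxM]
    have hlt : ‖x‖ < M := not_le.1 hxM
    have := abs_bi_le w (tau n v) d1 d2 hκ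
    rw [hE] at this
    refine this.trans ?_
    have : en w (x, s) ≤ sg 1 M ^ 5 * (en w (x, s) / sg 1 ‖x‖ ^ 5) := by
      rw [← mul_div_assoc, le_div_iff₀ (by positivity), mul_comm]
      have : sg 1 ‖x‖ ≤ sg 1 M := Real.sqrt_le_sqrt (by nlinarith [norm_nonneg x])
      gcongr
    have := mul_le_mul_of_nonneg_left this (by positivity : 0 ≤ κ / 2)
    have : 0 ≤ 1 / (2 * κ) * en w (x, s) := by positivity
    linarith

lemma ergodic (hv : IsW v) {ε : ℝ} (hε : 0 < ε) : ∃ N : ℕ, 1 ≤ N ∧ Eg ((1 / (N : ℝ)) • trs v N) 0 ≤ ε := by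
  set E := Eg v 0 with hE
  have hE0 : 0 ≤ E := Eg_nonneg _ _
  set κ := 4 * (E + 1) / ε with hκ
  have hκ0 : 0 < κ := by positivity
  obtain ⟨R, hR1, hR⟩ := tail hv.toIsW0 (ε := ε / (2 * κ)) (by positivity)
  set M := R + 1 with hM
  set C := κ / 2 * sg 1 M ^ 5 * (4 * d * E) with hC
  obtain ⟨N, hN⟩ := exists_nat_gt (max 1 (2 * C / ε))
  have hN1 : (1 : ℝ) < N := (le_max_left _ _).trans_lt hN
  have hN2 : 2 * C / ε < N := (le_max_right _ _).trans_lt hN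
  refine ⟨N, by exact_mod_cast hN1.le, ?_⟩
  have hN0 : (0 : ℝ) < N := by linarith
  set Y := (1 / (N : ℝ)) • trs v N with hY
  have hYW : IsW Y := (hv.trs N).smul _
  have hYE : ∀ t, Eg Y t ≤ E := fun t => by
    rw [hY, Eg_smul]
    have h := Eg_trs hv N t
    have h2 : Eg (trs v N) t ≤ N ^ 2 * E := by
      have := pow_le_pow_left₀ (Real.sqrt_nonneg _) h 2
      rwa [Real.sq_sqrt (Eg_nonneg _ _), mul_pow, Real.sq_sqrt hE0] at this
    calc (1 / (N : ℝ)) ^ 2 * Eg (trs v N) t ≤ (1 / (N : ℝ)) ^ 2 * (N ^ 2 * E) := by gcongr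
      _ = E := by field_simp
  set f : ℝ → ℝ := fun s => ∫ x, en Y (x, s) / sg 1 ‖x‖ ^ 5 with hf
  set K := E / κ + ε / 4 with hK
  have hb : ∀ n : ℕ, |∫ x, bi Y (tau n v) (x, 0)| ≤
      κ / 2 * sg 1 M ^ 5 * (∫ s in (-n : ℝ)..(1 - n), f s) + K := fun n => by
    have hp : ∀ s ∈ Set.Icc (-n : ℝ) (1 - n), |∫ x, bi Y (tau n v) (x, 0)| ≤ κ / 2 * sg 1 M ^ 5 * f s + K := by
      intro s hs
      rw [bi_conserve hYW (hv.tau n) 0 s]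
      refine (corr_le (M := M) hYW.toIsW0 hv.toIsW0 hκ0 s n).trans ?_
      have h1 := hYE s
      have h2 : Eg v (s + n) = E := hv.conserve _ _
      have h3 : ∫ x in {x : Spc d | M ≤ ‖x‖}, en v (x, s + n) ≤ ε / (2 * κ) :=
        (ext_anti hv.toIsW0 _ fun x (hx : M ≤ ‖x‖) => by
          show s + n + R ≤ ‖x‖
          linarith [hs.2]).trans (hR (s + n) (by linarith [hs.1]))
      have h4 : κ / 2 * (ε / (2 * κ)) = ε / 4 := by field_simp; norm_num
      have h5 : 1 / (2 * κ) * (E + E) = E / κ := by field_simp; ring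
      have h6 := mul_le_mul_of_nonneg_left h3 (by positivity : 0 ≤ κ / 2)
      have h7 : 1 / (2 * κ) * (Eg Y s + Eg v (s + n)) ≤ 1 / (2 * κ) * (E + E) := by rw [h2]; gcongr
      simp only [hf]
      linarith
    have hfi : IntervalIntegrable f volume (-n : ℝ) (1 - n) := by
      have h := (local_decay hYW.toIsW0 (t0 := -n) (t1 := 1 - n) (by linarith) hYE).1
      rw [intervalIntegrable_iff_integrableOn_Ioc_of_le (by linarith)]
      rw [slab] at h
      exact h.integral_prod_right
    have := intervalIntegral.integral_mono_on (by linarith : (-n : ℝ) ≤ 1 - n)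
      (_root_.intervalIntegrable_const) ((hfi.const_mul (κ / 2 * sg 1 M ^ 5)).add
        (_root_.intervalIntegrable_const (c := K))) hp
    rw [intervalIntegral.integral_add (hfi.const_mul _) _root_.intervalIntegrable_const,
      intervalIntegral.integral_const_mul] at this
    simpa using this
  have hfi : ∀ a b, IntervalIntegrable f volume a b := fun a b => by
    rcases le_total a b with h | h
    · have h' := (local_decay hYW.toIsW0 h hYE).1
      rw [intervalIntegrable_iff_integrableOn_Ioc_of_le h]
      rw [slab] at h'
      exact h'.integral_prod_right
    · have h' := (local_decay hYW.toIsW0 h hYE).1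
      refine IntervalIntegrable.symm ?_
      rw [intervalIntegrable_iff_integrableOn_Ioc_of_le h]
      rw [slab] at h'
      exact h'.integral_prod_right
  have hsum : ∑ n ∈ Finset.range N, ∫ s in (-n : ℝ)..(1 - n), f s = ∫ s in (-N + 1 : ℝ)..1, f s := by
    have := intervalIntegral.sum_integral_adjacent_intervals (μ := volume) (f := f) (a := fun k : ℕ => (1 - k : ℝ)) (n := N)
      (fun k _ => hfi _ _)
    rw [intervalIntegral.integral_symm, show (-N + 1 : ℝ) = 1 - N by ring]
    simp only [Nat.cast_zero, sub_zero] at this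
    rw [← this, ← Finset.sum_neg_distrib]
    refine Finset.sum_congr rfl fun n _ => ?_
    rw [← intervalIntegral.integral_symm]
    push_cast
    congr 1; ring
  have hld : ∫ s in (-N + 1 : ℝ)..1, f s ≤ 4 * d * E := by
    obtain ⟨h1, h2⟩ := local_decay hYW.toIsW0 (t0 := -N + 1) (t1 := 1) (by linarith) hYE
    rwa [slab_fubini (by linarith) h1] at h2
  have hmain : Eg Y 0 ≤ 1 / N * (C + N * K) := by
    rw [← bi_self hYW.toIsW0]
    conv_lhs => rw [show bi Y Y = bi Y ((1 / (N : ℝ)) • trs v N) from rfl]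
    rw [bi_smul_right', bi_trs hYW.toIsW0 hv]
    refine mul_le_mul_of_nonneg_left ?_ (by positivity)
    calc _ ≤ ∑ n ∈ Finset.range N, (κ / 2 * sg 1 M ^ 5 * (∫ s in (-n : ℝ)..(1 - n), f s) + K) :=
          Finset.sum_le_sum fun n _ => (le_abs_self _).trans (hb n)
      _ = κ / 2 * sg 1 M ^ 5 * (∫ s in (-N + 1 : ℝ)..1, f s) + N * K := by
          rw [Finset.sum_add_distrib, ← Finset.mul_sum, hsum]; simp
      _ ≤ _ := by
          have := sg_pos one_pos M
          rw [hC]; gcongr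
  refine hmain.trans ?_
  have e1 : 1 / (N : ℝ) * (C + N * K) = C / N + K := by field_simp
  rw [e1]
  have h1 : C / N ≤ ε / 2 := by
    rw [div_le_iff₀ hN0]; rw [div_lt_iff₀ hε] at hN2; linarith
  have h2 : E / κ ≤ ε / 4 := by
    rw [hκ, div_le_iff₀ (by positivity)]
    have : ε / 4 * (4 * (E + 1) / ε) = E + 1 := by field_simp
    linarith
  linarith

/-! ### Waves bounded in `L²` -/

/-- `v` is bounded in `L²` uniformly in time. -/
def L2b (v : Spc d × ℝ → ℝ) (A : ℝ) : Prop :=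
  ∀ t, Integrable (fun x => v (x, t) ^ 2) ∧ ∫ x, v (x, t) ^ 2 ≤ A

lemma L2b.add {A B : ℝ} (hv : L2b v A) (hw : L2b w B) (h1 : Measurable v) (h2 : Measurable w) :
    L2b (v + w) (2 * A + 2 * B) := fun t => by
  have i := ((hv t).1.const_mul 2).add ((hw t).1.const_mul 2)
  have hp : ∀ x, (v + w) (x, t) ^ 2 ≤ 2 * v (x, t) ^ 2 + 2 * w (x, t) ^ 2 := fun x => by
    simp only [Pi.add_apply]; nlinarith [sq_nonneg (v (x, t) - w (x, t))]
  have i2 : Integrable fun x => (v + w) (x, t) ^ 2 :=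
    i.mono' ((slice_meas (h1.add h2) t).pow_const 2).aestronglyMeasurable
      (Eventually.of_forall fun x => by
        rw [Real.norm_eq_abs, abs_of_nonneg (sq_nonneg _)]; exact hp x)
  refine ⟨i2, (integral_mono i2 i hp).trans ?_⟩
  have := integral_add ((hv t).1.const_mul 2) ((hw t).1.const_mul 2)
  simp only [Pi.add_apply] at this ⊢
  rw [this, integral_const_mul, integral_const_mul]
  linarith [(hv t).2, (hw t).2]

lemma L2b.smul {A : ℝ} (hv : L2b v A) (c : ℝ) : L2b (c • v) (c ^ 2 * A) := fun t => by
  have e : (fun x => (c • v) (x, t) ^ 2) = fun x => c ^ 2 * v (x, t) ^ 2 := by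
    funext x; simp [mul_pow]
  rw [e, integral_const_mul]
  exact ⟨(hv t).1.const_mul _, mul_le_mul_of_nonneg_left (hv t).2 (sq_nonneg c)⟩

lemma L2b_sub_tau (hv : IsW v) {s : ℝ} (hs : s ≠ 0) : L2b (v - tau s v) (s ^ 2 * (2 * Eg v 0)) := fun t => by
  have hA := (hv.A s).toIsW0
  have hp : ∀ x, x ≠ 0 → (v - tau s v) (x, t) ^ 2 = s ^ 2 * Dt (A s v) (x, t) ^ 2 := fun x hx => by
    rw [A_Dt hv.toIsW0 hs hx, Pi.sub_apply, tau_apply, div_pow]; field_simp; ring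
  have hle : ∀ x, x ≠ 0 → (v - tau s v) (x, t) ^ 2 ≤ s ^ 2 * (2 * en (A s v) (x, t)) := fun x hx => by
    rw [hp x hx]; exact mul_le_mul_of_nonneg_left (Dt_sq_le_en _ _) (sq_nonneg _)
  have i1 := ((hA.int t).const_mul 2).const_mul (s ^ 2)
  have i2 : Integrable fun x => (v - tau s v) (x, t) ^ 2 :=
    i1.mono' ((slice_meas (hv.meas.sub (hv.tau s).meas) t).pow_const 2).aestronglyMeasurable
      (ae_ne.mono fun x hx => by
        rw [Real.norm_eq_abs, abs_of_nonneg (sq_nonneg _)]; exact hle x hx)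
  refine ⟨i2, (integral_mono_ae i2 i1 (ae_ne.mono hle)).trans ?_⟩
  simp only [integral_const_mul]
  exact mul_le_mul_of_nonneg_left (mul_le_mul_of_nonneg_left (Eg_A_le hv s t) (by norm_num)) (sq_nonneg _)

lemma L2b_trs (hv : IsW v) (N : ℕ) : ∃ A, L2b ((N : ℝ) • v - trs v N) A := by
  induction N with
  | zero =>
    refine ⟨0, fun t => ?_⟩
    rw [trs_zero]; simp
  | succ n ih =>
    obtain ⟨A, hA⟩ := ih
    have h2 : ∃ B, L2b (v - tau n v) B := by
      rcases Nat.eq_zero_or_pos n with rfl | hn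
      · refine ⟨0, fun t => ?_⟩
        simp [tau_zero]
      · exact ⟨_, L2b_sub_tau hv (by exact_mod_cast hn.ne')⟩
    obtain ⟨B, hB⟩ := h2
    refine ⟨2 * A + 2 * B, ?_⟩
    have e : ((n + 1 : ℕ) : ℝ) • v - trs v (n + 1) = ((n : ℝ) • v - trs v n) + (v - tau n v) := by
      rw [trs_succ]; push_cast; rw [add_smul, one_smul]; abel
    rw [e]
    exact hA.add hB ((hv.meas.const_smul _).sub (hv.trs n).meas) (hv.meas.sub (hv.tau _).meas)

lemma approx_L2 (hv : IsW v) {ε : ℝ} (hε : 0 < ε) : ∃ w A, IsW w ∧ Eg (v - w) 0 ≤ ε ∧ L2b w A := by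
  obtain ⟨N, hN1, hN⟩ := ergodic hv hε
  obtain ⟨A, hA⟩ := L2b_trs hv N
  have hN0 : (N : ℝ) ≠ 0 := by positivity
  have e : v - (1 / (N : ℝ)) • trs v N = (1 / (N : ℝ)) • ((N : ℝ) • v - trs v N) := by
    rw [smul_sub, smul_smul, one_div_mul_cancel hN0, one_smul]
  refine ⟨v - (1 / (N : ℝ)) • trs v N, _, hv.sub ((hv.trs N).smul _), ?_, e ▸ hA.smul _⟩
  rwa [sub_sub_cancel]

end Coulomb

namespace Coulomb
open scoped Topology
set_option linter.unusedSectionVars false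
variable {d : ℕ} {v w : Spc d × ℝ → ℝ}

/-! ### Averages over rotations -/

/-- The orthogonal group of `ℝ^d`. -/
abbrev Rot (d : ℕ) : Type := unitary (Spc d →L[ℝ] Spc d)

instance : ContinuousStar (Spc d →L[ℝ] Spc d) :=
  ⟨(ContinuousLinearMap.adjoint (𝕜 := ℝ) (E := Spc d) (F := Spc d)).continuous⟩

instance : IsTopologicalGroup (Rot d) := inferInstance

lemma norm_rot_le (g : Rot d) : ‖(g : Spc d →L[ℝ] Spc d)‖ ≤ 1 :=
  ContinuousLinearMap.opNorm_le_bound _ zero_le_one fun x => by rw [Unitary.norm_map, one_mul]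

instance : CompactSpace (Rot d) := by
  refine isCompact_iff_compactSpace.1 ?_
  refine Metric.isCompact_of_isClosed_isBounded (isClosed_unitary) ?_
  refine (Metric.isBounded_closedBall (x := (0 : Spc d →L[ℝ] Spc d)) (r := 1)).subset fun g hg => ?_
  rw [mem_closedBall_zero_iff]
  exact norm_rot_le ⟨g, hg⟩

instance : SecondCountableTopology (Rot d) := inferInstance

noncomputable abbrev haarRot (d : ℕ) : Measure (Rot d) := Measure.haarMeasure ⊤

instance : IsProbabilityMeasure (haarRot d) :=
  ⟨by
    have := Measure.haarMeasure_self (K₀ := (⊤ : TopologicalSpace.PositiveCompacts (Rot d)))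
    simpa using this⟩

noncomputable def rotL (g : Rot d) : Spc d ≃ₗᵢ[ℝ] Spc d := Unitary.linearIsometryEquiv g⁻¹

lemma rotL_apply (g : Rot d) (x : Spc d) : rotL g x = ((g⁻¹ : Rot d) : Spc d →L[ℝ] Spc d) x := rfl

lemma rotL_cont : Continuous fun g : Rot d => toC (rotL g) := by
  have : (fun g : Rot d => toC (rotL g)) = fun g : Rot d => ((g⁻¹ : Rot d) : Spc d →L[ℝ] Spc d) := rfl
  rw [this]
  exact continuous_subtype_val.comp continuous_inv

/-- A Lipschitz bump at the identity. -/
noncomputable def bump (δ : ℝ) (g : Rot d) : ℝ := max 0 (1 - ‖(g : Spc d →L[ℝ] Spc d) - 1‖ / δ)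

lemma bump_nonneg (δ : ℝ) (g : Rot d) : 0 ≤ bump δ g := le_max_left _ _

lemma bump_cont (δ : ℝ) : Continuous (bump δ : Rot d → ℝ) := by unfold bump; fun_prop

lemma bump_supp {δ : ℝ} (hδ : 0 < δ) {g : Rot d} (h : bump δ g ≠ 0) : ‖(g : Spc d →L[ℝ] Spc d) - 1‖ < δ := by
  by_contra! h2
  refine h (max_eq_left ?_)
  have := (one_le_div hδ).2 h2
  linarith

lemma bump_lip {δ : ℝ} (hδ : 0 < δ) (h g : Rot d) :
    |bump δ (h * g) - bump δ g| ≤ ‖(h : Spc d →L[ℝ] Spc d) - 1‖ / δ := by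
  have h1 := abs_max_sub_max_le_abs (1 - ‖((h * g : Rot d) : Spc d →L[ℝ] Spc d) - 1‖ / δ)
    (1 - ‖(g : Spc d →L[ℝ] Spc d) - 1‖ / δ) 0
  rw [max_comm, max_comm _ (0 : ℝ)] at h1
  refine h1.trans ?_
  have e : (1 - ‖((h * g : Rot d) : Spc d →L[ℝ] Spc d) - 1‖ / δ) - (1 - ‖(g : Spc d →L[ℝ] Spc d) - 1‖ / δ)
      = (‖(g : Spc d →L[ℝ] Spc d) - 1‖ - ‖((h * g : Rot d) : Spc d →L[ℝ] Spc d) - 1‖) / δ := by ring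
  rw [e, abs_div, abs_of_pos hδ]
  gcongr
  refine (abs_norm_sub_norm_le _ _).trans ?_
  have e2 : (g : Spc d →L[ℝ] Spc d) - 1 - (((h * g : Rot d) : Spc d →L[ℝ] Spc d) - 1)
      = - (((h : Spc d →L[ℝ] Spc d) - 1) * (g : Spc d →L[ℝ] Spc d)) := by
    rw [sub_mul, one_mul]; simp
  rw [e2, norm_neg]
  refine (norm_mul_le _ _).trans ?_
  exact mul_le_of_le_one_right (norm_nonneg _) (norm_rot_le g)

noncomputable def bumpZ (d : ℕ) (δ : ℝ) : ℝ := ∫ g, bump δ g ∂(haarRot d)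

lemma bumpZ_pos (δ : ℝ) : 0 < bumpZ d δ := by
  refine (bump_cont δ).integral_pos_of_hasCompactSupport_nonneg_nonzero
    (HasCompactSupport.of_compactSpace _) (bump_nonneg δ) (x := 1) ?_
  simp [bump]

noncomputable def rotK (d : ℕ) (δ : ℝ) : Measure (Rot d) :=
  (haarRot d).withDensity fun g => ENNReal.ofReal (bump δ g / bumpZ d δ)

lemma rotK_meas (δ : ℝ) : Measurable fun g : Rot d => ENNReal.ofReal (bump δ g / bumpZ d δ) :=
  ((bump_cont δ).measurable.div_const _).ennreal_ofReal

instance (δ : ℝ) : IsProbabilityMeasure (rotK d δ) := by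
  refine isProbabilityMeasure_iff.2 ?_
  rw [rotK, withDensity_apply _ MeasurableSet.univ, Measure.restrict_univ,
    ← ofReal_integral_eq_lintegral_ofReal (compact_int ((bump_cont δ).div_const _))
      (Eventually.of_forall fun g => div_nonneg (bump_nonneg _ _) (bumpZ_pos δ).le),
    integral_div, ← bumpZ, div_self (bumpZ_pos δ).ne', ENNReal.ofReal_one]

lemma integral_rotK (δ : ℝ) (f : Rot d → ℝ) :
    ∫ g, f g ∂(rotK d δ) = ∫ g, bump δ g / bumpZ d δ * f g ∂(haarRot d) := by
  rw [rotK, integral_withDensity_eq_integral_toReal_smul (rotK_meas δ)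
    (Eventually.of_forall fun _ => ENNReal.ofReal_lt_top)]
  refine integral_congr_ae (Eventually.of_forall fun g => ?_)
  simp only [smul_eq_mul]
  rw [ENNReal.toReal_ofReal (div_nonneg (bump_nonneg _ _) (bumpZ_pos δ).le)]

lemma ae_rotK {δ : ℝ} (hδ : 0 < δ) : ∀ᵐ g : Rot d ∂(rotK d δ), ‖(g : Spc d →L[ℝ] Spc d) - 1‖ < δ := by
  refine (ae_withDensity_iff (rotK_meas δ)).2 ?_
  refine Eventually.of_forall fun g hg => bump_supp hδ fun h => hg ?_
  simp [h]

/-- Rotational smoothing of a wave. -/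
noncomputable def rotAvg (δ : ℝ) (v : Spc d × ℝ → ℝ) : Spc d × ℝ → ℝ :=
  avg (rotK d δ) fun g => act (rotL g) 0 v

section
variable [Fact (3 ≤ d)]

lemma IsW.rotAvg (hv : IsW v) (δ : ℝ) : IsW (rotAvg δ v) := hv.avg rotL_cont continuous_const

lemma rotAvg_close (hv : IsW v) {ε : ℝ} (hε : 0 < ε) : ∃ δ > 0, Eg (Coulomb.rotAvg δ v - v) 0 ≤ ε := by
  have hF : Fam fun g : Rot d => act (rotL g) 0 v := fam_act hv.cd hv.cont rotL_cont continuous_const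
  have e1 : act (rotL (1 : Rot d)) 0 v = v := by
    funext q
    obtain ⟨x, t⟩ := q
    simp [act, phi, rotL_apply]
  have ht : Tendsto (fun g : Rot d => Eg (act (rotL g) 0 v - v) 0) (𝓝 1) (𝓝 0) := by
    refine scheffe (fun g => hv.toIsW0.act _ _) hv.toIsW0 0 (fun x hx => ?_) (fun x hx => ?_) ?_
    · have := (fam_cont_en (hF.sub (fam_const hv.toIsW0)) (mem_Om.2 hx : (x, (0 : ℝ)) ∈ Om d)).tendsto 1
      simp only [e1, sub_self, en_zero] at this
      exact this
    · have := (fam_cont_en hF (mem_Om.2 hx : (x, (0 : ℝ)) ∈ Om d)).tendsto 1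
      simp only [e1] at this
      exact this
    · simp only [Eg_act hv.toIsW0, add_zero]; exact tendsto_const_nhds
  obtain ⟨δ, hδ, h⟩ := Metric.eventually_nhds_iff.1 (ht.eventually (gt_mem_nhds hε))
  have hC : ∀ᵐ g : Rot d ∂(rotK d δ), Eg (act (rotL g) 0 v - v) 0 ≤ ε := (ae_rotK hδ).mono fun g hg => by
    have : dist g 1 < δ := by rw [Subtype.dist_eq, dist_eq_norm]; exact hg
    exact (h this).le
  exact ⟨δ, hδ, avg_close hF (fun g => hv.toIsW0.act _ _) hv.toIsW0 hC⟩

end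

section
variable {ν : Measure (Rot d)} [IsProbabilityMeasure ν]

lemma sq_avg_rot (hv : Continuous v) {t : ℝ} (hi : Integrable fun x => v (x, t) ^ 2) :
    Integrable (fun x => ∫ g, v (rotL g x, t) ^ 2 ∂ν) ∧
      ∫ x, (∫ g, v (rotL g x, t) ^ 2 ∂ν) = ∫ x, v (x, t) ^ 2 := by
  have hc : Continuous fun p : Spc d × Rot d => v (rotL p.2 p.1, t) ^ 2 := by
    have : Continuous fun p : Spc d × Rot d => toC (rotL p.2) p.1 :=
      (rotL_cont.comp continuous_snd).clm_apply continuous_fst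
    exact (hv.comp (this.prodMk continuous_const)).pow 2
  have hg : ∀ g : Rot d, Integrable (fun x => v (rotL g x, t) ^ 2) ∧
      ∫ x, v (rotL g x, t) ^ 2 = ∫ x, v (x, t) ^ 2 := fun g =>
    ⟨((rotL g).measurePreserving.integrable_comp_emb (rotL g).toMeasurableEquiv.measurableEmbedding).2 hi,
      (rotL g).measurePreserving.integral_comp (rotL g).toMeasurableEquiv.measurableEmbedding
        (fun x => v (x, t) ^ 2)⟩
  have hI : Integrable (fun p : Spc d × Rot d => v (rotL p.2 p.1, t) ^ 2) (volume.prod ν) := by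
    rw [integrable_prod_iff' hc.aestronglyMeasurable]
    refine ⟨Eventually.of_forall fun g => (hg g).1, ?_⟩
    have : ∀ g : Rot d, ∫ x, ‖v (rotL g x, t) ^ 2‖ = ∫ x, v (x, t) ^ 2 := fun g => by
      rw [← (hg g).2]
      refine integral_congr_ae (Eventually.of_forall fun x => ?_)
      exact Real.norm_of_nonneg (sq_nonneg _)
    simp only [this]
    exact integrable_const _
  refine ⟨hI.integral_prod_left, ?_⟩
  rw [integral_integral_swap hI]
  simp [(hg _).2]

end

lemma rot_slice_cont (hv : Continuous v) (q : Spc d × ℝ) : Continuous fun g : Rot d => v (rotL g q.1, q.2) := by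
  have : Continuous fun g : Rot d => toC (rotL g) q.1 := rotL_cont.clm_apply continuous_const
  exact hv.comp (this.prodMk continuous_const)

lemma rotAvg_apply (δ : ℝ) (x : Spc d) (t : ℝ) :
    rotAvg δ v (x, t) = ∫ g, v (rotL g x, t) ∂(rotK d δ) := by
  simp [rotAvg, avg, act, phi]

lemma L2b.rotAvg [Fact (3 ≤ d)] (hv : IsW v) {A : ℝ} (h : L2b v A) (δ : ℝ) : L2b (rotAvg δ v) A := fun t => by
  obtain ⟨h1, h2⟩ := sq_avg_rot (ν := rotK d δ) hv.cont (h t).1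
  have hp : ∀ x, Coulomb.rotAvg δ v (x, t) ^ 2 ≤ ∫ g, v (rotL g x, t) ^ 2 ∂(rotK d δ) := fun x => by
    rw [rotAvg_apply]; exact sq_integral_le (rot_slice_cont hv.cont (x, t))
  have i : Integrable fun x => Coulomb.rotAvg δ v (x, t) ^ 2 :=
    h1.mono' ((slice_meas (hv.rotAvg δ).meas t).pow_const 2).aestronglyMeasurable
      (Eventually.of_forall fun x => by
        rw [Real.norm_eq_abs, abs_of_nonneg (sq_nonneg _)]; exact hp x)
  exact ⟨i, (integral_mono i h1 hp).trans (h2.trans_le (h t).2)⟩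

/-- Lipschitz dependence on the rotation variable. -/
lemma rotAvg_lip (hv : Continuous v) {δ : ℝ} (hδ : 0 < δ) (h : Rot d) (x : Spc d) (t : ℝ) :
    |rotAvg δ v ((h : Spc d →L[ℝ] Spc d) x, t) - rotAvg δ v (x, t)| ≤
      ‖(h : Spc d →L[ℝ] Spc d) - 1‖ * (1 / (δ * bumpZ d δ) * ∫ g, |v (rotL g x, t)| ∂(haarRot d)) := by
  have hZ := bumpZ_pos (d := d) δ
  have hc := rot_slice_cont hv (x, t)
  have hb : Continuous fun g : Rot d => bump δ (h * g) := (bump_cont δ).comp (by fun_prop)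
  have e1 : rotAvg δ v ((h : Spc d →L[ℝ] Spc d) x, t) =
      ∫ g, bump δ (h * g) / bumpZ d δ * v (rotL g x, t) ∂(haarRot d) := by
    rw [rotAvg_apply, integral_rotK, ← integral_mul_left_eq_self _ h]
    refine integral_congr_ae (Eventually.of_forall fun g => ?_)
    have : rotL (h * g) ((h : Spc d →L[ℝ] Spc d) x) = rotL g x := by
      rw [rotL_apply, rotL_apply, mul_inv_rev]
      have : ((h⁻¹ : Rot d) : Spc d →L[ℝ] Spc d) ((h : Spc d →L[ℝ] Spc d) x) = x := by
        have := congrArg (fun k : Rot d => (k : Spc d →L[ℝ] Spc d) x) (inv_mul_cancel h)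
        exact this
      show ((g⁻¹ : Rot d) : Spc d →L[ℝ] Spc d) (((h⁻¹ : Rot d) : Spc d →L[ℝ] Spc d) ((h : Spc d →L[ℝ] Spc d) x)) = _
      rw [this]
    simp only [this]
  have i1 : Integrable (fun g => bump δ (h * g) / bumpZ d δ * v (rotL g x, t)) (haarRot d) :=
    compact_int ((hb.div_const _).mul hc)
  have i2 : Integrable (fun g => bump δ g / bumpZ d δ * v (rotL g x, t)) (haarRot d) :=
    compact_int (((bump_cont δ).div_const _).mul hc)
  rw [e1, rotAvg_apply, integral_rotK, ← integral_sub i1 i2, ← mul_assoc, ← integral_const_mul]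
  refine abs_integral_le_integral_abs.trans (integral_mono (i1.sub i2).abs
    ((compact_int hc.abs).const_mul _) fun g => ?_)
  show |bump δ (h * g) / bumpZ d δ * v (rotL g x, t) - bump δ g / bumpZ d δ * v (rotL g x, t)| ≤ _
  rw [← sub_mul, ← sub_div, abs_mul, abs_div, abs_of_pos hZ]
  refine mul_le_mul_of_nonneg_right ?_ (abs_nonneg _)
  calc _ ≤ ‖(h : Spc d →L[ℝ] Spc d) - 1‖ / δ / bumpZ d δ := by
        gcongr; exact bump_lip hδ h g
    _ = _ := by field_simp

lemma abs_fderiv_skew_le {q : Spc d × ℝ} (hv : DifferentiableAt ℝ v q) {J : Spc d →L[ℝ] Spc d}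
    (hJ : star J = -J) {B : ℝ}
    (hB : ∀ h : Rot d, |v ((h : Spc d →L[ℝ] Spc d) q.1, q.2) - v q| ≤ ‖(h : Spc d →L[ℝ] Spc d) - 1‖ * B) :
    |fderiv ℝ v q (J q.1, 0)| ≤ ‖J‖ * B := by
  let +nondep : NormedAlgebra ℚ (Spc d →L[ℝ] Spc d) := .restrictScalars ℚ ℝ _
  have hz : NormedSpace.exp ((0 : ℝ) • J) = 1 := by
    have : (0 : ℝ) • J = 0 := zero_smul ℝ J
    rw [this, NormedSpace.exp_zero]
  have hu : ∀ s : ℝ, NormedSpace.exp (s • J) ∈ unitary (Spc d →L[ℝ] Spc d) := fun s => by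
    refine NormedSpace.exp_mem_unitary_of_mem_skewAdjoint ?_
    rw [skewAdjoint.mem_iff, star_smul, hJ, star_trivial, smul_neg]
  have h1 : HasDerivAt (fun s : ℝ => NormedSpace.exp (s • J)) J 0 := by
    have := hasDerivAt_exp_smul_const (𝕂 := ℝ) J 0
    rwa [hz, one_mul] at this
  have h2 : HasDerivAt (fun s : ℝ => v (NormedSpace.exp (s • J) q.1, q.2)) (fderiv ℝ v q (J q.1, 0)) 0 := by
    have h3 : HasDerivAt (fun s : ℝ => ((NormedSpace.exp (s • J)) q.1, q.2)) (J q.1, (0 : ℝ)) 0 := by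
      have := h1.clm_apply (hasDerivAt_const (0 : ℝ) q.1)
      simp only [map_zero, add_zero] at this
      exact this.prodMk (hasDerivAt_const _ _)
    have h4 : HasFDerivAt v (fderiv ℝ v q) ((NormedSpace.exp ((0 : ℝ) • J)) q.1, q.2) := by
      rw [hz]; exact hv.hasFDerivAt
    exact h4.comp_hasDerivAt (0 : ℝ) h3
  have t1 := (hasDerivAt_iff_tendsto_slope_zero.1 h1).norm.mul_const B
  have t2 := (hasDerivAt_iff_tendsto_slope_zero.1 h2).abs
  refine le_of_tendsto_of_tendsto t2 t1 (Eventually.of_forall fun s => ?_)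
  have := hB ⟨_, hu s⟩
  simp only [zero_add, hz, norm_smul, smul_eq_mul, abs_mul]
  rw [Real.norm_eq_abs, mul_assoc]
  refine mul_le_mul_of_nonneg_left ?_ (abs_nonneg _)
  exact this

lemma ang_pt {q : Spc d × ℝ} (hq : q ∈ Om d) (hv : DifferentiableAt ℝ v q) {B : ℝ}
    (hB : ∀ h : Rot d, |v ((h : Spc d →L[ℝ] Spc d) q.1, q.2) - v q| ≤ ‖(h : Spc d →L[ℝ] Spc d) - 1‖ * B) :
    ‖q.1‖ ^ 2 * Ns v q - Dr v q ^ 2 ≤ 4 * B ^ 2 := by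
  have hr := norm_pos_Om hq
  set x := q.1 with hx
  set g : Spc d →L[ℝ] ℝ := (fderiv ℝ v q).comp (ContinuousLinearMap.inl ℝ (Spc d) ℝ) with hg
  set G : Spc d := (InnerProductSpace.toDual ℝ (Spc d)).symm g with hG
  have hin : ∀ y, inner ℝ G y = fderiv ℝ v q (y, 0) := fun y => by
    rw [hG, InnerProductSpace.toDual_symm_apply]; rfl
  have hN : Ns v q = ‖G‖ ^ 2 := by
    rw [normsq_eq]
    refine Finset.sum_congr rfl fun i _ => ?_
    rw [← inner_bv, hin]; rfl
  have hP : Dr v q = inner ℝ G x := (hin x).symm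
  set P := Dr v q with hPd
  set a := ‖x‖ ^ 2 * Ns v q - P ^ 2 with ha
  set ξ : Spc d := ‖x‖ ^ 2 • G - P • x with hξ
  have hξx : inner ℝ ξ x = 0 := by
    rw [hξ, inner_sub_left, inner_smul_left, inner_smul_left, ← hP, real_inner_self_eq_norm_sq]
    simp; ring
  have hGξ : inner ℝ G ξ = a := by
    rw [hξ, inner_sub_right, inner_smul_right, inner_smul_right, ← hP, real_inner_self_eq_norm_sq, ← hN, ha]
    ring
  have hξn : ‖ξ‖ ^ 2 = ‖x‖ ^ 2 * a := by
    rw [← real_inner_self_eq_norm_sq]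
    nth_rewrite 1 [hξ]
    rw [inner_sub_left, inner_smul_left, inner_smul_left, hGξ, real_inner_comm, hξx]
    simp
  set J : Spc d →L[ℝ] Spc d := (innerSL ℝ x).smulRight ξ - (innerSL ℝ ξ).smulRight x with hJ
  have hJapp : ∀ y, J y = inner ℝ x y • ξ - inner ℝ ξ y • x := fun y => rfl
  have hJs : star J = -J := by
    rw [ContinuousLinearMap.star_eq_adjoint]
    symm
    rw [ContinuousLinearMap.eq_adjoint_iff]
    intro y z
    rw [neg_apply, hJapp, hJapp, inner_neg_left, inner_sub_left, inner_sub_right,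
      inner_smul_left, inner_smul_left, inner_smul_right, inner_smul_right, real_inner_comm x y, real_inner_comm ξ y]
    simp; ring
  have hJn : ‖J‖ ≤ 2 * (‖x‖ * ‖ξ‖) := by
    refine (norm_sub_le _ _).trans ?_
    rw [ContinuousLinearMap.norm_smulRight_apply, ContinuousLinearMap.norm_smulRight_apply, innerSL_apply_norm,
      innerSL_apply_norm]
    linarith
  have hJx : fderiv ℝ v q (J x, 0) = ‖x‖ ^ 2 * a := by
    rw [← hin, hJapp, hξx, zero_smul, sub_zero, inner_smul_right, hGξ, real_inner_self_eq_norm_sq]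
  have hB0 : 0 ≤ ‖J‖ * B := (abs_nonneg _).trans (abs_fderiv_skew_le hv hJs hB)
  have hkey := abs_fderiv_skew_le hv hJs hB
  rw [← hx, hJx] at hkey
  have ha0 : 0 ≤ a := by
    have : 0 ≤ ‖x‖ ^ 2 * a := hξn ▸ sq_nonneg _
    exact nonneg_of_mul_nonneg_right this (by positivity)
  rw [abs_of_nonneg (by positivity)] at hkey
  have h2 : (‖x‖ ^ 2 * a) ^ 2 ≤ (2 * (‖x‖ * ‖ξ‖)) ^ 2 * B ^ 2 := by
    calc (‖x‖ ^ 2 * a) ^ 2 ≤ (‖J‖ * B) ^ 2 := by gcongr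
      _ = ‖J‖ ^ 2 * B ^ 2 := mul_pow _ _ _
      _ ≤ _ := by gcongr
  have e : (2 * (‖x‖ * ‖ξ‖)) ^ 2 * B ^ 2 = ‖x‖ ^ 4 * (a * (4 * B ^ 2)) := by
    rw [mul_pow, mul_pow, hξn]; ring
  rw [e, mul_pow, ← pow_mul] at h2
  have h3 := le_of_mul_le_mul_left h2 (by positivity : 0 < ‖x‖ ^ 4)
  rcases ha0.eq_or_lt with h0 | h0
  · rw [← h0]; positivity
  · rw [sq] at h3; exact le_of_mul_le_mul_left h3 h0

lemma ang_nonneg (v : Spc d × ℝ → ℝ) (q : Spc d × ℝ) : 0 ≤ ‖q.1‖ ^ 2 * Ns v q - Dr v q ^ 2 := by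
  have := Dr_sq_le v q
  linarith

/-- Uniform bound on the angular part of the gradient. -/
def Ang (v : Spc d × ℝ → ℝ) (A : ℝ) : Prop :=
  ∀ t, Integrable (fun x => ‖x‖ ^ 2 * Ns v (x, t) - Dr v (x, t) ^ 2) ∧
    ∫ x, (‖x‖ ^ 2 * Ns v (x, t) - Dr v (x, t) ^ 2) ≤ A

lemma Ang_rotAvg [Fact (3 ≤ d)] (hv : IsW v) {A δ : ℝ} (h : L2b v A) (hδ : 0 < δ) :
    Ang (rotAvg δ v) (4 * (1 / (δ * bumpZ d δ)) ^ 2 * A) := fun t => by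
  have hZ := bumpZ_pos (d := d) δ
  have hW := (hv.rotAvg δ).toIsW0
  set c := 1 / (δ * bumpZ d δ) with hc
  obtain ⟨h1, h2⟩ := sq_avg_rot (ν := haarRot d) hv.cont (h t).1
  have hp : ∀ x, x ≠ 0 → ‖x‖ ^ 2 * Ns (rotAvg δ v) (x, t) - Dr (rotAvg δ v) (x, t) ^ 2
      ≤ 4 * c ^ 2 * ∫ g, v (rotL g x, t) ^ 2 ∂(haarRot d) := fun x hx => by
    have hq : (x, t) ∈ Om d := mem_Om.2 hx
    have hcont := rot_slice_cont hv.cont (x, t)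
    refine (ang_pt hq (hW.diff hq) fun h => rotAvg_lip hv.cont hδ h x t).trans ?_
    have := sq_integral_le (ν := haarRot d) hcont.abs
    simp only [sq_abs] at this
    rw [mul_pow, ← mul_assoc]
    exact mul_le_mul_of_nonneg_left this (by positivity)
  have hm : Measurable fun x : Spc d => ‖x‖ ^ 2 * Ns (rotAvg δ v) (x, t) - Dr (rotAvg δ v) (x, t) ^ 2 := by
    have a1 := slice_meas (meas_Ns (rotAvg δ v)) t
    have a2 := slice_meas (meas_Dr (rotAvg δ v)) t
    fun_prop
  have i := h1.const_mul (4 * c ^ 2)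
  have i2 : Integrable fun x : Spc d => ‖x‖ ^ 2 * Ns (rotAvg δ v) (x, t) - Dr (rotAvg δ v) (x, t) ^ 2 :=
    i.mono' hm.aestronglyMeasurable (ae_ne.mono fun x hx => by
      rw [Real.norm_eq_abs, abs_of_nonneg (ang_nonneg _ (x, t))]; exact hp x hx)
  refine ⟨i2, (integral_mono_ae i2 i (ae_ne.mono hp)).trans ?_⟩
  rw [integral_const_mul, h2]
  exact mul_le_mul_of_nonneg_left (h t).2 (by positivity)

/-- Approximation by waves with uniform `L²` and angular bounds. -/
lemma approx_ang [Fact (3 ≤ d)] (hv : IsW v) {ε : ℝ} (hε : 0 < ε) :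
    ∃ w A, 0 ≤ A ∧ IsW w ∧ Eg (v - w) 0 ≤ ε ∧ L2b w A ∧ Ang w A := by
  obtain ⟨w, A, hw, hE, hA⟩ := approx_L2 hv (ε := ε / 4) (by positivity)
  obtain ⟨δ, hδ, hE2⟩ := rotAvg_close hw (ε := ε / 4) (by positivity)
  have hW := hw.rotAvg δ
  have h1 := hA.rotAvg hw δ
  have h2 := Ang_rotAvg hw hA hδ
  have hA0 : 0 ≤ A := (integral_nonneg fun _ => sq_nonneg _).trans (hA 0).2
  refine ⟨rotAvg δ w, A + 4 * (1 / (δ * bumpZ d δ)) ^ 2 * A, by positivity, hW, ?_, fun t => ⟨(h1 t).1, ?_⟩,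
    fun t => ⟨(h2 t).1, ?_⟩⟩
  · have e : v - rotAvg δ w = (v - w) + (w - rotAvg δ w) := by abel
    rw [e]
    have := Eg_add_le (hv.sub hw).toIsW0 (hw.sub hW).toIsW0 0
    rw [Eg_sub_comm w] at this
    linarith
  · have : 0 ≤ 4 * (1 / (δ * bumpZ d δ)) ^ 2 * A := by positivity
    linarith [(h1 t).2]
  · linarith [(h2 t).2]

end Coulomb

namespace Coulomb
open scoped Topology
set_option linter.unusedSectionVars false
variable {d : ℕ} {v w z : Spc d × ℝ → ℝ} [Fact (3 ≤ d)]

/-! ### Logarithmic decay near the light cone -/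

lemma profile {L S R : ℝ} (hL : L = S + R + 1) (hS : 0 ≤ S) (hR : 0 ≤ R) :
    ∃ (G : ℝ → ℝ) (C : ℝ), ContDiff ℝ 1 G ∧ (∀ s, |G s| ≤ C) ∧ (∀ s, |deriv G s| ≤ C) ∧ (∀ s, 0 ≤ G s) ∧
      (∀ s, G s ≤ L) ∧ (∀ s, 0 ≤ deriv G s) ∧ (∀ s ≤ -(S + 1), G s = 0) ∧
      ∀ s, -S ≤ s → s ≤ R → 1 / 4 ≤ deriv G s := by
  obtain ⟨C, hC0, hC⟩ := th'_bound
  have hLp : 0 < L := by linarith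
  set lam : ℝ → ℝ := fun s => (s + (S + 1)) * th (s + (S + 1)) with hlam
  have l0 : ∀ s, 0 ≤ lam s := fun s => by
    rcases le_total (s + (S + 1)) 0 with h | h
    · simp [hlam, th_zero h]
    · exact mul_nonneg h (th_nonneg _)
  have lcd : ContDiff ℝ 1 lam := by
    have := th_cd1.comp (f := fun s : ℝ => s + (S + 1)) (by fun_prop)
    exact ContDiff.mul (by fun_prop) this
  have lhd : ∀ s, HasDerivAt lam (th (s + (S + 1)) + (s + (S + 1)) * deriv th (s + (S + 1))) s := fun s => by
    have h1 : HasDerivAt (fun s : ℝ => s + (S + 1)) 1 s := (hasDerivAt_id s).add_const _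
    have h2 : HasDerivAt (fun s : ℝ => th (s + (S + 1))) (deriv th (s + (S + 1))) s :=
      (th_hd (s + (S + 1))).comp_add_const s (S + 1)
    exact (h1.mul h2).congr_deriv (by simp)
  have p0 : ∀ y, 0 ≤ y * deriv th y := fun y => by
    rcases lt_or_ge y 0 with h | h
    · simp [th'_neg h]
    · exact mul_nonneg h (th'_nonneg _)
  have p1 : ∀ y, y * deriv th y ≤ C := fun y => by
    rcases lt_or_ge 1 y with h | h
    · simp [th'_gt h, hC0.le]
    · calc y * deriv th y ≤ 1 * deriv th y := mul_le_mul_of_nonneg_right h (th'_nonneg _)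
        _ ≤ C := by rw [one_mul]; exact (le_abs_self _).trans (hC y)
  have hpos : ∀ s, 0 < L + lam s := fun s => by linarith [l0 s]
  have Ghd : ∀ s, HasDerivAt (fun s => L * lam s / (L + lam s))
      (L ^ 2 / (L + lam s) ^ 2 * (th (s + (S + 1)) + (s + (S + 1)) * deriv th (s + (S + 1)))) s := fun s => by
    refine (((lhd s).const_mul L).div ((lhd s).const_add L) (hpos s).ne').congr_deriv ?_
    have := (hpos s).ne'
    field_simp
    ring
  have hL1 : ∀ s, L * lam s / (L + lam s) ≤ L := fun s => by
    rw [div_le_iff₀ (hpos s)]; nlinarith [l0 s]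
  have hG0 : ∀ s, 0 ≤ L * lam s / (L + lam s) := fun s =>
    div_nonneg (mul_nonneg hLp.le (l0 s)) (hpos s).le
  have hG'0 : ∀ s, 0 ≤ L ^ 2 / (L + lam s) ^ 2 * (th (s + (S + 1)) + (s + (S + 1)) * deriv th (s + (S + 1))) :=
    fun s => mul_nonneg (by positivity) (add_nonneg (th_nonneg _) (p0 _))
  refine ⟨fun s => L * lam s / (L + lam s), max L (1 + C), ?_, ?_, ?_, hG0, hL1, ?_, ?_, ?_⟩
  · exact (contDiff_const.mul lcd).div (contDiff_const.add lcd) fun s => (hpos s).ne'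
  · intro s; rw [abs_of_nonneg (hG0 s)]; exact (hL1 s).trans (le_max_left _ _)
  · intro s
    rw [(Ghd s).deriv, abs_of_nonneg (hG'0 s)]
    refine le_trans ?_ (le_max_right _ _)
    have h1 : L ^ 2 / (L + lam s) ^ 2 ≤ 1 := by
      rw [div_le_one (pow_pos (hpos s) 2)]; nlinarith [l0 s]
    have h2 := add_nonneg (th_nonneg (s + (S + 1))) (p0 (s + (S + 1)))
    have h3 := mul_le_mul_of_nonneg_right h1 h2
    linarith [th_le_one (s + (S + 1)), p1 (s + (S + 1))]
  · intro s; rw [(Ghd s).deriv]; exact hG'0 s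
  · intro s hs
    simp [hlam, th_zero (show s + (S + 1) ≤ 0 by linarith)]
  · intro s h1 h2
    rw [(Ghd s).deriv, th_one (by linarith)]
    have h3 : lam s ≤ L := by
      simp only [hlam]; rw [th_one (by linarith)]; linarith
    have h4 : 1 / 4 ≤ L ^ 2 / (L + lam s) ^ 2 := by
      rw [div_le_div_iff₀ (by norm_num) (pow_pos (hpos s) 2)]; nlinarith [l0 s]
    calc (1 / 4 : ℝ) = 1 / 4 * 1 := by ring
      _ ≤ _ := mul_le_mul h4 (by linarith [p0 (s + (S + 1))]) (by norm_num) (by positivity)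

lemma flux_le (hv : IsW0 v) {G : ℝ → ℝ} (hG : ContDiff ℝ 1 G) {C S t0 t1 L : ℝ} (hG0 : ∀ s, |G s| ≤ C)
    (hG1 : ∀ s, |deriv G s| ≤ C) (hGn : ∀ s, 0 ≤ G s) (hGL : ∀ s, G s ≤ L) (hGS : ∀ s ≤ -S, G s = 0)
    (h0 : 1 + S ≤ t0) (h01 : t0 ≤ t1) :
    ∫ p, deriv G (‖p.1‖ - p.2) * (en v p + Dt v p * Dr v p / ‖p.1‖) ∂slab d t0 t1 ≤ L * Eg v t0 := by
  have h := (flux hv hG hG0 hG1 hGS h0 h01).2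
  have h1 : 0 ≤ ∫ x, G (‖x‖ - t1) * en v (x, t1) :=
    integral_nonneg fun x => mul_nonneg (hGn _) (en_nonneg _ _)
  have h2 : ∫ x, G (‖x‖ - t0) * en v (x, t0) ≤ L * Eg v t0 := by
    rw [Eg, ← integral_const_mul]
    exact integral_mono (int_G hv hG.continuous hG0 t0 t0) ((hv.int t0).const_mul L) fun x =>
      mul_le_mul_of_nonneg_right (hGL _) (en_nonneg _ _)
  linarith

lemma ring_pt (v : Spc d × ℝ → ℝ) {q : Spc d × ℝ} (hq : q ∈ Om d) :
    en v q ≤ 2 * (en v q + Dt v q * Dr v q / ‖q.1‖) + 3 / 2 * Dt v q ^ 2 := by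
  have hr := norm_pos_Om hq
  have h1 : (Dr v q / ‖q.1‖) ^ 2 ≤ Ns v q := by
    rw [div_pow, div_le_iff₀ (by positivity), mul_comm]; exact Dr_sq_le v q
  have h2 := pot_nonneg v q
  rw [mul_div_assoc]
  simp only [en]
  nlinarith [sq_nonneg (Dr v q / ‖q.1‖ + 2 * Dt v q)]

lemma flux_pt (v : Spc d × ℝ → ℝ) {q : Spc d × ℝ} (hq : q ∈ Om d) :
    v q ^ 2 / (2 * ‖q.1‖) ≤ en v q + Dt v q * Dr v q / ‖q.1‖ := by
  have hr := norm_pos_Om hq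
  have h1 : (Dr v q / ‖q.1‖) ^ 2 ≤ Ns v q := by
    rw [div_pow, div_le_iff₀ (by positivity), mul_comm]; exact Dr_sq_le v q
  rw [mul_div_assoc]
  simp only [en]
  nlinarith [sq_nonneg (Dr v q / ‖q.1‖ + Dt v q)]

lemma ext_bound (hw : IsW0 w) (hz : IsW0 z) (hzT : ∀ q ∈ Om d, Dt w q = z q) {S R t0 T K ε : ℝ}
    (hS : 0 ≤ S) (hR : 1 ≤ R) (h0 : S + 2 ≤ t0) (hR0 : R ≤ t0) (h01 : t0 ≤ T)
    (hKw : Eg w t0 ≤ K) (hKz : Eg z t0 ≤ K)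
    (htail : ∀ t, 0 ≤ t → ∫ x in {x | t + R ≤ ‖x‖}, en w (x, t) ≤ ε) :
    ((∫ x in {x | T + 1 - S ≤ ‖x‖}, en w (x, T)) - ε) / 8 * Real.log (T / t0) ≤ 5 * (S + R + 1) * K := by
  obtain ⟨G, C, hG, hG0, hG1, hGn, hGL, hG'0, hGS, hG4⟩ := profile (L := S + R + 1) rfl hS (by linarith)
  set F := ∫ x in {x | T + 1 - S ≤ ‖x‖}, en w (x, T) with hF
  have ht0 : 0 < t0 := by linarith
  have hfw := flux_le hw hG hG0 hG1 hGn hGL hGS (by linarith) h01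
  have hfz := flux_le hz hG hG0 hG1 hGn hGL hGS (by linarith) h01
  have iw := (flux hw hG hG0 hG1 hGS (by linarith) h01).1
  have iz := (flux hz hG hG0 hG1 hGS (by linarith) h01).1
  set Rg : Set (Spc d × ℝ) := {p | p.2 - S ≤ ‖p.1‖ ∧ ‖p.1‖ ≤ p.2 + R} with hRg
  have mRg : MeasurableSet Rg := by
    refine MeasurableSet.inter (s₁ := {p : Spc d × ℝ | p.2 - S ≤ ‖p.1‖})
      (s₂ := {p : Spc d × ℝ | ‖p.1‖ ≤ p.2 + R}) ?_ ?_
    · exact measurableSet_le (by fun_prop) (by fun_prop)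
    · exact measurableSet_le (by fun_prop) (by fun_prop)
  set f : Spc d × ℝ → ℝ := fun p => 1 / (8 * p.2) * Rg.indicator (en w) p with hf
  have int_f : Integrable f (slab d t0 T) := by
    refine ((hw.int_slab t0 T).indicator mRg).bdd_mul (c := 1 / (8 * t0)) ?_ ?_
    · exact (by fun_prop : Measurable fun p : Spc d × ℝ => 1 / (8 * p.2)).aestronglyMeasurable
    · filter_upwards [slab_ae_time t0 T] with p hp
      have hp1 := hp.1
      rw [Real.norm_eq_abs, abs_of_nonneg (by have := ht0.trans hp1; positivity)]
      exact one_div_le_one_div_of_le (by positivity) (by linarith)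
  have up : ∫ p, f p ∂slab d t0 T ≤ 5 * (S + R + 1) * K := by
    have i2 : Integrable (fun p => 2 * (deriv G (‖p.1‖ - p.2) * (en w p + Dt w p * Dr w p / ‖p.1‖))
        + 3 * (deriv G (‖p.1‖ - p.2) * (en z p + Dt z p * Dr z p / ‖p.1‖))) (slab d t0 T) :=
      (iw.const_mul 2).add (iz.const_mul 3)
    have h1 : ∫ p, f p ∂slab d t0 T ≤ ∫ p, (2 * (deriv G (‖p.1‖ - p.2) * (en w p + Dt w p * Dr w p / ‖p.1‖))
        + 3 * (deriv G (‖p.1‖ - p.2) * (en z p + Dt z p * Dr z p / ‖p.1‖))) ∂slab d t0 T := by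
      refine integral_mono_ae int_f i2 ?_
      filter_upwards [slab_ae_time t0 T, slab_ae_Om t0 T] with p hp hq
      have hr := norm_pos_Om hq
      have hp1 := hp.1
      have hp0 := ht0.trans hp1
      have e1 := flux_pt w hq
      have e2 := flux_pt z hq
      have e1' : 0 ≤ en w p + Dt w p * Dr w p / ‖p.1‖ := le_trans (by positivity) e1
      have e2' : 0 ≤ en z p + Dt z p * Dr z p / ‖p.1‖ := le_trans (by positivity) e2
      have g0 := hG'0 (‖p.1‖ - p.2)
      by_cases hm : p ∈ Rg
      · obtain ⟨hm1, hm2⟩ := id hm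
        have g4 := hG4 (‖p.1‖ - p.2) (by linarith) (by linarith)
        have e3 := ring_pt w hq
        rw [hzT p hq] at e3
        simp only [hf, Set.indicator_of_mem hm]
        rw [hzT p hq] at e1'
        rw [hzT p hq]
        have a1 : 1 / (8 * p.2) ≤ deriv G (‖p.1‖ - p.2) / ‖p.1‖ := by
          rw [div_le_div_iff₀ (by positivity) hr]; nlinarith
        have a2 := mul_le_mul_of_nonneg_right a1 (en_nonneg w p)
        have a3 : en w p / ‖p.1‖ ≤ 2 * (en w p + z p * Dr w p / ‖p.1‖) +
            3 * (en z p + Dt z p * Dr z p / ‖p.1‖) := by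
          have b1 : en w p / ‖p.1‖ ≤
              2 * ((en w p + z p * Dr w p / ‖p.1‖) / ‖p.1‖) + 3 * (z p ^ 2 / (2 * ‖p.1‖)) := by
            have := div_le_div_of_nonneg_right e3 hr.le
            refine this.trans (le_of_eq ?_)
            field_simp
          have b2 := div_le_self e1' (show 1 ≤ ‖p.1‖ by linarith)
          linarith
        have a4 := mul_le_mul_of_nonneg_left a3 g0
        calc _ ≤ _ := a2
          _ = deriv G (‖p.1‖ - p.2) * (en w p / ‖p.1‖) := by ring
          _ ≤ _ := a4
          _ = _ := by ring
      · simp only [hf, Set.indicator_of_notMem hm, mul_zero]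
        exact add_nonneg (mul_nonneg (by norm_num) (mul_nonneg g0 e1'))
          (mul_nonneg (by norm_num) (mul_nonneg g0 e2'))
    rw [integral_add (iw.const_mul 2) (iz.const_mul 3), integral_const_mul, integral_const_mul] at h1
    have hL : 0 ≤ S + R + 1 := by linarith
    nlinarith [mul_le_mul_of_nonneg_left hKw hL, mul_le_mul_of_nonneg_left hKz hL]
  refine le_trans ?_ up
  rw [slab_fubini h01 int_f]
  have low : ∀ t ∈ Set.Icc t0 T, (F - ε) / 8 * t⁻¹ ≤ ∫ x, f (x, t) := by
    intro t ht
    have ht1 := ht.1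
    have htp : 0 < t := ht0.trans_le ht1
    have hfs := finite_speed hw (S := S) (t0 := t) (t1 := T) (by linarith) ht.2
    have htl := htail t htp.le
    have mR : MeasurableSet {x : Spc d | (x, t) ∈ Rg} := mRg.preimage (by fun_prop)
    have e : ∀ x, f (x, t) = 1 / (8 * t) * {x : Spc d | (x, t) ∈ Rg}.indicator (fun x => en w (x, t)) x :=
      fun x => rfl
    simp only [e]
    rw [integral_const_mul, integral_indicator mR]
    have h3 : ∫ x in {x : Spc d | t - S ≤ ‖x‖}, en w (x, t) ≤
        (∫ x in {x : Spc d | (x, t) ∈ Rg}, en w (x, t)) + ∫ x in {x | t + R ≤ ‖x‖}, en w (x, t) := by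
      rw [← integral_indicator (meas_ext _), ← integral_indicator (meas_ext _), ← integral_indicator mR,
        ← integral_add ((hw.int t).indicator mR) ((hw.int t).indicator (meas_ext _))]
      refine integral_mono ((hw.int t).indicator (meas_ext _))
        (((hw.int t).indicator mR).add ((hw.int t).indicator (meas_ext _))) fun x => ?_
      have hn := en_nonneg w (x, t)
      have n1 := Set.indicator_nonneg (s := {x : Spc d | (x, t) ∈ Rg}) (f := fun x => en w (x, t))
        (fun x _ => en_nonneg w (x, t)) x
      have n2 := Set.indicator_nonneg (s := {x : Spc d | t + R ≤ ‖x‖}) (f := fun x => en w (x, t))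
        (fun x _ => en_nonneg w (x, t)) x
      by_cases hx : t - S ≤ ‖x‖
      · rw [Set.indicator_of_mem (show x ∈ {x : Spc d | t - S ≤ ‖x‖} from hx)]
        rcases le_total ‖x‖ (t + R) with h | h
        · rw [Set.indicator_of_mem (show x ∈ {x : Spc d | (x, t) ∈ Rg} from ⟨hx, h⟩)]; linarith
        · rw [Set.indicator_of_mem (show x ∈ {x : Spc d | t + R ≤ ‖x‖} from h)]; linarith
      · rw [Set.indicator_of_notMem (show x ∉ {x : Spc d | t - S ≤ ‖x‖} from hx)]; linarith
    have h4 : F - ε ≤ ∫ x in {x : Spc d | (x, t) ∈ Rg}, en w (x, t) := by linarith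
    calc (F - ε) / 8 * t⁻¹ = 1 / (8 * t) * (F - ε) := by field_simp
      _ ≤ _ := mul_le_mul_of_nonneg_left h4 (by positivity)
  have i3 : IntervalIntegrable (fun t => ∫ x, f (x, t)) volume t0 T := by
    rw [intervalIntegrable_iff_integrableOn_Ioc_of_le h01]
    rw [slab] at int_f
    exact int_f.integral_prod_right
  have hT : 0 < T := ht0.trans_le h01
  have i4 : IntervalIntegrable (fun t : ℝ => (F - ε) / 8 * t⁻¹) volume t0 T := by
    refine IntervalIntegrable.const_mul ?_ _
    refine intervalIntegral.intervalIntegrable_inv (fun x hx => ?_) continuousOn_id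
    rw [Set.uIcc_of_le h01] at hx
    exact (ht0.trans_le hx.1).ne'
  have := intervalIntegral.integral_mono_on h01 i4 i3 low
  rwa [intervalIntegral.integral_const_mul, integral_inv_of_pos ht0 hT] at this

lemma log_le_sqrt {c : ℝ} (hc : 0 < c) : ∀ᶠ T : ℝ in atTop, c * Real.log T ≤ √T := by
  have h := (isLittleO_log_rpow_atTop (r := 1 / 2) (by norm_num)).bound (inv_pos.2 hc)
  filter_upwards [h, eventually_ge_atTop 1] with T h hT
  rw [← Real.sqrt_eq_rpow, Real.norm_eq_abs, Real.norm_eq_abs, abs_of_nonneg (Real.log_nonneg hT),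
    abs_of_nonneg (Real.sqrt_nonneg _), inv_mul_eq_div, le_div_iff₀ hc] at h
  linarith

lemma set_en_le (hv : IsW0 v) (hw : IsW0 w) (t : ℝ) {S : Set (Spc d)} :
    ∫ x in S, en v (x, t) ≤ 2 * (∫ x in S, en w (x, t)) + 2 * Eg (v - w) t := by
  have h1 : ∫ x in S, en v (x, t) ≤ ∫ x in S, (2 * en w (x, t) + 2 * en (v - w) (x, t)) := by
    refine setIntegral_mono_ae (hv.int t).integrableOn
      (((hw.int t).const_mul 2).add (((hv.sub hw).int t).const_mul 2)).integrableOn ?_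
    filter_upwards [ae_ne] with x hx
    have hq : (x, t) ∈ Om d := mem_Om.2 hx
    have := en_add_le (hw.diff hq) ((hv.sub hw).diff hq)
    rwa [add_sub_cancel] at this
  rw [integral_add ((hw.int t).const_mul 2).integrableOn (((hv.sub hw).int t).const_mul 2).integrableOn,
    integral_const_mul, integral_const_mul] at h1
  have := loc_le (hv.sub hw) t S
  linarith

theorem exterior_small (hv : IsW v) {ε : ℝ} (hε : 0 < ε) : ∃ c, 0 < c ∧ ∀ᶠ T in atTop,
    ∫ x in {x | T - c * Real.log T ≤ ‖x‖}, en v (x, T) ≤ ε := by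
  have hε' : 0 < ε / 8 := by positivity
  obtain ⟨h, h1, h2⟩ := ((((A_tendsto hv 0).eventually (ge_mem_nhds hε')).filter_mono
    nhdsWithin_le_nhds).and (self_mem_nhdsWithin (s := {(0 : ℝ)}ᶜ))).exists
  have hh : h ≠ 0 := h2
  set w := A h v with hwd
  have hw : IsW w := hv.A h
  set z := (1 / h) • (tau h v - v) with hzd
  have hz : IsW z := ((hv.tau h).sub hv).smul _
  have hzT : ∀ q ∈ Om d, Dt w q = z q := fun q hq => by
    obtain ⟨x, t⟩ := q
    rw [hwd, A_Dt hv.toIsW0 hh (mem_Om.1 hq), hzd]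
    simp only [Pi.smul_apply, Pi.sub_apply, smul_eq_mul, tau_apply]
    ring
  obtain ⟨R, hR, htail⟩ := tail hw.toIsW0 hε'
  set K := max (Eg w 0) (Eg z 0) with hK
  have hK0 : 0 ≤ K := (Eg_nonneg w 0).trans (le_max_left _ _)
  set c := ε / 8 / (80 * (K + 1)) with hc
  have hc0 : 0 < c := by positivity
  refine ⟨c, hc0, ?_⟩
  have ev1 := log_le_sqrt (c := 2 * c) (by positivity)
  have ev2 := Real.tendsto_sqrt_atTop.eventually_ge_atTop (6 + R)
  have ev3 := Real.tendsto_log_atTop.eventually_ge_atTop (80 * (R + 2) * K / (ε / 8))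
  filter_upwards [ev1, ev2, ev3, eventually_gt_atTop 1] with T e1 e2 e3 e4
  have hT : 0 < T := by linarith
  have hlog : 0 < Real.log T := Real.log_pos e4
  have hs : √T ≤ T := Real.sqrt_le_self_iff.2 (Or.inr e4.le)
  have hsp : 0 < √T := by linarith
  have key := ext_bound hw.toIsW0 hz.toIsW0 hzT (S := c * Real.log T + 1) (R := R) (t0 := √T) (T := T)
    (K := K) (ε := ε / 8) (by positivity) hR (by linarith) (by linarith) hs
    (by rw [hw.conserve _ 0]; exact le_max_left _ _) (by rw [hz.conserve _ 0]; exact le_max_right _ _) htail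
  rw [Real.log_div hT.ne' hsp.ne', Real.log_sqrt hT.le,
    show T + 1 - (c * Real.log T + 1) = T - c * Real.log T by ring] at key
  have h3 := set_en_le hv.toIsW0 hw.toIsW0 T (S := {x | T - c * Real.log T ≤ ‖x‖})
  rw [(hv.sub hw).conserve T 0, Eg_sub_comm] at h3
  set F := ∫ x in {x | T - c * Real.log T ≤ ‖x‖}, en w (x, T) with hF
  have hcK : 80 * c * K ≤ ε / 8 := by
    have : c * (80 * (K + 1)) = ε / 8 := by rw [hc]; field_simp
    nlinarith
  rw [div_le_iff₀ hε'] at e3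
  have h4 : (F - ε / 8) * Real.log T ≤ 2 * (ε / 8) * Real.log T := by
    nlinarith [mul_le_mul_of_nonneg_right hcK hlog.le]
  have h5 := le_of_mul_le_mul_right h4 hlog
  linarith

end Coulomb

namespace Coulomb
open scoped Topology
set_option linter.unusedSectionVars false
variable {d : ℕ} {v w z : Spc d × ℝ → ℝ} [Fact (3 ≤ d)]

/-! ### Asymptotic outgoingness -/

lemma slab_le {f : Spc d × ℝ → ℝ} {B : ℝ → ℝ} {t0 t1 : ℝ} (h01 : t0 ≤ t1) (hf : Integrable f (slab d t0 t1))
    (hB : IntervalIntegrable B volume t0 t1) (h : ∀ t ∈ Set.Icc t0 t1, ∫ x, f (x, t) ≤ B t) :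
    ∫ p, f p ∂slab d t0 t1 ≤ ∫ t in t0..t1, B t := by
  rw [slab_fubini h01 hf]
  refine intervalIntegral.integral_mono_on h01 ?_ hB h
  rw [intervalIntegrable_iff_integrableOn_Ioc_of_le h01]
  rw [slab] at hf
  exact hf.integral_prod_right

lemma slab_const {f : Spc d × ℝ → ℝ} {B t0 t1 : ℝ} (h01 : t0 ≤ t1) (hf : Integrable f (slab d t0 t1))
    (h : ∀ t ∈ Set.Icc t0 t1, ∫ x, f (x, t) = B) : ∫ p, f p ∂slab d t0 t1 = (t1 - t0) * B := by
  rw [slab_fubini h01 hf, intervalIntegral.integral_congr (g := fun _ => B)]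
  · simp
  · intro t ht
    rw [Set.uIcc_of_le h01] at ht
    exact h t ht

lemma slab_le_const {f : Spc d × ℝ → ℝ} {B t0 t1 : ℝ} (h01 : t0 ≤ t1) (hf : Integrable f (slab d t0 t1))
    (h : ∀ t ∈ Set.Icc t0 t1, ∫ x, f (x, t) ≤ B) : ∫ p, f p ∂slab d t0 t1 ≤ (t1 - t0) * B := by
  have := slab_le (B := fun _ => B) h01 hf (by simp) h
  simpa using this

lemma int_pot (hv : IsW0 v) (t0 t1 : ℝ) : Integrable (fun q => v q ^ 2 / (2 * ‖q.1‖)) (slab d t0 t1) := by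
  have hm : Measurable v := hv.meas
  refine (hv.int_slab t0 t1).mono' (by fun_prop : Measurable fun q : Spc d × ℝ =>
    v q ^ 2 / (2 * ‖q.1‖)).aestronglyMeasurable (Eventually.of_forall fun q => ?_)
  rw [Real.norm_eq_abs, abs_of_nonneg (by positivity)]
  have := Ns_nonneg v q
  simp only [en]
  nlinarith [sq_nonneg (Dt v q)]

lemma pot_avg (hv : IsW0 v) {A E : ℝ} (hA : L2b v A) (hE : ∀ t, Eg v t ≤ E) {δ : ℝ} (hδ : 0 < δ) :
    ∀ᶠ T in atTop, ∫ q, v q ^ 2 / (2 * ‖q.1‖) ∂slab d 0 T ≤ T * δ := by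
  have hm : Measurable v := hv.meas
  have hA0 : 0 ≤ A := (integral_nonneg fun x => sq_nonneg _).trans (hA 0).2
  have hE0 : 0 ≤ E := (Eg_nonneg v 0).trans (hE 0)
  set M := (A + 1) / δ with hM
  have hMp : 0 < M := by positivity
  set D := sg 1 M ^ 5 * (4 * d * E) with hD
  have hs0 := sg_pos one_pos M
  filter_upwards [eventually_ge_atTop (2 * D / δ), eventually_ge_atTop 0] with T h1 h2
  obtain ⟨i1, h3⟩ := local_decay hv h2 hE
  set S : Set (Spc d × ℝ) := {p | M ≤ ‖p.1‖} with hS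
  have mS : MeasurableSet S := measurableSet_le (by fun_prop) (by fun_prop)
  have i2 := (int_pot hv 0 T).indicator mS
  have h4 := slab_le_const (B := δ / 2) h2 i2 (fun t ht => by
    have e : ∫ x, v (x, t) ^ 2 / (2 * M) ≤ A / (2 * M) := by
      rw [integral_div]; exact div_le_div_of_nonneg_right (hA t).2 (by positivity)
    refine le_trans (integral_mono_of_nonneg (Eventually.of_forall fun x => Set.indicator_nonneg
      (fun q _ => by positivity) _) ((hA t).1.div_const (2 * M)) (Eventually.of_forall fun x => ?_)) (e.trans ?_)
    · by_cases hx : (x, t) ∈ S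
      · have hx' : M ≤ ‖x‖ := hx
        simp only [Set.indicator_of_mem hx]
        gcongr
      · simp only [Set.indicator_of_notMem hx]; positivity
    · rw [div_le_div_iff₀ (by positivity) (by norm_num), hM]
      field_simp
      nlinarith)
  have h5 : ∫ q, v q ^ 2 / (2 * ‖q.1‖) ∂slab d 0 T ≤
      ∫ q, (sg 1 M ^ 5 * (en v q / sg 1 ‖q.1‖ ^ 5) + S.indicator (fun q => v q ^ 2 / (2 * ‖q.1‖)) q) ∂slab d 0 T := by
    refine integral_mono (int_pot hv 0 T) ((i1.const_mul _).add i2) fun q => ?_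
    have hs := sg_pos one_pos ‖q.1‖
    have hen := en_nonneg v q
    by_cases hq : q ∈ S
    · simp only [Set.indicator_of_mem hq]
      have : 0 ≤ sg 1 M ^ 5 * (en v q / sg 1 ‖q.1‖ ^ 5) := by positivity
      linarith
    · have hq' : ‖q.1‖ < M := not_le.1 hq
      simp only [Set.indicator_of_notMem hq, add_zero]
      have h6 : sg 1 ‖q.1‖ ≤ sg 1 M := Real.sqrt_le_sqrt (by nlinarith [norm_nonneg q.1])
      have h7 : sg 1 ‖q.1‖ ^ 5 ≤ sg 1 M ^ 5 := by gcongr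
      have h8 : v q ^ 2 / (2 * ‖q.1‖) ≤ en v q := by
        have := Ns_nonneg v q
        simp only [en]
        nlinarith [sq_nonneg (Dt v q)]
      rw [mul_div_assoc', le_div_iff₀ (by positivity)]
      calc _ ≤ en v q * sg 1 M ^ 5 := mul_le_mul h8 h7 (by positivity) hen
        _ = _ := by ring
  rw [integral_add (i1.const_mul _) i2, integral_const_mul] at h5
  have h9 := mul_le_mul_of_nonneg_left h3 (pow_pos hs0 5).le
  rw [div_le_iff₀ hδ] at h1
  linarith

lemma qm0_tendsto (hv : IsW0 v) : Tendsto (fun ρ => ∫ x, qm v ρ (x, 0)) atTop (𝓝 0) := by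
  have h : Tendsto (fun ρ => ∫ x, qm v ρ (x, 0)) atTop (𝓝 (∫ _ : Spc d, (0 : ℝ))) := by
    refine tendsto_integral_filter_of_dominated_convergence (fun x => d * en v (x, 0)) ?_ ?_
      ((hv.int 0).const_mul _) ?_
    · filter_upwards [eventually_ge_atTop 1] with ρ hρ
      exact (int_qm hv hρ 0).aestronglyMeasurable
    · filter_upwards [eventually_ge_atTop 1] with ρ hρ
      filter_upwards [ae_ne] with x hx
      exact qm_le hρ v (mem_Om.2 hx)
    · refine Eventually.of_forall fun x => ?_
      have h1 : Tendsto (fun ρ => 1 / sg ρ ‖x‖) atTop (𝓝 0) := by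
        refine squeeze_zero' (g := fun ρ => 1 / ρ) (Eventually.of_forall fun ρ => ?_) ?_ ?_
        · unfold sg; positivity
        · filter_upwards [eventually_gt_atTop 0] with ρ hρ
          exact one_div_le_one_div_of_le hρ (le_sg' _ _)
        · simpa using tendsto_inv_atTop_zero (𝕜 := ℝ)
      simp only [qm, qM, wt, pow_one, one_mul]
      have h2 := ((h1.mul_const (Dr v (x, 0))).add ((h1.const_mul (((d : ℝ) - 1) / 2)).mul_const (v (x, 0)))).const_mul
        (Dt v (x, 0))
      simpa using h2
  simpa using h

lemma good_low {ρ T K : ℝ} (hK : 3 ≤ K) (hT : 1 ≤ T) (hρ : ρ = K * T) (v : Spc d × ℝ → ℝ) {q : Spc d × ℝ}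
    (hq : q ∈ Om d) : (1 - 6 / K ^ 2) * en v q - v q ^ 2 / (2 * ‖q.1‖) -
      {p : Spc d × ℝ | 2 * T ≤ ‖p.1‖}.indicator (en v) q ≤ ρ * good v ρ q := by
  have hρ1 : 1 ≤ ρ := by nlinarith
  have hr := norm_pos_Om hq
  have hs := sg_pos (show 0 < ρ by linarith) ‖q.1‖
  have hg := good_ge hρ1 v hq
  have hg0 := good_nonneg hρ1 v hq
  have hen := en_nonneg v q
  have hpot : 0 ≤ v q ^ 2 / (2 * ‖q.1‖) := by positivity
  have h6 : 0 ≤ 1 - 6 / K ^ 2 := by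
    rw [sub_nonneg, div_le_one (by positivity)]; nlinarith
  have h6' : 0 ≤ 6 / K ^ 2 := by positivity
  by_cases h : 2 * T ≤ ‖q.1‖
  · rw [Set.indicator_of_mem (show q ∈ {p : Spc d × ℝ | 2 * T ≤ ‖p.1‖} from h)]
    have : 0 ≤ ρ * good v ρ q := by positivity
    nlinarith
  · rw [Set.indicator_of_notMem (show q ∉ {p : Spc d × ℝ | 2 * T ≤ ‖p.1‖} from h)]
    push Not at h
    have hN := Ns_nonneg v q
    have key : 1 - 6 / K ^ 2 ≤ ρ ^ 3 / sg ρ ‖q.1‖ ^ 3 := by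
      set y := ‖q.1‖ ^ 2 / ρ ^ 2 with hy
      have hy0 : 0 ≤ y := by positivity
      have hy1 : y ≤ 4 / K ^ 2 := by
        rw [hy, hρ, div_le_div_iff₀ (by positivity) (by positivity)]
        have : ‖q.1‖ ^ 2 ≤ (2 * T) ^ 2 := by gcongr
        nlinarith [sq_nonneg K]
      set s := sg ρ ‖q.1‖ / ρ with hs1
      have hsy : s ^ 2 = 1 + y := by
        rw [hs1, hy, div_pow, sg_sq]; field_simp; ring
      have hs2 : 0 < s := by positivity
      have e : ρ ^ 3 / sg ρ ‖q.1‖ ^ 3 = 1 / s ^ 3 := by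
        rw [hs1, div_pow]; field_simp
      rw [e]
      have hs3 : 1 ≤ s := by nlinarith
      have h7 : 1 - 3 / 2 * y ≤ 1 / s ^ 3 := by
        rw [le_div_iff₀ (by positivity)]
        have : y = s ^ 2 - 1 := by linarith
        rw [this]
        nlinarith [mul_nonneg (sq_nonneg (s - 1)) (show 0 ≤ 3 * s ^ 3 + 6 * s ^ 2 + 4 * s + 2 by positivity)]
      have : 6 / K ^ 2 = 3 / 2 * (4 / K ^ 2) := by ring
      linarith
    have h8 : ρ ^ 2 / (2 * sg ρ ‖q.1‖ ^ 3) * (Dt v q ^ 2 + Ns v q) ≤ good v ρ q := by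
      have a1 : 0 ≤ 3 / 2 * ρ ^ 2 * v q ^ 2 / sg ρ ‖q.1‖ ^ 5 := by positivity
      have a2 : 0 ≤ v q ^ 2 * ‖q.1‖ / (2 * sg ρ ‖q.1‖ ^ 3) := by positivity
      linarith
    have h9 := mul_le_mul_of_nonneg_left h8 (show 0 ≤ ρ by linarith)
    have e2 : ρ * (ρ ^ 2 / (2 * sg ρ ‖q.1‖ ^ 3) * (Dt v q ^ 2 + Ns v q)) =
        ρ ^ 3 / sg ρ ‖q.1‖ ^ 3 * (1 / 2 * (Dt v q ^ 2 + Ns v q)) := by field_simp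
    rw [e2] at h9
    have h10 := mul_le_mul_of_nonneg_right key (show 0 ≤ 1 / 2 * (Dt v q ^ 2 + Ns v q) by positivity)
    have e3 : en v q = 1 / 2 * (Dt v q ^ 2 + Ns v q) + v q ^ 2 / (2 * ‖q.1‖) := by simp only [en]; ring
    rw [e3]
    nlinarith

end Coulomb

namespace Coulomb
open scoped Topology
set_option linter.unusedSectionVars false
variable {d : ℕ} {v w z : Spc d × ℝ → ℝ} [Fact (3 ≤ d)]

lemma TSr_bds (v : Spc d × ℝ → ℝ) {q : Spc d × ℝ} (hq : q ∈ Om d) :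
    -en v q ≤ Dt v q * Dr v q / ‖q.1‖ ∧ Dt v q * Dr v q / ‖q.1‖ ≤ en v q := abs_le.1 (TSr_le v hq)

lemma outgoing_scalar {e τ l β r T K : ℝ} (hK : 3 ≤ K) (hT : 0 < T) (he : 0 ≤ e) (h1 : -e ≤ τ) (h2 : τ ≤ e)
    (hl : l = K * r / sg (K * T) r) (hr : 0 < r) (b0 : 0 ≤ β) (b1 : β ≤ 1) (hb : 3 / 4 * T ≤ r → β = 1) :
    e + β * τ ≤ 8 * (e + l * τ) + 8 * (max (l - 1) 0 * e) := by
  have hKT : 0 < K * T := by positivity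
  have hs := sg_pos hKT r
  have hsq := sg_sq (K * T) r
  have hm := mul_nonneg (le_max_right (l - 1) 0) he
  have hm' := mul_le_mul_of_nonneg_right (le_max_left (l - 1) 0) he
  have hl0 : 0 ≤ l := by rw [hl]; positivity
  have hX : 0 ≤ e + l * τ + max (l - 1) 0 * e := by nlinarith
  rcases le_total (3 / 4 * T) r with h | h
  · rw [hb h, one_mul]
    have l2 : 1 / 2 ≤ l := by
      rw [hl, div_le_div_iff₀ (by norm_num) hs]
      refine le_of_sq_le_sq ?_ (by positivity)
      rw [one_mul, hsq]
      have : (3 / 4 * T) ^ 2 ≤ r ^ 2 := by gcongr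
      have h3 : 9 ≤ K ^ 2 := by nlinarith
      nlinarith [mul_le_mul_of_nonneg_left this (show 0 ≤ K ^ 2 by positivity), sq_nonneg r]
    rcases le_total 0 τ with ht | ht
    · nlinarith
    · rcases le_total l 1 with hl1 | hl1
      · nlinarith
      · nlinarith
  · have l3 : l ≤ 3 / 4 := by
      rw [hl, div_le_iff₀ hs]
      have := le_sg' (K * T) r
      nlinarith
    nlinarith

lemma K_qm {ρ T K : ℝ} (hT : 0 < T) (hK : 0 < K) (hρ : ρ = K * T) (v : Spc d × ℝ → ℝ) {q : Spc d × ℝ}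
    (hq : q ∈ Om d) : (K * ‖q.1‖ / sg ρ ‖q.1‖) * (Dt v q * Dr v q / ‖q.1‖) ≤
      K * qm v ρ q + d * (2 * en v q + v q ^ 2) / T := by
  have hρ0 : 0 < ρ := by rw [hρ]; positivity
  have hs := sg_pos hρ0 ‖q.1‖
  have hr := norm_pos_Om hq
  have hd := three_le d
  simp only [qm, qM, wt, pow_one, one_mul]
  have e : (K * ‖q.1‖ / sg ρ ‖q.1‖) * (Dt v q * Dr v q / ‖q.1‖) =
      K * (Dt v q * (1 / sg ρ ‖q.1‖ * Dr v q + (d - 1) / 2 * (1 / sg ρ ‖q.1‖) * v q)) +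
        K / sg ρ ‖q.1‖ * ((d - 1) / 2) * -(Dt v q * v q) := by field_simp; ring
  rw [e]
  refine add_le_add le_rfl ?_
  have h1 : K / sg ρ ‖q.1‖ ≤ 1 / T := by
    rw [div_le_div_iff₀ hs hT, one_mul, ← hρ]; exact le_sg' _ _
  have h2 := Dt_sq_le_en v q
  have h3 : -(Dt v q * v q) ≤ 2 * en v q + v q ^ 2 := by nlinarith [sq_nonneg (Dt v q + v q)]
  have h4 : 0 ≤ 2 * en v q + v q ^ 2 := by have := en_nonneg v q; positivity
  calc K / sg ρ ‖q.1‖ * ((d - 1) / 2) * -(Dt v q * v q)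
      ≤ K / sg ρ ‖q.1‖ * ((d - 1) / 2) * (2 * en v q + v q ^ 2) := by
        refine mul_le_mul_of_nonneg_left h3 ?_
        have : (0 : ℝ) ≤ (d - 1) / 2 := by linarith
        positivity
    _ ≤ 1 / T * d * (2 * en v q + v q ^ 2) :=
        mul_le_mul_of_nonneg_right (mul_le_mul h1 (by linarith) (by linarith) (by positivity)) h4
    _ = _ := by ring

lemma qm_upper (hv : IsW v) {K R T ε : ℝ} (hK : 3 ≤ K) (hT : 1 ≤ T) (hRT : R ≤ T)
    (htail : ∀ t, 0 ≤ t → ∫ x in {x | t + R ≤ ‖x‖}, en v (x, t) ≤ ε) {δ : ℝ}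
    (hp : ∫ q, v q ^ 2 / (2 * ‖q.1‖) ∂slab d 0 T ≤ T * δ) :
    Eg v 0 + K * (∫ x, qm v (K * T) (x, T)) ≤ K * (∫ x, qm v (K * T) (x, 0)) + 6 / K ^ 2 * Eg v 0 + δ + ε := by
  have hT0 : 0 < T := by linarith
  set S : Set (Spc d × ℝ) := {p | 2 * T ≤ ‖p.1‖} with hS
  have mS : MeasurableSet S := measurableSet_le (by fun_prop) (by fun_prop)
  have hρ : 1 ≤ K * T := by nlinarith
  have h0 := hv.toIsW0
  have i1 := h0.int_slab 0 T
  have i2 := i1.indicator mS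
  have i3 := int_pot h0 0 T
  have i4 := int_good h0 hρ 0 T
  have h1 : ∫ q, ((1 - 6 / K ^ 2) * en v q - v q ^ 2 / (2 * ‖q.1‖) - S.indicator (en v) q) ∂slab d 0 T ≤
      ∫ q, K * T * good v (K * T) q ∂slab d 0 T := by
    refine integral_mono_ae (((i1.const_mul _).sub i3).sub i2) (i4.const_mul _) ?_
    filter_upwards [slab_ae_Om 0 T] with q hq
    exact good_low hK hT rfl v hq
  have i5 : Integrable (fun q => (1 - 6 / K ^ 2) * en v q - v q ^ 2 / (2 * ‖q.1‖)) (slab d 0 T) :=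
    (i1.const_mul _).sub i3
  rw [integral_sub i5 i2, integral_sub (i1.const_mul _) i3, integral_const_mul, integral_const_mul,
    morawetz h0 hρ hT0.le, slab_const hT0.le i1 (fun t _ => hv.conserve t 0)] at h1
  have h2 := slab_le_const (B := ε) hT0.le i2 (fun t ht => by
    have mt : MeasurableSet {x : Spc d | (x, t) ∈ S} := mS.preimage (by fun_prop)
    have e : ∀ x, S.indicator (en v) (x, t) = {x : Spc d | (x, t) ∈ S}.indicator (fun x => en v (x, t)) x :=
      fun x => rfl
    simp only [e]
    rw [integral_indicator mt]
    refine (ext_anti h0 t fun x hx => ?_).trans (htail t ht.1)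
    have hx : 2 * T ≤ ‖x‖ := hx
    have := ht.2
    show t + R ≤ ‖x‖
    linarith)
  refine le_of_mul_le_mul_left ?_ hT0
  nlinarith

/-- Asymptotically, waves with bounded `L²` norm are purely outgoing. -/
theorem outgoing (hv : IsW v) {A : ℝ} (hA : L2b v A) {δ : ℝ} (hδ : 0 < δ) : ∀ᶠ T in atTop,
    ∀ β : Spc d → ℝ, Measurable β → (∀ x, 0 ≤ β x) → (∀ x, β x ≤ 1) → (∀ x, 3 / 4 * T ≤ ‖x‖ → β x = 1) →
    Eg v 0 + ∫ x, β x * (Dt v (x, T) * Dr v (x, T) / ‖x‖) ≤ δ := by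
  have h0 := hv.toIsW0
  set E := Eg v 0 with hE
  have hE0 : 0 ≤ E := Eg_nonneg v 0
  have hA0 : 0 ≤ A := (integral_nonneg fun x => sq_nonneg _).trans (hA 0).2
  have hd := three_le d
  set K := 3 + 288 * E / δ with hKd
  have hK : 3 ≤ K := by
    have : 0 ≤ 288 * E / δ := by positivity
    linarith
  have hK0 : 0 < K := by linarith
  have hKE : 48 * E / K ^ 2 ≤ δ / 6 := by
    rw [div_le_div_iff₀ (by positivity) (by norm_num)]
    have : 288 * E = (K - 3) * δ := by rw [hKd]; field_simp; ring
    have : K - 3 ≤ K ^ 2 := by nlinarith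
    nlinarith
  set ε := δ / (48 * (K + 1)) with hε
  have hε0 : 0 < ε := by positivity
  have hεK : 8 * ε + 8 * (K * ε) = δ / 6 := by rw [hε]; field_simp; ring
  obtain ⟨R, hR, htail⟩ := tail h0 hε0
  have ev1 := pot_avg h0 hA (fun t => (hv.conserve t 0).le) (show 0 < δ / 48 by positivity)
  have ev2 : ∀ᶠ T in atTop, ∫ x, qm v (K * T) (x, 0) ≤ δ / (48 * K) :=
    ((qm0_tendsto h0).comp (tendsto_id.const_mul_atTop hK0)).eventually (ge_mem_nhds (by positivity))
  filter_upwards [ev1, ev2, eventually_ge_atTop 1, eventually_ge_atTop R, eventually_ge_atTop (48 * (R * E) / δ),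
    eventually_ge_atTop (48 * (d * (2 * E + A)) / δ)] with T e1 e2 e3 e4 e5 e6
  intro β mβ b0 b1 hb
  have hT : 0 < T := by linarith
  have key := qm_upper hv hK e3 e4 htail e1
  have hρ : 1 ≤ K * T := by nlinarith
  have ET : Eg v T = E := hv.conserve T 0
  have mR : MeasurableSet {x : Spc d | T + R ≤ ‖x‖} := meas_ext _
  have ie := h0.int T
  have iq := int_qm h0 hρ T
  have i2 := (hA T).1
  have iτ : Integrable (fun x => Dt v (x, T) * Dr v (x, T) / ‖x‖) := by
    refine ie.mono' ?_ ?_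
    · have : Measurable v := h0.meas
      exact (slice_meas (by fun_prop : Measurable fun q : Spc d × ℝ => Dt v q * Dr v q / ‖q.1‖) T).aestronglyMeasurable
    · filter_upwards [ae_ne] with x hx
      exact TSr_le v (mem_Om.2 hx)
  have ib : Integrable (fun x => β x * (Dt v (x, T) * Dr v (x, T) / ‖x‖)) :=
    iτ.bdd_mul mβ.aestronglyMeasurable (c := 1) (Eventually.of_forall fun x => by
      rw [Real.norm_eq_abs, abs_of_nonneg (b0 x)]; exact b1 x)
  have pt : ∀ᵐ x : Spc d, en v (x, T) + β x * (Dt v (x, T) * Dr v (x, T) / ‖x‖) ≤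
      8 * en v (x, T) + 8 * (K * qm v (K * T) (x, T)) + 8 * (d / T) * (2 * en v (x, T) + v (x, T) ^ 2)
        + 8 * (R / T) * en v (x, T) + 8 * K * {x : Spc d | T + R ≤ ‖x‖}.indicator (fun x => en v (x, T)) x := by
    filter_upwards [ae_ne] with x hx
    have hq : (x, T) ∈ Om d := mem_Om.2 hx
    have hr : 0 < ‖x‖ := norm_pos_iff.2 hx
    have hen := en_nonneg v (x, T)
    have h1 := outgoing_scalar (l := K * ‖x‖ / sg (K * T) ‖x‖) hK hT hen (TSr_bds v hq).1 (TSr_bds v hq).2 rfl hr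
      (b0 x) (b1 x) (hb x)
    have h2 := K_qm hT hK0 rfl v hq
    have hs := sg_pos (show 0 < K * T by positivity) ‖x‖
    have h3 : max (K * ‖x‖ / sg (K * T) ‖x‖ - 1) 0 * en v (x, T) ≤ (R / T) * en v (x, T)
        + K * {x : Spc d | T + R ≤ ‖x‖}.indicator (fun x => en v (x, T)) x := by
      by_cases h : T + R ≤ ‖x‖
      · rw [Set.indicator_of_mem (show x ∈ {x : Spc d | T + R ≤ ‖x‖} from h)]
        have h4 : max (K * ‖x‖ / sg (K * T) ‖x‖ - 1) 0 ≤ K := by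
          refine max_le ?_ hK0.le
          have : K * ‖x‖ / sg (K * T) ‖x‖ ≤ K := by
            rw [div_le_iff₀ hs]; exact mul_le_mul_of_nonneg_left (le_sg _ _) hK0.le
          linarith
        have h5 : 0 ≤ R / T * en v (x, T) := by positivity
        have := mul_le_mul_of_nonneg_right h4 hen
        linarith
      · rw [Set.indicator_of_notMem (show x ∉ {x : Spc d | T + R ≤ ‖x‖} from h), mul_zero, add_zero]
        push Not at h
        refine mul_le_mul_of_nonneg_right (max_le ?_ (by positivity)) hen
        have : K * ‖x‖ / sg (K * T) ‖x‖ ≤ (T + R) / T := by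
          rw [div_le_div_iff₀ hs hT]
          have h6 := le_sg' (K * T) ‖x‖
          nlinarith
        rw [add_div, div_self hT.ne'] at this
        linarith
    have e7 : 8 * (d / T) * (2 * en v (x, T) + v (x, T) ^ 2) = 8 * (d * (2 * en v (x, T) + v (x, T) ^ 2) / T) := by
      ring
    rw [e7]
    linarith
  have ia : Integrable (fun x => 2 * en v (x, T) + v (x, T) ^ 2) := (ie.const_mul 2).add i2
  have ii : Integrable ({x : Spc d | T + R ≤ ‖x‖}.indicator (fun x => en v (x, T))) := ie.indicator mR
  have j1 : Integrable (fun x => 8 * en v (x, T) + 8 * (K * qm v (K * T) (x, T))) :=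
    (ie.const_mul 8).add ((iq.const_mul K).const_mul 8)
  have j2 : Integrable (fun x => 8 * en v (x, T) + 8 * (K * qm v (K * T) (x, T))
      + 8 * (d / T) * (2 * en v (x, T) + v (x, T) ^ 2)) := j1.add (ia.const_mul _)
  have j3 : Integrable (fun x => 8 * en v (x, T) + 8 * (K * qm v (K * T) (x, T))
      + 8 * (d / T) * (2 * en v (x, T) + v (x, T) ^ 2) + 8 * (R / T) * en v (x, T)) := j2.add (ie.const_mul _)
  have h1 := integral_mono_ae (ie.add ib) (j3.add (ii.const_mul (8 * K))) pt
  rw [integral_add' ie ib, integral_add' j3 (ii.const_mul (8 * K)), integral_add j2 (ie.const_mul _),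
    integral_add j1 (ia.const_mul _), integral_add (ie.const_mul 8) ((iq.const_mul K).const_mul 8),
    integral_const_mul, integral_const_mul, integral_const_mul, integral_const_mul, integral_const_mul,
    integral_const_mul, integral_add (ie.const_mul 2) i2, integral_const_mul, integral_indicator mR] at h1
  rw [show ∫ x, en v (x, T) = E from ET] at h1
  have h2 := htail T hT.le
  have h3 := (hA T).2
  have h4 : 8 * (d / T) * (2 * E + ∫ x, v (x, T) ^ 2) ≤ δ / 6 := by
    have : 8 * (d / T) * (2 * E + ∫ x, v (x, T) ^ 2) ≤ 8 * (d / T) * (2 * E + A) := by gcongr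
    refine this.trans ?_
    rw [div_le_iff₀ hδ] at e6
    rw [show 8 * (d / T) * (2 * E + A) = 8 * (d * (2 * E + A)) / T by ring, div_le_div_iff₀ hT (by norm_num)]
    linarith
  have h5 : 8 * (R / T) * E ≤ δ / 6 := by
    rw [div_le_iff₀ hδ] at e5
    rw [show 8 * (R / T) * E = 8 * (R * E) / T by ring, div_le_div_iff₀ hT (by norm_num)]
    linarith
  have h6 := mul_le_mul_of_nonneg_left h2 (show 0 ≤ 8 * K by positivity)
  have h7 : K * (∫ x, qm v (K * T) (x, 0)) ≤ δ / 48 := by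
    have := mul_le_mul_of_nonneg_left e2 hK0.le
    rwa [show K * (δ / (48 * K)) = δ / 48 by field_simp] at this
  have h8 : 8 * (6 / K ^ 2 * E) ≤ δ / 6 := by
    rw [show 8 * (6 / K ^ 2 * E) = 48 * E / K ^ 2 by ring]; exact hKE
  linarith

end Coulomb

namespace Coulomb
open scoped Topology
set_option linter.unusedSectionVars false
variable {d : ℕ} {v w : Spc d × ℝ → ℝ} [Fact (3 ≤ d)]

/-! ### Smallness of the energy far inside the light cone -/

/-- A cutoff to `t - |x| ≲ W`. -/
noncomputable def cb (W : ℝ) (q : Spc d × ℝ) : ℝ := 1 - th ((q.2 - ‖q.1‖) / W - 1)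

/-- The radial derivative of `cb`. -/
noncomputable def cb' (W : ℝ) (q : Spc d × ℝ) : ℝ := deriv th ((q.2 - ‖q.1‖) / W - 1) / W

/-- The weight `k |x|^{-n} cb`. -/
noncomputable def cw (d : ℕ) (k : ℝ) (n : ℕ) (W : ℝ) (q : Spc d × ℝ) : ℝ := k * cb W q / ‖q.1‖ ^ n

noncomputable def cF (k : ℝ) (n : ℕ) (W : ℝ) (z : ℝ × ℝ) : ℝ :=
  k * (1 - th ((z.2 - z.1) / W - 1)) / z.1 ^ n

lemma cF_cd (k : ℝ) (n : ℕ) (W : ℝ) : ContDiffOn ℝ 1 (cF k n W) (Set.Ioi 0 ×ˢ Set.univ) := by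
  unfold cF
  refine ContDiffOn.div ?_ (contDiff_fst.pow n).contDiffOn fun z hz => pow_ne_zero n (Set.mem_Ioi.1 hz.1).ne'
  refine ContDiff.contDiffOn (contDiff_const.mul (contDiff_const.sub (th_cd1.comp ?_)))
  exact ((contDiff_snd.sub contDiff_fst).div_const W).sub contDiff_const

lemma cF_meas (k : ℝ) (n : ℕ) (W : ℝ) : Measurable (cF k n W) := by
  unfold cF
  have := th_meas
  fun_prop

lemma rad_cw (k : ℝ) (n : ℕ) (W : ℝ) : Rad (cw d k n W) := Rad.of (cF_cd k n W) (cF_meas k n W)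

lemma Dt_cw (k : ℝ) (n : ℕ) (W : ℝ) {q : Spc d × ℝ} (hq : q ∈ Om d) :
    Dt (cw d k n W) q = -(k * cb' W q) / ‖q.1‖ ^ n := by
  refine Dt_of (cF_cd k n W) hq ?_
  have h1 : HasDerivAt (fun s : ℝ => (s - ‖q.1‖) / W - 1) (1 / W) q.2 :=
    (((hasDerivAt_id q.2).sub_const _).div_const W).sub_const 1
  have h2 := ((((th_hd _).comp q.2 h1).const_sub 1).const_mul k).div_const (‖q.1‖ ^ n)
  refine h2.congr_deriv ?_
  simp only [cb']; ring

lemma ra_cw (k : ℝ) (n : ℕ) (W : ℝ) {q : Spc d × ℝ} (hq : q ∈ Om d) :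
    ra (cw d k n W) q = k * cb' W q / ‖q.1‖ ^ (n + 1) - n * (k * cb W q) / ‖q.1‖ ^ (n + 2) := by
  have hr := norm_pos_Om hq
  have h1 : HasDerivAt (fun s : ℝ => (q.2 - s) / W - 1) (-1 / W) ‖q.1‖ :=
    (((hasDerivAt_id ‖q.1‖).const_sub _).div_const W).sub_const 1
  have h2 := ((((th_hd _).comp ‖q.1‖ h1).const_sub 1).const_mul k).div (hasDerivAt_pow n ‖q.1‖)
    (pow_ne_zero n hr.ne')
  refine (ra_of (cF_cd k n W) hq h2).trans ?_
  simp only [cb', cb, Function.comp]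
  rcases n with _ | n
  · simp; ring
  · simp only [Nat.add_sub_cancel]
    field_simp
    push_cast
    ring

lemma cb_nonneg (W : ℝ) (q : Spc d × ℝ) : 0 ≤ cb W q := sub_nonneg.2 (th_le_one _)

lemma cb_le_one (W : ℝ) (q : Spc d × ℝ) : cb W q ≤ 1 := sub_le_self _ (th_nonneg _)

lemma cb_meas (W : ℝ) : Measurable (cb W : Spc d × ℝ → ℝ) := by
  have := th_meas
  unfold cb
  fun_prop

lemma cb_one {W : ℝ} (hW : 0 < W) {q : Spc d × ℝ} (h : q.2 - W ≤ ‖q.1‖) : cb W q = 1 := by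
  rw [cb, th_zero, sub_zero]
  rw [sub_nonpos, div_le_one hW]; linarith

lemma cb_zero {W : ℝ} (hW : 0 < W) {q : Spc d × ℝ} (h : ‖q.1‖ < q.2 - 2 * W) : cb W q = 0 ∧ cb' W q = 0 := by
  have : 1 < (q.2 - ‖q.1‖) / W - 1 := by
    rw [lt_sub_iff_add_lt, lt_div_iff₀ hW]; linarith
  rw [cb, cb', th_one this.le, th'_gt this]; simp

lemma cb'_nonneg {W : ℝ} (hW : 0 < W) (q : Spc d × ℝ) : 0 ≤ cb' W q := div_nonneg (th'_nonneg _) hW.le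

/-- The multiplier identity, as an inequality in the variables `r`, `Dt v`, `v`, `∂_r v`, `|∇v|²`. -/
lemma bulk_hI_eq (W : ℝ) (v : Spc d × ℝ → ℝ) {q : Spc d × ℝ} (hq : q ∈ Om d) :
    bulk v (cw d 1 1 W) (cw d ((d - 1) / 2) 1 W) q + hI v (cw d (1 / 2) 2 W) q =
      -cb' W q * (Dt v q * (Dr v q / ‖q.1‖) + (d - 1) / 2 / ‖q.1‖ * v q * (Dt v q + Dr v q / ‖q.1‖) +
        1 / 2 * (Dt v q ^ 2 - Ns v q) + (Dr v q / ‖q.1‖) ^ 2 - v q ^ 2 / (2 * ‖q.1‖)) -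
      cb W q / ‖q.1‖ ^ 3 * (‖q.1‖ ^ 2 * Ns v q - Dr v q ^ 2) +
      (d - 1) / 2 / ‖q.1‖ ^ 2 * cb W q * (v q * (Dr v q / ‖q.1‖)) - cb W q * v q ^ 2 / (2 * ‖q.1‖ ^ 2) := by
  have hr := norm_pos_Om hq
  simp only [bulk, hI, Dt_cw _ _ _ hq, ra_cw _ _ _ hq, cw]
  push_cast
  field_simp
  ring

lemma inner_scalar {T V S N a k n r t : ℝ} (hk : 0 ≤ k) (hkn : k ≤ n / 2) (hn : 3 ≤ n) (hr : 0 < r) (ht : 0 < t)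
    (hrt : 1 / r ≤ 2 / t) (hr2 : 1 / r ^ 2 ≤ 1 / r) (ha : 0 ≤ a) (hS : S ^ 2 = N - a / r ^ 2) :
    -(T * S + k / r * V * (T + S) + 1 / 2 * (T ^ 2 - N) + S ^ 2 - V ^ 2 / (2 * r)) ≤
      2 / t * (a + n ^ 2 * V ^ 2) := by
  have e1 : V ^ 2 / (2 * r) = 1 / r * (V ^ 2 / 2) := by field_simp
  have e2 : a / r ^ 2 = 1 / r ^ 2 * a := by ring
  have e3 : k / r * V * (T + S) = (1 / r * (k * V)) * (T + S) := by ring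
  have h3 : (1 / r * (k * V)) ^ 2 ≤ 1 / r * (k * V) ^ 2 := by
    rw [mul_pow, one_div_pow]; exact mul_le_mul_of_nonneg_right hr2 (sq_nonneg _)
  have h4 := mul_le_mul_of_nonneg_right hr2 ha
  have h5 : 1 / r * (a / 2 + (k * V) ^ 2 / 2 + V ^ 2 / 2) ≤ 2 / t * (a + n ^ 2 * V ^ 2) := by
    refine mul_le_mul hrt ?_ (by positivity) (by positivity)
    have h5 : k ^ 2 ≤ n ^ 2 / 4 := by nlinarith
    have h6 : (1 : ℝ) ≤ n ^ 2 / 4 := by nlinarith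
    have h7 := mul_le_mul_of_nonneg_right h5 (sq_nonneg V)
    have h8 := mul_le_mul_of_nonneg_right h6 (sq_nonneg V)
    rw [mul_pow]
    linarith [sq_nonneg V]
  rw [e3, e1]
  rw [e2] at hS
  have h9 := sq_nonneg (T + S + 1 / r * (k * V))
  set m := 1 / r * (k * V)
  have h10 : (T + S + m) ^ 2 = T ^ 2 + S ^ 2 + 2 * (T * S) + 2 * (m * (T + S)) + m ^ 2 := by ring
  linarith

lemma bulk_hI_le {W D t : ℝ} (hW : 1 / 2 ≤ W) (hD : ∀ s, |deriv th s| ≤ D) (v : Spc d × ℝ → ℝ)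
    {q : Spc d × ℝ} (hq : q ∈ Om d) (ht : 4 * W ≤ q.2) (hqt : q.2 = t) :
    bulk v (cw d 1 1 W) (cw d ((d - 1) / 2) 1 W) q + hI v (cw d (1 / 2) 2 W) q ≤
      2 * D / (W * t) * ((‖q.1‖ ^ 2 * Ns v q - Dr v q ^ 2) + d ^ 2 * v q ^ 2) +
        d / (W * t) * (v q ^ 2 + en v q) := by
  have hr := norm_pos_Om hq
  have hW0 : 0 < W := by linarith
  have ht0 : 0 < t := by linarith
  have hd := three_le d
  have ha := ang_nonneg v q
  have he := en_nonneg v q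
  have hD0 : 0 ≤ D := (abs_nonneg _).trans (hD 0)
  rw [bulk_hI_eq W v hq]
  rcases lt_or_ge ‖q.1‖ (q.2 - 2 * W) with h | h
  · rw [(cb_zero hW0 h).1, (cb_zero hW0 h).2]
    simp only [neg_zero, zero_mul, zero_div, mul_zero, sub_zero, add_zero]
    positivity
  have b0 := cb_nonneg W q
  have b1 := cb_le_one W q
  have c0 := cb'_nonneg hW0 q
  have c1 : cb' W q ≤ D / W := div_le_div_of_nonneg_right ((le_abs_self _).trans (hD _)) hW0.le
  have hS : (Dr v q / ‖q.1‖) ^ 2 = Ns v q - (‖q.1‖ ^ 2 * Ns v q - Dr v q ^ 2) / ‖q.1‖ ^ 2 := by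
    field_simp; ring
  have hS2 : (Dr v q / ‖q.1‖) ^ 2 ≤ 2 * en v q := by
    rw [hS]; have := Ns_le_en v q
    have : 0 ≤ (‖q.1‖ ^ 2 * Ns v q - Dr v q ^ 2) / ‖q.1‖ ^ 2 := by positivity
    linarith
  set a := ‖q.1‖ ^ 2 * Ns v q - Dr v q ^ 2
  set S := Dr v q / ‖q.1‖
  set r := ‖q.1‖
  set b := cb W q
  set c := cb' W q
  set k : ℝ := (d - 1) / 2 with hk
  have hk0 : 0 ≤ k := by rw [hk]; linarith
  have hkd : k ≤ d / 2 := by rw [hk]; linarith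
  have hr1 : 1 ≤ r := by linarith
  have hrt : 1 / r ≤ 2 / t := by rw [div_le_div_iff₀ hr ht0]; linarith
  have hr2 : 1 / r ^ 2 ≤ 1 / r := by
    refine one_div_le_one_div_of_le hr ?_; nlinarith
  have hrW : 1 / r ^ 2 ≤ 1 / (W * t) := by
    refine one_div_le_one_div_of_le (by positivity) ?_
    nlinarith
  have X1 := inner_scalar (T := Dt v q) (V := v q) (N := Ns v q) hk0 (by linarith) hd hr ht0 hrt hr2 ha hS
  have X2 : -c * (Dt v q * S + k / r * v q * (Dt v q + S) + 1 / 2 * (Dt v q ^ 2 - Ns v q) + S ^ 2 - v q ^ 2 / (2 * r))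
      ≤ 2 * D / (W * t) * (a + d ^ 2 * v q ^ 2) := by
    have h1 := mul_le_mul_of_nonneg_left X1 c0
    have h2 : c * (2 / t * (a + d ^ 2 * v q ^ 2)) ≤ D / W * (2 / t * (a + d ^ 2 * v q ^ 2)) :=
      mul_le_mul_of_nonneg_right c1 (by positivity)
    have e : D / W * (2 / t * (a + d ^ 2 * v q ^ 2)) = 2 * D / (W * t) * (a + d ^ 2 * v q ^ 2) := by
      field_simp
    linarith
  have X3 : k / r ^ 2 * b * (v q * S) ≤ d / (W * t) * (v q ^ 2 + en v q) := by
    have h1 : v q * S ≤ v q ^ 2 + en v q := by nlinarith [sq_nonneg (v q - S)]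
    have h2 : k / r ^ 2 * b ≤ d / (W * t) := by
      calc k / r ^ 2 * b ≤ k / r ^ 2 * 1 := by gcongr
        _ = k * (1 / r ^ 2) := by ring
        _ ≤ d * (1 / (W * t)) := mul_le_mul (by linarith) hrW (by positivity) (by positivity)
        _ = _ := by ring
    exact (mul_le_mul_of_nonneg_left h1 (by positivity)).trans
      (mul_le_mul_of_nonneg_right h2 (by positivity))
  have X4 : 0 ≤ b / r ^ 3 * a := by positivity
  have X5 : 0 ≤ b * v q ^ 2 / (2 * r ^ 2) := by positivity
  linarith

lemma qM_near {W : ℝ} (hW : 1 / 2 ≤ W) (v : Spc d × ℝ → ℝ) {q : Spc d × ℝ} (hq : q ∈ Om d)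
    (ht : 4 * W ≤ q.2) :
    |qM v (cw d 1 1 W) (cw d ((d - 1) / 2) 1 W) q - cb W q * (Dt v q * Dr v q / ‖q.1‖)| ≤
      d / W * (2 * en v q + v q ^ 2) := by
  have hr := norm_pos_Om hq
  have hW0 : 0 < W := by linarith
  have hd := three_le d
  have he := en_nonneg v q
  have e : qM v (cw d 1 1 W) (cw d ((d - 1) / 2) 1 W) q - cb W q * (Dt v q * Dr v q / ‖q.1‖) =
      (d - 1) / 2 / ‖q.1‖ * cb W q * (Dt v q * v q) := by
    simp only [qM, cw]; field_simp; ring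
  rw [e]
  rcases lt_or_ge ‖q.1‖ (q.2 - 2 * W) with h | h
  · rw [(cb_zero hW0 h).1]
    simp only [zero_mul, mul_zero, abs_zero]
    positivity
  have b0 := cb_nonneg W q
  have b1 := cb_le_one W q
  have hk0 : (0 : ℝ) ≤ (d - 1) / 2 := by linarith
  rw [abs_mul, abs_of_nonneg (by positivity : 0 ≤ (d - 1) / 2 / ‖q.1‖ * cb W q)]
  refine mul_le_mul ?_ ?_ (abs_nonneg _) (by positivity)
  · calc (d - 1) / 2 / ‖q.1‖ * cb W q ≤ (d - 1) / 2 / ‖q.1‖ * 1 := by gcongr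
      _ ≤ d / W := by
        rw [mul_one]
        exact div_le_div₀ (by positivity) (by linarith) hW0 (by linarith)
  · have := abs_mul_le_half (Dt v q) (v q)
    have := Dt_sq_le_en v q
    nlinarith [sq_nonneg (v q)]

lemma MW_cw {W D : ℝ} (hW : 1 / 2 ≤ W) (hD : ∀ s, |deriv th s| ≤ D) (t1 : ℝ) :
    MW (cw d 1 1 W) (cw d ((d - 1) / 2) 1 W) (4 * W) t1 ((d : ℝ) ^ 2 * (2 * D + 1) ^ 2) := by
  have hW0 : 0 < W := by linarith
  have hd := three_le d
  have hD0 : 0 ≤ D := (abs_nonneg _).trans (hD 0)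
  have hk0 : (0 : ℝ) ≤ (d - 1) / 2 := by linarith
  have hkd : ((d - 1) / 2 : ℝ) ≤ d := by linarith
  have hD1 : 2 * D + 1 ≤ (2 * D + 1) ^ 2 := by nlinarith
  have hd2 : (d : ℝ) ≤ d ^ 2 := by nlinarith
  have hdC : (d : ℝ) ≤ (d : ℝ) ^ 2 * (2 * D + 1) ^ 2 := by nlinarith
  have hDC : 2 * D + 1 ≤ (d : ℝ) ^ 2 * (2 * D + 1) ^ 2 := by nlinarith
  have key : ∀ q ∈ Om d, q.2 ∈ Set.Icc (4 * W) t1 → (cb W q = 0 ∧ cb' W q = 0) ∨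
      (1 ≤ ‖q.1‖ ∧ 0 ≤ cb' W q ∧ cb' W q ≤ 2 * D) := fun q hq ht => by
    rcases lt_or_ge ‖q.1‖ (q.2 - 2 * W) with h | h
    · exact Or.inl (cb_zero hW0 h)
    · refine Or.inr ⟨by linarith [ht.1], cb'_nonneg hW0 q, ?_⟩
      rw [cb', div_le_iff₀ hW0]
      have := (le_abs_self _).trans (hD ((q.2 - ‖q.1‖) / W - 1))
      nlinarith
  have kd2 : ((d - 1) / 2 : ℝ) ^ 2 ≤ d ^ 2 := pow_le_pow_left₀ hk0 hkd 2
  have sq_bd : ∀ {x r : ℝ}, 1 ≤ r → |x| ≤ 2 * D + 1 → ((d - 1) / 2 * x) ^ 2 / r ≤ (d : ℝ) ^ 2 * (2 * D + 1) ^ 2 := by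
    intro x r hr hx
    refine (div_le_self (sq_nonneg _) hr).trans ?_
    rw [mul_pow, ← sq_abs x]
    exact mul_le_mul kd2 (pow_le_pow_left₀ (abs_nonneg _) hx 2) (sq_nonneg _) (sq_nonneg _)
  have zero : (0 : ℝ) ≤ (d : ℝ) ^ 2 * (2 * D + 1) ^ 2 := by positivity
  refine ⟨rad_cw _ _ _, rad_cw _ _ _, ?_, ?_, ?_, ?_, ?_, ?_, ?_, ?_⟩ <;> intro q hq ht <;>
    have hr := norm_pos_Om hq <;> have b0 := cb_nonneg W q <;> have b1 := cb_le_one W q <;>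
    (try rw [Dt_cw _ _ _ hq]) <;> (try rw [ra_cw _ _ _ hq]) <;> (try rw [cw]) <;>
    rcases key q hq ht with ⟨k1, k2⟩ | ⟨r1, c0, c1⟩ <;>
    (try (simp only [k1, k2, mul_zero, zero_div, neg_zero, sub_zero, abs_zero, ne_eq, OfNat.ofNat_ne_zero,
      not_false_eq_true, zero_pow]; exact zero))
  · rw [abs_of_nonneg (by positivity), one_mul, pow_one]
    refine (div_le_self b0 r1).trans ?_; linarith
  · rw [abs_of_nonneg (by positivity), one_mul, pow_one, mul_div_cancel₀ _ hr.ne']; linarith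
  · have e : ‖q.1‖ ^ 2 * |1 * cb' W q / ‖q.1‖ ^ (1 + 1) - ((1 : ℕ) : ℝ) * (1 * cb W q) / ‖q.1‖ ^ (1 + 2)| =
        |cb' W q - cb W q / ‖q.1‖| := by
      rw [← abs_of_nonneg (sq_nonneg ‖q.1‖), ← abs_mul, abs_of_nonneg (sq_nonneg ‖q.1‖)]
      congr 1; push_cast; field_simp
    rw [e, abs_le]
    have h1 := div_le_self b0 r1
    have h2 : 0 ≤ cb W q / ‖q.1‖ := by positivity
    constructor <;> linarith
  · rw [neg_div, abs_neg, abs_of_nonneg (by positivity), one_mul, pow_one, mul_div_cancel₀ _ hr.ne']; linarith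
  · rw [abs_of_nonneg (by positivity), pow_one]
    refine (div_le_self (by positivity) r1).trans ?_
    nlinarith
  · have e : ‖q.1‖ * ((d - 1) / 2 * cb W q / ‖q.1‖ ^ 1) ^ 2 = ((d - 1) / 2 * cb W q) ^ 2 / ‖q.1‖ := by field_simp
    rw [e]
    exact sq_bd r1 (by rw [abs_of_nonneg b0]; linarith)
  · have e : ‖q.1‖ ^ 3 * ((d - 1) / 2 * cb' W q / ‖q.1‖ ^ (1 + 1) -
        ((1 : ℕ) : ℝ) * ((d - 1) / 2 * cb W q) / ‖q.1‖ ^ (1 + 2)) ^ 2 =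
        ((d - 1) / 2 * (cb' W q - cb W q / ‖q.1‖)) ^ 2 / ‖q.1‖ := by push_cast; field_simp
    rw [e]
    have h1 := div_le_self b0 r1
    have h2 : 0 ≤ cb W q / ‖q.1‖ := by positivity
    exact sq_bd r1 (by rw [abs_le]; constructor <;> linarith)
  · have e : ‖q.1‖ * (-((d - 1) / 2 * cb' W q) / ‖q.1‖ ^ 1) ^ 2 = ((d - 1) / 2 * cb' W q) ^ 2 / ‖q.1‖ := by
      field_simp
    rw [e]
    exact sq_bd r1 (by rw [abs_of_nonneg c0]; linarith)

lemma hI_cw_zero (hv : IsW0 v) {W D t : ℝ} (hW : 1 / 2 ≤ W) (hD : ∀ s, |deriv th s| ≤ D) (ht : 4 * W ≤ t) :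
    Integrable (fun x => hI v (cw d (1 / 2) 2 W) (x, t)) ∧ ∫ x, hI v (cw d (1 / 2) 2 W) (x, t) = 0 := by
  have hW0 : 0 < W := by linarith
  have hd := three_le d
  have hD0 : 0 ≤ D := (abs_nonneg _).trans (hD 0)
  have key : ∀ x : Spc d, x ≠ 0 → (cb W (x, t) = 0 ∧ cb' W (x, t) = 0) ∨
      (1 ≤ ‖x‖ ∧ 0 ≤ cb' W (x, t) ∧ cb' W (x, t) ≤ 2 * D) := fun x hx => by
    rcases lt_or_ge ‖x‖ (t - 2 * W) with h | h
    · exact Or.inl (cb_zero hW0 h)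
    · refine Or.inr ⟨by linarith, cb'_nonneg hW0 _, ?_⟩
      rw [cb', div_le_iff₀ hW0]
      have := (le_abs_self _).trans (hD ((t - ‖x‖) / W - 1))
      nlinarith
  have zero : (0 : ℝ) ≤ d + D := by positivity
  refine H_full (C := d + D) hv (rad_cw _ _ _) ?_ ?_ ?_ <;> intro x hx <;>
    have hr : 0 < ‖x‖ := norm_pos_iff.2 hx <;>
    have b0 := cb_nonneg W (x, t) <;> have b1 := cb_le_one W (x, t) <;>
    (try rw [ra_cw _ _ _ (show (x, t) ∈ Om d from mem_Om.2 hx)]) <;> rw [cw] <;>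
    rcases key x hx with ⟨k1, k2⟩ | ⟨r1, c0, c1⟩ <;>
    (try (simp only [k1, k2, mul_zero, zero_div, sub_zero, abs_zero, ne_eq, OfNat.ofNat_ne_zero,
      not_false_eq_true, zero_pow, add_zero, zero_mul]; exact zero))
  · rw [abs_of_nonneg (by positivity)]
    have e : ‖x‖ * (1 / 2 * cb W (x, t) / ‖x‖ ^ 2) = 1 / 2 * cb W (x, t) / ‖x‖ := by field_simp
    rw [e]
    refine (div_le_self (by positivity) r1).trans ?_
    linarith
  · have e : ‖x‖ * (1 / 2 * cb W (x, t) / ‖x‖ ^ 2) ^ 2 * ‖x‖ ^ 2 = (1 / 2 * cb W (x, t)) ^ 2 / ‖x‖ := by field_simp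
    simp only at e ⊢
    rw [e]
    refine (div_le_self (by positivity) r1).trans ?_
    nlinarith
  · have e : ‖x‖ * |(d : ℝ) * (1 / 2 * cb W (x, t) / ‖x‖ ^ 2) + ‖x‖ ^ 2 * (1 / 2 * cb' W (x, t) / ‖x‖ ^ (2 + 1) -
        ((2 : ℕ) : ℝ) * (1 / 2 * cb W (x, t)) / ‖x‖ ^ (2 + 2))| =
        |1 / 2 * cb' W (x, t) + (d / 2 - 1) * (cb W (x, t) / ‖x‖)| := by
      rw [← abs_of_pos hr, ← abs_mul, abs_of_pos hr]
      congr 1; push_cast; field_simp; ring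
    simp only at e ⊢
    rw [e]
    have h1 := div_le_self b0 r1
    have h2 : 0 ≤ cb W (x, t) / ‖x‖ := by positivity
    have h3 : (0 : ℝ) ≤ d / 2 - 1 := by linarith
    rw [abs_of_nonneg (by positivity)]
    have : (d / 2 - 1) * (cb W (x, t) / ‖x‖) ≤ (d / 2 - 1 : ℝ) * 1 := mul_le_mul_of_nonneg_left (by linarith) h3
    linarith

lemma bulk_slice_le (hv : IsW v) {W D t A : ℝ} (hW : 1 / 2 ≤ W) (hD : ∀ s, |deriv th s| ≤ D) (hA : 0 ≤ A)
    (h2 : L2b v A) (h3 : Ang v A) (ht : 4 * W ≤ t) :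
    ∫ x, bulk v (cw d 1 1 W) (cw d ((d - 1) / 2) 1 W) (x, t) ≤
      (2 * D * (A + d ^ 2 * A) + d * (A + Eg v 0)) / W * t⁻¹ := by
  have hW0 : 0 < W := by linarith
  have ht0 : 0 < t := by linarith
  have hd := three_le d
  have hE := Eg_nonneg v 0
  have hD0 : 0 ≤ D := (abs_nonneg _).trans (hD 0)
  by_cases hi : Integrable (fun x => bulk v (cw d 1 1 W) (cw d ((d - 1) / 2) 1 W) (x, t))
  swap
  · rw [integral_undef hi]; positivity
  obtain ⟨i1, e1⟩ := hI_cw_zero hv.toIsW0 hW hD ht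
  obtain ⟨i2, e2⟩ := h2 t
  obtain ⟨i3, e3⟩ := h3 t
  have i4 := hv.int t
  have j1 : Integrable (fun x => (‖x‖ ^ 2 * Ns v (x, t) - Dr v (x, t) ^ 2) + d ^ 2 * v (x, t) ^ 2) :=
    i3.add (i2.const_mul _)
  have j2 : Integrable (fun x => v (x, t) ^ 2 + en v (x, t)) := i2.add i4
  have h := integral_mono_ae (hi.add i1) ((j1.const_mul (2 * D / (W * t))).add (j2.const_mul (d / (W * t))))
    (ae_ne.mono fun x hx => bulk_hI_le hW hD v (q := (x, t)) (mem_Om.2 hx) ht rfl)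
  rw [integral_add' hi i1, integral_add' (j1.const_mul _) (j2.const_mul _), e1, integral_const_mul, integral_const_mul,
    integral_add i3 (i2.const_mul _), integral_add i2 i4, integral_const_mul,
    show ∫ x, en v (x, t) = Eg v 0 from hv.conserve t 0, add_zero] at h
  refine h.trans ?_
  calc _ ≤ 2 * D / (W * t) * (A + d ^ 2 * A) + d / (W * t) * (A + Eg v 0) := by gcongr
    _ = _ := by field_simp

lemma qM_near_int (hv : IsW v) {A D : ℝ} (hD : ∀ s, |deriv th s| ≤ D) (h2 : L2b v A)
    {W t : ℝ} (hW : 1 / 2 ≤ W) (ht : 4 * W ≤ t) :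
    Integrable (fun x => cb W (x, t) * (Dt v (x, t) * Dr v (x, t) / ‖x‖)) ∧
      |(∫ x, qM v (cw d 1 1 W) (cw d ((d - 1) / 2) 1 W) (x, t)) -
        ∫ x, cb W (x, t) * (Dt v (x, t) * Dr v (x, t) / ‖x‖)| ≤ d / W * (2 * Eg v 0 + A) := by
  have h0 := hv.toIsW0
  have hW0 : 0 < W := by linarith
  have mv := h0.meas
  have ic : Integrable (fun x => cb W (x, t) * (Dt v (x, t) * Dr v (x, t) / ‖x‖)) := by
    refine (hv.int t).mono' ?_ (ae_ne.mono fun x hx => ?_)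
    · have m1 := slice_meas (meas_Dt (v := v) ) t
      have m2 := slice_meas (meas_Dr (v := v) ) t
      have m3 := slice_meas (cb_meas (d := d) W) t
      exact (m3.mul ((m1.mul m2).div measurable_norm)).aestronglyMeasurable
    · rw [norm_mul, Real.norm_eq_abs, Real.norm_eq_abs, abs_of_nonneg (cb_nonneg _ _)]
      have h1 := TSr_le v (q := (x, t)) (mem_Om.2 hx)
      calc _ ≤ 1 * |Dt v (x, t) * Dr v (x, t) / ‖x‖| :=
            mul_le_mul_of_nonneg_right (cb_le_one _ _) (abs_nonneg _)
        _ ≤ _ := by rw [one_mul]; exact h1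
  refine ⟨ic, ?_⟩
  have iq := (MW_cw hW hD t).int_qM h0 ⟨ht, le_rfl⟩
  obtain ⟨i2, e2⟩ := h2 t
  have i4 := hv.int t
  rw [← integral_sub iq ic]
  refine abs_integral_le_integral_abs.trans ?_
  have j : Integrable (fun x => 2 * en v (x, t) + v (x, t) ^ 2) := (i4.const_mul 2).add i2
  refine (integral_mono_ae (iq.sub ic).abs (j.const_mul (d / W)) (ae_ne.mono fun x hx =>
    qM_near hW v (q := (x, t)) (mem_Om.2 hx) ht)).trans ?_
  rw [integral_const_mul, integral_add (i4.const_mul 2) i2, integral_const_mul,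
    show ∫ x, en v (x, t) = Eg v 0 from hv.conserve t 0]
  gcongr

lemma interior_bound (hv : IsW v) {A D : ℝ} (hD : ∀ s, |deriv th s| ≤ D) (hA : 0 ≤ A) (h2 : L2b v A) (h3 : Ang v A)
    {W T : ℝ} (hW : 1 / 2 ≤ W) (hT : 4 * W ≤ T) :
    ∫ x in {x | ‖x‖ < T - 2 * W}, en v (x, T) ≤
      (Eg v 0 + ∫ x, cb W (x, 4 * W) * (Dt v (x, 4 * W) * Dr v (x, 4 * W) / ‖x‖)) +
      2 * (d / W * (2 * Eg v 0 + A)) +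
      (2 * D * (A + d ^ 2 * A) + d * (A + Eg v 0)) / W * Real.log T := by
  have hW0 : 0 < W := by linarith
  have hT0 : 0 < T := by linarith
  have hd := three_le d
  have h0 := hv.toIsW0
  set P := (2 * D * (A + d ^ 2 * A) + d * (A + Eg v 0)) with hP
  have hP0 : 0 ≤ P := by
    have hE := Eg_nonneg v 0
    have hD0 : 0 ≤ D := (abs_nonneg _).trans (hD 0)
    positivity
  have hMW := MW_cw (d := d) hW hD T
  obtain ⟨ib, eb⟩ := M_full h0 hMW hT
  have hcont : ContinuousOn (fun t : ℝ => P / W * t⁻¹) (Set.uIcc (4 * W) T) :=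
    continuousOn_const.mul (continuousOn_id.inv₀ fun t ht => by
      rw [Set.uIcc_of_le hT] at ht
      have : 0 < t := by linarith [ht.1]
      exact this.ne')
  have hb := slab_le hT ib hcont.intervalIntegrable fun t ht => bulk_slice_le hv hW hD hA h2 h3 ht.1
  rw [intervalIntegral.integral_const_mul, integral_inv_of_pos (by linarith) hT0] at hb
  have hlog : Real.log (T / (4 * W)) ≤ Real.log T :=
    Real.log_le_log (by positivity) (div_le_self hT0.le (by linarith))
  have hb2 := hb.trans (mul_le_mul_of_nonneg_left hlog (by positivity : 0 ≤ P / W))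
  obtain ⟨-, n1⟩ := qM_near_int hv hD h2 hW le_rfl
  obtain ⟨ic, n2⟩ := qM_near_int hv hD h2 hW hT
  have n1 := (abs_le.1 n1).2
  have n2 := (abs_le.1 n2).1
  have mS : MeasurableSet {x : Spc d | ‖x‖ < T - 2 * W} := measurableSet_lt (by fun_prop) (by fun_prop)
  have i4 := hv.int T
  have pt : ∀ x : Spc d, x ≠ 0 → {x : Spc d | ‖x‖ < T - 2 * W}.indicator (fun x => en v (x, T)) x ≤
      en v (x, T) + cb W (x, T) * (Dt v (x, T) * Dr v (x, T) / ‖x‖) := fun x hx => by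
    have h1 : -en v (x, T) ≤ Dt v (x, T) * Dr v (x, T) / ‖x‖ := (TSr_bds v (mem_Om.2 hx)).1
    have he := en_nonneg v (x, T)
    have b0 := cb_nonneg W (x, T)
    have b1 := cb_le_one W (x, T)
    by_cases hS : ‖x‖ < T - 2 * W
    · rw [Set.indicator_of_mem (show x ∈ {x : Spc d | ‖x‖ < T - 2 * W} from hS), (cb_zero (q := (x, T)) hW0 hS).1]
      simp
    · rw [Set.indicator_of_notMem (show x ∉ {x : Spc d | ‖x‖ < T - 2 * W} from hS)]
      have h6 := mul_le_mul_of_nonneg_left h1 b0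
      have h7 := mul_le_mul_of_nonneg_right b1 he
      linarith
  have h5 := integral_mono_ae (i4.indicator mS) (i4.add ic) (ae_ne.mono pt)
  rw [integral_indicator mS, integral_add' i4 ic, show ∫ x, en v (x, T) = Eg v 0 from hv.conserve T 0] at h5
  linarith

theorem interior_small (hv : IsW v) {ε : ℝ} (hε : 0 < ε) : ∃ C, 0 < C ∧ ∀ c ≥ C, ∀ᶠ T in atTop,
    ∫ x in {x | ‖x‖ < T - c * Real.log T}, en v (x, T) ≤ ε := by
  obtain ⟨w, A, hA, hw, hclose, h2, h3⟩ := approx_ang hv (ε := ε / 4) (by positivity)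
  obtain ⟨D, hD0, hD⟩ := th'_bound
  set P := (2 * D * (A + d ^ 2 * A) + d * (A + Eg w 0)) with hP
  set Q := 2 * (d * (2 * Eg w 0 + A)) with hQ
  set δ := ε / 12 with hδd
  have hδ : 0 < δ := by positivity
  have hE := Eg_nonneg w 0
  have hP0 : 0 ≤ P := by positivity
  refine ⟨2 * P / δ + 1, by positivity, fun c hc => ?_⟩
  have hc0 : 0 < c := lt_of_lt_of_le (by positivity) hc
  have hPc : 2 * P / c ≤ δ := by
    rw [div_le_iff₀ hc0]
    have : 2 * P / δ ≤ c := by linarith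
    rw [div_le_iff₀ hδ] at this
    linarith
  have hlim : Tendsto (fun T => c / 2 * Real.log T) atTop atTop :=
    Real.tendsto_log_atTop.const_mul_atTop (by positivity)
  have hlim4 : Tendsto (fun T => 4 * (c / 2 * Real.log T)) atTop atTop := hlim.const_mul_atTop (by norm_num)
  filter_upwards [hlim4.eventually (outgoing hw h2 hδ), hlim.eventually_ge_atTop (1 / 2),
    hlim.eventually_ge_atTop (Q / δ), log_le_sqrt (c := 2 * c) (by positivity), eventually_gt_atTop 1]
    with T e1 e2 e3 e4 e5
  have hlog : 0 < Real.log T := Real.log_pos e5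
  set W := c / 2 * Real.log T with hW
  have hW0 : 0 < W := by linarith
  have hs : √T ≤ T := Real.sqrt_le_self_iff.2 (Or.inr e5.le)
  have h4T : 4 * W ≤ T := by rw [hW]; linarith
  have k1 := interior_bound hw hD hA h2 h3 e2 h4T
  have k2 := e1 (fun x => cb W (x, 4 * W)) (slice_meas (cb_meas W) _) (fun x => cb_nonneg _ _)
    (fun x => cb_le_one _ _) fun x hx => cb_one hW0 (by simp only; linarith)
  have k3 : 2 * (d / W * (2 * Eg w 0 + A)) ≤ δ := by
    rw [show 2 * (d / W * (2 * Eg w 0 + A)) = Q / W by rw [hQ]; ring, div_le_iff₀ hW0]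
    rw [div_le_iff₀ hδ] at e3
    linarith
  have k4 : P / W * Real.log T ≤ δ := by
    rwa [show P / W * Real.log T = 2 * P / c by rw [hW]; field_simp]
  have k5 := set_en_le hv.toIsW0 hw.toIsW0 T (S := {x | ‖x‖ < T - c * Real.log T})
  rw [(hv.sub hw).conserve T 0] at k5
  rw [show 2 * W = c * Real.log T by rw [hW]; ring] at k1
  linarith

end Coulomb

namespace Coulomb
open scoped Topology
set_option linter.unusedSectionVars false
variable {d : ℕ} {f : Spc d × ℝ → ℝ} {x : Spc d} {t : ℝ}

/-! ### Passing to the spacetime formulation -/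

lemma deriv_slice (h : DifferentiableAt ℝ f (x, t)) : deriv (fun s => f (x, s)) t = Dt f (x, t) := by
  have h1 : HasDerivAt (fun s : ℝ => (x, s)) ((0, 1) : Spc d × ℝ) t :=
    (hasDerivAt_const t x).prodMk (hasDerivAt_id t)
  exact (h.hasFDerivAt.comp_hasDerivAt t h1).deriv

lemma fderiv_slice_bv (h : DifferentiableAt ℝ f (x, t)) (i : Fin d) :
    fderiv ℝ (fun y => f (y, t)) x (bv i) = Dx i f (x, t) := by
  have h1 : HasFDerivAt (fun y : Spc d => (y, t)) (ContinuousLinearMap.inl ℝ (Spc d) ℝ) x :=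
    hasFDerivAt_prodMk_left x t
  have h2 : HasFDerivAt (fun y => f (y, t)) ((fderiv ℝ f (x, t)).comp (ContinuousLinearMap.inl ℝ (Spc d) ℝ)) x :=
    h.hasFDerivAt.comp x h1
  rw [h2.fderiv]
  rfl

lemma lap_eq (hf : ContDiffOn ℝ 2 f (Om d)) (hx : x ≠ 0) :
    lap (fun y => f (y, t)) x = ∑ i, Dx i (Dx i f) (x, t) := by
  have hq : (x, t) ∈ Om d := mem_Om.2 hx
  refine Finset.sum_congr rfl fun i _ => ?_
  have hc : ContDiffAt ℝ 2 (fun y => f (y, t)) x :=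
    (cdAt hf hq).comp x (contDiffAt_id.prodMk contDiffAt_const)
  have hd : DifferentiableAt ℝ (fderiv ℝ fun y => f (y, t)) x :=
    (hc.fderiv_right (m := 1) (by norm_num)).differentiableAt one_ne_zero
  rw [iteratedFDeriv_two_apply]
  have e : (fun y => fderiv ℝ (fun y => f (y, t)) y (bv i)) =ᶠ[𝓝 x] fun y => Dx i f (y, t) := by
    filter_upwards [isOpen_compl_singleton.mem_nhds hx] with y hy
    exact fderiv_slice_bv (diffAt two_ne_zero hf (mem_Om.2 hy)) i
  have h1 : fderiv ℝ (fun y => fderiv ℝ (fun y => f (y, t)) y (bv i)) x (bv i) =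
      fderiv ℝ (fderiv ℝ fun y => f (y, t)) x (bv i) (bv i) := by
    rw [fderiv_clm_apply hd (differentiableAt_const (bv i))]
    simp
  rw [e.fderiv_eq] at h1
  exact h1.symm.trans (fderiv_slice_bv (diffAt one_ne_zero (cd_Dx hf i) hq) i)

lemma eDenFree_eq (hf : ContDiffOn ℝ 2 f (Om d)) (hx : x ≠ 0) :
    eDenFree (fun x t => f (x, t)) x t = en f (x, t) := by
  have hdf := diffAt two_ne_zero hf (mem_Om.2 hx : (x, t) ∈ Om d)
  have h1 : ‖gradient (fun y => f (y, t)) x‖ ^ 2 = Ns f (x, t) := by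
    rw [normsq_eq, Ns]
    refine Finset.sum_congr rfl fun i _ => ?_
    rw [← fderiv_slice_bv hdf i, ← inner_bv, gradient, InnerProductSpace.toDual_symm_apply]
  rw [eDenFree, h1, deriv_slice hdf, en]

variable [Fact (3 ≤ d)]

lemma isW_of_wave {u : Spc d → ℝ → ℝ} {E : ℝ} (hu : IsFreeCoulombWave u E) : IsW fun q => u q.1 q.2 := by
  obtain ⟨h1, h2, h3, h4, h5⟩ := hu
  have hcd : ContDiffOn ℝ 2 (fun q : Spc d × ℝ => u q.1 q.2) (Om d) := h2
  have e : ∀ t, (fun x => eDenFree u x t) =ᵐ[volume] fun x => en (fun q : Spc d × ℝ => u q.1 q.2) (x, t) :=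
    fun t =>
      ae_ne.mono fun x hx => eDenFree_eq (f := fun q : Spc d × ℝ => u q.1 q.2) (t := t) hcd hx
  have hE : ∀ t, Eg (fun q : Spc d × ℝ => u q.1 q.2) t = E := fun t =>
    (integral_congr_ae (e t)).symm.trans (h5 t)
  refine IsW.of_const ⟨h1, hcd, ?_, fun t => (h4 t).congr (e t), E, fun t => (hE t).le⟩ hE
  rintro ⟨x, t⟩ hq
  have hx : x ≠ 0 := mem_Om.1 hq
  have h := h3 x hx t
  have e1 : deriv (u x) = fun s => Dt (fun q : Spc d × ℝ => u q.1 q.2) (x, s) := by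
    funext s
    exact deriv_slice (f := fun q : Spc d × ℝ => u q.1 q.2) (diffAt two_ne_zero hcd (mem_Om.2 hx))
  rw [e1, deriv_slice (diffAt one_ne_zero (cd_Dt hcd) hq),
    lap_eq (f := fun q : Spc d × ℝ => u q.1 q.2) hcd hx] at h
  simp only
  linarith

lemma set_eDenFree {u : Spc d → ℝ → ℝ} {E : ℝ} (hu : IsFreeCoulombWave u E) (t : ℝ) (S : Set (Spc d)) :
    ∫ x in S, eDenFree u x t = ∫ x in S, en (fun q : Spc d × ℝ => u q.1 q.2) (x, t) :=
  integral_congr_ae (ae_restrict_of_ae (ae_ne.mono fun _ hx =>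
    eDenFree_eq (f := fun q : Spc d × ℝ => u q.1 q.2) (t := t) hu.2.1 hx))

lemma limsup_lt {g : ℝ → ℝ} {ε : ℝ} (hε : 0 < ε) (h0 : ∀ t, 0 ≤ g t) (h : ∀ᶠ t in atTop, g t ≤ ε / 2) :
    limsup g atTop < ε := by
  refine lt_of_le_of_lt (limsup_le_of_le ?_ h) (by linarith)
  refine ⟨0, fun a ha => ?_⟩
  obtain ⟨t, ht⟩ := (eventually_map.1 ha).exists
  exact (h0 t).trans ht

end Coulomb

/-- Asymptotic energy distribution of finite-energy free
Coulomb waves: for every `ε > 0` there are `0 < c₁ < c₂` with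
`limsup_{t→+∞} ∫_{|x| < t - c₂ ln t} e(x,t) dx < ε` and
`limsup_{t→+∞} ∫_{|x| > t - c₁ ln t} e(x,t) dx < ε`. -/
theorem stmt18 (d : ℕ) (hd : 3 ≤ d)
    (u : EuclideanSpace ℝ (Fin d) → ℝ → ℝ) (E : ℝ)
    (hu : IsFreeCoulombWave u E)
    (ε : ℝ) (hε : 0 < ε) :
    ∃ c₁ c₂ : ℝ, 0 < c₁ ∧ c₁ < c₂ ∧
      limsup (fun t : ℝ =>
          ∫ x in {x : EuclideanSpace ℝ (Fin d) | ‖x‖ < t - c₂ * Real.log t},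
            eDenFree u x t) atTop < ε ∧
      limsup (fun t : ℝ =>
          ∫ x in {x : EuclideanSpace ℝ (Fin d) | t - c₁ * Real.log t < ‖x‖},
            eDenFree u x t) atTop < ε := by
  have : Fact (3 ≤ d) := ⟨hd⟩
  have hw := Coulomb.isW_of_wave hu
  obtain ⟨c, hc, h1⟩ := Coulomb.exterior_small hw (half_pos hε)
  obtain ⟨C, hC, h2⟩ := Coulomb.interior_small hw (half_pos hε)
  refine ⟨c, max C (2 * c), hc, lt_of_lt_of_le (by linarith) (le_max_right _ _), ?_, ?_⟩
  · refine Coulomb.limsup_lt hε (fun t => ?_) ((h2 (max C (2 * c)) (le_max_left _ _)).mono fun t ht => ?_)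
    · rw [Coulomb.set_eDenFree hu]
      exact integral_nonneg fun x => Coulomb.en_nonneg _ _
    · rwa [Coulomb.set_eDenFree hu]
  · refine Coulomb.limsup_lt hε (fun t => ?_) (h1.mono fun t ht => ?_)
    · rw [Coulomb.set_eDenFree hu]
      exact integral_nonneg fun x => Coulomb.en_nonneg _ _
    · rw [Coulomb.set_eDenFree hu]
      refine (Coulomb.ext_anti hw.toIsW0 t (S' := {x | t - c * Real.log t ≤ ‖x‖}) fun x hx => ?_).trans ht
      exact le_of_lt (show t - c * Real.log t < ‖x‖ from hx)
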